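/- Let T > 0 and let u_s : [0,T] × [0,∞) → ℝ be a smooth shear flow satisfying sup_{0≤t≤T} ( sup_{y≥0} |u_s(t,y)| + ∫₀^∞ y |∂_y u_s(t,y)|² dy ) < ∞. Let u : [0,T] × 𝕋 × [0,∞) → ℝ be a classical solution (C¹ in t, C¹ in x, C² in y, with u(t,·,·), ∂_x u(t,·,·), ∂_y u(t,·,·) square-integrable on 𝕋 × (0,∞) uniformly in t) of the linearized Prandtl equation ∂_t u + u_s ∂_x u + v ∂_y u_s − ∂_y² u = 0 on (0,T) × 𝕋 × (0,∞), where v(t,x,y) = −∫₀^y ∂_x u(t,x,y') dy', with boundary condition u(t,x,0) = 0 for all t,x and initial condition u(0,x,y) = 0 for all x,y. Then u ≡ 0 on [0,T] × 𝕋 × [0,∞). -/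

import Mathlib

open MeasureTheory

namespace Prandtl

open Set Filter Topology
open scoped NNReal ContDiff Convolution

/-- Two functions agreeing on a set have the same derivatives at almost every point of it. -/
lemma ae_deriv_eq_of_eqOn {f g f' g' : ℝ → ℝ} {S : Set ℝ} (h : EqOn f g S) :
    ∀ᵐ x, x ∈ S → HasDerivAt f (f' x) x → HasDerivAt g (g' x) x → f' x = g' x := by
  have hc : {x ∈ S | 𝓝[S ∩ Ioi x] x = ⊥}.Countable := countable_setOfPred_isolated_right_within
  filter_upwards [hc.ae_notMem volume] with x hx hxS hf hg
  have hne : (𝓝[S ∩ Ioi x] x).NeBot := by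
    rw [neBot_iff]
    intro hbot
    exact hx ⟨hxS, hbot⟩
  have h1 := (hf.sub hg).hasDerivWithinAt (s := S ∩ Ioi x)
  rw [hasDerivWithinAt_iff_tendsto_slope' (by simp)] at h1
  have h2 : Tendsto (slope (f - g) x) (𝓝[S ∩ Ioi x] x) (𝓝 0) := by
    apply tendsto_const_nhds.congr'
    filter_upwards [self_mem_nhdsWithin] with y hy
    simp [slope_def_field, h hy.1, h hxS]
  have := tendsto_nhds_unique h1 h2
  linarith

lemma hasDerivAt_of_lipschitz_ae {G : ℝ → ℝ} {K : ℝ≥0} (hG : LipschitzWith K G) :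
    ∀ᵐ x, HasDerivAt G (deriv G x) x := by
  filter_upwards [hG.ae_differentiableAt_real] with x hx using hx.hasDerivAt

lemma lipschitz_abs_deriv_le {G : ℝ → ℝ} {K : ℝ≥0} (hG : LipschitzWith K G) (x : ℝ) :
    |deriv G x| ≤ K := by
  simpa using norm_deriv_le_of_lipschitz hG (x₀ := x)

lemma lipschitz_ac {G : ℝ → ℝ} {K : ℝ≥0} (hG : LipschitzWith K G) (a b : ℝ) :
    AbsolutelyContinuousOnInterval G a b :=
  (hG.lipschitzOnWith (s := uIcc a b)).absolutelyContinuousOnInterval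

/-- Lipschitz control at the points of a closed set bounds the defect in the fundamental theorem
of calculus by the measure of the complement. -/
lemma abs_sub_setIntegral_le {f f' : ℝ → ℝ} {s t N : ℝ} {S : Set ℝ} (hst : s ≤ t) (hN : 0 ≤ N)
    (hSm : MeasurableSet S) (hS : S ⊆ Icc s t) (hne : S.Nonempty)
    (hf : ∀ x, HasDerivAt f (f' x) x)
    (hlip : ∀ x ∈ S, ∀ y ∈ Icc s t, |f y - f x| ≤ N * |y - x|) :
    |f t - f s - ∫ x in S, f' x| ≤ N * volume.real (Icc s t \ S) := by
  obtain ⟨K, rfl⟩ : ∃ K : ℝ≥0, (K : ℝ) = N := ⟨⟨N, hN⟩, rfl⟩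
  obtain ⟨x₀, hx₀⟩ := hne
  have hx₀' := hS hx₀
  have hends : |f t - f s| ≤ K * |t - s| := by
    have h1 := hlip x₀ hx₀ t ⟨hst, le_rfl⟩
    have h2 := hlip x₀ hx₀ s ⟨le_rfl, hst⟩
    rw [abs_of_nonneg (by linarith [hx₀'.2] : 0 ≤ t - x₀)] at h1
    rw [abs_of_nonpos (by linarith [hx₀'.1] : s - x₀ ≤ 0)] at h2
    rw [abs_of_nonneg (by linarith : 0 ≤ t - s)]
    calc |f t - f s| = |(f t - f x₀) - (f s - f x₀)| := by ring_nf
      _ ≤ |f t - f x₀| + |f s - f x₀| := abs_sub _ _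
      _ ≤ K * (t - s) := by nlinarith
  have hL : LipschitzOnWith K f (S ∪ {s, t}) := by
    apply LipschitzOnWith.of_dist_le_mul
    have hmem : ∀ y ∈ S ∪ {s, t}, y ∈ Icc s t := by
      rintro y (hy | rfl | rfl)
      · exact hS hy
      · exact ⟨le_rfl, hst⟩
      · exact ⟨hst, le_rfl⟩
    intro x hx y hy
    rw [Real.dist_eq, Real.dist_eq]
    by_cases hxS : x ∈ S
    · rw [abs_sub_comm (f x), abs_sub_comm x]
      exact hlip x hxS y (hmem y hy)
    by_cases hyS : y ∈ S
    · exact hlip y hyS x (hmem x hx)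
    simp only [mem_union, hxS, hyS, false_or, mem_insert_iff, mem_singleton_iff] at hx hy
    rcases hx with rfl | rfl <;> rcases hy with rfl | rfl
    · simp
    · rw [abs_sub_comm (f _), abs_sub_comm x]; exact hends
    · exact hends
    · simp
  obtain ⟨G, hG, hfG⟩ := hL.extend_real
  have hs : f s = G s := hfG (by simp)
  have ht : f t = G t := hfG (by simp)
  have hintg := (lipschitz_ac hG s t).integral_deriv_eq_sub
  have hii : IntegrableOn (deriv G) (Icc s t) := by
    have := (lipschitz_ac hG s t).intervalIntegrable_deriv
    rwa [intervalIntegrable_iff_integrableOn_Icc_of_le hst] at this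
  rw [intervalIntegral.integral_of_le hst, ← integral_Icc_eq_integral_Ioc,
    ← integral_inter_add_sdiff hSm hii, inter_eq_self_of_subset_right hS] at hintg
  have hSe : ∫ x in S, f' x = ∫ x in S, deriv G x := by
    apply setIntegral_congr_ae hSm
    filter_upwards [ae_deriv_eq_of_eqOn (f' := f') (g' := deriv G)
      (hfG.mono (subset_union_left (s := S) (t := {s, t}))), hasDerivAt_of_lipschitz_ae hG]
      with x h1 h2 hx using h1 hx (hf x) h2
  rw [hs, ht, ← hintg, hSe, add_sub_cancel_left]
  have hfin : volume (Icc s t \ S) < ⊤ :=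
    (measure_mono sdiff_subset).trans_lt measure_Icc_lt_top
  rw [← Real.norm_eq_abs]
  exact norm_setIntegral_le_of_norm_le_const hfin
    (fun x _ => by simpa using lipschitz_abs_deriv_le hG x)

/-- Quadratic control at the points of a closed set bounds the defect in double integration by
parts by the measure of the complement. -/
lemma abs_integral_deriv2_sub_le {f f' f'' ζ ζ' ζ'' : ℝ → ℝ} {c d N A₀ A₂ : ℝ} {S : Set ℝ}
    (hcd : c ≤ d) (hN : 0 ≤ N)
    (hSc : MeasurableSet S) (hS : S ⊆ Icc c d) (hne : S.Nonempty)
    (hf : ∀ x, HasDerivAt f (f' x) x) (hf' : ∀ x, HasDerivAt f' (f'' x) x)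
    (hq : ∀ x ∈ S, ∀ y ∈ Icc c d, |f y - f x - f' x * (y - x)| ≤ N * (y - x) ^ 2)
    (hζ : ∀ x, HasDerivAt ζ (ζ' x) x) (hζ' : ∀ x, HasDerivAt ζ' (ζ'' x) x)
    (hζc : Continuous ζ'') (hc : ζ c = 0) (hd : ζ d = 0) (hc' : ζ' c = 0) (hd' : ζ' d = 0)
    (hA₀ : ∀ x, |ζ x| ≤ A₀) (hA₂ : ∀ x, |ζ'' x| ≤ A₂) :
    |(∫ x in c..d, f x * ζ'' x) - ∫ x in S, f'' x * ζ x| ≤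
      (2 * N * A₀ + 2 * N * (d - c) ^ 2 * A₂) * volume.real (Icc c d \ S) := by
  obtain ⟨K, rfl⟩ : ∃ K : ℝ≥0, (K : ℝ) = N := ⟨⟨N, hN⟩, rfl⟩
  have hfc : Continuous f := continuous_iff_continuousAt.2 fun x => (hf x).continuousAt
  have hf'c : Continuous f' := continuous_iff_continuousAt.2 fun x => (hf' x).continuousAt
  have hζc0 : Continuous ζ := continuous_iff_continuousAt.2 fun x => (hζ x).continuousAt
  have hζc1 : Continuous ζ' := continuous_iff_continuousAt.2 fun x => (hζ' x).continuousAt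
  obtain ⟨a₀, ha₀⟩ := hne
  have hL : LipschitzOnWith (2 * K) f' S := by
    apply LipschitzOnWith.of_dist_le_mul
    intro x hx y hy
    rw [Real.dist_eq, Real.dist_eq]
    rcases eq_or_ne x y with rfl | hxy
    · simp
    have h1 := abs_le.1 (hq x hx y (hS hy))
    have h2 := abs_le.1 (hq y hy x (hS hx))
    have h3 : |f' x - f' y| * |x - y| ≤ 2 * K * |x - y| ^ 2 := by
      rw [← abs_mul, sq_abs, abs_le]
      constructor <;> nlinarith
    have : 0 < |x - y| := abs_pos.2 (sub_ne_zero.2 hxy)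
    push_cast
    nlinarith
  obtain ⟨G, hG, hfG⟩ := hL.extend_real
  have hGc := hG.continuous
  set P : ℝ → ℝ := fun y => f a₀ + ∫ z in a₀..y, G z with hP
  have hPd : ∀ y, HasDerivAt P (G y) y := fun y =>
    (intervalIntegral.integral_hasDerivAt_right (hGc.intervalIntegrable _ _)
      (hGc.stronglyMeasurableAtFilter _ _) hGc.continuousAt).const_add _
  have hPc : Continuous P := continuous_iff_continuousAt.2 fun x => (hPd x).continuousAt
  -- integration by parts for `P`
  have e1 : ∫ x in c..d, P x * ζ'' x = - ∫ x in c..d, G x * ζ' x := by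
    rw [intervalIntegral.integral_mul_deriv_eq_deriv_mul (fun x _ => hPd x) (fun x _ => hζ' x)
      (hGc.intervalIntegrable _ _) (hζc.intervalIntegrable _ _), hc', hd']
    simp
  have dζ : deriv ζ = ζ' := funext fun x => (hζ x).deriv
  have hζac : AbsolutelyContinuousOnInterval ζ c d := by
    apply ContDiffOn.absolutelyContinuousOnInterval
    apply ContDiff.contDiffOn
    rw [contDiff_one_iff_deriv, dζ]
    exact ⟨fun x => (hζ x).differentiableAt, hζc1⟩
  have e2 : ∫ x in c..d, G x * ζ' x = - ∫ x in c..d, deriv G x * ζ x := by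
    have := (lipschitz_ac hG c d).integral_mul_deriv_eq_deriv_mul hζac
    rw [dζ, hc, hd] at this
    rw [this]; simp
  have hii : IntegrableOn (fun x => deriv G x * ζ x) (Icc c d) := by
    have := (lipschitz_ac hG c d).intervalIntegrable_deriv.mul_continuousOn hζc0.continuousOn
    rwa [intervalIntegrable_iff_integrableOn_Icc_of_le hcd] at this
  have e3 : ∫ x in c..d, deriv G x * ζ x =
      (∫ x in S, f'' x * ζ x) + ∫ x in Icc c d \ S, deriv G x * ζ x := by
    rw [intervalIntegral.integral_of_le hcd, ← integral_Icc_eq_integral_Ioc,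
      ← integral_inter_add_sdiff hSc hii, inter_eq_self_of_subset_right hS]
    congr 1
    apply setIntegral_congr_ae hSc
    filter_upwards [ae_deriv_eq_of_eqOn (f' := f'') (g' := deriv G) hfG,
      hasDerivAt_of_lipschitz_ae hG] with x h1 h2 hx
    rw [h1 hx (hf' x) h2]
  have hfin : volume (Icc c d \ S) < ⊤ :=
    (measure_mono sdiff_subset).trans_lt measure_Icc_lt_top
  have hA₀' : 0 ≤ A₀ := (abs_nonneg _).trans (hA₀ c)
  have hA₂' : 0 ≤ A₂ := (abs_nonneg _).trans (hA₂ c)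
  have b1 : |∫ x in Icc c d \ S, deriv G x * ζ x| ≤ 2 * K * A₀ * volume.real (Icc c d \ S) := by
    rw [← Real.norm_eq_abs]
    refine norm_setIntegral_le_of_norm_le_const hfin (fun x _ => ?_)
    rw [Real.norm_eq_abs, abs_mul]
    exact mul_le_mul (by simpa using lipschitz_abs_deriv_le hG x) (hA₀ x) (abs_nonneg _)
      (by positivity)
  -- the remainder `f - P`
  have hh : ∀ x, HasDerivAt (fun y => f y - P y) (f' x - G x) x := fun x => (hf x).sub (hPd x)
  have hquad : ∀ x ∈ S, ∀ y ∈ Icc c d, |(f y - P y) - (f x - P x)| ≤ 2 * K * (y - x) ^ 2 := by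
    intro x hx y hy
    have i1 : P y - P x - f' x * (y - x) = ∫ z in x..y, (G z - G x) := by
      rw [intervalIntegral.integral_sub (hGc.intervalIntegrable _ _) (by simp),
        ← intervalIntegral.integral_interval_sub_left (hGc.intervalIntegrable a₀ y)
          (hGc.intervalIntegrable a₀ x), hfG hx]
      simp [hP, mul_comm]
    have i2 : |∫ z in x..y, (G z - G x)| ≤ K * (y - x) ^ 2 := by
      have hbd : ∀ p q : ℝ, p ≤ q → ∀ m, (m = p ∨ m = q) →
          |∫ z in p..q, (G z - G m)| ≤ K * (q - p) ^ 2 := by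
        intro p q hpq m hm
        have hb : ∀ z ∈ Icc p q, |G z - G m| ≤ 2 * K * |z - m| := fun z _ => by
          have := hG.dist_le_mul z m
          simpa [Real.dist_eq] using this
        have hpoly : ∫ z in p..q, 2 * K * |z - m| = K * (q - p) ^ 2 := by
          rcases hm with rfl | rfl
          · have : ∫ z in m..q, 2 * (K : ℝ) * |z - m| = ∫ z in m..q, 2 * (K : ℝ) * (z - m) := by
              apply intervalIntegral.integral_congr
              intro z hz
              rw [uIcc_of_le hpq] at hz
              simp only
              rw [abs_of_nonneg (by linarith [hz.1])]
            rw [this, intervalIntegral.integral_const_mul, intervalIntegral.integral_comp_sub_right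
              (fun z => z) m, integral_id]
            ring
          · have : ∫ z in p..m, 2 * (K : ℝ) * |z - m| = ∫ z in p..m, 2 * (K : ℝ) * (m - z) := by
              apply intervalIntegral.integral_congr
              intro z hz
              rw [uIcc_of_le hpq] at hz
              simp only
              rw [abs_of_nonpos (by linarith [hz.2])]
              ring
            rw [this, intervalIntegral.integral_const_mul, intervalIntegral.integral_comp_sub_left
              (fun z => z) m, integral_id]
            ring
        rw [← hpoly]
        calc |∫ z in p..q, (G z - G m)| ≤ ∫ z in p..q, |G z - G m| :=
              intervalIntegral.abs_integral_le_integral_abs hpq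
          _ ≤ _ := by
            apply intervalIntegral.integral_mono_on hpq
            · exact Continuous.intervalIntegrable (by fun_prop) _ _
            · exact Continuous.intervalIntegrable (by fun_prop) _ _
            · exact hb
      rcases le_total x y with h | h
      · exact hbd x y h x (Or.inl rfl)
      · rw [intervalIntegral.integral_symm, abs_neg]
        have := hbd y x h x (Or.inr rfl)
        linarith [sq_nonneg (y - x), (by ring : (x - y) ^ 2 = (y - x) ^ 2)]
    have i3 := hq x hx y hy
    calc |(f y - P y) - (f x - P x)| =
        |(f y - f x - f' x * (y - x)) - (P y - P x - f' x * (y - x))| := by ring_nf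
      _ ≤ _ := abs_sub _ _
      _ ≤ 2 * K * (y - x) ^ 2 := by rw [i1]; linarith
  have hsmall : ∀ y ∈ Icc c d, |f y - P y| ≤ 2 * K * (d - c) * volume.real (Icc c d \ S) := by
    intro y hy
    have ha₀' := hS ha₀
    have h0 : f a₀ - P a₀ = 0 := by simp [hP]
    have key : ∀ p q : ℝ, c ≤ p → p ≤ q → q ≤ d → (a₀ ∈ Icc p q) →
        |(f q - P q) - (f p - P p)| ≤ 2 * K * (d - c) * volume.real (Icc c d \ S) := by
      intro p q hp hpq hqd ha
      have hm : MeasurableSet (S ∩ Icc p q) := hSc.inter measurableSet_Icc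
      have hsub : Icc p q ⊆ Icc c d := Icc_subset_Icc hp hqd
      have := abs_sub_setIntegral_le (f := fun y => f y - P y) (f' := fun x => f' x - G x)
        (S := S ∩ Icc p q) (N := 2 * K * (d - c)) hpq (by have := sub_nonneg.2 hcd; positivity) hm
        inter_subset_right ⟨a₀, ha₀, ha⟩ hh (by
          intro x hx z hz
          refine (hquad x hx.1 z (hsub hz)).trans ?_
          rw [← sq_abs, sq, ← mul_assoc]
          apply mul_le_mul_of_nonneg_right _ (abs_nonneg _)
          apply mul_le_mul_of_nonneg_left _ (by positivity)
          rw [abs_le]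
          constructor <;> linarith [hz.1, hz.2, hx.2.1, hx.2.2])
      have hz : ∫ x in S ∩ Icc p q, (f' x - G x) = 0 := by
        apply setIntegral_eq_zero_of_forall_eq_zero
        intro x hx
        rw [hfG hx.1, sub_self]
      rw [hz, sub_zero] at this
      refine this.trans ?_
      apply mul_le_mul_of_nonneg_left _ (by have := sub_nonneg.2 hcd; positivity)
      apply measureReal_mono _ hfin.ne
      intro x hx
      exact ⟨hsub hx.1, fun h => hx.2 ⟨h, hx.1⟩⟩
    rcases le_total a₀ y with h | h
    · have := key a₀ y ha₀'.1 h hy.2 ⟨le_rfl, h⟩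
      rwa [h0, sub_zero] at this
    · have := key y a₀ hy.1 h ha₀'.2 ⟨h, le_rfl⟩
      rwa [h0, zero_sub, abs_neg] at this
  have b2 : |∫ x in c..d, (f x - P x) * ζ'' x| ≤
      2 * K * (d - c) ^ 2 * A₂ * volume.real (Icc c d \ S) := by
    have := intervalIntegral.norm_integral_le_of_norm_le_const (a := c) (b := d)
      (f := fun x => (f x - P x) * ζ'' x)
      (C := 2 * K * (d - c) * volume.real (Icc c d \ S) * A₂) (by
        intro x hx
        rw [uIoc_of_le hcd] at hx
        rw [Real.norm_eq_abs, abs_mul]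
        exact mul_le_mul (hsmall x ⟨hx.1.le, hx.2⟩) (hA₂ x) (abs_nonneg _)
          (by have := sub_nonneg.2 hcd; positivity))
    rw [Real.norm_eq_abs, abs_of_nonneg (by linarith : 0 ≤ d - c)] at this
    linarith
  have hsplit : ∫ x in c..d, f x * ζ'' x =
      (∫ x in c..d, (f x - P x) * ζ'' x) + ∫ x in c..d, P x * ζ'' x := by
    rw [← intervalIntegral.integral_add]
    · congr 1; ext x; ring
    · exact Continuous.intervalIntegrable (by fun_prop) _ _
    · exact Continuous.intervalIntegrable (by fun_prop) _ _
  rw [hsplit, e1, e2, e3]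
  calc _ = |(∫ x in c..d, (f x - P x) * ζ'' x) + ∫ x in Icc c d \ S, deriv G x * ζ x| := by
        congr 1; ring
    _ ≤ _ := abs_add_le _ _
    _ ≤ _ := by linarith

/-- Du Bois-Reymond: a continuous function with vanishing second distributional derivative on an
interval is affine there. -/
lemma affine_of_integral_mul_deriv2_eq_zero {q : ℝ → ℝ} {c d : ℝ} (hcd : c < d)
    (hq : ContinuousOn q (Icc c d))
    (h : ∀ φ : ℝ → ℝ, ContDiff ℝ ∞ φ → tsupport φ ⊆ Ioo c d →
      ∫ y in c..d, q y * deriv (deriv φ) y = 0) :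
    ∃ m p : ℝ, ∀ y ∈ Icc c d, q y = m + p * y := by
  set Q : ℝ → ℝ := IccExtend hcd.le ((Icc c d).domRestrict q) with hQ
  have hQc : Continuous Q := (continuousOn_iff_continuous_domRestrict.1 hq).Icc_extend'
  have hQq : ∀ y ∈ Icc c d, Q y = q y := fun y hy => by
    rw [hQ, IccExtend_of_mem _ _ hy]; rfl
  let bump : ℕ → ContDiffBump (0 : ℝ) := fun n =>
    ⟨1 / (2 * (n + 1)), 1 / (n + 1), by positivity,
      one_div_lt_one_div_of_lt (by positivity) (by linarith [(n.cast_nonneg : (0:ℝ) ≤ n)])⟩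
  have hb0 : Tendsto (fun n => (bump n).rOut) atTop (𝓝 0) := tendsto_one_div_add_atTop_nhds_zero_nat
  let ρ : ℕ → ℝ → ℝ := fun n => (bump n).normed volume
  let A : ℕ → ℝ → ℝ := fun n => (ρ n ⋆[ContinuousLinearMap.lsmul ℝ ℝ, volume] Q)
  have hA : ∀ x, Tendsto (fun n => A n x) atTop (𝓝 (Q x)) := fun x =>
    ContDiffBump.convolution_tendsto_right_of_continuous hb0 hQc x
  have hρ : ∀ n, ContDiff ℝ ∞ (ρ n) := fun n => (bump n).contDiff_normed
  have hρc : ∀ n, HasCompactSupport (ρ n) := fun n => (bump n).hasCompactSupport_normed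
  have hρ1 : ∀ n, ContDiff ℝ ∞ (deriv (ρ n)) := fun n => (contDiff_infty_iff_deriv.1 (hρ n)).2
  have hA1 : ∀ n x, HasDerivAt (A n)
      ((deriv (ρ n) ⋆[ContinuousLinearMap.lsmul ℝ ℝ, volume] Q) x) x := fun n x =>
    (hρc n).hasDerivAt_convolution_left _ ((hρ n).of_le (by norm_cast))
      hQc.locallyIntegrable x
  have hA2 : ∀ n x, HasDerivAt (deriv (ρ n) ⋆[ContinuousLinearMap.lsmul ℝ ℝ, volume] Q)
      ((deriv (deriv (ρ n)) ⋆[ContinuousLinearMap.lsmul ℝ ℝ, volume] Q) x) x := fun n x =>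
    (hρc n).deriv.hasDerivAt_convolution_left _ ((hρ1 n).of_le (by norm_cast))
      hQc.locallyIntegrable x
  have hzero : ∀ n, ∀ x ∈ Ioo (c + (bump n).rOut) (d - (bump n).rOut),
      (deriv (deriv (ρ n)) ⋆[ContinuousLinearMap.lsmul ℝ ℝ, volume] Q) x = 0 := by
    intro n x hx
    set φ : ℝ → ℝ := fun y => ρ n (x - y) with hφ
    have hφs : ContDiff ℝ ∞ φ := (hρ n).comp (contDiff_const.sub contDiff_id)
    have hφ1 : deriv φ = fun y => - deriv (ρ n) (x - y) := by
      ext y; exact deriv_comp_const_sub _ _ _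
    have hφ2 : deriv (deriv φ) = fun y => deriv (deriv (ρ n)) (x - y) := by
      rw [hφ1]; ext y
      rw [deriv.fun_neg, deriv_comp_const_sub, neg_neg]
    have hball : tsupport φ ⊆ Metric.closedBall x (bump n).rOut := by
      apply closure_minimal _ Metric.isClosed_closedBall
      intro y hy
      have : x - y ∈ Function.support (ρ n) := hy
      rw [(bump n).support_normed_eq] at this
      simp only [Metric.mem_ball, dist_zero_right, Metric.mem_closedBall] at this ⊢
      rw [dist_comm, Real.dist_eq]; exact this.le
    have hts : tsupport φ ⊆ Ioo c d := by
      refine hball.trans fun y hy => ?_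
      rw [Metric.mem_closedBall, Real.dist_eq, abs_le] at hy
      exact ⟨by linarith [hx.1, hy.1], by linarith [hx.2, hy.2]⟩
    have h0 := h φ hφs hts
    rw [convolution_eq_swap]
    have : ∀ t, (ContinuousLinearMap.lsmul ℝ ℝ) (deriv (deriv (ρ n)) (x - t)) (Q t) =
        Q t * deriv (deriv φ) t := fun t => by
      rw [hφ2]; simp [mul_comm]
    simp_rw [this]
    rw [← h0, intervalIntegral.integral_of_le hcd.le, ← setIntegral_eq_integral_of_forall_compl_eq_zero
      (s := Ioc c d)]
    · apply setIntegral_congr_fun measurableSet_Ioc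
      intro y hy
      simp only
      rw [hQq y ⟨hy.1.le, hy.2⟩]
    · intro y hy
      have : deriv (deriv φ) y = 0 := by
        by_contra hne
        have h1 : y ∈ tsupport φ := by
          apply tsupport_deriv_subset _
          apply tsupport_deriv_subset _
          exact subset_tsupport _ hne
        exact hy (Ioo_subset_Ioc_self (hts h1))
      rw [this, mul_zero]
  -- the mollifications are affine on the shrunk interval
  have haff : ∀ n, ∀ x₁ ∈ Ioo (c + (bump n).rOut) (d - (bump n).rOut),
      ∀ x₂ ∈ Ioo (c + (bump n).rOut) (d - (bump n).rOut),
      ∀ x₃ ∈ Ioo (c + (bump n).rOut) (d - (bump n).rOut),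
      (A n x₃ - A n x₁) * (x₂ - x₁) = (A n x₂ - A n x₁) * (x₃ - x₁) := by
    intro n x₁ h₁ x₂ h₂ x₃ h₃
    set J := Ioo (c + (bump n).rOut) (d - (bump n).rOut)
    have hJ : IsPreconnected J := isPreconnected_Ioo
    have k1 : ∀ x ∈ J, (deriv (ρ n) ⋆[ContinuousLinearMap.lsmul ℝ ℝ, volume] Q) x =
        (deriv (ρ n) ⋆[ContinuousLinearMap.lsmul ℝ ℝ, volume] Q) x₁ := fun x hx =>
      isOpen_Ioo.is_const_of_deriv_eq_zero hJ
        (fun y _ => (hA2 n y).differentiableAt.differentiableWithinAt)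
        (fun y hy => by rw [(hA2 n y).deriv, hzero n y hy]; rfl) hx h₁
    set p := (deriv (ρ n) ⋆[ContinuousLinearMap.lsmul ℝ ℝ, volume] Q) x₁ with hp
    have hd : ∀ y, HasDerivAt (fun y => A n y - p * y)
        ((deriv (ρ n) ⋆[ContinuousLinearMap.lsmul ℝ ℝ, volume] Q) y - p) y := fun y => by
      have := (hA1 n y).sub ((hasDerivAt_id y).const_mul p)
      rw [mul_one] at this
      exact this
    have k2 : ∀ x ∈ J, A n x - p * x = A n x₁ - p * x₁ := fun x hx =>
      isOpen_Ioo.is_const_of_deriv_eq_zero (f := fun y => A n y - p * y) hJ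
        (fun y _ => (hd y).differentiableAt.differentiableWithinAt)
        (fun y hy => by rw [(hd y).deriv, k1 y hy, sub_self]; rfl) hx h₁
    have e2 := k2 x₂ h₂
    have e3 := k2 x₃ h₃
    have : A n x₃ - A n x₁ = p * (x₃ - x₁) := by linarith
    have h' : A n x₂ - A n x₁ = p * (x₂ - x₁) := by linarith
    rw [this, h']; ring
  have hev : ∀ x ∈ Ioo c d, ∀ᶠ n in atTop, x ∈ Ioo (c + (bump n).rOut) (d - (bump n).rOut) := by
    intro x hx
    have h1 : ∀ᶠ n in atTop, (bump n).rOut < x - c := hb0.eventually_lt_const (by linarith [hx.1])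
    have h2 : ∀ᶠ n in atTop, (bump n).rOut < d - x := hb0.eventually_lt_const (by linarith [hx.2])
    filter_upwards [h1, h2] with n h1 h2
    exact ⟨by linarith, by linarith⟩
  have haffQ : ∀ x₁ ∈ Ioo c d, ∀ x₂ ∈ Ioo c d, ∀ x₃ ∈ Ioo c d,
      (Q x₃ - Q x₁) * (x₂ - x₁) = (Q x₂ - Q x₁) * (x₃ - x₁) := by
    intro x₁ h₁ x₂ h₂ x₃ h₃
    refine tendsto_nhds_unique_of_eventuallyEq (((hA x₃).sub (hA x₁)).mul_const _)
      (((hA x₂).sub (hA x₁)).mul_const _) ?_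
    filter_upwards [hev x₁ h₁, hev x₂ h₂, hev x₃ h₃] with n i1 i2 i3 using haff n _ i1 _ i2 _ i3
  set x₁ := c + (d - c) / 3
  set x₂ := c + 2 * (d - c) / 3
  have h₁ : x₁ ∈ Ioo c d := ⟨by simp only [x₁]; linarith, by simp only [x₁]; linarith⟩
  have h₂ : x₂ ∈ Ioo c d := ⟨by simp only [x₂]; linarith, by simp only [x₂]; linarith⟩
  have h12 : x₂ - x₁ ≠ 0 := by simp only [x₁, x₂]; linarith
  set p := (Q x₂ - Q x₁) / (x₂ - x₁) with hp
  have hIoo : EqOn Q (fun y => (Q x₁ - p * x₁) + p * y) (Ioo c d) := by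
    intro y hy
    have := haffQ x₁ h₁ x₂ h₂ y hy
    have : Q y - Q x₁ = p * (y - x₁) := by
      rw [hp, div_mul_eq_mul_div, eq_div_iff h12, this]
    simp only
    linarith
  refine ⟨Q x₁ - p * x₁, p, fun y hy => ?_⟩
  rw [← hQq y hy]
  have := hIoo.closure hQc (by fun_prop)
  rw [closure_Ioo hcd.ne] at this
  exact this hy

/-- Pointwise convergence with bounded `L²` norms on a finite measure space gives `L¹`
convergence. -/
lemma tendsto_integral_abs_sub_of_sq_bounded {α ι : Type*} [MeasurableSpace α] {μ : Measure α}
    [IsFiniteMeasure μ] {l : Filter ι} [l.IsCountablyGenerated] {f : ι → α → ℝ} {g : α → ℝ} {M : ℝ}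
    (hfm : ∀ᶠ i in l, AEStronglyMeasurable (f i) μ) (hgm : AEStronglyMeasurable g μ)
    (hf2 : ∀ᶠ i in l, Integrable (fun x => f i x ^ 2) μ) (hg2 : Integrable (fun x => g x ^ 2) μ)
    (hfM : ∀ᶠ i in l, ∫ x, f i x ^ 2 ∂μ ≤ M) (hgM : ∫ x, g x ^ 2 ∂μ ≤ M)
    (hlim : ∀ᵐ x ∂μ, Tendsto (fun i => f i x) l (𝓝 (g x))) :
    Tendsto (fun i => ∫ x, |f i x - g x| ∂μ) l (𝓝 0) := by
  have hM : 0 ≤ M := (integral_nonneg fun x => sq_nonneg _).trans hgM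
  rw [Metric.tendsto_nhds]
  intro ε hε
  set K : ℝ := 8 * M / ε + 1 with hK
  have hKpos : 0 < K := by positivity
  have h1 : Tendsto (fun i => ∫ x, min |f i x - g x| K ∂μ) l (𝓝 (∫ _, (0 : ℝ) ∂μ)) := by
    apply tendsto_integral_filter_of_dominated_convergence (fun _ => K)
    · filter_upwards [hfm] with i hi
      exact (hi.sub hgm).norm.inf aestronglyMeasurable_const
    · filter_upwards with i
      filter_upwards with x
      rw [Real.norm_eq_abs, abs_of_nonneg (le_min (abs_nonneg _) hKpos.le)]
      exact min_le_right _ _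
    · exact integrable_const _
    · filter_upwards [hlim] with x hx
      have : Tendsto (fun i => min |f i x - g x| K) l (𝓝 (min |g x - g x| K)) :=
        ((hx.sub_const _).abs).min tendsto_const_nhds
      simpa [hKpos.le] using this
  rw [integral_zero] at h1
  filter_upwards [h1.eventually_lt_const (half_pos hε), hfm, hf2, hfM] with i hi hm h2 hMi
  rw [dist_zero_right, Real.norm_eq_abs, abs_of_nonneg (integral_nonneg fun x => abs_nonneg _)]
  have hsq : Integrable (fun x => 2 * (f i x ^ 2 + g x ^ 2) / K) μ :=
    ((h2.add hg2).const_mul 2).div_const K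
  have hmin : Integrable (fun x => min |f i x - g x| K) μ := by
    refine (integrable_const K).mono' ((hm.sub hgm).norm.inf aestronglyMeasurable_const) ?_
    filter_upwards with x
    rw [Real.norm_eq_abs, abs_of_nonneg (le_min (abs_nonneg _) hKpos.le)]
    exact min_le_right _ _
  calc ∫ x, |f i x - g x| ∂μ
      ≤ ∫ x, (min |f i x - g x| K + 2 * (f i x ^ 2 + g x ^ 2) / K) ∂μ := by
        apply integral_mono_of_nonneg (Eventually.of_forall fun x => abs_nonneg _) (hmin.add hsq)
        filter_upwards with x
        simp only [Pi.add_apply]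
        rcases le_total |f i x - g x| K with h | h
        · rw [min_eq_left h]
          have : 0 ≤ 2 * (f i x ^ 2 + g x ^ 2) / K := by positivity
          linarith
        · rw [min_eq_right h]
          have h3 : |f i x - g x| ^ 2 ≤ 2 * (f i x ^ 2 + g x ^ 2) := by
            rw [sq_abs]; nlinarith [sq_nonneg (f i x + g x)]
          have : |f i x - g x| ≤ 2 * (f i x ^ 2 + g x ^ 2) / K := by
            rw [le_div_iff₀ hKpos]
            nlinarith [abs_nonneg (f i x - g x)]
          linarith
    _ = (∫ x, min |f i x - g x| K ∂μ) +
        2 * ((∫ x, f i x ^ 2 ∂μ) + ∫ x, g x ^ 2 ∂μ) / K := by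
        rw [integral_add hmin hsq, integral_div, integral_const_mul, integral_add h2 hg2]
    _ < ε := by
        have : 2 * ((∫ x, f i x ^ 2 ∂μ) + ∫ x, g x ^ 2 ∂μ) / K ≤ ε / 2 := by
          rw [div_le_iff₀ hKpos]
          have : ε / 2 * K = 4 * M + ε / 2 := by rw [hK]; field_simp; ring
          linarith
        linarith

/-- Integration by parts against a primitive of an integrable function. -/
lemma integral_mul_primitive {θ θ' g : ℝ → ℝ} {c d p : ℝ}
    (hθ : ∀ x, HasDerivAt θ (θ' x) x) (hθc : Continuous θ') (hg : IntervalIntegrable g volume c d) :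
    ∫ y in c..d, θ' y * (p + ∫ z in c..y, g z) =
      θ d * (p + ∫ z in c..d, g z) - θ c * p - ∫ y in c..d, θ y * g y := by
  have dθ : deriv θ = θ' := funext fun x => (hθ x).deriv
  have hθac : AbsolutelyContinuousOnInterval θ c d := by
    apply ContDiffOn.absolutelyContinuousOnInterval
    apply ContDiff.contDiffOn
    rw [contDiff_one_iff_deriv, dθ]
    exact ⟨fun x => (hθ x).differentiableAt, hθc⟩
  have hGac : AbsolutelyContinuousOnInterval (fun y => ∫ z in c..y, g z) c d :=
    hg.absolutelyContinuousOnInterval_intervalIntegral (by simp)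
  have hθ0 : Continuous θ := continuous_iff_continuousAt.2 fun x => (hθ x).continuousAt
  have h1 := hθac.integral_mul_deriv_eq_deriv_mul hGac
  rw [dθ] at h1
  have h2 : ∫ y in c..d, θ y * deriv (fun y => ∫ z in c..y, g z) y = ∫ y in c..d, θ y * g y := by
    apply intervalIntegral.integral_congr_ae
    filter_upwards [hg.ae_hasDerivAt_integral] with x hx hxm
    rw [(hx (uIoc_subset_uIcc hxm) c (by simp)).deriv]
  have h3 : ∫ y in c..d, θ' y * (p + ∫ z in c..y, g z) =
      p * (θ d - θ c) + ∫ y in c..d, θ' y * ∫ z in c..y, g z := by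
    simp_rw [mul_add]
    rw [intervalIntegral.integral_add, intervalIntegral.integral_mul_const,
      intervalIntegral.integral_eq_sub_of_hasDerivAt (fun x _ => hθ x)
        (hθc.intervalIntegrable _ _)]
    · ring
    · exact (hθc.mul continuous_const).intervalIntegrable _ _
    · exact (hθc.continuousOn.mul hGac.continuousOn).intervalIntegrable
  rw [h3]
  rw [h2, intervalIntegral.integral_same] at h1
  linarith

/-! ### Measurability -/

lemma measurable_uncurry_of_hasDerivAt_fst {α : Type*} [MeasurableSpace α] {f f' : ℝ → α → ℝ}
    (hm : Measurable (Function.uncurry f))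
    (h : ∀ t a, HasDerivAt (fun s => f s a) (f' t a) t) : Measurable (Function.uncurry f') := by
  let e : ℕ → ℝ := fun n => 1 / ((n : ℝ) + 1)
  have he : Tendsto e atTop (𝓝[≠] 0) := by
    apply tendsto_nhdsWithin_iff.2 ⟨tendsto_one_div_add_atTop_nhds_zero_nat, ?_⟩
    filter_upwards with n
    simp only [mem_compl_iff, mem_singleton_iff]
    positivity
  apply measurable_of_tendsto_metrizable
    (f := fun n (p : ℝ × α) => (e n)⁻¹ • (f (p.1 + e n) p.2 - f p.1 p.2))
  · intro n
    simp only [smul_eq_mul]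
    refine Measurable.const_mul (f := fun p : ℝ × α => f (p.1 + e n) p.2 - f p.1 p.2) ?_ _
    refine Measurable.sub ?_ hm
    exact hm.comp ((measurable_fst.add_const _).prodMk measurable_snd)
  · rw [tendsto_pi_nhds]
    rintro ⟨t, a⟩
    have := (hasDerivAt_iff_tendsto_slope_zero.1 (h t a)).comp he
    exact this

lemma measurable_uncurry_of_sep {w : ℝ → ℝ → ℝ} (h1 : ∀ y, Continuous fun t => w t y)
    (h2 : ∀ t, Continuous (w t)) : Measurable (Function.uncurry w) :=
  measurable_uncurry_of_continuous_of_measurable h1 fun t => (h2 t).measurable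

/-! ### Functions integrable on a rectangle -/

section Rect
variable {f : ℝ → ℝ → ℝ} {α β a b : ℝ}

lemma uIoc_subset_Ioo {s t : ℝ} (hs : s ∈ Ioo α β) (ht : t ∈ Ioo α β) : uIoc s t ⊆ Ioo α β :=
  fun _ hx => ⟨(lt_min hs.1 ht.1).trans hx.1, hx.2.trans_lt (max_lt hs.2 ht.2)⟩

lemma ae_integrableOn_fst
    (hf : IntegrableOn (Function.uncurry f) (Ioo α β ×ˢ Ioo a b)) :
    ∀ᵐ y, y ∈ Ioo a b → IntegrableOn (fun t => f t y) (Ioo α β) := by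
  rw [IntegrableOn, Measure.volume_eq_prod, ← Measure.prod_restrict] at hf
  exact (ae_restrict_iff' measurableSet_Ioo).1 hf.prod_left_ae

lemma ae_integrableOn_snd
    (hf : IntegrableOn (Function.uncurry f) (Ioo α β ×ˢ Ioo a b)) :
    ∀ᵐ t, t ∈ Ioo α β → IntegrableOn (f t) (Ioo a b) := by
  rw [IntegrableOn, Measure.volume_eq_prod, ← Measure.prod_restrict] at hf
  exact (ae_restrict_iff' measurableSet_Ioo).1 hf.prod_right_ae

lemma integrableOn_integral_fst {s t : ℝ} (hs : s ∈ Ioo α β) (ht : t ∈ Ioo α β)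
    (hf : IntegrableOn (Function.uncurry f) (Ioo α β ×ˢ Ioo a b)) :
    IntegrableOn (fun y => ∫ τ in s..t, f τ y) (Ioo a b) := by
  have h1 : IntegrableOn (Function.uncurry f) (uIoc s t ×ˢ Ioo a b) :=
    hf.mono_set (prod_mono (uIoc_subset_Ioo hs ht) le_rfl)
  rw [IntegrableOn, Measure.volume_eq_prod, ← Measure.prod_restrict] at h1
  simp_rw [intervalIntegral.intervalIntegral_eq_integral_uIoc]
  exact h1.integral_prod_right.smul (if s ≤ t then (1 : ℝ) else -1)

lemma integrableOn_integral_snd {c d : ℝ} (hc : c ∈ Ioo a b) (hd : d ∈ Ioo a b)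
    (hf : IntegrableOn (Function.uncurry f) (Ioo α β ×ˢ Ioo a b)) :
    IntegrableOn (fun τ => ∫ y in c..d, f τ y) (Ioo α β) := by
  have h1 : IntegrableOn (Function.uncurry f) (Ioo α β ×ˢ uIoc c d) :=
    hf.mono_set (prod_mono le_rfl (uIoc_subset_Ioo hc hd))
  rw [IntegrableOn, Measure.volume_eq_prod, ← Measure.prod_restrict] at h1
  simp_rw [intervalIntegral.intervalIntegral_eq_integral_uIoc]
  exact h1.integral_prod_left.smul (if c ≤ d then (1 : ℝ) else -1)

lemma rect_swap {s t c d : ℝ} (hs : s ∈ Ioo α β) (ht : t ∈ Ioo α β) (hc : c ∈ Ioo a b)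
    (hd : d ∈ Ioo a b) (hf : IntegrableOn (Function.uncurry f) (Ioo α β ×ˢ Ioo a b)) :
    ∫ τ in s..t, ∫ y in c..d, f τ y = ∫ y in c..d, ∫ τ in s..t, f τ y :=
  intervalIntegral_intervalIntegral_swap
    (hf.mono_set (prod_mono (uIoc_subset_Ioo hs ht) (uIoc_subset_Ioo hc hd)))

lemma IntegrableOn.interval {g : ℝ → ℝ} (hg : IntegrableOn g (Ioo a b)) {c d : ℝ}
    (hc : c ∈ Ioo a b) (hd : d ∈ Ioo a b) : IntervalIntegrable g volume c d :=
  intervalIntegrable_iff.2 (hg.mono_set (uIoc_subset_Ioo hc hd))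

lemma rect_mul_snd {ζ : ℝ → ℝ} {A : ℝ} (hζ : Continuous ζ) (hA : ∀ y, |ζ y| ≤ A)
    (hf : IntegrableOn (Function.uncurry f) (Ioo α β ×ˢ Ioo a b)) :
    IntegrableOn (Function.uncurry fun t y => f t y * ζ y) (Ioo α β ×ˢ Ioo a b) :=
  Integrable.mul_bdd (c := A) hf (hζ.comp continuous_snd).aestronglyMeasurable
    (Eventually.of_forall fun p => hA p.2)

end Rect

/-- A function whose pure derivatives `wt`, `wy`, `wyy` exist everywhere, with `F = wt - wyy` and
`wy` integrable on a rectangle, and with bounded `L²` norms on time slices. -/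
structure HeatData (w wt wy wyy F : ℝ → ℝ → ℝ) (α β a b M : ℝ) : Prop where
  ht : ∀ t y, HasDerivAt (fun s => w s y) (wt t y) t
  hy : ∀ t y, HasDerivAt (w t) (wy t y) y
  hyy : ∀ t y, HasDerivAt (wy t) (wyy t y) y
  hF : ∀ t y, F t y = wt t y - wyy t y
  iF : IntegrableOn (Function.uncurry F) (Ioo α β ×ˢ Ioo a b)
  iwy : IntegrableOn (Function.uncurry wy) (Ioo α β ×ˢ Ioo a b)
  sq : ∀ t ∈ Ioo α β, IntegrableOn (fun y => w t y ^ 2) (Ioo a b)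
  sqM : ∀ t ∈ Ioo α β, ∫ y in Ioo a b, w t y ^ 2 ≤ M

/-- Time integral of `w`. -/
noncomputable def Zf (w : ℝ → ℝ → ℝ) (s t y : ℝ) : ℝ := ∫ τ in s..t, w τ y

/-- The expected second derivative of `Zf`. -/
noncomputable def gf (w F : ℝ → ℝ → ℝ) (s t y : ℝ) : ℝ := w t y - w s y - ∫ τ in s..t, F τ y

/-- `w` satisfies the time-integrated equation between times `s` and `t` on the interval `(c, d)`. -/
def Sol (w F : ℝ → ℝ → ℝ) (s t c d : ℝ) : Prop :=
  ∃ p : ℝ, ∀ y ∈ Ioo c d, HasDerivAt (Zf w s t) (p + ∫ z in c..y, gf w F s t z) y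

/-- The defect of the weak formulation. -/
noncomputable def Df (w F : ℝ → ℝ → ℝ) (ζ ζ'' : ℝ → ℝ) (s t c d : ℝ) : ℝ :=
  ∫ y in c..d, (gf w F s t y * ζ y - Zf w s t y * ζ'' y)

namespace HeatData
variable {w wt wy wyy F : ℝ → ℝ → ℝ} {α β a b M : ℝ} (H : HeatData w wt wy wyy F α β a b M)
include H

lemma cont_t (y : ℝ) : Continuous fun t => w t y :=
  continuous_iff_continuousAt.2 fun t => (H.ht t y).continuousAt

lemma cont_y (t : ℝ) : Continuous (w t) :=
  continuous_iff_continuousAt.2 fun y => (H.hy t y).continuousAt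

lemma cont_wy (t : ℝ) : Continuous (wy t) :=
  continuous_iff_continuousAt.2 fun y => (H.hyy t y).continuousAt

lemma meas_w : Measurable (Function.uncurry w) := measurable_uncurry_of_sep H.cont_t H.cont_y

lemma meas_wt : Measurable (Function.uncurry wt) :=
  measurable_uncurry_of_hasDerivAt_fst H.meas_w H.ht

lemma meas_wy : Measurable (Function.uncurry wy) := by
  have h := measurable_uncurry_of_hasDerivAt_fst (f := fun y t => w t y) (f' := fun y t => wy t y)
    (H.meas_w.comp measurable_swap) (fun y t => H.hy t y)
  exact h.comp measurable_swap

lemma meas_wyy : Measurable (Function.uncurry wyy) := by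
  have h := measurable_uncurry_of_hasDerivAt_fst (f := fun y t => wy t y)
    (f' := fun y t => wyy t y) (H.meas_wy.comp measurable_swap) (fun y t => H.hyy t y)
  exact h.comp measurable_swap

lemma meas_F : Measurable (Function.uncurry F) := by
  have : Function.uncurry F = fun p => Function.uncurry wt p - Function.uncurry wyy p := by
    ext p; exact H.hF _ _
  rw [this]
  exact H.meas_wt.sub H.meas_wyy

lemma int_w : IntegrableOn (Function.uncurry w) (Ioo α β ×ˢ Ioo a b) := by
  have h2 : IntegrableOn (fun p => Function.uncurry w p ^ 2) (Ioo α β ×ˢ Ioo a b) := by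
    rw [IntegrableOn, Measure.volume_eq_prod, ← Measure.prod_restrict]
    rw [integrable_prod_iff (H.meas_w.pow_const 2).aestronglyMeasurable]
    constructor
    · rw [ae_restrict_iff' measurableSet_Ioo]
      exact Eventually.of_forall fun t ht => H.sq t ht
    · have hfin : IntegrableOn (fun _ : ℝ => M) (Ioo α β) := by
        simp
      refine Integrable.mono' hfin ?_ ?_
      · exact (H.meas_w.pow_const 2).norm.stronglyMeasurable.integral_prod_right.aestronglyMeasurable
      · rw [ae_restrict_iff' measurableSet_Ioo]
        refine Eventually.of_forall fun t ht => ?_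
        rw [Real.norm_eq_abs, abs_of_nonneg (integral_nonneg fun _ => norm_nonneg _)]
        have := H.sqM t ht
        simpa [Function.uncurry] using this
  have h1 : IntegrableOn (fun p => 1 + Function.uncurry w p ^ 2) (Ioo α β ×ˢ Ioo a b) := by
    refine Integrable.add ?_ h2
    have : volume (Ioo α β ×ˢ Ioo a b) ≠ ⊤ := by
      rw [Measure.volume_eq_prod, Measure.prod_prod]; exact ENNReal.mul_ne_top (by simp) (by simp)
    exact integrableOn_const this
  refine Integrable.mono' h1 H.meas_w.aestronglyMeasurable (Eventually.of_forall fun p => ?_)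
  rw [Real.norm_eq_abs, abs_le]
  constructor <;> nlinarith [sq_nonneg (Function.uncurry w p - 1), sq_nonneg (Function.uncurry w p + 1)]

lemma int_slice {t : ℝ} (ht : t ∈ Ioo α β) : IntegrableOn (w t) (Ioo a b) := by
  have h1 : IntegrableOn (fun y => 1 + w t y ^ 2) (Ioo a b) :=
    (integrableOn_const (by simp)).add (H.sq t ht)
  refine Integrable.mono' h1 (H.cont_y t).aestronglyMeasurable (Eventually.of_forall fun p => ?_)
  rw [Real.norm_eq_abs, abs_le]
  constructor <;> nlinarith [sq_nonneg (w t p - 1), sq_nonneg (w t p + 1)]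

lemma int_g {s t : ℝ} (hs : s ∈ Ioo α β) (ht : t ∈ Ioo α β) :
    IntegrableOn (gf w F s t) (Ioo a b) :=
  ((H.int_slice ht).sub (H.int_slice hs)).sub (integrableOn_integral_fst hs ht H.iF)

/-- `t ↦ w t` is continuous into `L¹`. -/
lemma tendsto_L1 {t : ℝ} (ht : t ∈ Ioo α β) :
    Tendsto (fun τ => ∫ y in Ioo a b, |w τ y - w t y|) (𝓝 t) (𝓝 0) := by
  have hev : ∀ᶠ τ in 𝓝 t, τ ∈ Ioo α β := Ioo_mem_nhds ht.1 ht.2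
  refine tendsto_integral_abs_sub_of_sq_bounded (M := M)
    (Eventually.of_forall fun τ => (H.cont_y τ).aestronglyMeasurable)
    (H.cont_y t).aestronglyMeasurable (hev.mono fun τ h => H.sq τ h) (H.sq t ht)
    (hev.mono fun τ h => H.sqM τ h) (H.sqM t ht)
    (Eventually.of_forall fun y => (H.cont_t y).continuousAt)

lemma tendsto_integral_mul {t c d A : ℝ} {ζ : ℝ → ℝ} (ht : t ∈ Ioo α β) (hc : c ∈ Ioo a b)
    (hd : d ∈ Ioo a b) (hcd : c ≤ d) (hζ : Continuous ζ) (hA : ∀ y, |ζ y| ≤ A) :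
    Tendsto (fun τ => ∫ y in c..d, w τ y * ζ y) (𝓝 t) (𝓝 (∫ y in c..d, w t y * ζ y)) := by
  have hev : ∀ᶠ τ in 𝓝 t, τ ∈ Ioo α β := Ioo_mem_nhds ht.1 ht.2
  rw [tendsto_iff_norm_sub_tendsto_zero]
  have h0 := (H.tendsto_L1 ht).const_mul A
  rw [mul_zero] at h0
  refine squeeze_zero' (Eventually.of_forall fun _ => norm_nonneg _) ?_ h0
  filter_upwards [hev] with τ hτ
  have hi : ∀ r, IntervalIntegrable (fun y => w r y * ζ y) volume c d := fun r =>
    ((H.cont_y r).mul hζ).intervalIntegrable _ _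
  rw [← intervalIntegral.integral_sub (hi τ) (hi t), Real.norm_eq_abs]
  calc |∫ y in c..d, (w τ y * ζ y - w t y * ζ y)|
      ≤ ∫ y in c..d, |w τ y * ζ y - w t y * ζ y| :=
        intervalIntegral.abs_integral_le_integral_abs hcd
    _ ≤ ∫ y in c..d, A * |w τ y - w t y| := by
        have c1 := H.cont_y τ
        have c2 := H.cont_y t
        apply intervalIntegral.integral_mono_on hcd
        · exact Continuous.intervalIntegrable (by fun_prop) _ _
        · exact Continuous.intervalIntegrable (by fun_prop) _ _
        · intro y _
          rw [← sub_mul, abs_mul, mul_comm]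
          exact mul_le_mul_of_nonneg_right (hA y) (abs_nonneg _)
    _ = A * ∫ y in Ioc c d, |w τ y - w t y| := by
        rw [intervalIntegral.integral_const_mul, intervalIntegral.integral_of_le hcd]
    _ ≤ A * ∫ y in Ioo a b, |w τ y - w t y| := by
        apply mul_le_mul_of_nonneg_left _ ((abs_nonneg _).trans (hA 0))
        apply setIntegral_mono_set ((H.int_slice hτ).sub (H.int_slice ht)).abs
          (Eventually.of_forall fun _ => abs_nonneg _)
        exact LE.le.eventuallyLE fun y hy => ⟨hc.1.trans hy.1, hy.2.trans_lt hd.2⟩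

lemma Zf_sub {s t y y' : ℝ} (hs : s ∈ Ioo α β) (ht : t ∈ Ioo α β) (hy : y ∈ Ioo a b)
    (hy' : y' ∈ Ioo a b) :
    Zf w s t y' - Zf w s t y = ∫ z in y..y', ∫ τ in s..t, wy τ z := by
  rw [← rect_swap hs ht hy hy' H.iwy, Zf, Zf, ← intervalIntegral.integral_sub
    ((H.cont_t y').intervalIntegrable _ _) ((H.cont_t y).intervalIntegrable _ _)]
  apply intervalIntegral.integral_congr
  intro τ _
  simp only
  rw [intervalIntegral.integral_eq_sub_of_hasDerivAt (fun z _ => H.hy τ z)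
    ((H.cont_wy τ).intervalIntegrable _ _)]

lemma Zf_continuousOn {s t : ℝ} (hs : s ∈ Ioo α β) (ht : t ∈ Ioo α β) :
    ContinuousOn (Zf w s t) (Ioo a b) := by
  intro y hy
  obtain ⟨c, hc⟩ := exists_between hy.1
  obtain ⟨d, hd⟩ := exists_between hy.2
  have hc' : c ∈ Ioo a b := ⟨hc.1, hc.2.trans hy.2⟩
  have hd' : d ∈ Ioo a b := ⟨hy.1.trans hd.1, hd.2⟩
  apply ContinuousAt.continuousWithinAt
  have hi : IntervalIntegrable (fun z => ∫ τ in s..t, wy τ z) volume c d :=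
    IntegrableOn.interval (integrableOn_integral_fst hs ht H.iwy) hc' hd'
  have h1 : ContinuousOn (fun y => Zf w s t c + ∫ z in c..y, ∫ τ in s..t, wy τ z) (uIcc c d) :=
    continuousOn_const.add
      (hi.absolutelyContinuousOnInterval_intervalIntegral (by simp)).continuousOn
  rw [uIcc_of_le (hc.2.trans hd.1).le] at h1
  refine (h1.continuousAt (Icc_mem_nhds hc.2 hd.1)).congr ?_
  filter_upwards [Ioo_mem_nhds hy.1 hy.2] with z hz
  rw [← H.Zf_sub hs ht hc' hz]
  ring

lemma Zf_add (r s t y : ℝ) : Zf w r s y + Zf w s t y = Zf w r t y :=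
  intervalIntegral.integral_add_adjacent_intervals ((H.cont_t y).intervalIntegrable _ _)
    ((H.cont_t y).intervalIntegrable _ _)

lemma gf_add {r s t : ℝ} (hr : r ∈ Ioo α β) (hs : s ∈ Ioo α β) (ht : t ∈ Ioo α β) :
    ∀ᵐ y, y ∈ Ioo a b → gf w F r s y + gf w F s t y = gf w F r t y := by
  filter_upwards [ae_integrableOn_fst H.iF] with y hy hyab
  have := intervalIntegral.integral_add_adjacent_intervals
    (IntegrableOn.interval (hy hyab) hr hs) (IntegrableOn.interval (hy hyab) hs ht)
  simp only [gf]
  rw [← this]; ring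

omit H in
lemma gf_symm (s t y : ℝ) : gf w F t s y = - gf w F s t y := by
  simp only [gf]; rw [intervalIntegral.integral_symm]; ring

omit H in
lemma Zf_symm (s t y : ℝ) : Zf w t s y = - Zf w s t y := by
  simp only [Zf]; rw [intervalIntegral.integral_symm]

omit H in
lemma sol_self (s c d : ℝ) : Sol w F s s c d :=
  ⟨0, fun y _ => by
    have h1 : Zf w s s = fun _ => 0 := by ext y; simp [Zf]
    have h2 : gf w F s s = fun _ => 0 := by ext y; simp [gf]
    rw [h1, h2]
    simpa using hasDerivAt_const y (0 : ℝ)⟩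

omit H in
lemma sol_symm {s t c d : ℝ} (h : Sol w F s t c d) : Sol w F t s c d := by
  obtain ⟨p, hp⟩ := h
  refine ⟨-p, fun y hy => ?_⟩
  have h1 : Zf w t s = fun y => - Zf w s t y := funext fun y => Zf_symm s t y
  have h2 : gf w F t s = fun y => - gf w F s t y := funext fun y => gf_symm s t y
  rw [h1, h2, intervalIntegral.integral_neg]
  convert! (hp y hy).neg using 1
  ring

lemma sol_trans {r s t c d : ℝ} (hr : r ∈ Ioo α β) (hs : s ∈ Ioo α β) (ht : t ∈ Ioo α β)
    (hc : c ∈ Ioo a b) (hd : d ∈ Ioo a b) (h1 : Sol w F r s c d) (h2 : Sol w F s t c d) :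
    Sol w F r t c d := by
  obtain ⟨p, hp⟩ := h1
  obtain ⟨q, hq⟩ := h2
  refine ⟨p + q, fun y hy => ?_⟩
  have e1 : Zf w r t = fun y => Zf w r s y + Zf w s t y := funext fun y => (H.Zf_add r s t y).symm
  have hy' : y ∈ Ioo a b := ⟨hc.1.trans hy.1, hy.2.trans hd.2⟩
  have e2 : ∫ z in c..y, gf w F r t z =
      (∫ z in c..y, gf w F r s z) + ∫ z in c..y, gf w F s t z := by
    rw [← intervalIntegral.integral_add (IntegrableOn.interval (H.int_g hr hs) hc hy')
      (IntegrableOn.interval (H.int_g hs ht) hc hy')]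
    apply intervalIntegral.integral_congr_ae
    filter_upwards [H.gf_add hr hs ht] with z hz hzm
    exact (hz (uIoc_subset_Ioo hc hy' hzm)).symm
  rw [e1, e2]
  convert! (hp y hy).add (hq y hy) using 1
  ring

lemma sol_mono {s t c d c' d' : ℝ} (hs : s ∈ Ioo α β) (ht : t ∈ Ioo α β)
    (hc : c ∈ Ioo a b) (hd : d ∈ Ioo a b) (hcc : c ≤ c') (hc' : c' ≤ d) (hdd : d' ≤ d)
    (h : Sol w F s t c d) : Sol w F s t c' d' := by
  obtain ⟨p, hp⟩ := h
  refine ⟨p + ∫ z in c..c', gf w F s t z, fun y hy => ?_⟩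
  convert! hp y ⟨hcc.trans_lt hy.1, hy.2.trans_le hdd⟩ using 1
  have hc'' : c' ∈ Ioo a b := ⟨hc.1.trans_le hcc, hc'.trans_lt hd.2⟩
  have hy' : y ∈ Ioo a b := ⟨hc''.1.trans hy.1, (hy.2.trans_le hdd).trans hd.2⟩
  rw [← intervalIntegral.integral_add_adjacent_intervals
    (IntegrableOn.interval (H.int_g hs ht) hc hc'') (IntegrableOn.interval (H.int_g hs ht) hc'' hy')]
  ring

/-- Gluing in the space variable. -/
lemma sol_of_local {s t c d : ℝ} (hs : s ∈ Ioo α β) (ht : t ∈ Ioo α β)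
    (hc : c ∈ Ioo a b) (hd : d ∈ Ioo a b)
    (h : ∀ y ∈ Ioo c d, ∃ c' d', y ∈ Ioo c' d' ∧ c' ∈ Ioo a b ∧ Sol w F s t c' d') :
    Sol w F s t c d := by
  have hdiff : ∀ y ∈ Ioo c d, DifferentiableAt ℝ (Zf w s t) y := fun y hy => by
    obtain ⟨c', d', hy', -, p, hp⟩ := h y hy
    exact (hp y hy').differentiableAt
  set Hf : ℝ → ℝ := fun y => deriv (Zf w s t) y - ∫ z in c..y, gf w F s t z with hH
  have hd0 : ∀ y ∈ Ioo c d, HasDerivAt Hf 0 y := by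
    intro y hy
    obtain ⟨c', d', hy', hc', p, hp⟩ := h y hy
    have hyab : y ∈ Ioo a b := ⟨hc.1.trans hy.1, hy.2.trans hd.2⟩
    have : Hf =ᶠ[𝓝 y] fun _ => p - ∫ z in c..c', gf w F s t z := by
      filter_upwards [Ioo_mem_nhds hy'.1 hy'.2, Ioo_mem_nhds hyab.1 hyab.2] with z hz hzab
      simp only [hH]
      rw [(hp z hz).deriv, ← intervalIntegral.integral_add_adjacent_intervals
        (IntegrableOn.interval (H.int_g hs ht) hc hc')
        (IntegrableOn.interval (H.int_g hs ht) hc' hzab)]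
      ring
    exact (hasDerivAt_const y _).congr_of_eventuallyEq this
  rcases le_or_gt d c with hdc | hcd
  · exact ⟨0, fun y hy => absurd (hy.1.trans hy.2) (not_lt.2 hdc)⟩
  set y₀ := (c + d) / 2
  have hy₀ : y₀ ∈ Ioo c d := ⟨by simp only [y₀]; linarith, by simp only [y₀]; linarith⟩
  refine ⟨Hf y₀, fun y hy => ?_⟩
  have := isOpen_Ioo.is_const_of_deriv_eq_zero (f := Hf) isPreconnected_Ioo
    (fun y hy => (hd0 y hy).differentiableAt.differentiableWithinAt)
    (fun y hy => (hd0 y hy).deriv) hy hy₀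
  rw [← this]
  simp only [hH, sub_add_cancel]
  exact (hdiff y hy).hasDerivAt

end HeatData

/-- Testing `∂²V = g` on `{V > δ}` against `χ k(V)`, where `k` is nondecreasing with primitive `j`
and `k = 0` on `(-∞, δ]`. -/
lemma integral_test_le {V g χ χ' χ'' k k' j : ℝ → ℝ} {c d δ : ℝ} (hcd : c ≤ d)
    (hg : IntervalIntegrable g volume c d)
    (hV : ∀ y, (∀ᶠ z in 𝓝 y, V z ≤ δ) ∨
      (y ∈ Ioo c d ∧ ∃ q, ∀ᶠ z in 𝓝 y, HasDerivAt V (q + ∫ x in c..z, g x) z))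
    (hχ : ∀ y, HasDerivAt χ (χ' y) y) (hχ' : ∀ y, HasDerivAt χ' (χ'' y) y)
    (hχc : Continuous χ'') (hχ0 : ∀ y, 0 ≤ χ y)
    (hk : ∀ v, HasDerivAt k (k' v) v) (hkc : Continuous k') (hj : ∀ v, HasDerivAt j (k v) v)
    (hk'0 : ∀ v, 0 ≤ k' v) (hk0 : ∀ v ≤ δ, k v = 0) (hk'δ : ∀ v ≤ δ, k' v = 0)
    (hj0 : ∀ v ≤ δ, j v = 0) :
    ∫ y in c..d, χ y * k (V y) * g y ≤ ∫ y in c..d, χ'' y * j (V y) := by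
  set P : ℝ → ℝ := fun y => ∫ x in c..y, g x with hP
  have cχ : Continuous χ := continuous_iff_continuousAt.2 fun y => (hχ y).continuousAt
  have cχ' : Continuous χ' := continuous_iff_continuousAt.2 fun y => (hχ' y).continuousAt
  have ck : Continuous k := continuous_iff_continuousAt.2 fun y => (hk y).continuousAt
  have cP : ∀ y ∈ Ioo c d, ContinuousAt P y := by
    intro y hy
    have h1 := (hg.absolutelyContinuousOnInterval_intervalIntegral (c := c) (by simp)).continuousOn
    rw [uIcc_of_le hcd] at h1
    exact h1.continuousAt (Icc_mem_nhds hy.1 hy.2)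
  set θ : ℝ → ℝ := fun y => χ y * k (V y) with hθ
  set θ' : ℝ → ℝ := fun y => χ' y * k (V y) + χ y * (k' (V y) * deriv V y) with hθ'
  set m : ℝ → ℝ := fun y => deriv V y - P y with hm
  have loc : ∀ y, (∀ᶠ z in 𝓝 y, V z ≤ δ) ∨ (y ∈ Ioo c d ∧ ContinuousAt V y ∧ HasDerivAt V (deriv V y) y ∧
      ∃ q, (∀ᶠ z in 𝓝 y, deriv V z = q + P z) ∧ ∀ᶠ z in 𝓝 y, m z = q) := by
    intro y
    rcases hV y with h | ⟨hy, q, hq⟩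
    · exact Or.inl h
    · refine Or.inr ⟨hy, hq.self_of_nhds.continuousAt, hq.self_of_nhds.differentiableAt.hasDerivAt, q, hq.mono fun z hz => hz.deriv, ?_⟩
      filter_upwards [hq] with z hz
      simp only [hm, hz.deriv, hP]; ring
  have cdV : ∀ {y q}, y ∈ Ioo c d → (∀ᶠ z in 𝓝 y, deriv V z = q + P z) →
      ContinuousAt (deriv V) y := fun {y q} hy h =>
    ContinuousAt.congr (continuousAt_const.add (cP y hy)) (h.mono fun z hz => hz.symm)
  have zz : ∀ {y}, V y ≤ δ → k (V y) = 0 ∧ k' (V y) = 0 ∧ j (V y) = 0 := fun h =>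
    ⟨hk0 _ h, hk'δ _ h, hj0 _ h⟩
  have dθ : ∀ y, HasDerivAt θ (θ' y) y := by
    intro y
    rcases loc y with h | ⟨hy, hVc, hVd, q, hq, -⟩
    · have e : θ' y = 0 := by simp [hθ', zz h.self_of_nhds]
      rw [e]
      exact (hasDerivAt_const y (0 : ℝ)).congr_of_eventuallyEq
        (h.mono fun z hz => by simp [hθ, zz hz])
    · exact (hχ y).mul ((hk (V y)).comp y hVd)
  have cθ' : Continuous θ' := by
    rw [continuous_iff_continuousAt]
    intro y
    rcases loc y with h | ⟨hy, hVc, hVd, q, hq, -⟩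
    · exact continuousAt_const.congr (h.mono fun z hz => (by simp [hθ', zz hz] : (0 : ℝ) = θ' z))
    · have := cdV hy hq
      have h1 : ContinuousAt (fun y => k (V y)) y := ck.continuousAt.comp hVc
      have h2 : ContinuousAt (fun y => k' (V y)) y := hkc.continuousAt.comp hVc
      exact (cχ'.continuousAt.mul h1).add (cχ.continuousAt.mul (h2.mul this))
  have dθm : ∀ y, HasDerivAt (fun y => θ y * m y) (θ' y * m y) y := by
    intro y
    rcases loc y with h | ⟨hy, hVc, hVd, q, hq, hmq⟩
    · have e : θ' y = 0 := by simp [hθ', zz h.self_of_nhds]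
      rw [e, zero_mul]
      exact (hasDerivAt_const y (0 : ℝ)).congr_of_eventuallyEq
        (h.mono fun z hz => by simp [hθ, zz hz])
    · rw [hmq.self_of_nhds]
      exact ((dθ y).mul_const q).congr_of_eventuallyEq (hmq.mono fun z hz => by simp only [hz])
  have cθm : Continuous fun y => θ' y * m y := by
    rw [continuous_iff_continuousAt]
    intro y
    rcases loc y with h | ⟨hy, hVc, hVd, q, hq, hmq⟩
    · exact continuousAt_const.congr
        (h.mono fun z hz => (by simp [hθ', zz hz] : (0 : ℝ) = θ' z * m z))
    · exact (cθ'.continuousAt.mul continuousAt_const).congr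
        (hmq.mono fun z hz => (by simp only [hz] : θ' z * q = θ' z * m z))
  have djV : ∀ y, HasDerivAt (fun y => j (V y)) (k (V y) * deriv V y) y := by
    intro y
    rcases loc y with h | ⟨hy, hVc, hVd, q, hq, -⟩
    · rw [(zz h.self_of_nhds).1, zero_mul]
      exact (hasDerivAt_const y (0 : ℝ)).congr_of_eventuallyEq (h.mono fun z hz => by simp [zz hz])
    · exact (hj (V y)).comp y hVd
  have ckV : Continuous fun y => k (V y) * deriv V y := by
    rw [continuous_iff_continuousAt]
    intro y
    rcases loc y with h | ⟨hy, hVc, hVd, q, hq, -⟩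
    · exact continuousAt_const.congr
        (h.mono fun z hz => (by simp [zz hz] : (0 : ℝ) = k (V z) * deriv V z))
    · exact ContinuousAt.mul (f := fun y => k (V y)) (ck.continuousAt.comp hVc) (cdV hy hq)
  have cθV : Continuous fun y => θ' y * deriv V y := by
    rw [continuous_iff_continuousAt]
    intro y
    rcases loc y with h | ⟨hy, hVc, hVd, q, hq, -⟩
    · exact continuousAt_const.congr
        (h.mono fun z hz => (by simp [hθ', zz hz] : (0 : ℝ) = θ' z * deriv V z))
    · exact cθ'.continuousAt.mul (cdV hy hq)
  have hc : V c ≤ δ := by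
    rcases hV c with h | h
    · exact h.self_of_nhds
    · exact absurd h.1.1 (lt_irrefl _)
  have hd : V d ≤ δ := by
    rcases hV d with h | h
    · exact h.self_of_nhds
    · exact absurd h.1.2 (lt_irrefl _)
  have θc : θ c = 0 := by simp [hθ, zz hc]
  have θd : θ d = 0 := by simp [hθ, zz hd]
  have I1 := integral_mul_primitive (p := 0) dθ cθ' hg
  have I2 : ∫ y in c..d, θ' y * m y = 0 := by
    rw [intervalIntegral.integral_eq_sub_of_hasDerivAt (fun y _ => dθm y)
      (cθm.intervalIntegrable _ _)]
    simp [θc, θd]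
  have I3 : ∫ y in c..d, θ' y * (0 + ∫ z in c..y, g z) = ∫ y in c..d, θ' y * deriv V y := by
    have : ∀ y, θ' y * (0 + ∫ z in c..y, g z) = θ' y * deriv V y - θ' y * m y := by
      intro y; simp only [hm, hP]; ring
    simp_rw [this]
    rw [intervalIntegral.integral_sub (cθV.intervalIntegrable _ _) (cθm.intervalIntegrable _ _), I2,
      sub_zero]
  have I4 : ∫ y in c..d, χ' y * (k (V y) * deriv V y) ≤ ∫ y in c..d, θ' y * deriv V y := by
    apply intervalIntegral.integral_mono hcd ((cχ'.mul ckV).intervalIntegrable _ _)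
      (cθV.intervalIntegrable _ _)
    intro y
    have := mul_nonneg (hχ0 y) (mul_nonneg (hk'0 (V y)) (sq_nonneg (deriv V y)))
    simp only [hθ', Pi.mul_apply]
    nlinarith
  have I5 := intervalIntegral.integral_mul_deriv_eq_deriv_mul (a := c) (b := d)
    (fun y _ => hχ' y) (fun y _ => djV y) (hχc.intervalIntegrable _ _) (ckV.intervalIntegrable _ _)
  rw [hj0 _ hc, hj0 _ hd] at I5
  rw [θc, θd] at I1
  have I6 : ∫ y in c..d, θ y * g y = - ∫ y in c..d, θ' y * deriv V y := by
    rw [← I3, I1]; ring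
  change ∫ y in c..d, θ y * g y ≤ _
  rw [I6]
  linarith

/-- A smooth convex approximation of the positive part. -/
lemma exists_pos_part_approx {δ : ℝ} (hδ : 0 < δ) :
    ∃ k k' j : ℝ → ℝ, (∀ v, HasDerivAt k (k' v) v) ∧ Continuous k' ∧ (∀ v, HasDerivAt j (k v) v) ∧
      (∀ v, 0 ≤ k' v) ∧ (∀ v ≤ δ, k v = 0) ∧ (∀ v ≤ δ, k' v = 0) ∧ (∀ v ≤ δ, j v = 0) ∧
      (∀ v, 0 ≤ k v) ∧ (∀ v, k v ≤ 1) ∧ (∀ v, 0 ≤ j v) ∧ (∀ v, max v 0 ≤ j v + 2 * δ) ∧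
      ∀ x y, |j x - j y| ≤ |x - y| := by
  set k : ℝ → ℝ := fun v => Real.smoothTransition ((v - δ) / δ) with hk
  have hks : ContDiff ℝ 1 k := Real.smoothTransition.contDiff.comp (by fun_prop)
  have ckd : Continuous k := hks.continuous
  have k0 : ∀ v ≤ δ, k v = 0 := fun v hv =>
    Real.smoothTransition.zero_of_nonpos (div_nonpos_of_nonpos_of_nonneg (by linarith) hδ.le)
  have k1 : ∀ v, 2 * δ ≤ v → k v = 1 := fun v hv =>
    Real.smoothTransition.one_of_one_le (by rw [le_div_iff₀ hδ]; linarith)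
  have kn : ∀ v, 0 ≤ k v := fun v => Real.smoothTransition.nonneg _
  have kl : ∀ v, k v ≤ 1 := fun v => Real.smoothTransition.le_one _
  have kmono : Monotone k := fun x y hxy => Real.smoothTransition.monotone (by gcongr)
  set j : ℝ → ℝ := fun v => ∫ x in δ..v, k x with hj
  have dj : ∀ v, HasDerivAt j (k v) v := fun v =>
    intervalIntegral.integral_hasDerivAt_right (ckd.intervalIntegrable _ _)
      (ckd.stronglyMeasurableAtFilter _ _) ckd.continuousAt
  have j0 : ∀ v ≤ δ, j v = 0 := by
    intro v hv
    simp only [hj]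
    rw [intervalIntegral.integral_congr (g := fun _ => 0), intervalIntegral.integral_zero]
    intro x hx
    rw [uIcc_of_ge hv] at hx
    exact k0 x hx.2
  have jlip : ∀ x y, |j x - j y| ≤ |x - y| := by
    intro x y
    simp only [hj]
    rw [intervalIntegral.integral_interval_sub_left (ckd.intervalIntegrable _ _)
      (ckd.intervalIntegrable _ _), ← Real.norm_eq_abs]
    have := intervalIntegral.norm_integral_le_of_norm_le_const (a := y) (b := x) (f := k) (C := 1)
      (fun z _ => by rw [Real.norm_eq_abs, abs_of_nonneg (kn z)]; exact kl z)
    simpa using this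
  have jn : ∀ v, 0 ≤ j v := by
    intro v
    rcases le_total v δ with h | h
    · rw [j0 v h]
    · exact intervalIntegral.integral_nonneg h fun x _ => kn x
  have kd : ∀ v, HasDerivAt k (deriv k v) v := fun v =>
    (hks.differentiable one_ne_zero v).hasDerivAt
  refine ⟨k, deriv k, j, kd, (contDiff_one_iff_deriv.1 hks).2, dj, fun v => kmono.deriv_nonneg,
    k0, ?_, j0, kn, kl, jn, ?_, jlip⟩
  · intro v hv
    rcases hv.lt_or_eq with h | rfl
    · have : HasDerivAt k 0 v := (hasDerivAt_const v (0 : ℝ)).congr_of_eventuallyEq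
        ((eventually_lt_nhds h).mono fun x hx => k0 x hx.le)
      exact this.deriv
    · have : IsLocalMin k v := Eventually.of_forall fun x => by rw [k0 v le_rfl]; exact kn x
      exact this.deriv_eq_zero
  · intro v
    rcases le_total v (2 * δ) with h | h
    · exact (max_le h (by positivity)).trans (le_add_of_nonneg_left (jn v))
    · have h1 : j v = j (2 * δ) + ∫ x in (2 * δ)..v, k x := by
        simp only [hj]
        rw [intervalIntegral.integral_add_adjacent_intervals (ckd.intervalIntegrable _ _)
          (ckd.intervalIntegrable _ _)]
      have h2 : ∫ x in (2 * δ)..v, k x = v - 2 * δ := by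
        rw [intervalIntegral.integral_congr (g := fun _ => 1), intervalIntegral.integral_const]
        · simp
        · intro x hx
          rw [uIcc_of_le h] at hx
          exact k1 x hx.1
      rw [max_eq_left (by linarith)]
      linarith [jn (2 * δ)]

/-- Steklov average in time. -/
noncomputable def Av (v : ℝ → ℝ → ℝ) (h τ y : ℝ) : ℝ := h⁻¹ * Zf v τ (τ + h) y

lemma integrableOn_rect_of_slice {G : ℝ → ℝ → ℝ} {s t c d C : ℝ}
    (hG : Measurable (Function.uncurry G)) (hi : ∀ τ ∈ Ioc s t, IntegrableOn (G τ) (Ioc c d))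
    (hC : ∀ τ ∈ Ioc s t, ∫ y in Ioc c d, |G τ y| ≤ C) :
    IntegrableOn (Function.uncurry G) (Ioc s t ×ˢ Ioc c d) := by
  rw [IntegrableOn, Measure.volume_eq_prod, ← Measure.prod_restrict]
  rw [integrable_prod_iff hG.aestronglyMeasurable]
  constructor
  · rw [ae_restrict_iff' measurableSet_Ioc]
    exact Eventually.of_forall fun t ht => hi t ht
  · have hfin : IntegrableOn (fun _ : ℝ => C) (Ioc s t) := by simp
    refine Integrable.mono' hfin
      hG.norm.stronglyMeasurable.integral_prod_right.aestronglyMeasurable ?_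
    rw [ae_restrict_iff' measurableSet_Ioc]
    refine Eventually.of_forall fun t ht => ?_
    rw [Real.norm_eq_abs, abs_of_nonneg (integral_nonneg fun _ => norm_nonneg _)]
    exact hC t ht

namespace HeatData
variable {v vt vy vyy F : ℝ → ℝ → ℝ} {α β a b M : ℝ} (H : HeatData v vt vy vyy F α β a b M)
include H

lemma meas_Av (h : ℝ) (hh : 0 ≤ h) : Measurable (Function.uncurry (Av v h)) := by
  have e : Function.uncurry (Av v h) = fun p : ℝ × ℝ => h⁻¹ * ∫ s in Ioc 0 h, v (p.1 + s) p.2 := by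
    ext ⟨τ, y⟩
    simp only [Function.uncurry, Av, Zf]
    rw [← intervalIntegral.integral_of_le hh,
      intervalIntegral.integral_comp_add_left (fun x => v x y) τ]
    simp
  rw [e]
  have m : Measurable fun q : (ℝ × ℝ) × ℝ => v (q.1.1 + q.2) q.1.2 :=
    H.meas_w.comp (g := Function.uncurry v) (f := fun q : (ℝ × ℝ) × ℝ => (q.1.1 + q.2, q.1.2))
      (by fun_prop)
  exact (m.stronglyMeasurable.integral_prod_right (ν := volume.restrict (Ioc 0 h))).measurable.const_mul
    _

lemma hasDerivAt_Av (h τ y : ℝ) :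
    HasDerivAt (fun τ => Av v h τ y) (h⁻¹ * (v (τ + h) y - v τ y)) τ := by
  have hc := H.cont_t y
  have e : (fun τ => Av v h τ y) = fun τ =>
      h⁻¹ * ((∫ s in (0 : ℝ)..(τ + h), v s y) - ∫ s in (0 : ℝ)..τ, v s y) := by
    ext τ
    rw [intervalIntegral.integral_interval_sub_left (hc.intervalIntegrable _ _)
      (hc.intervalIntegrable _ _), Av, Zf]
  rw [e]
  have hd : ∀ x, HasDerivAt (fun x => ∫ s in (0 : ℝ)..x, v s y) (v x y) x := fun x =>
    intervalIntegral.integral_hasDerivAt_right (hc.intervalIntegrable _ _)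
      (hc.stronglyMeasurableAtFilter _ _) hc.continuousAt
  exact (((hd (τ + h)).comp_add_const τ h).sub (hd τ)).const_mul _

lemma Av_continuousOn {h τ : ℝ} (hτ : τ ∈ Ioo α β) (hτh : τ + h ∈ Ioo α β) :
    ContinuousOn (Av v h τ) (Ioo a b) :=
  (H.Zf_continuousOn hτ hτh).const_smul h⁻¹

lemma avg_close {h τ c d ε : ℝ} {u₀ : ℝ → ℝ} (hu₀ : Continuous u₀) (hh : 0 < h)
    (hτ : τ ∈ Ioo α β) (hτh : τ + h ∈ Ioo α β) (hc : c ∈ Ioo a b) (hd : d ∈ Ioo a b) (hcd : c ≤ d)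
    (hε : ∀ s ∈ Icc τ (τ + h), ∫ y in c..d, |v s y - u₀ y| ≤ ε) :
    ∫ y in c..d, |Av v h τ y - u₀ y| ≤ ε := by
  have hle : τ ≤ τ + h := by linarith
  have hst : Icc τ (τ + h) ⊆ Ioo α β := fun s hs => ⟨hτ.1.trans_le hs.1, hs.2.trans_lt hτh.2⟩
  have hab : ∀ s, ContinuousOn (fun y => v s y) (Icc c d) := fun s => (H.cont_y s).continuousOn
  have hintg : IntegrableOn (Function.uncurry fun s y => |v s y - u₀ y|) (uIoc τ (τ + h) ×ˢ uIoc c d) := by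
    rw [uIoc_of_le hle, uIoc_of_le hcd]
    refine integrableOn_rect_of_slice (C := ε) ?_ ?_ ?_
    · exact (H.meas_w.sub (hu₀.measurable.comp measurable_snd)).abs
    · intro s _
      exact (((H.cont_y s).sub hu₀).abs.integrableOn_Icc).mono_set Ioc_subset_Icc_self
    · intro s hs
      simp only [abs_abs]
      rw [← intervalIntegral.integral_of_le hcd]
      exact hε s (Ioc_subset_Icc_self hs)
  have hpt : ∀ y, |Av v h τ y - u₀ y| ≤ h⁻¹ * ∫ s in τ..(τ + h), |v s y - u₀ y| := by
    intro y
    have hcy := H.cont_t y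
    have : Av v h τ y - u₀ y = h⁻¹ * ∫ s in τ..(τ + h), (v s y - u₀ y) := by
      rw [intervalIntegral.integral_sub (hcy.intervalIntegrable _ _) (by simp)]
      simp only [Av, Zf, intervalIntegral.integral_const, smul_eq_mul]
      field_simp
      ring
    rw [this, abs_mul, abs_of_pos (inv_pos.2 hh)]
    gcongr
    exact intervalIntegral.abs_integral_le_integral_abs hle
  have hint2 : IntervalIntegrable (fun y => ∫ s in τ..(τ + h), |v s y - u₀ y|) volume c d := by
    rw [intervalIntegrable_iff]
    rw [IntegrableOn, Measure.volume_eq_prod, ← Measure.prod_restrict] at hintg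
    have := hintg.integral_prod_right
    rw [uIoc_of_le hle] at this
    refine this.congr (Eventually.of_forall fun y => ?_)
    simp only [Function.uncurry]
    rw [intervalIntegral.integral_of_le hle]
  calc ∫ y in c..d, |Av v h τ y - u₀ y|
      ≤ ∫ y in c..d, h⁻¹ * ∫ s in τ..(τ + h), |v s y - u₀ y| := by
        apply intervalIntegral.integral_mono_on hcd _ (hint2.const_mul _) fun y _ => hpt y
        apply ContinuousOn.intervalIntegrable
        rw [uIcc_of_le hcd]
        exact (((H.Av_continuousOn hτ hτh).mono fun y hy =>
          ⟨hc.1.trans_le hy.1, hy.2.trans_lt hd.2⟩).sub hu₀.continuousOn).abs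
    _ = h⁻¹ * ∫ s in τ..(τ + h), ∫ y in c..d, |v s y - u₀ y| := by
        rw [intervalIntegral.integral_const_mul, intervalIntegral_intervalIntegral_swap hintg]
    _ ≤ h⁻¹ * ∫ s in τ..(τ + h), ε := by
        gcongr
        apply intervalIntegral.integral_mono_on hle _ (by simp) hε
        rw [intervalIntegrable_iff]
        rw [IntegrableOn, Measure.volume_eq_prod, ← Measure.prod_restrict] at hintg
        have := hintg.integral_prod_left
        rw [uIoc_of_le hcd] at this
        refine this.congr (Eventually.of_forall fun y => ?_)
        simp only [Function.uncurry]
        rw [intervalIntegral.integral_of_le hcd]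
    _ = ε := by
        simp only [intervalIntegral.integral_const, smul_eq_mul]
        field_simp
        ring

lemma slice_abs_le {t : ℝ} (ht : t ∈ Ioo α β) (hab : a ≤ b) :
    ∫ y in Ioo a b, |v t y| ≤ (b - a) + M := by
  calc ∫ y in Ioo a b, |v t y| ≤ ∫ y in Ioo a b, (1 + v t y ^ 2) := by
        apply integral_mono (H.int_slice ht).abs
          ((integrable_const (1 : ℝ)).add (H.sq t ht))
        intro y
        simp only [Pi.add_apply]
        nlinarith [sq_nonneg (|v t y| - 1), sq_abs (v t y), abs_nonneg (v t y)]
    _ ≤ (b - a) + M := by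
        rw [integral_add (integrable_const (1 : ℝ)) (H.sq t ht)]
        simp only [integral_const, smul_eq_mul, mul_one, measureReal_restrict_apply_univ,
          Real.volume_real_Ioo_of_le hab]
        linarith [H.sqM t ht]

end HeatData

namespace HeatData
variable {v vt vy vyy F : ℝ → ℝ → ℝ} {α β a b M : ℝ} (H : HeatData v vt vy vyy F α β a b M)
include H

lemma Av_sub_bound {h τ c d : ℝ} (hh : 0 < h) (hτ : τ ∈ Ioo α β) (hτh : τ + h ∈ Ioo α β)
    (hc : c ∈ Ioo a b) (hd : d ∈ Ioo a b) (hcd : c ≤ d) :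
    ∫ y in c..d, |Av v h τ y| ≤ (b - a) + M := by
  have := H.avg_close (u₀ := fun _ => 0) (ε := (b - a) + M) continuous_const hh hτ hτh hc hd hcd ?_
  · simpa using this
  · intro s hs
    have hs' : s ∈ Ioo α β := ⟨hτ.1.trans_le hs.1, hs.2.trans_lt hτh.2⟩
    simp only [sub_zero]
    rw [intervalIntegral.integral_of_le hcd]
    refine le_trans (setIntegral_mono_set (H.int_slice hs').abs
      (Eventually.of_forall fun _ => abs_nonneg _) ?_)
      (H.slice_abs_le hs' (hc.1.trans hc.2).le)
    exact LE.le.eventuallyLE fun y hy => ⟨hc.1.trans hy.1, hy.2.trans_lt hd.2⟩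

lemma slice_test {h τ c d δ : ℝ} {χ χ' χ'' k k' j : ℝ → ℝ} (hh : 0 < h)
    (hτ : τ ∈ Ioo α β) (hτh : τ + h ∈ Ioo α β)
    (hc : c ∈ Ioo a b) (hd : d ∈ Ioo a b) (hcd : c ≤ d) (hδ : 0 < δ)
    (hloc : ∀ y ∈ Ioo c d, (∀ s ∈ Icc τ (τ + h), v s y ≤ 0) ∨
      ∃ c' d', y ∈ Ioo c' d' ∧ c' ∈ Ioo a b ∧ Sol v F τ (τ + h) c' d')
    (hbc : ∀ s ∈ Icc τ (τ + h), v s c ≤ 0 ∧ v s d ≤ 0)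
    (hχ : ∀ y, HasDerivAt χ (χ' y) y) (hχ' : ∀ y, HasDerivAt χ' (χ'' y) y)
    (hχc : Continuous χ'') (hχ0 : ∀ y, 0 ≤ χ y)
    (hk : ∀ v, HasDerivAt k (k' v) v) (hkc : Continuous k') (hj : ∀ v, HasDerivAt j (k v) v)
    (hk'0 : ∀ v, 0 ≤ k' v) (hk0 : ∀ v ≤ δ, k v = 0) (hk'δ : ∀ v ≤ δ, k' v = 0)
    (hj0 : ∀ v ≤ δ, j v = 0) :
    ∫ y in c..d, χ y * k (Av v h τ y) * (h⁻¹ * gf v F τ (τ + h) y) ≤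
      ∫ y in c..d, χ'' y * j (Av v h τ y) := by
  have hle : τ ≤ τ + h := by linarith
  have neg : ∀ y, (∀ s ∈ Icc τ (τ + h), v s y ≤ 0) → Av v h τ y ≤ 0 := by
    intro y hy
    refine mul_nonpos_of_nonneg_of_nonpos (inv_pos.2 hh).le ?_
    rw [Zf, ← neg_nonneg, ← intervalIntegral.integral_neg]
    exact intervalIntegral.integral_nonneg hle fun s hs => by have := hy s hs; linarith
  set V : ℝ → ℝ := (Icc c d).indicator (Av v h τ) with hV
  have hVin : ∀ y ∈ Icc c d, V y = Av v h τ y := fun y hy => indicator_of_mem hy _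
  have hsmall : ∀ y ∈ Icc c d, Av v h τ y ≤ 0 → ∀ᶠ z in 𝓝 y, V z ≤ δ := by
    intro y hy h0
    have hyab : y ∈ Ioo a b := ⟨hc.1.trans_le hy.1, hy.2.trans_lt hd.2⟩
    have hcont := (H.Av_continuousOn hτ hτh).continuousAt (Ioo_mem_nhds hyab.1 hyab.2)
    filter_upwards [hcont.eventually (eventually_lt_nhds (h0.trans_lt hδ))] with z hz
    simp only [hV]
    by_cases hzm : z ∈ Icc c d
    · rw [indicator_of_mem hzm]; exact hz.le
    · rw [indicator_of_notMem hzm]; exact hδ.le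
  have main : ∫ y in c..d, χ y * k (V y) * (h⁻¹ * gf v F τ (τ + h) y) ≤
      ∫ y in c..d, χ'' y * j (V y) := by
    refine integral_test_le hcd ((IntegrableOn.interval (H.int_g hτ hτh) hc hd).const_mul _) ?_
      hχ hχ' hχc hχ0 hk hkc hj hk'0 hk0 hk'δ hj0
    intro y
    by_cases hy : y ∈ Icc c d
    swap
    · left
      filter_upwards [isClosed_Icc.isOpen_compl.mem_nhds hy] with z hz
      rw [hV, indicator_of_notMem hz]; exact hδ.le
    rcases hy.1.eq_or_lt with rfl | hyc
    · exact Or.inl (hsmall _ hy (neg _ fun s hs => (hbc s hs).1))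
    rcases hy.2.eq_or_lt with rfl | hyd
    · exact Or.inl (hsmall _ hy (neg _ fun s hs => (hbc s hs).2))
    rcases hloc y ⟨hyc, hyd⟩ with h1 | ⟨c', d', hy', hc', p, hp⟩
    · exact Or.inl (hsmall _ hy (neg _ h1))
    · refine Or.inr ⟨⟨hyc, hyd⟩, h⁻¹ * (p + ∫ z in c'..c, gf v F τ (τ + h) z), ?_⟩
      filter_upwards [(isOpen_Ioo (a := c) (b := d)).eventually_mem ⟨hyc, hyd⟩,
        isOpen_Ioo.eventually_mem hy'] with z hz hz'
      have hzab : z ∈ Ioo a b := ⟨hc.1.trans hz.1, hz.2.trans hd.2⟩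
      have e : V =ᶠ[𝓝 z] fun y => h⁻¹ * Zf v τ (τ + h) y := by
        filter_upwards [isOpen_Ioo.eventually_mem hz] with x hx
        exact hVin x (Ioo_subset_Icc_self hx)
      refine HasDerivAt.congr_of_eventuallyEq ?_ e
      convert! (hp z hz').const_mul h⁻¹ using 1
      rw [intervalIntegral.integral_const_mul, ← mul_add,
        ← intervalIntegral.integral_add_adjacent_intervals
          (IntegrableOn.interval (H.int_g hτ hτh) hc' hc)
          (IntegrableOn.interval (H.int_g hτ hτh) hc hzab)]
      ring
  have e1 : ∫ y in c..d, χ y * k (V y) * (h⁻¹ * gf v F τ (τ + h) y) =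
      ∫ y in c..d, χ y * k (Av v h τ y) * (h⁻¹ * gf v F τ (τ + h) y) := by
    apply intervalIntegral.integral_congr
    intro y hy
    rw [uIcc_of_le hcd] at hy
    simp only [hVin y hy]
  have e2 : ∫ y in c..d, χ'' y * j (V y) = ∫ y in c..d, χ'' y * j (Av v h τ y) := by
    apply intervalIntegral.integral_congr
    intro y hy
    rw [uIcc_of_le hcd] at hy
    simp only [hVin y hy]
  rwa [e1, e2] at main

lemma int_pos_part {χ : ℝ → ℝ} (hχc : Continuous χ) (hχ0 : ∀ y, 0 ≤ χ y) (hχ1 : ∀ y, χ y ≤ 1) :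
    IntegrableOn (Function.uncurry fun τ y => χ y * max (F τ y) 0) (Ioo α β ×ˢ Ioo a b) := by
  refine Integrable.mono' H.iF.norm ?_ (Eventually.of_forall fun p => ?_)
  · exact ((hχc.measurable.comp measurable_snd).mul
      (H.meas_F.max measurable_const)).aestronglyMeasurable
  · simp only [Function.uncurry]
    rw [Real.norm_eq_abs, abs_of_nonneg (mul_nonneg (hχ0 _) (le_max_right _ _)), Real.norm_eq_abs]
    calc χ p.2 * max (F p.1 p.2) 0 ≤ 1 * max (F p.1 p.2) 0 :=
          mul_le_mul_of_nonneg_right (hχ1 _) (le_max_right _ _)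
      _ ≤ _ := by rw [one_mul]; exact max_le (le_abs_self _) (abs_nonneg _)

lemma mean_F_le {h τ c d : ℝ} {χ κ : ℝ → ℝ} (hh : 0 < h)
    (hτ : τ ∈ Ioo α β) (hτh : τ + h ∈ Ioo α β)
    (hc : c ∈ Ioo a b) (hd : d ∈ Ioo a b) (hcd : c ≤ d) (hχc : Continuous χ)
    (hχ0 : ∀ y, 0 ≤ χ y) (hχ1 : ∀ y, χ y ≤ 1) (hκ0 : ∀ y, 0 ≤ κ y) (hκ1 : ∀ y, κ y ≤ 1)
    (hκm : AEStronglyMeasurable κ (volume.restrict (uIoc c d))) :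
    ∫ y in c..d, χ y * κ y * (h⁻¹ * ∫ s in τ..(τ + h), F s y) ≤
      h⁻¹ * ∫ s in τ..(τ + h), ∫ y in c..d, χ y * max (F s y) 0 := by
  have hle : τ ≤ τ + h := by linarith
  have iP := H.int_pos_part hχc hχ0 hχ1
  rw [rect_swap hτ hτh hc hd iP, ← intervalIntegral.integral_const_mul]
  have i2 := IntegrableOn.interval (integrableOn_integral_fst hτ hτh iP) hc hd
  have i1 := IntegrableOn.interval (integrableOn_integral_fst hτ hτh H.iF) hc hd
  apply intervalIntegral.integral_mono_ae_restrict hcd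
  · rw [intervalIntegrable_iff] at i1 ⊢
    refine (i1.const_mul h⁻¹).bdd_mul (c := 1) (hχc.aestronglyMeasurable.mul hκm) ?_
    refine Eventually.of_forall fun y => ?_
    rw [Real.norm_eq_abs, abs_of_nonneg (mul_nonneg (hχ0 y) (hκ0 y))]
    exact mul_le_one₀ (hχ1 y) (hκ0 y) (hκ1 y)
  · exact i2.const_mul _
  · rw [EventuallyLE, ae_restrict_iff' measurableSet_Icc]
    filter_upwards [ae_integrableOn_fst H.iF] with y hy hycd
    have hyab : y ∈ Ioo a b := ⟨hc.1.trans_le hycd.1, hycd.2.trans_lt hd.2⟩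
    have iy := IntegrableOn.interval (hy hyab) hτ hτh
    have ip : IntervalIntegrable (fun s => max (F s y) 0) volume τ (τ + h) := by
      rw [intervalIntegrable_iff] at iy ⊢
      exact iy.pos_part
    have hI0 : 0 ≤ ∫ s in τ..(τ + h), max (F s y) 0 :=
      intervalIntegral.integral_nonneg hle fun s _ => le_max_right _ _
    have h1 : ∫ s in τ..(τ + h), F s y ≤ ∫ s in τ..(τ + h), max (F s y) 0 :=
      intervalIntegral.integral_mono hle iy ip fun s => le_max_left _ _
    have hh' := inv_pos.2 hh
    rw [intervalIntegral.integral_const_mul]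
    calc χ y * κ y * (h⁻¹ * ∫ s in τ..(τ + h), F s y)
        ≤ χ y * κ y * (h⁻¹ * ∫ s in τ..(τ + h), max (F s y) 0) := by
          have := hκ0 y; have := hχ0 y; gcongr
      _ ≤ χ y * 1 * (h⁻¹ * ∫ s in τ..(τ + h), max (F s y) 0) := by
          have := hχ0 y; have := hκ1 y; gcongr
      _ = _ := by ring

end HeatData

lemma integral_window_le {Φ : ℝ → ℝ} {σ t' h : ℝ} (hh : 0 < h) (hσ : σ ≤ t')
    (hi : IntervalIntegrable Φ volume σ (t' + h)) (h0 : ∀ τ, 0 ≤ Φ τ) :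
    IntervalIntegrable (fun τ => h⁻¹ * ∫ s in τ..(τ + h), Φ s) volume σ t' ∧
    ∫ τ in σ..t', h⁻¹ * ∫ s in τ..(τ + h), Φ s ≤ ∫ τ in σ..(t' + h), Φ τ := by
  have hle : σ ≤ t' + h := by linarith
  have hσi : IntegrableOn Φ (Icc σ (t' + h)) := by
    rwa [integrableOn_Icc_iff_integrableOn_Ioc, ← intervalIntegrable_iff_integrableOn_Ioc_of_le hle]
  set Ψ : ℝ → ℝ := fun x => ∫ s in σ..x, Φ s with hΨ
  have cΨ : ContinuousOn Ψ (Icc σ (t' + h)) := by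
    have := (hi.absolutelyContinuousOnInterval_intervalIntegral (c := σ) (by simp)).continuousOn
    rwa [uIcc_of_le hle] at this
  have sub : ∀ {x y}, x ∈ Icc σ (t' + h) → y ∈ Icc σ (t' + h) → IntervalIntegrable Φ volume x y :=
    fun hx hy => (hσi.mono_set (uIcc_subset_Icc hx hy)).intervalIntegrable
  have hmem : ∀ {τ}, τ ∈ Icc σ t' → τ ∈ Icc σ (t' + h) ∧ τ + h ∈ Icc σ (t' + h) := fun hτ =>
    ⟨⟨hτ.1, by linarith [hτ.2]⟩, ⟨by linarith [hτ.1], by linarith [hτ.2]⟩⟩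
  have e : ∀ τ ∈ Icc σ t', (∫ s in τ..(τ + h), Φ s) = Ψ (τ + h) - Ψ τ := by
    intro τ hτ
    obtain ⟨h1, h2⟩ := hmem hτ
    have hs : σ ∈ Icc σ (t' + h) := ⟨le_rfl, hle⟩
    simp only [hΨ]
    rw [intervalIntegral.integral_interval_sub_left (sub hs h2) (sub hs h1)]
  have c1 : ContinuousOn (fun τ => Ψ (τ + h)) (uIcc σ t') := by
    rw [uIcc_of_le hσ]
    exact cΨ.comp (by fun_prop) fun τ hτ => (hmem hτ).2
  have c2 : ContinuousOn Ψ (uIcc σ t') := by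
    rw [uIcc_of_le hσ]
    exact cΨ.mono fun τ hτ => (hmem hτ).1
  have cc : IntervalIntegrable (fun τ => h⁻¹ * ∫ s in τ..(τ + h), Φ s) volume σ t' := by
    have := ((c1.sub c2).intervalIntegrable (μ := volume)).const_mul h⁻¹
    refine this.congr fun τ hτ => ?_
    simp only [Pi.sub_apply]
    rw [e τ (by rw [← uIcc_of_le hσ]; exact uIoc_subset_uIcc hτ)]
  refine ⟨cc, ?_⟩
  have e2 : ∫ τ in σ..t', h⁻¹ * ∫ s in τ..(τ + h), Φ s =
      h⁻¹ * ((∫ τ in (σ + h)..(t' + h), Ψ τ) - ∫ τ in σ..t', Ψ τ) := by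
    rw [intervalIntegral.integral_const_mul,
      ← intervalIntegral.integral_comp_add_right (fun τ => Ψ τ) h,
      ← intervalIntegral.integral_sub c1.intervalIntegrable c2.intervalIntegrable]
    congr 1
    apply intervalIntegral.integral_congr
    intro τ hτ
    rw [uIcc_of_le hσ] at hτ
    exact e τ hτ
  rw [e2]
  have cI : ∀ {x y}, x ∈ Icc σ (t' + h) → y ∈ Icc σ (t' + h) → IntervalIntegrable Ψ volume x y :=
    fun hx hy => (cΨ.mono (uIcc_subset_Icc hx hy)).intervalIntegrable
  have m1 : σ ∈ Icc σ (t' + h) := ⟨le_rfl, hle⟩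
  have m2 : t' ∈ Icc σ (t' + h) := ⟨hσ, by linarith⟩
  have m3 : σ + h ∈ Icc σ (t' + h) := ⟨by linarith, by linarith⟩
  have m4 : t' + h ∈ Icc σ (t' + h) := ⟨hle, le_rfl⟩
  have e3 : (∫ τ in (σ + h)..(t' + h), Ψ τ) - ∫ τ in σ..t', Ψ τ =
      (∫ τ in t'..(t' + h), Ψ τ) - ∫ τ in σ..(σ + h), Ψ τ := by
    have a1 := intervalIntegral.integral_add_adjacent_intervals (cI m1 m3) (cI m3 m4)
    have a2 := intervalIntegral.integral_add_adjacent_intervals (cI m1 m2) (cI m2 m4)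
    linarith
  rw [e3]
  have b1 : ∫ τ in t'..(t' + h), Ψ τ ≤ ∫ τ in t'..(t' + h), Ψ (t' + h) := by
    apply intervalIntegral.integral_mono_on (by linarith) (cI m2 m4) (by simp)
    intro τ hτ
    have := intervalIntegral.integral_nonneg (μ := volume) hτ.2 fun x _ => h0 x
    have h2 := intervalIntegral.integral_add_adjacent_intervals
      (sub m1 ⟨by linarith [hτ.1], hτ.2⟩ : IntervalIntegrable Φ volume σ τ)
      (sub ⟨by linarith [hτ.1], hτ.2⟩ m4)
    simp only [hΨ]
    linarith
  have b2 : 0 ≤ ∫ τ in σ..(σ + h), Ψ τ :=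
    intervalIntegral.integral_nonneg (by linarith) fun τ hτ =>
      intervalIntegral.integral_nonneg hτ.1 fun x _ => h0 x
  have b3 : ∫ τ in t'..(t' + h), Ψ (t' + h) = h * Ψ (t' + h) := by simp
  calc h⁻¹ * ((∫ τ in t'..(t' + h), Ψ τ) - ∫ τ in σ..(σ + h), Ψ τ)
      ≤ h⁻¹ * (h * Ψ (t' + h)) := by
        have := inv_pos.2 hh
        gcongr
        linarith
    _ = Ψ (t' + h) := by field_simp

namespace HeatData
variable {v vt vy vyy F : ℝ → ℝ → ℝ} {α β a b M : ℝ} (H : HeatData v vt vy vyy F α β a b M)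
include H

lemma Av_interval {h τ c d : ℝ} {χ j : ℝ → ℝ} (hτ : τ ∈ Ioo α β) (hτh : τ + h ∈ Ioo α β)
    (hc : c ∈ Ioo a b) (hd : d ∈ Ioo a b) (hcd : c ≤ d) (hχc : Continuous χ) (hj : Continuous j) :
    IntervalIntegrable (fun y => χ y * j (Av v h τ y)) volume c d := by
  apply ContinuousOn.intervalIntegrable
  rw [uIcc_of_le hcd]
  exact hχc.continuousOn.mul (hj.comp_continuousOn ((H.Av_continuousOn hτ hτh).mono fun y hy =>
          ⟨hc.1.trans_le hy.1, hy.2.trans_lt hd.2⟩))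

lemma forward_control_av {σ t' h c d δ lam : ℝ} {χ χ' χ'' k k' j : ℝ → ℝ} (hh : 0 < h)
    (hσ : σ ∈ Ioo α β) (hσt : σ ≤ t') (hth : t' + h ∈ Ioo α β)
    (hc : c ∈ Ioo a b) (hd : d ∈ Ioo a b) (hcd : c ≤ d) (hδ : 0 < δ) (hlam : 0 ≤ lam)
    (hloc : ∀ y ∈ Ioo c d, (∀ s ∈ Icc σ (t' + h), v s y ≤ 0) ∨
      ∀ s₁ ∈ Icc σ (t' + h), ∀ s₂ ∈ Icc σ (t' + h),
        ∃ c' d', y ∈ Ioo c' d' ∧ c' ∈ Ioo a b ∧ Sol v F s₁ s₂ c' d')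
    (hbc : ∀ s ∈ Icc σ (t' + h), v s c ≤ 0 ∧ v s d ≤ 0)
    (hχ : ∀ y, HasDerivAt χ (χ' y) y) (hχ' : ∀ y, HasDerivAt χ' (χ'' y) y)
    (hχc : Continuous χ'') (hχ0 : ∀ y, 0 ≤ χ y) (hχ1 : ∀ y, χ y ≤ 1)
    (hχlam : ∀ y, χ'' y ≤ lam * χ y)
    (hk : ∀ v, HasDerivAt k (k' v) v) (hkc : Continuous k') (hj : ∀ v, HasDerivAt j (k v) v)
    (hk'0 : ∀ v, 0 ≤ k' v) (hk0 : ∀ v ≤ δ, k v = 0) (hk'δ : ∀ v ≤ δ, k' v = 0)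
    (hj0 : ∀ v ≤ δ, j v = 0) (hkn : ∀ v, 0 ≤ k v) (hk1 : ∀ v, k v ≤ 1) (hjn : ∀ v, 0 ≤ j v)
    (hjl : ∀ x y, |j x - j y| ≤ |x - y|) :
    Real.exp (-(lam * (t' - σ))) * ∫ y in c..d, χ y * j (Av v h t' y) ≤
      (∫ y in c..d, χ y * j (Av v h σ y)) +
        ∫ τ in σ..(t' + h), ∫ y in c..d, χ y * max (F τ y) 0 := by
  have cχ : Continuous χ := continuous_iff_continuousAt.2 fun y => (hχ y).continuousAt
  have ck : Continuous k := continuous_iff_continuousAt.2 fun y => (hk y).continuousAt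
  have cj : Continuous j := continuous_iff_continuousAt.2 fun y => (hj y).continuousAt
  have hmem : ∀ {τ}, τ ∈ Icc σ t' → τ ∈ Ioo α β ∧ τ + h ∈ Ioo α β := fun hτ =>
    ⟨⟨hσ.1.trans_le hτ.1, by linarith [hτ.2, hth.2]⟩,
      ⟨by linarith [hτ.1, hσ.1], by linarith [hτ.2, hth.2]⟩⟩
  have jabs : ∀ x, |j x| ≤ |x| := fun x => by
    have := hjl x 0
    rwa [hj0 0 hδ.le, sub_zero, sub_zero] at this
  set ex : ℝ → ℝ := fun τ => Real.exp (-(lam * (τ - σ))) with hex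
  have cex : Continuous ex := by fun_prop
  have ex0 : ∀ τ, 0 < ex τ := fun τ => Real.exp_pos _
  have ex1 : ∀ τ, σ ≤ τ → ex τ ≤ 1 := fun τ hτ =>
    Real.exp_le_one_iff.2 (neg_nonpos.2 (mul_nonneg hlam (sub_nonneg.2 hτ)))
  set D : ℝ → ℝ → ℝ := fun τ y => h⁻¹ * (v (τ + h) y - v τ y) with hD
  set G : ℝ → ℝ → ℝ := fun τ y =>
    ex τ * (χ y * (k (Av v h τ y) * D τ y - lam * j (Av v h τ y))) with hG
  -- pointwise in y
  have hder : ∀ y τ, HasDerivAt (fun τ => ex τ * (χ y * j (Av v h τ y))) (G τ y) τ := by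
    intro y τ
    have h1 : HasDerivAt ex (ex τ * (-lam)) τ := by
      have : HasDerivAt (fun τ => -(lam * (τ - σ))) (-lam) τ := by
        convert! (((hasDerivAt_id τ).sub_const σ).const_mul lam).neg using 1
        ring
      exact this.exp
    have h2 := ((hj _).comp τ (H.hasDerivAt_Av h τ y)).const_mul (χ y)
    convert! h1.mul h2 using 1
    simp only [hG, hD, Function.comp]
    ring
  have cAv : ∀ y, Continuous fun τ => Av v h τ y := fun y =>
    continuous_iff_continuousAt.2 fun τ => (H.hasDerivAt_Av h τ y).continuousAt
  have cGt : ∀ y, Continuous fun τ => G τ y := by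
    intro y
    have c1 := cAv y
    have c2 := H.cont_t y
    have c3 : Continuous fun τ => v (τ + h) y := c2.comp (by fun_prop)
    simp only [hG, hD]
    exact cex.mul (continuous_const.mul (((ck.comp c1).mul (continuous_const.mul (c3.sub c2))).sub
      (continuous_const.mul (cj.comp c1))))
  have ftc : ∀ y, ∫ τ in σ..t', G τ y = ex t' * (χ y * j (Av v h t' y)) - χ y * j (Av v h σ y) := by
    intro y
    rw [intervalIntegral.integral_eq_sub_of_hasDerivAt (fun τ _ => hder y τ)
      ((cGt y).intervalIntegrable _ _)]
    simp [hex]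
  -- measurability and integrability
  have mAv := H.meas_Av h hh.le
  have mD : Measurable (Function.uncurry D) := by
    have m1 : Measurable fun p : ℝ × ℝ => v (p.1 + h) p.2 :=
      H.meas_w.comp (g := Function.uncurry v) (f := fun q : ℝ × ℝ => (q.1 + h, q.2)) (by fun_prop)
    exact (m1.sub H.meas_w).const_mul _
  have mG : Measurable (Function.uncurry G) := by
    have : Function.uncurry G = fun p : ℝ × ℝ => ex p.1 * (χ p.2 *
      (k (Function.uncurry (Av v h) p) * Function.uncurry D p
        - lam * j (Function.uncurry (Av v h) p))) := rfl
    rw [this]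
    exact (cex.measurable.comp measurable_fst).mul ((cχ.measurable.comp measurable_snd).mul
      (((ck.measurable.comp mAv).mul mD).sub ((cj.measurable.comp mAv).const_mul _)))
  have hab : a ≤ b := (hc.1.trans hc.2).le
  have vint : ∀ {s}, s ∈ Ioo α β → IntervalIntegrable (fun y => |v s y|) volume c d := fun {s} hs =>
    ((H.cont_y s).abs).intervalIntegrable _ _
  have vb : ∀ {s}, s ∈ Ioo α β → ∫ y in c..d, |v s y| ≤ (b - a) + M := by
    intro s hs
    rw [intervalIntegral.integral_of_le hcd]
    refine le_trans (setIntegral_mono_set (H.int_slice hs).abs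
      (Eventually.of_forall fun _ => abs_nonneg _) ?_) (H.slice_abs_le hs hab)
    exact LE.le.eventuallyLE fun y hy => ⟨hc.1.trans hy.1, hy.2.trans_lt hd.2⟩
  have cG : ∀ τ ∈ Icc σ t', ContinuousOn (G τ) (Icc c d) := by
    intro τ hτ
    obtain ⟨h1, h2⟩ := hmem hτ
    have c1 := (H.Av_continuousOn h1 h2).mono fun y (hy : y ∈ Icc c d) =>
          (⟨hc.1.trans_le hy.1, hy.2.trans_lt hd.2⟩ : y ∈ Ioo a b)
    have c2 := (H.cont_y τ).continuousOn (s := Icc c d)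
    have c3 := (H.cont_y (τ + h)).continuousOn (s := Icc c d)
    simp only [hG, hD]
    exact continuousOn_const.mul (cχ.continuousOn.mul (((ck.comp_continuousOn c1).mul
      (continuousOn_const.mul (c3.sub c2))).sub (continuousOn_const.mul (cj.comp_continuousOn c1))))
  have iG : IntegrableOn (Function.uncurry G) (Ioc σ t' ×ˢ Ioc c d) := by
    refine integrableOn_rect_of_slice
      (C := h⁻¹ * (((b - a) + M) + ((b - a) + M)) + lam * ((b - a) + M)) mG ?_ ?_
    · intro τ hτ
      exact (cG τ (Ioc_subset_Icc_self hτ)).integrableOn_Icc.mono_set Ioc_subset_Icc_self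
    · intro τ hτ
      have hτ' := Ioc_subset_Icc_self hτ
      obtain ⟨h1, h2⟩ := hmem hτ'
      have iAv : IntervalIntegrable (fun y => |Av v h τ y|) volume c d := by
        simpa using H.Av_interval h1 h2 hc hd hcd (χ := fun _ => 1) continuous_const continuous_abs
      rw [← intervalIntegral.integral_of_le hcd]
      calc ∫ y in c..d, |G τ y|
          ≤ ∫ y in c..d, (h⁻¹ * (|v (τ + h) y| + |v τ y|) + lam * |Av v h τ y|) := by
            apply intervalIntegral.integral_mono_on hcd
            · apply ContinuousOn.intervalIntegrable
              rw [uIcc_of_le hcd]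
              exact (cG τ hτ').abs
            · exact (((vint h2).add (vint h1)).const_mul _).add (iAv.const_mul _)
            · intro y _
              simp only [hG, hD]
              rw [abs_mul, abs_mul, abs_of_pos (ex0 τ), abs_of_nonneg (hχ0 y)]
              have e1 : |k (Av v h τ y) * (h⁻¹ * (v (τ + h) y - v τ y)) - lam * j (Av v h τ y)| ≤
                  h⁻¹ * (|v (τ + h) y| + |v τ y|) + lam * |Av v h τ y| := by
                refine (abs_sub _ _).trans (add_le_add ?_ ?_)
                · rw [abs_mul, abs_mul, abs_of_nonneg (hkn _), abs_of_pos (inv_pos.2 hh)]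
                  have := abs_sub (v (τ + h) y) (v τ y)
                  have h3 := inv_pos.2 hh
                  calc k (Av v h τ y) * (h⁻¹ * |v (τ + h) y - v τ y|)
                      ≤ 1 * (h⁻¹ * (|v (τ + h) y| + |v τ y|)) := by
                        gcongr
                        exact hk1 _
                    _ = _ := one_mul _
                · rw [abs_mul, abs_of_nonneg hlam]
                  exact mul_le_mul_of_nonneg_left (jabs _) hlam
              refine le_trans ?_ e1
              rw [← mul_assoc]
              exact mul_le_of_le_one_left (abs_nonneg _)
                (mul_le_one₀ (ex1 τ hτ.1.le) (hχ0 y) (hχ1 y))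
        _ = h⁻¹ * ((∫ y in c..d, |v (τ + h) y|) + ∫ y in c..d, |v τ y|)
              + lam * ∫ y in c..d, |Av v h τ y| := by
            rw [intervalIntegral.integral_add (((vint h2).add (vint h1)).const_mul _)
              (iAv.const_mul _), intervalIntegral.integral_const_mul,
              intervalIntegral.integral_const_mul,
              intervalIntegral.integral_add (vint h2) (vint h1)]
        _ ≤ _ := by
            have := vb h1
            have := vb h2
            have := H.Av_sub_bound hh h1 h2 hc hd hcd
            have := inv_pos.2 hh
            gcongr
  have swap : ∫ τ in σ..t', ∫ y in c..d, G τ y = ∫ y in c..d, ∫ τ in σ..t', G τ y := by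
    apply intervalIntegral_intervalIntegral_swap
    rwa [uIoc_of_le hσt, uIoc_of_le hcd]
  -- slices
  set Φ : ℝ → ℝ := fun τ => ∫ y in c..d, χ y * max (F τ y) 0 with hΦ
  have Φ0 : ∀ τ, 0 ≤ Φ τ := fun τ => intervalIntegral.integral_nonneg hcd fun y _ =>
    mul_nonneg (hχ0 y) (le_max_right _ _)
  have iΦ : IntervalIntegrable Φ volume σ (t' + h) :=
    IntegrableOn.interval (integrableOn_integral_snd hc hd (H.int_pos_part cχ hχ0 hχ1)) hσ hth
  obtain ⟨iW, hW⟩ := integral_window_le hh hσt iΦ Φ0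
  have slice : ∀ τ ∈ Icc σ t', ∫ y in c..d, G τ y ≤ h⁻¹ * ∫ s in τ..(τ + h), Φ s := by
    intro τ hτ
    obtain ⟨h1, h2⟩ := hmem hτ
    have hsub : Icc τ (τ + h) ⊆ Icc σ (t' + h) := Icc_subset_Icc hτ.1 (by linarith [hτ.2])
    have hle : τ ≤ τ + h := by linarith
    have T1 := H.slice_test hh h1 h2 hc hd hcd hδ
      (fun y hy => (hloc y hy).imp (fun h s hs => h s (hsub hs))
        (fun hS => hS τ (hsub ⟨le_rfl, hle⟩) (τ + h) (hsub ⟨hle, le_rfl⟩)))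
      (fun s hs => hbc s (hsub hs)) hχ hχ' hχc hχ0 hk hkc hj hk'0 hk0 hk'δ hj0
    have cκ : ContinuousOn (fun y => k (Av v h τ y)) (uIcc c d) := by
      rw [uIcc_of_le hcd]
      exact ck.comp_continuousOn ((H.Av_continuousOn h1 h2).mono fun y (hy : y ∈ Icc c d) =>
          (⟨hc.1.trans_le hy.1, hy.2.trans_lt hd.2⟩ : y ∈ Ioo a b))
    have T2 := H.mean_F_le hh h1 h2 hc hd hcd cχ hχ0 hχ1 (κ := fun y => k (Av v h τ y))
      (fun _ => hkn _) (fun _ => hk1 _)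
      ((cκ.mono uIoc_subset_uIcc).aestronglyMeasurable measurableSet_uIoc)
    have i1 : IntervalIntegrable (fun y => χ y * k (Av v h τ y) * (h⁻¹ * gf v F τ (τ + h) y))
        volume c d :=
      ((IntegrableOn.interval (H.int_g h1 h2) hc hd).const_mul _).continuousOn_mul
        (cχ.continuousOn.mul cκ)
    have i2 : IntervalIntegrable (fun y => χ y * k (Av v h τ y) * (h⁻¹ * ∫ s in τ..(τ + h), F s y))
        volume c d :=
      ((IntegrableOn.interval (integrableOn_integral_fst h1 h2 H.iF) hc hd).const_mul _).continuousOn_mul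
        (cχ.continuousOn.mul cκ)
    have i3 := (H.Av_interval h1 h2 hc hd hcd cχ cj).const_mul lam
    have T3 : ∫ y in c..d, χ'' y * j (Av v h τ y) ≤ ∫ y in c..d, lam * (χ y * j (Av v h τ y)) := by
      apply intervalIntegral.integral_mono_on hcd (H.Av_interval h1 h2 hc hd hcd hχc cj) i3
      intro y _
      rw [← mul_assoc]
      exact mul_le_mul_of_nonneg_right (hχlam y) (hjn _)
    have e : ∫ y in c..d, G τ y = ex τ *
        ((∫ y in c..d, χ y * k (Av v h τ y) * (h⁻¹ * gf v F τ (τ + h) y)) +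
          (∫ y in c..d, χ y * k (Av v h τ y) * (h⁻¹ * ∫ s in τ..(τ + h), F s y)) -
          ∫ y in c..d, lam * (χ y * j (Av v h τ y))) := by
      rw [← intervalIntegral.integral_add i1 i2, ← intervalIntegral.integral_sub (i1.add i2) i3,
        ← intervalIntegral.integral_const_mul]
      apply intervalIntegral.integral_congr
      intro y _
      simp only [hG, hD, gf]
      ring
    have hY0 : 0 ≤ h⁻¹ * ∫ s in τ..(τ + h), Φ s :=
      mul_nonneg (inv_pos.2 hh).le (intervalIntegral.integral_nonneg hle fun s _ => Φ0 s)
    rw [e]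
    calc _ ≤ ex τ * (h⁻¹ * ∫ s in τ..(τ + h), Φ s) := by
          apply mul_le_mul_of_nonneg_left _ (ex0 τ).le
          simp only [hΦ]
          linarith
      _ ≤ 1 * (h⁻¹ * ∫ s in τ..(τ + h), Φ s) := mul_le_mul_of_nonneg_right (ex1 τ hτ.1) hY0
      _ = _ := one_mul _
  have iGs : IntervalIntegrable (fun τ => ∫ y in c..d, G τ y) volume σ t' := by
    rw [intervalIntegrable_iff, uIoc_of_le hσt]
    rw [IntegrableOn, Measure.volume_eq_prod, ← Measure.prod_restrict] at iG
    refine iG.integral_prod_left.congr (Eventually.of_forall fun y => ?_)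
    simp only [Function.uncurry]
    rw [intervalIntegral.integral_of_le hcd]
  have fin := intervalIntegral.integral_mono_on hσt iGs iW slice
  have hmt := hmem (τ := t') ⟨hσt, le_rfl⟩
  have hms := hmem (τ := σ) ⟨le_rfl, hσt⟩
  rw [swap, intervalIntegral.integral_congr (fun y _ => ftc y), intervalIntegral.integral_sub
    ((H.Av_interval hmt.1 hmt.2 hc hd hcd cχ cj).const_mul _)
    (H.Av_interval hms.1 hms.2 hc hd hcd cχ cj), intervalIntegral.integral_const_mul] at fin
  linarith

end HeatData

namespace HeatData
variable {v vt vy vyy F : ℝ → ℝ → ℝ} {α β a b M : ℝ} (H : HeatData v vt vy vyy F α β a b M)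
include H

lemma exists_L1_close {t c d ε : ℝ} (ht : t ∈ Ioo α β) (hc : c ∈ Ioo a b) (hd : d ∈ Ioo a b)
    (hcd : c ≤ d) (hε : 0 < ε) :
    ∃ η > 0, ∀ s, |s - t| < η → ∫ y in c..d, |v s y - v t y| ≤ ε := by
  have h1 := (H.tendsto_L1 ht).eventually (eventually_lt_nhds hε)
  obtain ⟨η, hη, hs⟩ := Metric.eventually_nhds_iff.1 (h1.and (Ioo_mem_nhds ht.1 ht.2))
  refine ⟨η, hη, fun s hst => ?_⟩
  obtain ⟨h2, hsab⟩ := hs (by rwa [Real.dist_eq])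
  rw [intervalIntegral.integral_of_le hcd]
  refine le_trans (setIntegral_mono_set ((H.int_slice hsab).sub (H.int_slice ht)).abs
      (Eventually.of_forall fun _ => abs_nonneg _) ?_) h2.le
  exact LE.le.eventuallyLE fun y hy => ⟨hc.1.trans hy.1, hy.2.trans_lt hd.2⟩

/-- Maximum principle: if `v ≤ 0` initially, on the lateral boundary, and on every line near which
the equation may fail, then `v₊` is controlled by `F₊`. -/
theorem forward_control {σ t c d lam : ℝ} {χ χ' χ'' : ℝ → ℝ}
    (hσ : σ ∈ Ioo α β) (hσt : σ ≤ t) (ht : t ∈ Ioo α β)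
    (hc : c ∈ Ioo a b) (hd : d ∈ Ioo a b) (hcd : c ≤ d) (hlam : 0 ≤ lam)
    (hloc : ∀ y ∈ Ioo c d, (∀ s ∈ Icc σ t, v s y ≤ 0) ∨
      ∀ s₁ ∈ Icc σ t, ∀ s₂ ∈ Icc σ t, ∃ c' d', y ∈ Ioo c' d' ∧ c' ∈ Ioo a b ∧ Sol v F s₁ s₂ c' d')
    (hbc : ∀ s ∈ Icc σ t, v s c ≤ 0 ∧ v s d ≤ 0) (hic : ∀ y ∈ Icc c d, v σ y ≤ 0)
    (hχ : ∀ y, HasDerivAt χ (χ' y) y) (hχ' : ∀ y, HasDerivAt χ' (χ'' y) y)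
    (hχc : Continuous χ'') (hχ0 : ∀ y, 0 ≤ χ y) (hχ1 : ∀ y, χ y ≤ 1)
    (hχlam : ∀ y, χ'' y ≤ lam * χ y) :
    Real.exp (-(lam * (t - σ))) * ∫ y in c..d, χ y * max (v t y) 0 ≤
        ∫ τ in σ..t, ∫ y in c..d, χ y * max (F τ y) 0 := by
  have cχ : Continuous χ := continuous_iff_continuousAt.2 fun y => (hχ y).continuousAt
  set Φ := ∫ τ in σ..t, ∫ y in c..d, χ y * max (F τ y) 0 with hΦ
  rcases hσt.eq_or_lt with rfl | hlt
  · have : ∫ y in c..d, χ y * max (v σ y) 0 = 0 := by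
      rw [intervalIntegral.integral_congr (g := fun _ => 0), intervalIntegral.integral_zero]
      intro y hy
      rw [uIcc_of_le hcd] at hy
      simp [max_eq_right (hic y hy)]
    rw [this, hΦ]; simp
  have key : ∀ ε > 0, Real.exp (-(lam * (t - σ))) * ∫ y in c..d, χ y * max (v t y) 0 ≤
      Φ + ε * (2 + 2 * (d - c)) := by
    intro ε hε
    obtain ⟨k, k', j, hk, hkc, hj, hk'0, hk0, hk'δ, hj0, hkn, hk1, hjn, hjm, hjl⟩ :=
      exists_pos_part_approx hε
    have cj : Continuous j := continuous_iff_continuousAt.2 fun y => (hj y).continuousAt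
    obtain ⟨η₁, hη₁, h1⟩ := H.exists_L1_close ht hc hd hcd hε
    obtain ⟨η₂, hη₂, h2⟩ := H.exists_L1_close hσ hc hd hcd hε
    obtain ⟨h, hh, hlt'⟩ : ∃ h > 0, h < min (min η₁ η₂) (t - σ) :=
      exists_between (by have : 0 < t - σ := by linarith
                         positivity)
    have hl1 : h < η₁ := hlt'.trans_le ((min_le_left _ _).trans (min_le_left _ _))
    have hl2 : h < η₂ := hlt'.trans_le ((min_le_left _ _).trans (min_le_right _ _))
    have hl3 : h < t - σ := hlt'.trans_le (min_le_right _ _)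
    have et : t - h + h = t := by ring
    have main := H.forward_control_av (t' := t - h) hh hσ (by linarith) (by rwa [et]) hc hd hcd hε
      hlam (by rwa [et]) (by rwa [et]) hχ hχ' hχc hχ0 hχ1 hχlam hk hkc hj hk'0 hk0 hk'δ hj0 hkn hk1
      hjn hjl
    rw [et] at main
    have m1 : t - h ∈ Ioo α β := ⟨by linarith [hσ.1], by linarith [ht.2]⟩
    have m2 : σ + h ∈ Ioo α β := ⟨by linarith [hσ.1], by linarith [ht.2]⟩
    have A1 := H.avg_close (H.cont_y t) hh m1 (by rwa [et]) hc hd hcd (ε := ε) fun s hs =>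
      h1 s (by rw [abs_lt]; constructor <;> linarith [hs.1, hs.2])
    have A2 := H.avg_close (H.cont_y σ) hh hσ m2 hc hd hcd (ε := ε) fun s hs =>
      h2 s (by rw [abs_lt]; constructor <;> linarith [hs.1, hs.2])
    have iA : ∀ {τ} (u₀ : ℝ → ℝ), Continuous u₀ → τ ∈ Ioo α β → τ + h ∈ Ioo α β →
        IntervalIntegrable (fun y => |Av v h τ y - u₀ y|) volume c d := by
      intro τ u₀ hu hτ hτh
      apply ContinuousOn.intervalIntegrable
      rw [uIcc_of_le hcd]
      exact (((H.Av_continuousOn hτ hτh).mono fun y hy =>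
          ⟨hc.1.trans_le hy.1, hy.2.trans_lt hd.2⟩).sub hu.continuousOn).abs
    have iA1 := iA (v t) (H.cont_y t) m1 (by rwa [et])
    have iA2 := iA (v σ) (H.cont_y σ) hσ m2
    have iJ1 := H.Av_interval m1 (by rwa [et]) hc hd hcd cχ cj
    have iJ2 := H.Av_interval hσ m2 hc hd hcd cχ cj
    have cvt := H.cont_y t
    have B1 : ∫ y in c..d, χ y * max (v t y) 0 ≤
        (∫ y in c..d, χ y * j (Av v h (t - h) y)) + (∫ y in c..d, |Av v h (t - h) y - v t y|) +
          2 * ε * (d - c) := by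
      have e : 2 * ε * (d - c) = ∫ y in c..d, 2 * ε := by simp; ring
      rw [e, ← intervalIntegral.integral_add iJ1 iA1,
        ← intervalIntegral.integral_add (iJ1.add iA1) (by simp)]
      apply intervalIntegral.integral_mono_on hcd _ ((iJ1.add iA1).add (by simp))
      · intro y _
        have b1 := hjm (v t y)
        have b2 := hjl (v t y) (Av v h (t - h) y)
        rw [abs_sub_comm (v t y)] at b2
        have b3 := le_abs_self (j (v t y) - j (Av v h (t - h) y))
        have b4 := abs_nonneg (Av v h (t - h) y - v t y)
        calc χ y * max (v t y) 0
            ≤ χ y * (j (Av v h (t - h) y) + (|Av v h (t - h) y - v t y| + 2 * ε)) := by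
              apply mul_le_mul_of_nonneg_left _ (hχ0 y)
              linarith
          _ = χ y * j (Av v h (t - h) y) + χ y * (|Av v h (t - h) y - v t y| + 2 * ε) := by ring
          _ ≤ χ y * j (Av v h (t - h) y) + 1 * (|Av v h (t - h) y - v t y| + 2 * ε) := by
              have := hχ1 y
              gcongr
          _ = _ := by ring
      · exact Continuous.intervalIntegrable (by fun_prop) _ _
    have B2 : ∫ y in c..d, χ y * j (Av v h σ y) ≤ ∫ y in c..d, |Av v h σ y - v σ y| := by
      apply intervalIntegral.integral_mono_on hcd iJ2 iA2
      intro y hy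
      have b2 := hjl (Av v h σ y) (v σ y)
      rw [hj0 (v σ y) ((hic y hy).trans hε.le), sub_zero, abs_of_nonneg (hjn _)] at b2
      exact (mul_le_of_le_one_left (hjn _) (hχ1 y)).trans b2
    have e1 : Real.exp (-(lam * (t - σ))) ≤ 1 :=
      Real.exp_le_one_iff.2 (neg_nonpos.2 (mul_nonneg hlam (by linarith)))
    have e2 : Real.exp (-(lam * (t - σ))) ≤ Real.exp (-(lam * (t - h - σ))) := by
      apply Real.exp_le_exp.2
      nlinarith
    have e0 := Real.exp_pos (-(lam * (t - σ)))
    have j0 : 0 ≤ ∫ y in c..d, χ y * j (Av v h (t - h) y) :=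
      intervalIntegral.integral_nonneg hcd fun y _ => mul_nonneg (hχ0 y) (hjn _)
    have hcd' : 0 ≤ d - c := by linarith
    calc _ ≤ Real.exp (-(lam * (t - σ))) * ((∫ y in c..d, χ y * j (Av v h (t - h) y)) + ε +
          2 * ε * (d - c)) := by
          apply mul_le_mul_of_nonneg_left _ e0.le
          linarith
      _ = Real.exp (-(lam * (t - σ))) * (∫ y in c..d, χ y * j (Av v h (t - h) y)) +
          Real.exp (-(lam * (t - σ))) * (ε + 2 * ε * (d - c)) := by ring
      _ ≤ Real.exp (-(lam * (t - h - σ))) * (∫ y in c..d, χ y * j (Av v h (t - h) y)) +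
          1 * (ε + 2 * ε * (d - c)) := by
          gcongr
      _ ≤ _ := by linarith
  by_contra hlt2
  push Not at hlt2
  set X := Real.exp (-(lam * (t - σ))) * ∫ y in c..d, χ y * max (v t y) 0
  have hp : 0 < 2 + 2 * (d - c) := by linarith
  have := key ((X - Φ) / (2 * (2 + 2 * (d - c)))) (div_pos (by linarith) (by linarith))
  have e : (X - Φ) / (2 * (2 + 2 * (d - c))) * (2 + 2 * (d - c)) = (X - Φ) / 2 := by
    rw [div_mul_eq_mul_div, div_eq_div_iff (by positivity) (by norm_num)]
    ring
  rw [e] at this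
  linarith

end HeatData

namespace HeatData
variable {w wt wy wyy F : ℝ → ℝ → ℝ} {α β a b M : ℝ} (H : HeatData w wt wy wyy F α β a b M)
include H

lemma neg : HeatData (fun t y => -w t y) (fun t y => -wt t y) (fun t y => -wy t y)
    (fun t y => -wyy t y) (fun t y => -F t y) α β a b M where
  ht t y := (H.ht t y).fun_neg
  hy t y := (H.hy t y).fun_neg
  hyy t y := (H.hyy t y).fun_neg
  hF t y := by rw [H.hF]; ring
  iF := H.iF.neg
  iwy := H.iwy.neg
  sq t ht := by simpa using H.sq t ht
  sqM t ht := by simpa using H.sqM t ht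

omit H in
lemma sol_neg {s t c d : ℝ} (h : Sol w F s t c d) :
    Sol (fun t y => -w t y) (fun t y => -F t y) s t c d := by
  obtain ⟨p, hp⟩ := h
  refine ⟨-p, fun y hy => ?_⟩
  have h1 : Zf (fun t y => -w t y) s t = fun y => - Zf w s t y := by
    ext y; simp [Zf]
  have h2 : gf (fun t y => -w t y) (fun t y => -F t y) s t = fun y => - gf w F s t y := by
    ext y; simp only [gf, intervalIntegral.integral_neg]; ring
  rw [h1, h2, intervalIntegral.integral_neg]
  convert! (hp y hy).neg using 1
  ring

lemma sub_quadratic (A B C E L y₀ σ : ℝ) (hE : E = 2 * C + L) : ∃ M',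
    HeatData (fun t y => w t y - (A + B * (y - y₀) + C * (y - y₀) ^ 2 + E * (t - σ)))
      (fun t y => wt t y - E) (fun t y => wy t y - (B + 2 * C * (y - y₀)))
      (fun t y => wyy t y - 2 * C) (fun t y => F t y - L) α β a b M' := by
  have hcont : Continuous fun p : ℝ × ℝ =>
      A + B * (p.2 - y₀) + C * (p.2 - y₀) ^ 2 + E * (p.1 - σ) := by fun_prop
  obtain ⟨P, hP⟩ := (isCompact_Icc (a := α) (b := β)).prod (isCompact_Icc (a := a) (b := b))
    |>.exists_bound_of_continuousOn hcont.continuousOn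
  have hfin : volume (Ioo α β ×ˢ Ioo a b) ≠ ⊤ := by
    rw [Measure.volume_eq_prod, Measure.prod_prod]; exact ENNReal.mul_ne_top (by simp) (by simp)
  have hb : ∀ t ∈ Ioo α β, ∀ y ∈ Ioo a b,
      (w t y - (A + B * (y - y₀) + C * (y - y₀) ^ 2 + E * (t - σ))) ^ 2 ≤
        2 * w t y ^ 2 + 2 * P ^ 2 := by
    intro t ht y hy
    have h1 := hP (t, y) ⟨Ioo_subset_Icc_self ht, Ioo_subset_Icc_self hy⟩
    rw [Real.norm_eq_abs] at h1
    have h2 := sq_le_sq' (by linarith [neg_abs_le (A + B * (y - y₀) + C * (y - y₀) ^ 2 + E * (t - σ))]) ((le_abs_self _).trans h1)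
    simp only at h2
    nlinarith [sq_nonneg (w t y + (A + B * (y - y₀) + C * (y - y₀) ^ 2 + E * (t - σ)))]
  have hdom : ∀ t ∈ Ioo α β, IntegrableOn (fun y => 2 * w t y ^ 2 + 2 * P ^ 2) (Ioo a b) :=
    fun t ht => ((H.sq t ht).const_mul 2).add (integrableOn_const (by simp))
  have hq : ∀ t ∈ Ioo α β, IntegrableOn (fun y =>
      (w t y - (A + B * (y - y₀) + C * (y - y₀) ^ 2 + E * (t - σ))) ^ 2) (Ioo a b) := by
    intro t ht
    have := H.cont_y t
    refine Integrable.mono' (hdom t ht) (Continuous.aestronglyMeasurable (by fun_prop)) ?_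
    refine (ae_restrict_iff' measurableSet_Ioo).2 (Eventually.of_forall fun y hy => ?_)
    rw [Real.norm_eq_abs, abs_of_nonneg (sq_nonneg _)]
    exact hb t ht y hy
  refine ⟨2 * M + 2 * P ^ 2 * volume.real (Ioo a b), ?_, ?_, ?_, ?_, ?_, ?_, hq, ?_⟩
  · intro t y
    have := (((hasDerivAt_id t).sub_const σ).const_mul E).const_add
      (A + B * (y - y₀) + C * (y - y₀) ^ 2)
    convert! (H.ht t y).sub this using 1
    ring
  · intro t y
    have h1 := (hasDerivAt_id y).sub_const y₀
    have := (((h1.const_mul B).const_add A).add ((h1.pow 2).const_mul C)).add_const (E * (t - σ))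
    convert! (H.hy t y).sub this using 1
    simp; ring
  · intro t y
    have h1 := (hasDerivAt_id y).sub_const y₀
    convert! (H.hyy t y).sub ((h1.const_mul (2 * C)).const_add B) using 1
    ring
  · intro t y
    rw [H.hF, hE]; ring
  · exact H.iF.sub (integrableOn_const hfin)
  · refine H.iwy.sub (f := Function.uncurry wy) (g := fun p : ℝ × ℝ => B + 2 * C * (p.2 - y₀)) ?_
    have : Continuous fun p : ℝ × ℝ => B + 2 * C * (p.2 - y₀) := by fun_prop
    exact (this.continuousOn.integrableOn_compact (isCompact_Icc.prod isCompact_Icc)).mono_set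
      (prod_mono Ioo_subset_Icc_self Ioo_subset_Icc_self)
  · intro t ht
    calc _ ≤ ∫ y in Ioo a b, (2 * w t y ^ 2 + 2 * P ^ 2) :=
          setIntegral_mono_on (hq t ht) (hdom t ht) measurableSet_Ioo (hb t ht)
      _ = 2 * (∫ y in Ioo a b, w t y ^ 2) + 2 * P ^ 2 * volume.real (Ioo a b) := by
          rw [integral_add ((H.sq t ht).const_mul 2) (integrableOn_const (by simp)),
            integral_const_mul, setIntegral_const, smul_eq_mul, mul_comm (volume.real _)]
      _ ≤ _ := by linarith [H.sqM t ht]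

lemma sol_sub_quadratic {A B C E L y₀ σ s t c d : ℝ} (hE : E = 2 * C + L)
    (hs : s ∈ Ioo α β) (ht : t ∈ Ioo α β) (hc : c ∈ Ioo a b) (hd : d ∈ Ioo a b)
    (h : Sol w F s t c d) :
    Sol (fun t y => w t y - (A + B * (y - y₀) + C * (y - y₀) ^ 2 + E * (t - σ)))
      (fun t y => F t y - L) s t c d := by
  obtain ⟨p, hp⟩ := h
  refine ⟨p - (t - s) * (B + 2 * C * (c - y₀)), fun y hy => ?_⟩
  have hy' : y ∈ Ioo a b := ⟨hc.1.trans hy.1, hy.2.trans hd.2⟩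
  have h1 : Zf (fun t y => w t y - (A + B * (y - y₀) + C * (y - y₀) ^ 2 + E * (t - σ))) s t =
      fun y => Zf w s t y - ((t - s) * (A + B * (y - y₀) + C * (y - y₀) ^ 2) +
        ∫ τ in s..t, E * (τ - σ)) := by
    ext y
    have := H.cont_t y
    simp only [Zf]
    rw [intervalIntegral.integral_sub (this.intervalIntegrable _ _)
      (Continuous.intervalIntegrable (by fun_prop) _ _),
      intervalIntegral.integral_add (by simp) (Continuous.intervalIntegrable (by fun_prop) _ _),
      intervalIntegral.integral_const, smul_eq_mul]
  have h2 : ∀ᵐ z, z ∈ Ioo a b →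
      gf (fun t y => w t y - (A + B * (y - y₀) + C * (y - y₀) ^ 2 + E * (t - σ)))
      (fun t y => F t y - L) s t z = gf w F s t z - 2 * C * (t - s) := by
    filter_upwards [ae_integrableOn_fst H.iF] with z hz hzab
    simp only [gf]
    rw [intervalIntegral.integral_sub (IntegrableOn.interval (hz hzab) hs ht) (by simp),
      intervalIntegral.integral_const, smul_eq_mul, hE]
    ring
  have h3 : ∫ z in c..y, gf (fun t y => w t y - (A + B * (y - y₀) + C * (y - y₀) ^ 2 +
      E * (t - σ))) (fun t y => F t y - L) s t z =
      (∫ z in c..y, gf w F s t z) - 2 * C * (t - s) * (y - c) := by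
    have : 2 * C * (t - s) * (y - c) = ∫ z in c..y, 2 * C * (t - s) := by
      rw [intervalIntegral.integral_const, smul_eq_mul]; ring
    rw [this, ← intervalIntegral.integral_sub (IntegrableOn.interval (H.int_g hs ht) hc hy')
      (by simp)]
    apply intervalIntegral.integral_congr_ae
    filter_upwards [h2] with z hz hzm
    exact hz (uIoc_subset_Ioo hc hy' hzm)
  rw [h1, h3]
  have h4 := (hasDerivAt_id y).sub_const y₀
  have h5 := ((((h4.const_mul B).const_add A).add ((h4.pow 2).const_mul C)).const_mul
    (t - s)).add_const (∫ τ in s..t, E * (τ - σ))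
  convert! (hp y hy).sub h5 using 1
  simp; ring

/-- Comparison with parabolas from both sides. -/
theorem comparison {σ t c d lam A B C L y₀ : ℝ} {χ χ' χ'' : ℝ → ℝ}
    (hσ : σ ∈ Ioo α β) (hσt : σ ≤ t) (ht : t ∈ Ioo α β)
    (hc : c ∈ Ioo a b) (hd : d ∈ Ioo a b) (hcd : c ≤ d) (hlam : 0 ≤ lam) (hL : 0 ≤ L)
    {D : ℝ} (hD : 0 ≤ D) (hC : 0 ≤ C)
    (hloc : ∀ y ∈ Ioo c d,
      (∀ s ∈ Icc σ t, |w s y - (A + B * (y - y₀))| ≤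
        D + C * (y - y₀) ^ 2 + (2 * C + L) * (s - σ)) ∨
      ∀ s₁ ∈ Icc σ t, ∀ s₂ ∈ Icc σ t,
        ∃ c' d', y ∈ Ioo c' d' ∧ c' ∈ Ioo a b ∧ d' ∈ Ioo a b ∧ Sol w F s₁ s₂ c' d')
    (hbc : ∀ s ∈ Icc σ t, ∀ y, y = c ∨ y = d → |w s y - (A + B * (y - y₀))| ≤
        D + C * (y - y₀) ^ 2 + (2 * C + L) * (s - σ))
    (hic : ∀ y ∈ Icc c d, |w σ y - (A + B * (y - y₀))| ≤ D + C * (y - y₀) ^ 2)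
    (hχ : ∀ y, HasDerivAt χ (χ' y) y) (hχ' : ∀ y, HasDerivAt χ' (χ'' y) y)
    (hχc : Continuous χ'') (hχ0 : ∀ y, 0 ≤ χ y) (hχ1 : ∀ y, χ y ≤ 1)
    (hχlam : ∀ y, χ'' y ≤ lam * χ y) :
    Real.exp (-(lam * (t - σ))) * ∫ y in c..d, χ y * max (|w t y - (A + B * (y - y₀))| -
        (D + C * (y - y₀) ^ 2 + (2 * C + L) * (t - σ))) 0 ≤
        ∫ τ in σ..t, ∫ y in c..d, χ y * max (|F τ y| - L) 0 := by
  have cχ : Continuous χ := continuous_iff_continuousAt.2 fun y => (hχ y).continuousAt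
  obtain ⟨M₁, H₁⟩ := H.sub_quadratic (A + D) B C (2 * C + L) L y₀ σ rfl
  obtain ⟨M₂, H₂⟩ := H.neg.sub_quadratic (-A + D) (-B) C (2 * C + L) L y₀ σ rfl
  have R₁ := H₁.forward_control hσ hσt ht hc hd hcd hlam (χ := χ) (by
    intro y hy
    refine (hloc y hy).imp (fun h s hs => ?_) fun h s₁ h₁ s₂ h₂ => ?_
    · linarith [(abs_le.1 (h s hs)).2]
    · obtain ⟨c', d', h3, h4, h5, h6⟩ := h s₁ h₁ s₂ h₂
      exact ⟨c', d', h3, h4, H.sol_sub_quadratic rfl ⟨hσ.1.trans_le h₁.1, h₁.2.trans_lt ht.2⟩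
        ⟨hσ.1.trans_le h₂.1, h₂.2.trans_lt ht.2⟩ h4 h5 h6⟩) (by
    intro s hs
    have e1 := (abs_le.1 (hbc s hs c (Or.inl rfl))).2
    have e2 := (abs_le.1 (hbc s hs d (Or.inr rfl))).2
    constructor <;> linarith) (by
    intro y hy
    have := (abs_le.1 (hic y hy)).2
    simp only [sub_self, mul_zero]
    linarith) hχ hχ' hχc hχ0 hχ1 hχlam
  have R₂ := H₂.forward_control hσ hσt ht hc hd hcd hlam (χ := χ) (by
    intro y hy
    refine (hloc y hy).imp (fun h s hs => ?_) fun h s₁ h₁ s₂ h₂ => ?_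
    · linarith [(abs_le.1 (h s hs)).1]
    · obtain ⟨c', d', h3, h4, h5, h6⟩ := h s₁ h₁ s₂ h₂
      exact ⟨c', d', h3, h4, H.neg.sol_sub_quadratic rfl
        ⟨hσ.1.trans_le h₁.1, h₁.2.trans_lt ht.2⟩
        ⟨hσ.1.trans_le h₂.1, h₂.2.trans_lt ht.2⟩ h4 h5 (sol_neg h6)⟩) (by
    intro s hs
    have e1 := (abs_le.1 (hbc s hs c (Or.inl rfl))).1
    have e2 := (abs_le.1 (hbc s hs d (Or.inr rfl))).1
    constructor <;> linarith) (by
    intro y hy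
    have := (abs_le.1 (hic y hy)).1
    simp only [sub_self, mul_zero]
    linarith) hχ hχ' hχc hχ0 hχ1 hχlam
  have cw := H.cont_y t
  have e1 : ∀ x p : ℝ, 0 ≤ p → max (|x| - p) 0 = max (x - p) 0 + max (-x - p) 0 := by
    intro x p hp
    rcases le_total 0 x with hx | hx
    · rw [abs_of_nonneg hx, max_eq_right (by linarith : -x - p ≤ 0), add_zero]
    · rw [abs_of_nonpos hx, max_eq_right (by linarith : x - p ≤ 0), zero_add]
  have hLs : 0 ≤ (2 * C + L) * (t - σ) := mul_nonneg (by linarith) (by linarith)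
  have E1 : ∫ y in c..d, χ y * max (|w t y - (A + B * (y - y₀))| -
        (D + C * (y - y₀) ^ 2 + (2 * C + L) * (t - σ))) 0 =
      (∫ y in c..d, χ y * max (w t y - (A + D + B * (y - y₀) + C * (y - y₀) ^ 2 +
        (2 * C + L) * (t - σ))) 0) + ∫ y in c..d, χ y * max (-w t y - (-A + D + -B * (y - y₀) +
        C * (y - y₀) ^ 2 + (2 * C + L) * (t - σ))) 0 := by
    rw [← intervalIntegral.integral_add (Continuous.intervalIntegrable (by fun_prop) _ _)
      (Continuous.intervalIntegrable (by fun_prop) _ _)]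
    refine intervalIntegral.integral_congr fun y _ => ?_
    rw [e1 _ _ (by positivity), mul_add]
    congr 3 <;> ring
  have i₁ := H₁.int_pos_part cχ hχ0 hχ1
  have i₂ := H₂.int_pos_part cχ hχ0 hχ1
  have E2 : ∫ τ in σ..t, ∫ y in c..d, χ y * max (|F τ y| - L) 0 =
      (∫ τ in σ..t, ∫ y in c..d, χ y * max (F τ y - L) 0) +
        ∫ τ in σ..t, ∫ y in c..d, χ y * max (-F τ y - L) 0 := by
    rw [← intervalIntegral.integral_add
      (IntegrableOn.interval (integrableOn_integral_snd hc hd i₁) hσ ht)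
      (IntegrableOn.interval (integrableOn_integral_snd hc hd i₂) hσ ht)]
    apply intervalIntegral.integral_congr_ae
    filter_upwards [ae_integrableOn_snd i₁, ae_integrableOn_snd i₂] with τ h1 h2 hτ
    have hτ' := uIoc_subset_Ioo hσ ht hτ
    rw [← intervalIntegral.integral_add (IntegrableOn.interval (h1 hτ') hc hd)
      (IntegrableOn.interval (h2 hτ') hc hd)]
    refine intervalIntegral.integral_congr fun y _ => ?_
    rw [e1 _ _ hL, mul_add]
  rw [E1, E2, mul_add]
  exact add_le_add R₁ R₂

end HeatData

/-- Second-order weak derivatives are classical one derivative earlier. -/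
lemma hasDerivAt_of_weak {Z g : ℝ → ℝ} {c d : ℝ} (hcd : c < d) (hZ : ContinuousOn Z (Icc c d))
    (hg : IntervalIntegrable g volume c d)
    (h : ∀ φ : ℝ → ℝ, ContDiff ℝ ∞ φ → tsupport φ ⊆ Ioo c d →
      ∫ y in c..d, (g y * φ y - Z y * deriv (deriv φ) y) = 0) :
    ∃ m p : ℝ, (∀ y ∈ Icc c d, Z y = m + p * y + ∫ z in c..y, ∫ x in c..z, g x) ∧
      ∀ y ∈ Ioo c d, HasDerivAt Z (p + ∫ z in c..y, g z) y := by
  have hG1 : ContinuousOn (fun y => ∫ z in c..y, g z) (Icc c d) := by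
    have := (hg.absolutelyContinuousOnInterval_intervalIntegral (c := c) (by simp)).continuousOn
    rwa [uIcc_of_le hcd.le] at this
  have iG1 : IntervalIntegrable (fun y => ∫ z in c..y, g z) volume c d := by
    apply ContinuousOn.intervalIntegrable
    rwa [uIcc_of_le hcd.le]
  have hG2 : ContinuousOn (fun y => ∫ z in c..y, ∫ x in c..z, g x) (Icc c d) := by
    have := (iG1.absolutelyContinuousOnInterval_intervalIntegral (c := c) (by simp)).continuousOn
    rwa [uIcc_of_le hcd.le] at this
  obtain ⟨m, p, hmp⟩ := affine_of_integral_mul_deriv2_eq_zero hcd (hZ.sub hG2) (by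
    intro φ hφ hs
    have hφ1 : ContDiff ℝ ∞ (deriv φ) := hφ.iterate_deriv 1
    have hφ2 : ContDiff ℝ ∞ (deriv (deriv φ)) := hφ.iterate_deriv 2
    have d0 : ∀ x, HasDerivAt φ (deriv φ x) x := fun x =>
      (hφ.differentiable (by simp) x).hasDerivAt
    have d1 : ∀ x, HasDerivAt (deriv φ) (deriv (deriv φ) x) x := fun x =>
      (hφ1.differentiable (by simp) x).hasDerivAt
    have z0 : ∀ x, x ∉ Ioo c d → φ x = 0 := fun x hx =>
      image_eq_zero_of_notMem_tsupport fun h => hx (hs h)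
    have z1 : ∀ x, x ∉ Ioo c d → deriv φ x = 0 := fun x hx => by
      by_contra hne
      exact hx (hs (support_deriv_subset hne))
    have e1 := integral_mul_primitive (p := 0) d0 hφ1.continuous hg
    have e2 := integral_mul_primitive (p := 0) d1 hφ2.continuous iG1
    rw [z0 c (by simp), z0 d (by simp)] at e1
    rw [z1 c (by simp), z1 d (by simp)] at e2
    simp only [zero_add, zero_mul, sub_self, zero_sub] at e1 e2
    have e3 := h φ hφ hs
    have i1 : IntervalIntegrable (fun y => g y * φ y) volume c d :=
      hg.mul_continuousOn hφ.continuous.continuousOn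
    have i2 : IntervalIntegrable (fun y => Z y * deriv (deriv φ) y) volume c d := by
      apply ContinuousOn.intervalIntegrable
      rw [uIcc_of_le hcd.le]
      exact hZ.mul hφ2.continuous.continuousOn
    have i3 : IntervalIntegrable (fun y => deriv (deriv φ) y * ∫ z in c..y, ∫ x in c..z, g x)
        volume c d := by
      apply ContinuousOn.intervalIntegrable
      rw [uIcc_of_le hcd.le]
      exact hφ2.continuous.continuousOn.mul hG2
    rw [intervalIntegral.integral_sub i1 i2] at e3
    have e4 : ∫ y in c..d, (Z y - ∫ z in c..y, ∫ x in c..z, g x) * deriv (deriv φ) y =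
        (∫ y in c..d, Z y * deriv (deriv φ) y) -
        ∫ y in c..d, deriv (deriv φ) y * ∫ z in c..y, ∫ x in c..z, g x := by
      rw [← intervalIntegral.integral_sub i2 i3]
      exact intervalIntegral.integral_congr fun y _ => by ring
    have e5 : ∫ y in c..d, φ y * g y = ∫ y in c..d, g y * φ y :=
      intervalIntegral.integral_congr fun y _ => mul_comm _ _
    simp only [Pi.sub_apply]
    rw [e4]
    linarith)
  have hZe : ∀ y ∈ Icc c d, Z y = m + p * y + ∫ z in c..y, ∫ x in c..z, g x := fun y hy => by
    have := hmp y hy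
    simp only [Pi.sub_apply] at this
    linarith
  refine ⟨m, p, hZe, fun y hy => ?_⟩
  have hnb : Icc c d ∈ 𝓝 y := Icc_mem_nhds hy.1 hy.2
  have h1 : HasDerivAt (fun y => ∫ z in c..y, ∫ x in c..z, g x) (∫ z in c..y, g z) y := by
    have hsub : uIcc c y ⊆ uIcc c d := by
      rw [uIcc_of_le hy.1.le, uIcc_of_le hcd.le]
      exact Icc_subset_Icc_right hy.2.le
    refine intervalIntegral.integral_hasDerivAt_right (iG1.mono_set hsub) ?_ (hG1.continuousAt hnb)
    exact ContinuousOn.stronglyMeasurableAtFilter isOpen_Ioo (hG1.mono Ioo_subset_Icc_self) _ hy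
  have h2 := (((hasDerivAt_id y).const_mul p).const_add m).add h1
  rw [mul_one] at h2
  refine h2.congr_of_eventuallyEq ?_
  filter_upwards [hnb] with z hz
  exact hZe z hz

lemma weak_of_hasDerivAt {Z g ζ ζ' ζ'' : ℝ → ℝ} {c d p : ℝ} (hcd : c < d)
    (hZ : ContinuousOn Z (Icc c d)) (hg : IntervalIntegrable g volume c d)
    (hd : ∀ y ∈ Ioo c d, HasDerivAt Z (p + ∫ z in c..y, g z) y)
    (hζ : ∀ y, HasDerivAt ζ (ζ' y) y) (hζ' : ∀ y, HasDerivAt ζ' (ζ'' y) y) (hζc : Continuous ζ'')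
    (h1 : ζ c = 0) (h2 : ζ d = 0) (h3 : ζ' c = 0) (h4 : ζ' d = 0) :
    ∫ y in c..d, (g y * ζ y - Z y * ζ'' y) = 0 := by
  have cζ : Continuous ζ := continuous_iff_continuousAt.2 fun y => (hζ y).continuousAt
  have cζ' : Continuous ζ' := continuous_iff_continuousAt.2 fun y => (hζ' y).continuousAt
  have hG1 : ContinuousOn (fun y => p + ∫ z in c..y, g z) (uIcc c d) :=
    continuousOn_const.add
      (hg.absolutelyContinuousOnInterval_intervalIntegral (c := c) (by simp)).continuousOn
  rw [← uIcc_of_le hcd.le] at hZ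
  have e1 := intervalIntegral.integral_mul_deriv_eq_deriv_mul_of_hasDerivAt hZ cζ'.continuousOn
    (by rwa [min_eq_left hcd.le, max_eq_right hcd.le]) (fun y _ => hζ' y) hG1.intervalIntegrable
    (hζc.intervalIntegrable _ _)
  have e2 := integral_mul_primitive (p := p) hζ cζ' hg
  rw [intervalIntegral.integral_sub (hg.mul_continuousOn cζ.continuousOn)
    (ContinuousOn.intervalIntegrable (u := fun y => Z y * ζ'' y) (hZ.mul hζc.continuousOn)), e1]
  simp only [h1, h2, h3, h4, mul_zero, zero_mul, sub_self, zero_sub] at e2 ⊢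
  have e3 : ∫ y in c..d, ζ y * g y = ∫ y in c..d, g y * ζ y :=
    intervalIntegral.integral_congr fun y _ => mul_comm _ _
  have e4 : ∫ y in c..d, (p + ∫ z in c..y, g z) * ζ' y =
      ∫ y in c..d, ζ' y * (p + ∫ z in c..y, g z) :=
    intervalIntegral.integral_congr fun y _ => mul_comm _ _
  rw [e4, e2, e3]; ring

namespace HeatData
variable {w wt wy wyy F : ℝ → ℝ → ℝ} {α β a b M : ℝ} (H : HeatData w wt wy wyy F α β a b M)
include H

lemma Df_eq_zero_of_sol {s t c d : ℝ} {ζ ζ' ζ'' : ℝ → ℝ} (hs : s ∈ Ioo α β) (ht : t ∈ Ioo α β)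
    (hc : c ∈ Ioo a b) (hd : d ∈ Ioo a b) (hcd : c < d) (h : Sol w F s t c d)
    (hζ : ∀ y, HasDerivAt ζ (ζ' y) y) (hζ' : ∀ y, HasDerivAt ζ' (ζ'' y) y) (hζc : Continuous ζ'')
    (h1 : ζ c = 0) (h2 : ζ d = 0) (h3 : ζ' c = 0) (h4 : ζ' d = 0) :
    Df w F ζ ζ'' s t c d = 0 := by
  obtain ⟨p, hp⟩ := h
  exact weak_of_hasDerivAt hcd ((H.Zf_continuousOn hs ht).mono fun y hy =>
    ⟨hc.1.trans_le hy.1, hy.2.trans_lt hd.2⟩) (IntegrableOn.interval (H.int_g hs ht) hc hd) hp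
    hζ hζ' hζc h1 h2 h3 h4

lemma sol_of_Df {s t c d : ℝ} (hs : s ∈ Ioo α β) (ht : t ∈ Ioo α β)
    (hc : c ∈ Ioo a b) (hd : d ∈ Ioo a b) (hcd : c < d)
    (h : ∀ φ : ℝ → ℝ, ContDiff ℝ ∞ φ → tsupport φ ⊆ Ioo c d →
      Df w F φ (deriv (deriv φ)) s t c d = 0) : Sol w F s t c d := by
  obtain ⟨m, p, -, hp⟩ := hasDerivAt_of_weak hcd ((H.Zf_continuousOn hs ht).mono fun y hy =>
    ⟨hc.1.trans_le hy.1, hy.2.trans_lt hd.2⟩) (IntegrableOn.interval (H.int_g hs ht) hc hd) h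
  exact ⟨p, hp⟩

/-- The weak formulation after exchanging the integrals. -/
lemma Df_eq {s t c d A : ℝ} {ζ ζ'' : ℝ → ℝ} (hs : s ∈ Ioo α β) (ht : t ∈ Ioo α β)
    (hc : c ∈ Ioo a b) (hd : d ∈ Ioo a b) (hζ : Continuous ζ) (hζc : Continuous ζ'')
    (hA : ∀ y, |ζ y| ≤ A) {A₂ : ℝ} (hA₂ : ∀ y, |ζ'' y| ≤ A₂) :
    Df w F ζ ζ'' s t c d = (∫ y in c..d, (w t y - w s y) * ζ y) -
      ∫ τ in s..t, ((∫ y in c..d, F τ y * ζ y) + ∫ y in c..d, w τ y * ζ'' y) := by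
  have iF := rect_mul_snd hζ hA H.iF
  have iw := rect_mul_snd hζc hA₂ H.int_w
  have i1 := IntegrableOn.interval (integrableOn_integral_snd hc hd iF) hs ht
  have i2 := IntegrableOn.interval (integrableOn_integral_snd hc hd iw) hs ht
  have j1 := IntegrableOn.interval (integrableOn_integral_fst hs ht iF) hc hd
  have j2 := IntegrableOn.interval (integrableOn_integral_fst hs ht iw) hc hd
  have cs := H.cont_y s
  have ct := H.cont_y t
  rw [intervalIntegral.integral_add i1 i2, rect_swap hs ht hc hd iF, rect_swap hs ht hc hd iw,
    ← intervalIntegral.integral_add j1 j2, ← intervalIntegral.integral_sub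
    (Continuous.intervalIntegrable (by fun_prop) _ _) (j1.add j2)]
  refine intervalIntegral.integral_congr fun y _ => ?_
  simp only [intervalIntegral.integral_mul_const, gf, Zf]
  ring

lemma Df_add {r s t c d : ℝ} {ζ ζ'' : ℝ → ℝ} (hr : r ∈ Ioo α β) (hs : s ∈ Ioo α β)
    (ht : t ∈ Ioo α β) (hc : c ∈ Ioo a b) (hd : d ∈ Ioo a b) (hζ : Continuous ζ)
    (hζc : Continuous ζ'') :
    Df w F ζ ζ'' r s c d + Df w F ζ ζ'' s t c d = Df w F ζ ζ'' r t c d := by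
  have ii : ∀ {s t}, s ∈ Ioo α β → t ∈ Ioo α β →
      IntervalIntegrable (fun y => gf w F s t y * ζ y - Zf w s t y * ζ'' y) volume c d := by
    intro s t hs ht
    refine ((IntegrableOn.interval (H.int_g hs ht) hc hd).mul_continuousOn hζ.continuousOn).sub ?_
    exact (((H.Zf_continuousOn hs ht).mono (ordConnected_Ioo.uIcc_subset hc hd)).mul
      hζc.continuousOn).intervalIntegrable
  simp only [Df]
  rw [← intervalIntegral.integral_add (ii hr hs) (ii hs ht)]
  apply intervalIntegral.integral_congr_ae
  filter_upwards [H.gf_add hr hs ht] with y hy hym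
  rw [← hy (uIoc_subset_Ioo hc hd hym), ← H.Zf_add r s t]
  ring

lemma Df_continuousAt {s t c d A : ℝ} {ζ ζ'' : ℝ → ℝ} (hs : s ∈ Ioo α β) (ht : t ∈ Ioo α β)
    (hc : c ∈ Ioo a b) (hd : d ∈ Ioo a b) (hcd : c ≤ d) (hζ : Continuous ζ) (hζc : Continuous ζ'')
    (hA : ∀ y, |ζ y| ≤ A) {A₂ : ℝ} (hA₂ : ∀ y, |ζ'' y| ≤ A₂) :
    Tendsto (fun τ => Df w F ζ ζ'' s τ c d) (𝓝 t) (𝓝 (Df w F ζ ζ'' s t c d)) := by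
  have hev : ∀ᶠ τ in 𝓝 t, τ ∈ Ioo α β := Ioo_mem_nhds ht.1 ht.2
  have iF := rect_mul_snd hζ hA H.iF
  have iw := rect_mul_snd hζc hA₂ H.int_w
  have key : Tendsto (fun τ => (∫ y in c..d, w τ y * ζ y) - (∫ y in c..d, w s y * ζ y) -
      ∫ τ in s..τ, ((∫ y in c..d, F τ y * ζ y) + ∫ y in c..d, w τ y * ζ'' y)) (𝓝 t)
      (𝓝 ((∫ y in c..d, w t y * ζ y) - (∫ y in c..d, w s y * ζ y) -
      ∫ τ in s..t, ((∫ y in c..d, F τ y * ζ y) + ∫ y in c..d, w τ y * ζ'' y))) := by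
    refine ((H.tendsto_integral_mul ht hc hd hcd hζ hA).sub_const _).sub ?_
    obtain ⟨t₁, h1⟩ := exists_between (lt_min hs.1 ht.1)
    obtain ⟨t₂, h2⟩ := exists_between (max_lt hs.2 ht.2)
    have m1 : t₁ ∈ Ioo α β := ⟨h1.1, (h1.2.trans_le (min_le_left _ _)).trans hs.2⟩
    have m2 : t₂ ∈ Ioo α β := ⟨hs.1.trans ((le_max_left _ _).trans_lt h2.1), h2.2⟩
    have l1 : t₁ < t := h1.2.trans_le (min_le_right _ _)
    have l2 : t < t₂ := (le_max_right _ _).trans_lt h2.1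
    have l3 : t₁ < s := h1.2.trans_le (min_le_left _ _)
    have l4 : s < t₂ := (le_max_left _ _).trans_lt h2.1
    have ii := (IntegrableOn.interval (integrableOn_integral_snd hc hd iF) m1 m2).add
      (IntegrableOn.interval (integrableOn_integral_snd hc hd iw) m1 m2)
    have := (ii.absolutelyContinuousOnInterval_intervalIntegral (c := s)
      (by rw [uIcc_of_le (l1.trans l2).le]; exact ⟨l3.le, l4.le⟩)).continuousOn
    rw [uIcc_of_le (l1.trans l2).le] at this
    exact this.continuousAt (Icc_mem_nhds l1 l2)
  have e : ∀ {τ}, τ ∈ Ioo α β → Df w F ζ ζ'' s τ c d = (∫ y in c..d, w τ y * ζ y) -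
      (∫ y in c..d, w s y * ζ y) -
      ∫ τ in s..τ, ((∫ y in c..d, F τ y * ζ y) + ∫ y in c..d, w τ y * ζ'' y) := by
    intro τ hτ
    have cs := H.cont_y s
    have ct := H.cont_y τ
    rw [H.Df_eq hs hτ hc hd hζ hζc hA hA₂, ← intervalIntegral.integral_sub
      (Continuous.intervalIntegrable (by fun_prop) _ _)
      (Continuous.intervalIntegrable (by fun_prop) _ _)]
    simp only [sub_mul]
  rw [e ht]
  refine key.congr' ?_
  filter_upwards [hev] with τ hτ
  exact (e hτ).symm

end HeatData

/-- A localizing weight whose second derivative is controlled by the weight. -/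
noncomputable def weight (r m y : ℝ) : ℝ := (1 + ((y - m) / r) ^ 2)⁻¹

lemma weight_nonneg (r m y : ℝ) : 0 ≤ weight r m y := by unfold weight; positivity

lemma weight_le_one (r m y : ℝ) : weight r m y ≤ 1 :=
  inv_le_one_of_one_le₀ (by nlinarith [sq_nonneg ((y - m) / r)])

lemma continuous_weight (r m : ℝ) : Continuous (weight r m) := by
  unfold weight
  exact Continuous.inv₀ (by fun_prop) fun y => by positivity

lemma half_le_weight {r m y : ℝ} (hr : 0 < r) (hy : |y - m| ≤ r) : 1 ≤ 2 * weight r m y := by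
  unfold weight
  have h1 : ((y - m) / r) ^ 2 ≤ 1 := by
    rw [sq_le_one_iff_abs_le_one, abs_div, abs_of_pos hr]
    exact div_le_one_of_le₀ hy hr.le
  have h2 : 0 < 1 + ((y - m) / r) ^ 2 := by positivity
  rw [← div_eq_mul_inv, le_div_iff₀ h2]
  linarith

lemma weight_deriv {r m : ℝ} : ∃ χ' χ'' : ℝ → ℝ,
    (∀ y, HasDerivAt (weight r m) (χ' y) y) ∧ (∀ y, HasDerivAt χ' (χ'' y) y) ∧ Continuous χ'' ∧
      ∀ y, χ'' y ≤ 6 / r ^ 2 * weight r m y := by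
  have hx : ∀ y, HasDerivAt (fun y => (y - m) / r) (1 / r) y := fun y =>
    ((hasDerivAt_id y).sub_const m).div_const r
  have hp : ∀ y, 1 + ((y - m) / r) ^ 2 ≠ 0 := fun y => by positivity
  have hq : ∀ y, HasDerivAt (fun y => 1 + ((y - m) / r) ^ 2) (2 * ((y - m) / r) * (1 / r)) y :=
    fun y => by convert! ((hx y).pow 2).const_add 1 using 1; simp
  refine ⟨fun y => -(2 * ((y - m) / r) * (1 / r)) / (1 + ((y - m) / r) ^ 2) ^ 2,
    fun y => (6 * ((y - m) / r) ^ 2 - 2) * (1 / r ^ 2) / (1 + ((y - m) / r) ^ 2) ^ 3, ?_, ?_, ?_, ?_⟩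
  · intro y
    exact (hq y).inv (hp y)
  · intro y
    have h1 := (((hx y).const_mul 2).mul_const (1 / r)).neg
    have h2 := (hq y).pow 2
    convert! h1.div h2 (pow_ne_zero 2 (hp y)) using 1
    simp only [Pi.pow_apply, Pi.neg_apply, Nat.cast_ofNat]
    rw [div_eq_div_iff (pow_ne_zero 3 (hp y)) (pow_ne_zero 2 (pow_ne_zero 2 (hp y)))]
    ring
  · exact Continuous.div (by fun_prop) (by fun_prop) fun y => pow_ne_zero 3 (hp y)
  · intro y
    unfold weight
    set x := (y - m) / r
    have hx1 : 0 < 1 + x ^ 2 := by positivity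
    have hr : 0 ≤ 1 / r ^ 2 := by positivity
    have : (6 * x ^ 2 - 2) / (1 + x ^ 2) ^ 3 ≤ 6 * (1 + x ^ 2)⁻¹ := by
      rw [← div_eq_mul_inv, div_le_div_iff₀ (by positivity) hx1]
      nlinarith [sq_nonneg x, sq_nonneg (x ^ 2), mul_nonneg (sq_nonneg x) (sq_nonneg (x ^ 2))]
    calc _ = (1 / r ^ 2) * ((6 * x ^ 2 - 2) / (1 + x ^ 2) ^ 3) := by ring
      _ ≤ (1 / r ^ 2) * (6 * (1 + x ^ 2)⁻¹) := mul_le_mul_of_nonneg_left this hr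
      _ = _ := by ring

/-- A closed set of possible singularities in a closed box, at which `w` has quantitative
derivatives, and off which the equation holds. -/
structure BadBox (w wy F : ℝ → ℝ → ℝ) (K : Set (ℝ × ℝ)) (a b i₁ i₂ c₀ d₀ N : ℝ) : Prop where
  hi : i₁ < i₂
  hcd : c₀ < d₀
  hlen : d₀ - c₀ ≤ 1
  closed : IsClosed K
  sub : K ⊆ Icc i₁ i₂ ×ˢ Icc c₀ d₀
  N0 : 0 ≤ N
  bw : ∀ τ y, (τ, y) ∈ K → |w τ y| ≤ N
  bwy : ∀ τ y, (τ, y) ∈ K → |wy τ y| ≤ N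
  T : ∀ τ y, (τ, y) ∈ K → ∀ τ' ∈ Icc i₁ i₂, |w τ' y - w τ y| ≤ N * |τ' - τ|
  Y : ∀ τ y, (τ, y) ∈ K → ∀ y' ∈ Icc c₀ d₀,
    |w τ y' - w τ y - wy τ y * (y' - y)| ≤ N * (y' - y) ^ 2
  loc : ∀ s ∈ Icc i₁ i₂, ∀ t ∈ Icc i₁ i₂, s ≤ t → ∀ y ∈ Ioo c₀ d₀,
    (∀ τ ∈ Icc s t, (τ, y) ∉ K) →
    ∃ c' d', y ∈ Ioo c' d' ∧ c' ∈ Ioo a b ∧ d' ∈ Ioo a b ∧ Sol w F s t c' d'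

namespace HeatData
variable {w wt wy wyy F : ℝ → ℝ → ℝ} {α β a b M : ℝ} (H : HeatData w wt wy wyy F α β a b M)
include H

lemma int_weight_pos {L r m : ℝ} (hL : 0 ≤ L) : IntegrableOn
    (Function.uncurry fun τ y => weight r m y * max (|F τ y| - L) 0) (Ioo α β ×ˢ Ioo a b) := by
  refine Integrable.mono' H.iF.norm ?_ (Eventually.of_forall fun p => ?_)
  · have h1 : Measurable fun p : ℝ × ℝ => weight r m p.2 :=
      (continuous_weight r m).measurable.comp measurable_snd
    have h2 : Measurable fun p : ℝ × ℝ => F p.1 p.2 := H.meas_F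
    have h3 : Measurable fun p : ℝ × ℝ => |F p.1 p.2| := by
      simpa only [Real.norm_eq_abs] using h2.norm
    exact (h1.mul ((h3.sub_const L).max measurable_const)).aestronglyMeasurable
  · simp only [Function.uncurry, Real.norm_eq_abs]
    have h0 := abs_nonneg (F p.1 p.2)
    rw [abs_of_nonneg (mul_nonneg (weight_nonneg _ _ _) (le_max_right _ _))]
    calc _ ≤ 1 * max (|F p.1 p.2| - L) 0 :=
          mul_le_mul_of_nonneg_right (weight_le_one _ _ _) (le_max_right _ _)
      _ ≤ _ := by rw [one_mul]; exact max_le (by linarith) h0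

/-- Behind a singular point, `w` stays close to its tangent line in the mean. -/
lemma touch_control {K : Set (ℝ × ℝ)} {i₁ i₂ c₀ d₀ N : ℝ}
    (B : BadBox w wy F K a b i₁ i₂ c₀ d₀ N) (hi₁ : i₁ ∈ Ioo α β) (hi₂ : i₂ ∈ Ioo α β)
    (hc₀ : c₀ ∈ Ioo a b) (hd₀ : d₀ ∈ Ioo a b) {σ y₀ s t t' r m ρ C L M₀ : ℝ}
    (hK : (σ, y₀) ∈ K) (hsσ : s ∈ Icc i₁ σ) (ht : t ∈ Icc σ t') (ht' : t' ≤ i₂) (hr : 0 < r)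
    (hrt : t' - s ≤ r ^ 2)
    (hρ : 0 < ρ) (hy₁ : c₀ + ρ ≤ y₀) (hy₂ : y₀ ≤ d₀ - ρ) (hL : 0 ≤ L)
    (hCN : N ≤ C) (hCρ : M₀ + 2 * N ≤ C * ρ ^ 2)
    (hM₁ : ∀ s ∈ Icc i₁ i₂, |w s c₀| ≤ M₀) (hM₂ : ∀ s ∈ Icc i₁ i₂, |w s d₀| ≤ M₀) :
    ∫ y in c₀..d₀, weight r m y * max (|w t y - (w σ y₀ + wy σ y₀ * (y - y₀))| -
      (2 * N * r ^ 2 + C * (y - y₀) ^ 2 + (2 * C + L) * r ^ 2)) 0 ≤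
      Real.exp 6 * ∫ τ in s..t', ∫ y in c₀..d₀, weight r m y * max (|F τ y| - L) 0 := by
  have hσI : σ ∈ Icc i₁ i₂ := (B.sub hK).1
  have hN := B.N0
  have hC : 0 ≤ C := hN.trans hCN
  have tI : t ∈ Icc i₁ i₂ := ⟨hσI.1.trans ht.1, ht.2.trans ht'⟩
  have inI : ∀ {x}, x ∈ Icc i₁ i₂ → x ∈ Ioo α β := fun hx =>
    ⟨hi₁.1.trans_le hx.1, hx.2.trans_lt hi₂.2⟩
  have hsI : s ∈ Icc i₁ i₂ := ⟨hsσ.1, hsσ.2.trans hσI.2⟩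
  have ht'I : t' ∈ Icc i₁ i₂ := ⟨tI.1.trans ht.2, ht'⟩
  have hy₀ : y₀ ∈ Icc c₀ d₀ := (B.sub hK).2
  obtain ⟨χ', χ'', hχ, hχ', hχc, hχl⟩ := weight_deriv (r := r) (m := m)
  have hbw := B.bw σ y₀ hK
  have hbwy := B.bwy σ y₀ hK
  have hr2 : 0 < r ^ 2 := by positivity
  have hσt : t - σ ≤ r ^ 2 := by linarith [ht.2, hsσ.2]
  have hlin : ∀ y ∈ Icc c₀ d₀, |w σ y₀ + wy σ y₀ * (y - y₀)| ≤ 2 * N := by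
    intro y hy
    have h1 : |y - y₀| ≤ 1 := by
      rw [abs_le]; constructor <;> linarith [hy.1, hy.2, hy₀.1, hy₀.2, B.hlen]
    calc _ ≤ |w σ y₀| + |wy σ y₀ * (y - y₀)| := abs_add_le _ _
      _ ≤ N + N * 1 := by rw [abs_mul]; gcongr
      _ = _ := by ring
  have main := H.comparison (σ := σ) (t := t) (lam := 6 / r ^ 2) (A := w σ y₀) (B := wy σ y₀)
    (C := C) (L := L) (y₀ := y₀) (D := 2 * N * r ^ 2) (χ := weight r m)
    (inI hσI) ht.1 (inI tI) hc₀ hd₀ B.hcd.le (by positivity) hL (by positivity) hC (by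
      intro y hy
      by_cases htouch : ∃ τ ∈ Icc σ t, (τ, y) ∈ K
      · left
        obtain ⟨τ, hτ, hτK⟩ := htouch
        intro s' hs'
        have s'I : s' ∈ Icc i₁ i₂ := ⟨hσI.1.trans hs'.1, hs'.2.trans tI.2⟩
        have h1 := B.T τ y hτK s' s'I
        have h2 := B.T τ y hτK σ hσI
        have h3 := B.Y σ y₀ hK y (Ioo_subset_Icc_self hy)
        have h4 : |s' - τ| ≤ r ^ 2 := by
          rw [abs_le]; constructor <;> linarith [hs'.1, hs'.2, hτ.1, hτ.2]
        have h5 : |σ - τ| ≤ r ^ 2 := by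
          rw [abs_le]; constructor <;> linarith [hτ.1, hτ.2]
        have h6 : w s' y - (w σ y₀ + wy σ y₀ * (y - y₀)) = (w s' y - w τ y) - (w σ y - w τ y) +
          (w σ y - w σ y₀ - wy σ y₀ * (y - y₀)) := by ring
        have h7 : 0 ≤ (2 * C + L) * (s' - σ) := mul_nonneg (by linarith) (by linarith [hs'.1])
        have h8 : N * (y - y₀) ^ 2 ≤ C * (y - y₀) ^ 2 :=
          mul_le_mul_of_nonneg_right hCN (sq_nonneg _)
        have h9 := mul_le_mul_of_nonneg_left h4 hN
        have h10 := mul_le_mul_of_nonneg_left h5 hN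
        rw [h6]
        refine (abs_add_le _ _).trans ?_
        have := abs_sub (w s' y - w τ y) (w σ y - w τ y)
        linarith
      · right
        push Not at htouch
        intro s₁ h₁ s₂ h₂
        have m1 : s₁ ∈ Icc i₁ i₂ := ⟨hσI.1.trans h₁.1, h₁.2.trans tI.2⟩
        have m2 : s₂ ∈ Icc i₁ i₂ := ⟨hσI.1.trans h₂.1, h₂.2.trans tI.2⟩
        rcases le_total s₁ s₂ with h | h
        · exact B.loc s₁ m1 s₂ m2 h y hy fun τ hτ => htouch τ ⟨h₁.1.trans hτ.1, hτ.2.trans h₂.2⟩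
        · obtain ⟨c', d', e1, e2, e3, e4⟩ := B.loc s₂ m2 s₁ m1 h y hy fun τ hτ =>
            htouch τ ⟨h₂.1.trans hτ.1, hτ.2.trans h₁.2⟩
          exact ⟨c', d', e1, e2, e3, sol_symm e4⟩) (by
      intro s' hs' y hy
      have s'I : s' ∈ Icc i₁ i₂ := ⟨hσI.1.trans hs'.1, hs'.2.trans tI.2⟩
      have h7 : 0 ≤ (2 * C + L) * (s' - σ) := mul_nonneg (by linarith) (by linarith [hs'.1])
      have h8 : 0 ≤ 2 * N * r ^ 2 := by positivity
      have h1 : |w s' y| ≤ M₀ := by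
        rcases hy with rfl | rfl
        exacts [hM₁ s' s'I, hM₂ s' s'I]
      have h2 : y ∈ Icc c₀ d₀ := by
        rcases hy with rfl | rfl
        exacts [left_mem_Icc.2 B.hcd.le, right_mem_Icc.2 B.hcd.le]
      have h3 : ρ ^ 2 ≤ (y - y₀) ^ 2 := by
        rcases hy with rfl | rfl
        · rw [← neg_sub, neg_sq]
          exact pow_le_pow_left₀ hρ.le (by linarith) 2
        · exact pow_le_pow_left₀ hρ.le (by linarith) 2
      have h4 := mul_le_mul_of_nonneg_left h3 hC
      have := (abs_sub (w s' y) (w σ y₀ + wy σ y₀ * (y - y₀)))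
      linarith [hlin y h2]) (by
      intro y hy
      have h3 := B.Y σ y₀ hK y hy
      have h8 : N * (y - y₀) ^ 2 ≤ C * (y - y₀) ^ 2 :=
        mul_le_mul_of_nonneg_right hCN (sq_nonneg _)
      have h9 : 0 ≤ 2 * N * r ^ 2 := by positivity
      rw [← sub_sub]
      linarith) hχ hχ' hχc (weight_nonneg r m) (weight_le_one r m) hχl
  have ip := H.int_weight_pos (r := r) (m := m) hL
  have isnd := integrableOn_integral_snd hc₀ hd₀ ip
  have hnn : ∀ τ, 0 ≤ ∫ y in c₀..d₀, weight r m y * max (|F τ y| - L) 0 := fun τ =>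
    intervalIntegral.integral_nonneg B.hcd.le fun y _ =>
      mul_nonneg (weight_nonneg _ _ _) (le_max_right _ _)
  have hmono : ∫ τ in σ..t, ∫ y in c₀..d₀, weight r m y * max (|F τ y| - L) 0 ≤
      ∫ τ in s..t', ∫ y in c₀..d₀, weight r m y * max (|F τ y| - L) 0 :=
    intervalIntegral.integral_mono_interval hsσ.2 ht.1 ht.2 (Eventually.of_forall hnn)
      (IntegrableOn.interval isnd (inI hsI) (inI ht'I))
  have cw := H.cont_y t
  have cχ := continuous_weight r m
  have hX : ∫ y in c₀..d₀, weight r m y * max (|w t y - (w σ y₀ + wy σ y₀ * (y - y₀))| -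
      (2 * N * r ^ 2 + C * (y - y₀) ^ 2 + (2 * C + L) * r ^ 2)) 0 ≤
      ∫ y in c₀..d₀, weight r m y * max (|w t y - (w σ y₀ + wy σ y₀ * (y - y₀))| -
      (2 * N * r ^ 2 + C * (y - y₀) ^ 2 + (2 * C + L) * (t - σ))) 0 := by
    apply intervalIntegral.integral_mono_on B.hcd.le
      (Continuous.intervalIntegrable (by fun_prop) _ _)
      (Continuous.intervalIntegrable (by fun_prop) _ _)
    intro y _
    apply mul_le_mul_of_nonneg_left _ (weight_nonneg _ _ _)
    apply max_le_max _ le_rfl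
    have := mul_le_mul_of_nonneg_left hσt (by linarith : 0 ≤ 2 * C + L)
    linarith
  refine hX.trans ?_
  set X := ∫ y in c₀..d₀, weight r m y * max (|w t y - (w σ y₀ + wy σ y₀ * (y - y₀))| -
      (2 * N * r ^ 2 + C * (y - y₀) ^ 2 + (2 * C + L) * (t - σ))) 0 with hXdef
  have hXn : 0 ≤ X := intervalIntegral.integral_nonneg B.hcd.le fun y _ =>
      mul_nonneg (weight_nonneg _ _ _) (le_max_right _ _)
  have he : Real.exp (-6) ≤ Real.exp (-(6 / r ^ 2 * (t - σ))) := by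
    apply Real.exp_le_exp.2
    rw [neg_le_neg_iff, div_mul_eq_mul_div, div_le_iff₀ hr2]
    linarith
  have h1 : Real.exp (-6) * X ≤ ∫ τ in s..t', ∫ y in c₀..d₀, weight r m y * max (|F τ y| - L) 0 :=
    (mul_le_mul_of_nonneg_right he hXn).trans (main.trans hmono)
  have h2 := mul_le_mul_of_nonneg_left h1 (Real.exp_pos 6).le
  rwa [← mul_assoc, ← Real.exp_add, add_neg_cancel, Real.exp_zero, one_mul] at h2

end HeatData

/-- Indicator function of the complement of `K`. -/
noncomputable def off (K : Set (ℝ × ℝ)) (τ y : ℝ) : ℝ := Kᶜ.indicator (fun _ => 1) (τ, y)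

section Off
variable {K : Set (ℝ × ℝ)}

lemma off_of_mem {τ y : ℝ} (h : (τ, y) ∈ K) : off K τ y = 0 := by simp [off, h]

lemma off_of_notMem {τ y : ℝ} (h : (τ, y) ∉ K) : off K τ y = 1 := by simp [off, h]

lemma off_nonneg (τ y : ℝ) : 0 ≤ off K τ y := indicator_nonneg (fun _ _ => zero_le_one) _

lemma off_le_one (τ y : ℝ) : off K τ y ≤ 1 := by
  by_cases h : (τ, y) ∈ K
  · simp [off_of_mem h]
  · simp [off_of_notMem h]

lemma meas_off (hK : IsClosed K) : Measurable (Function.uncurry (off K)) := by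
  have : Function.uncurry (off K) = Kᶜ.indicator fun _ => 1 := by ext ⟨τ, y⟩; rfl
  rw [this]
  exact measurable_const.indicator hK.measurableSet.compl

lemma section_integral {f k : ℝ → ℝ} {S : Set ℝ} {s t : ℝ} (hst : s ≤ t) (hS : MeasurableSet S)
    (h0 : ∀ x ∈ S, k x = 0) (h1 : ∀ x ∉ S, k x = 1) :
    ∫ x in Icc s t ∩ S, f x = ∫ x in s..t, (1 - k x) * f x := by
  rw [intervalIntegral.integral_of_le hst, ← integral_Icc_eq_integral_Ioc, ← setIntegral_indicator hS]
  congr 1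
  ext x
  by_cases hx : x ∈ S
  · simp [hx, h0 x hx]
  · simp [hx, h1 x hx]

lemma section_measure {k : ℝ → ℝ} {S : Set ℝ} {s t : ℝ} (hst : s ≤ t) (hS : MeasurableSet S)
    (h0 : ∀ x ∈ S, k x = 0) (h1 : ∀ x ∉ S, k x = 1) :
    volume.real (Icc s t \ (Icc s t ∩ S)) = ∫ x in s..t, k x := by
  rw [intervalIntegral.integral_of_le hst, ← integral_Icc_eq_integral_Ioc]
  have e : Icc s t \ (Icc s t ∩ S) = Icc s t ∩ Sᶜ := by ext x; simp
  have e2 : k = Sᶜ.indicator fun _ => (1 : ℝ) := by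
    ext x
    by_cases hx : x ∈ S
    · simp [hx, h0 x hx]
    · simp [hx, h1 x hx]
  rw [e, e2, setIntegral_indicator hS.compl, setIntegral_const, smul_eq_mul, mul_one]

end Off

/-- A one-sided Lipschitz bound at a point bounds the derivative there. -/
lemma abs_deriv_le_of_lipschitz_at {f : ℝ → ℝ} {f' x i₁ i₂ N : ℝ} (hi : i₁ < i₂)
    (hx : x ∈ Icc i₁ i₂) (hf : HasDerivAt f f' x)
    (h : ∀ y ∈ Icc i₁ i₂, |f y - f x| ≤ N * |y - x|) : |f'| ≤ N := by
  have h1 := hf.hasDerivWithinAt (s := Icc i₁ i₂)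
  rw [hasDerivWithinAt_iff_tendsto_slope] at h1
  have hne : (𝓝[Icc i₁ i₂ \ {x}] x).NeBot :=
    (uniqueDiffOn_Icc hi x hx).accPt |> fun h => by rwa [accPt_principal_iff_nhdsWithin] at h
  refine le_of_tendsto h1.abs ?_
  filter_upwards [self_mem_nhdsWithin] with y hy
  have h2 : 0 < |y - x| := abs_pos.2 (sub_ne_zero.2 hy.2)
  rw [slope_def_field, abs_div, div_le_iff₀ h2]
  exact h y hy.1

namespace HeatData
variable {w wt wy wyy F : ℝ → ℝ → ℝ} {α β a b M : ℝ} (H : HeatData w wt wy wyy F α β a b M)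

lemma int_off {K : Set (ℝ × ℝ)} (hK : IsClosed K) :
    IntegrableOn (Function.uncurry (off K)) (Ioo α β ×ˢ Ioo a b) := by
  have hfin : volume (Ioo α β ×ˢ Ioo a b) ≠ ⊤ := by
    rw [Measure.volume_eq_prod, Measure.prod_prod]; exact ENNReal.mul_ne_top (by simp) (by simp)
  refine Integrable.mono' (integrableOn_const hfin (C := (1 : ℝ))) (meas_off hK).aestronglyMeasurable
    (Eventually.of_forall fun p => ?_)
  rw [Real.norm_eq_abs, Function.uncurry, abs_of_nonneg (off_nonneg _ _)]
  exact off_le_one _ _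

include H

lemma int_off_mul {K : Set (ℝ × ℝ)} (hK : IsClosed K) :
    IntegrableOn (Function.uncurry fun τ y => off K τ y * F τ y) (Ioo α β ×ˢ Ioo a b) := by
  refine Integrable.mono' H.iF.norm ((meas_off hK).mul H.meas_F).aestronglyMeasurable
    (Eventually.of_forall fun p => ?_)
  simp only [Function.uncurry, Real.norm_eq_abs, abs_mul, abs_of_nonneg (off_nonneg _ _)]
  exact mul_le_of_le_one_left (abs_nonneg _) (off_le_one _ _)

lemma int_off_one_add {K : Set (ℝ × ℝ)} (hK : IsClosed K) :
    IntegrableOn (Function.uncurry fun τ y => off K τ y * (1 + |F τ y|))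
      (Ioo α β ×ˢ Ioo a b) := by
  refine ((int_off hK).add (H.int_off_mul hK).norm).congr (Eventually.of_forall fun p => ?_)
  simp only [Function.uncurry, Real.norm_eq_abs, Pi.add_apply, abs_mul,
    abs_of_nonneg (off_nonneg _ _)]
  ring

lemma abs_wt_le {K : Set (ℝ × ℝ)} {i₁ i₂ c₀ d₀ N : ℝ} (B : BadBox w wy F K a b i₁ i₂ c₀ d₀ N)
    {τ y : ℝ} (h : (τ, y) ∈ K) : |wt τ y| ≤ N :=
  abs_deriv_le_of_lipschitz_at B.hi (B.sub h).1 (H.ht τ y) (B.T τ y h)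

lemma int_on_wt {K : Set (ℝ × ℝ)} {i₁ i₂ c₀ d₀ N : ℝ} (B : BadBox w wy F K a b i₁ i₂ c₀ d₀ N) :
    IntegrableOn (Function.uncurry fun τ y => (1 - off K τ y) * wt τ y) (Ioo α β ×ˢ Ioo a b) := by
  have hfin : volume (Ioo α β ×ˢ Ioo a b) ≠ ⊤ := by
    rw [Measure.volume_eq_prod, Measure.prod_prod]; exact ENNReal.mul_ne_top (by simp) (by simp)
  refine Integrable.mono' (integrableOn_const hfin (C := N))
    (((meas_off B.closed).const_sub 1).mul H.meas_wt).aestronglyMeasurable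
    (Eventually.of_forall fun p => ?_)
  simp only [Function.uncurry, Real.norm_eq_abs]
  by_cases hp : (p.1, p.2) ∈ K
  · rw [off_of_mem hp, sub_zero, one_mul]
    exact H.abs_wt_le B hp
  · rw [off_of_notMem hp, sub_self, zero_mul, abs_zero]
    exact B.N0

lemma int_on_wyy {K : Set (ℝ × ℝ)} {i₁ i₂ c₀ d₀ N : ℝ} (B : BadBox w wy F K a b i₁ i₂ c₀ d₀ N) :
    IntegrableOn (Function.uncurry fun τ y => (1 - off K τ y) * wyy τ y) (Ioo α β ×ˢ Ioo a b) := by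
  refine (((H.int_on_wt B).sub H.iF).add (H.int_off_mul B.closed)).congr
    (Eventually.of_forall fun p => ?_)
  simp only [Function.uncurry, Pi.add_apply, Pi.sub_apply, H.hF]
  ring

/-- Splitting of the weak formulation into the contributions of `K` and of its complement. -/
lemma Df_split {K : Set (ℝ × ℝ)} {i₁ i₂ c₀ d₀ N : ℝ} (B : BadBox w wy F K a b i₁ i₂ c₀ d₀ N)
    {s t c d A A₂ : ℝ} {ζ ζ'' : ℝ → ℝ} (hs : s ∈ Ioo α β) (ht : t ∈ Ioo α β)
    (hc : c ∈ Ioo a b) (hd : d ∈ Ioo a b) (hζ : Continuous ζ) (hζc : Continuous ζ'')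
    (hA : ∀ y, |ζ y| ≤ A) (hA₂ : ∀ y, |ζ'' y| ≤ A₂) :
    Df w F ζ ζ'' s t c d =
      (∫ y in c..d, ((w t y - w s y) - ∫ τ in s..t, (1 - off K τ y) * wt τ y) * ζ y) -
      (∫ τ in s..t, ((∫ y in c..d, w τ y * ζ'' y) -
        ∫ y in c..d, (1 - off K τ y) * wyy τ y * ζ y)) -
      ∫ τ in s..t, ∫ y in c..d, off K τ y * F τ y * ζ y := by
  have iw := integrableOn_integral_snd hc hd (rect_mul_snd hζc hA₂ H.int_w)
  have iF := integrableOn_integral_snd hc hd (rect_mul_snd hζ hA H.iF)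
  have r1 := rect_mul_snd hζ hA (H.int_on_wt B)
  have r2 := rect_mul_snd hζ hA (H.int_on_wyy B)
  have r3 := rect_mul_snd hζ hA (H.int_off_mul B.closed)
  have s1 := integrableOn_integral_snd hc hd r1
  have s2 := integrableOn_integral_snd hc hd r2
  have s3 := integrableOn_integral_snd hc hd r3
  have cs := H.cont_y s
  have ct := H.cont_y t
  have e1 : (∫ y in c..d, ((w t y - w s y) - ∫ τ in s..t, (1 - off K τ y) * wt τ y) * ζ y) =
      (∫ y in c..d, (w t y - w s y) * ζ y) -
        ∫ τ in s..t, ∫ y in c..d, (1 - off K τ y) * wt τ y * ζ y := by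
    rw [rect_swap hs ht hc hd r1, ← intervalIntegral.integral_sub
      (Continuous.intervalIntegrable (by fun_prop) _ _)
      (IntegrableOn.interval (integrableOn_integral_fst hs ht r1) hc hd)]
    refine intervalIntegral.integral_congr fun y _ => ?_
    simp only [intervalIntegral.integral_mul_const]
    ring
  have I : ∀ {f : ℝ → ℝ}, IntegrableOn f (Ioo α β) → IntervalIntegrable f volume s t :=
    fun h => IntegrableOn.interval h hs ht
  rw [H.Df_eq hs ht hc hd hζ hζc hA hA₂, e1, intervalIntegral.integral_sub (I iw) (I s2),
    intervalIntegral.integral_add (I iF) (I iw)]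
  have e2 : ∫ τ in s..t, ∫ y in c..d, F τ y * ζ y =
      (∫ τ in s..t, ∫ y in c..d, (1 - off K τ y) * wt τ y * ζ y) -
      (∫ τ in s..t, ∫ y in c..d, (1 - off K τ y) * wyy τ y * ζ y) +
      ∫ τ in s..t, ∫ y in c..d, off K τ y * F τ y * ζ y := by
    rw [← intervalIntegral.integral_sub (I s1) (I s2),
      ← intervalIntegral.integral_add ((I s1).sub (I s2)) (I s3)]
    apply intervalIntegral.integral_congr_ae
    filter_upwards [ae_integrableOn_snd r1, ae_integrableOn_snd r2, ae_integrableOn_snd r3]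
      with τ h1 h2 h3 hτ
    have hτ' := uIoc_subset_Ioo hs ht hτ
    have J : ∀ {f : ℝ → ℝ}, IntegrableOn f (Ioo a b) → IntervalIntegrable f volume c d :=
      fun h => IntegrableOn.interval h hc hd
    rw [← intervalIntegral.integral_sub (J (h1 hτ')) (J (h2 hτ')),
      ← intervalIntegral.integral_add ((J (h1 hτ')).sub (J (h2 hτ'))) (J (h3 hτ'))]
    refine intervalIntegral.integral_congr fun y _ => ?_
    simp only [H.hF]
    ring
  rw [e2]
  ring

end HeatData

lemma off_fst {K : Set (ℝ × ℝ)} (hK : IsClosed K) (y s t : ℝ) :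
    IntervalIntegrable (fun τ => off K τ y) volume s t := by
  refine (intervalIntegrable_const (c := (1 : ℝ))).mono_fun
    ((meas_off hK).comp (measurable_id.prodMk measurable_const)).aestronglyMeasurable
    (Eventually.of_forall fun τ => ?_)
  simp only [Real.norm_eq_abs, abs_one]
  rw [abs_of_nonneg (off_nonneg _ _)]
  exact off_le_one _ _

lemma off_snd {K : Set (ℝ × ℝ)} (hK : IsClosed K) (τ c d : ℝ) :
    IntervalIntegrable (off K τ) volume c d := by
  refine (intervalIntegrable_const (c := (1 : ℝ))).mono_fun
    ((meas_off hK).comp (measurable_const.prodMk measurable_id)).aestronglyMeasurable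
    (Eventually.of_forall fun y => ?_)
  simp only [Real.norm_eq_abs, abs_one]
  rw [abs_of_nonneg (off_nonneg _ _)]
  exact off_le_one _ _

lemma integral_affine_mul_deriv2 {ζ ζ' ζ'' : ℝ → ℝ} {c d p q y₀ : ℝ}
    (hζ : ∀ y, HasDerivAt ζ (ζ' y) y) (hζ' : ∀ y, HasDerivAt ζ' (ζ'' y) y) (hζc : Continuous ζ'')
    (h1 : ζ c = 0) (h2 : ζ d = 0) (h3 : ζ' c = 0) (h4 : ζ' d = 0) :
    ∫ y in c..d, (p + q * (y - y₀)) * ζ'' y = 0 := by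
  have cζ' : Continuous ζ' := continuous_iff_continuousAt.2 fun y => (hζ' y).continuousAt
  have e := intervalIntegral.integral_mul_deriv_eq_deriv_mul (a := c) (b := d)
    (u := fun y => p + q * (y - y₀)) (u' := fun _ => q)
    (fun y _ => by
      have := (((hasDerivAt_id y).sub_const y₀).const_mul q).const_add p
      rwa [mul_one] at this) (fun y _ => hζ' y) (by simp) (hζc.intervalIntegrable _ _)
  rw [e, intervalIntegral.integral_const_mul, intervalIntegral.integral_eq_sub_of_hasDerivAt
    (fun y _ => hζ y) (cζ'.intervalIntegrable _ _)]
  simp [h1, h2, h3, h4]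

namespace HeatData
variable {w wt wy wyy F : ℝ → ℝ → ℝ} {α β a b M : ℝ} (H : HeatData w wt wy wyy F α β a b M)
include H

/-- Defect of the weak formulation on a cell whose first singular point occurs at the initial
time `σ`, the cell being free of singular points on `[s, σ)`. -/
lemma cell_bound_aux {K : Set (ℝ × ℝ)} {i₁ i₂ c₀ d₀ N : ℝ}
    (B : BadBox w wy F K a b i₁ i₂ c₀ d₀ N) (hi₁ : i₁ ∈ Ioo α β) (hi₂ : i₂ ∈ Ioo α β)
    (hc₀ : c₀ ∈ Ioo a b) (hd₀ : d₀ ∈ Ioo a b) {σ y₀ s t r m ρ C L M₀ A : ℝ}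
    (hK : (σ, y₀) ∈ K) (hsσ : s ∈ Icc i₁ σ) (hσt : σ ≤ t) (ht : t ≤ i₂) (hr : 0 < r)
    (hrt : t - s = r ^ 2) (hρ : 0 < ρ) (hm₁ : c₀ + ρ ≤ m - r) (hm₂ : m + r ≤ d₀ - ρ)
    (hy₀ : y₀ ∈ Icc (m - r) (m + r)) (hL : 0 ≤ L)
    (hCN : N ≤ C) (hCρ : M₀ + 2 * N ≤ C * ρ ^ 2)
    (hM₁ : ∀ s ∈ Icc i₁ i₂, |w s c₀| ≤ M₀) (hM₂ : ∀ s ∈ Icc i₁ i₂, |w s d₀| ≤ M₀)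
    (hfree : ∀ τ ∈ Ico s σ, ∀ y ∈ Icc (m - r) (m + r), (τ, y) ∉ K)
    {ζ ζ' ζ'' : ℝ → ℝ} (hζ : ∀ y, HasDerivAt ζ (ζ' y) y) (hζ' : ∀ y, HasDerivAt ζ' (ζ'' y) y)
    (hζc : Continuous ζ'') (h1 : ζ (m - r) = 0) (h2 : ζ (m + r) = 0) (h3 : ζ' (m - r) = 0)
    (h4 : ζ' (m + r) = 0) (hA : ∀ y, |ζ y| ≤ A) (hA₂ : ∀ y, |ζ'' y| ≤ A / r ^ 2) :
    |Df w F ζ ζ'' σ t (m - r) (m + r)| ≤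
      A * (20 * N + 12 * C + 2 * L + 1) *
        (∫ τ in s..t, ∫ y in (m - r)..(m + r), off K τ y * (1 + |F τ y|)) +
      4 * A * (Real.exp 6 *
        ∫ τ in s..t, ∫ y in c₀..d₀, weight r m y * max (|F τ y| - L) 0) := by
  have hN := B.N0
  have hC : 0 ≤ C := hN.trans hCN
  have hA0 : 0 ≤ A := (abs_nonneg _).trans (hA 0)
  have hσI : σ ∈ Icc i₁ i₂ := (B.sub hK).1
  have inI : ∀ {x}, x ∈ Icc i₁ i₂ → x ∈ Ioo α β := fun hx =>
    ⟨hi₁.1.trans_le hx.1, hx.2.trans_lt hi₂.2⟩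
  have hsI : s ∈ Icc i₁ i₂ := ⟨hsσ.1, hsσ.2.trans hσI.2⟩
  have htI : t ∈ Icc i₁ i₂ := ⟨hσI.1.trans hσt, ht⟩
  have hst : s ≤ t := hsσ.2.trans hσt
  set Φ := Real.exp 6 * ∫ τ in s..t, ∫ y in c₀..d₀, weight r m y * max (|F τ y| - L) 0 with hΦ
  set c := m - r with hc_def
  set d := m + r with hd_def
  have hcd : c ≤ d := by linarith
  have hdc : d - c = 2 * r := by rw [hc_def, hd_def]; ring
  have hcc : c₀ ≤ c := by linarith
  have hdd : d ≤ d₀ := by linarith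
  have hc : c ∈ Ioo a b := ⟨hc₀.1.trans_le hcc, (hcd.trans hdd).trans_lt hd₀.2⟩
  have hd : d ∈ Ioo a b := ⟨hc.1.trans_le hcd, hdd.trans_lt hd₀.2⟩
  have cζ : Continuous ζ := continuous_iff_continuousAt.2 fun y => (hζ y).continuousAt
  have cχ := continuous_weight r m
  have hr2 : 0 < r ^ 2 := by positivity
  set l : ℝ → ℝ := fun y => w σ y₀ + wy σ y₀ * (y - y₀) with hl
  have cl : Continuous l := by fun_prop
  set X : ℝ → ℝ → ℝ := fun τ y => weight r m y *
    max (|w τ y - l y| - (2 * N * r ^ 2 + C * (y - y₀) ^ 2 + (2 * C + L) * r ^ 2)) 0 with hX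
  have cX : ∀ τ, Continuous (X τ) := fun τ => by
    have := H.cont_y τ
    fun_prop
  have X0 : ∀ τ y, 0 ≤ X τ y := fun τ y => mul_nonneg (weight_nonneg _ _ _) (le_max_right _ _)
  have XΦ : ∀ τ ∈ Icc σ t, ∫ y in c..d, X τ y ≤ Φ := fun τ hτ =>
    (intervalIntegral.integral_mono_interval hcc hcd hdd (Eventually.of_forall (X0 τ))
      ((cX τ).intervalIntegrable _ _)).trans
    (H.touch_control B hi₁ hi₂ hc₀ hd₀ hK hsσ hτ ht hr hrt.le hρ (by linarith [hy₀.1])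
      (by linarith [hy₀.2]) hL hCN hCρ hM₁ hM₂)
  have hsq : ∀ y ∈ Icc c d, (y - y₀) ^ 2 ≤ 4 * r ^ 2 := by
    intro y hy
    have : |y - y₀| ≤ 2 * r := by
      rw [abs_le]; constructor <;> linarith [hy.1, hy.2, hy₀.1, hy₀.2]
    calc (y - y₀) ^ 2 = |y - y₀| ^ 2 := (sq_abs _).symm
      _ ≤ (2 * r) ^ 2 := pow_le_pow_left₀ (abs_nonneg _) this 2
      _ = _ := by ring
  have hpt : ∀ τ, ∀ y ∈ Icc c d, |w τ y - l y| ≤ 2 * X τ y + (2 * N + 6 * C + L) * r ^ 2 := by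
    intro τ y hy
    have hw : 1 ≤ 2 * weight r m y := half_le_weight hr (by
      rw [abs_le]; constructor <;> linarith [hy.1, hy.2])
    have e1 := mul_le_mul_of_nonneg_left (hsq y hy) hC
    have e2 := le_max_left (|w τ y - l y| -
      (2 * N * r ^ 2 + C * (y - y₀) ^ 2 + (2 * C + L) * r ^ 2)) 0
    have e3 := le_max_right (|w τ y - l y| -
      (2 * N * r ^ 2 + C * (y - y₀) ^ 2 + (2 * C + L) * r ^ 2)) 0
    have e4 := mul_le_mul_of_nonneg_right hw e3
    simp only [hX]
    nlinarith
  have hKt : ∀ y, MeasurableSet {τ | (τ, y) ∈ K} := fun y =>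
    (measurable_id.prodMk measurable_const) B.closed.measurableSet
  have hKy : ∀ τ, MeasurableSet {y | (τ, y) ∈ K} := fun τ =>
    (measurable_const.prodMk measurable_id) B.closed.measurableSet
  have off_mono : ∀ y, ∫ τ in σ..t, off K τ y ≤ ∫ τ in s..t, off K τ y := fun y =>
    intervalIntegral.integral_mono_interval hsσ.2 hσt le_rfl
      (Eventually.of_forall fun _ => off_nonneg _ _) (off_fst B.closed _ _ _)
  have off0 : ∀ y, 0 ≤ ∫ τ in s..t, off K τ y := fun y =>
    intervalIntegral.integral_nonneg hst fun _ _ => off_nonneg _ _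
  have off0' : ∀ τ, 0 ≤ ∫ y in c..d, off K τ y := fun τ =>
    intervalIntegral.integral_nonneg hcd fun _ _ => off_nonneg _ _
  have T1 : ∀ y ∈ Icc c d,
      |((w t y - w σ y) - ∫ τ in σ..t, (1 - off K τ y) * wt τ y) * ζ y| ≤
        A * ((8 * N + 6 * C + L) * (∫ τ in s..t, off K τ y) + 2 * X t y) := by
    intro y hy
    rw [abs_mul, mul_comm]
    refine mul_le_mul (hA y) ?_ (abs_nonneg _) hA0
    by_cases htouch : ∃ τ ∈ Icc σ t, (τ, y) ∈ K
    · obtain ⟨τ, hτ, hτK⟩ := htouch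
      have := abs_sub_setIntegral_le hσt hN (measurableSet_Icc.inter (hKt y))
        inter_subset_left ⟨τ, hτ, hτK⟩ (fun x => H.ht x y)
        (fun x hx x' hx' => B.T x y hx.2 x' ⟨hσI.1.trans hx'.1, hx'.2.trans ht⟩)
      have g0 : ∀ x ∈ {τ | (τ, y) ∈ K}, off K x y = 0 := fun x hx => off_of_mem hx
      have g1 : ∀ x ∉ {τ | (τ, y) ∈ K}, off K x y = 1 := fun x hx => off_of_notMem hx
      rw [section_integral (k := fun x => off K x y) hσt (hKt y) g0 g1,
        section_measure (k := fun x => off K x y) hσt (hKt y) g0 g1] at this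
      refine this.trans ?_
      have e1 := mul_le_mul_of_nonneg_left (off_mono y) hN
      have e2 := X0 t y
      have e3 : 0 ≤ (7 * N + 6 * C + L) * ∫ τ in s..t, off K τ y :=
        mul_nonneg (by positivity) (off0 y)
      linarith
    · push Not at htouch
      have z1 : ∫ τ in σ..t, (1 - off K τ y) * wt τ y = 0 := by
        rw [intervalIntegral.integral_congr (g := fun _ => 0), intervalIntegral.integral_zero]
        intro τ hτ
        rw [uIcc_of_le hσt] at hτ
        simp [off_of_notMem (htouch τ hτ)]
      have z2 : ∫ τ in s..t, off K τ y = r ^ 2 := by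
        rw [intervalIntegral.integral_congr (g := fun _ => 1), intervalIntegral.integral_const,
          smul_eq_mul, mul_one, hrt]
        intro τ hτ
        rw [uIcc_of_le hst] at hτ
        rcases lt_or_ge τ σ with h | h
        · exact off_of_notMem (hfree τ ⟨hτ.1, h⟩ y hy)
        · exact off_of_notMem (htouch τ ⟨h, hτ.2⟩)
      rw [z1, z2, sub_zero]
      have e1 := hpt t y hy
      have e2 := B.Y σ y₀ hK y ⟨hcc.trans hy.1, hy.2.trans hdd⟩
      have e3 := mul_le_mul_of_nonneg_left (hsq y hy) hN
      have e4 : w t y - w σ y = (w t y - l y) - (w σ y - w σ y₀ - wy σ y₀ * (y - y₀)) := by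
        simp only [hl]; ring
      rw [e4]
      refine (abs_sub _ _).trans ?_
      nlinarith
  have T2 : ∀ τ ∈ Icc σ t,
      |(∫ y in c..d, w τ y * ζ'' y) - ∫ y in c..d, (1 - off K τ y) * wyy τ y * ζ y| ≤
        A * (12 * N + 6 * C + L) * (∫ y in c..d, off K τ y) + 2 * A * Φ / r ^ 2 := by
    intro τ hτ
    have hΦ0 : 0 ≤ Φ := (intervalIntegral.integral_nonneg hcd fun y _ => X0 τ y).trans (XΦ τ hτ)
    have hΦ1 : 0 ≤ 2 * A * Φ / r ^ 2 := by positivity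
    by_cases htouch : ∃ y ∈ Icc c d, (τ, y) ∈ K
    · obtain ⟨y, hy, hyK⟩ := htouch
      have := abs_integral_deriv2_sub_le hcd hN (measurableSet_Icc.inter (hKy τ))
        inter_subset_left ⟨y, hy, hyK⟩ (fun x => H.hy τ x) (fun x => H.hyy τ x)
        (fun x hx x' hx' => B.Y τ x hx.2 x' ⟨hcc.trans hx'.1, hx'.2.trans hdd⟩)
        hζ hζ' hζc h1 h2 h3 h4 hA hA₂
      have g0 : ∀ x ∈ {y | (τ, y) ∈ K}, off K τ x = 0 := fun x hx => off_of_mem hx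
      have g1 : ∀ x ∉ {y | (τ, y) ∈ K}, off K τ x = 1 := fun x hx => off_of_notMem hx
      rw [section_integral (k := fun x => off K τ x) hcd (hKy τ) g0 g1,
        section_measure (k := fun x => off K τ x) hcd (hKy τ) g0 g1, hdc] at this
      simp only [← mul_assoc] at this
      have e1 : 2 * N * A + 2 * N * (2 * r) ^ 2 * (A / r ^ 2) = 10 * N * A := by
        field_simp; ring
      rw [e1] at this
      have e3 : 0 ≤ (2 * N + 6 * C + L) * A * ∫ y in c..d, off K τ y :=
        mul_nonneg (by positivity) (off0' τ)
      linarith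
    · push Not at htouch
      have z1 : ∫ y in c..d, (1 - off K τ y) * wyy τ y * ζ y = 0 := by
        rw [intervalIntegral.integral_congr (g := fun _ => 0), intervalIntegral.integral_zero]
        intro y hy
        rw [uIcc_of_le hcd] at hy
        simp [off_of_notMem (htouch y hy)]
      have z2 : ∫ y in c..d, off K τ y = 2 * r := by
        rw [intervalIntegral.integral_congr (g := fun _ => 1), intervalIntegral.integral_const,
          smul_eq_mul, mul_one, hdc]
        intro y hy
        rw [uIcc_of_le hcd] at hy
        exact off_of_notMem (htouch y hy)
      have cw := H.cont_y τ
      have z3 : ∫ y in c..d, w τ y * ζ'' y = ∫ y in c..d, (w τ y - l y) * ζ'' y := by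
        have := integral_affine_mul_deriv2 (p := w σ y₀) (q := wy σ y₀) (y₀ := y₀) hζ hζ' hζc
          h1 h2 h3 h4
        rw [← sub_zero (∫ y in c..d, w τ y * ζ'' y), ← this, ← intervalIntegral.integral_sub
          (Continuous.intervalIntegrable (by fun_prop) _ _)
          (Continuous.intervalIntegrable (by fun_prop) _ _)]
        exact intervalIntegral.integral_congr fun y _ => by simp only [hl]; ring
      rw [z1, z2, z3, sub_zero]
      calc |∫ y in c..d, (w τ y - l y) * ζ'' y|
          ≤ ∫ y in c..d, |(w τ y - l y) * ζ'' y| :=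
            intervalIntegral.abs_integral_le_integral_abs hcd
        _ ≤ ∫ y in c..d, (2 * X τ y + (2 * N + 6 * C + L) * r ^ 2) * (A / r ^ 2) := by
            have := cX τ
            apply intervalIntegral.integral_mono_on hcd
              (Continuous.intervalIntegrable (by fun_prop) _ _)
              (Continuous.intervalIntegrable (by fun_prop) _ _)
            intro y hy
            rw [abs_mul]
            exact mul_le_mul (hpt τ y hy) (hA₂ y) (abs_nonneg _) ((abs_nonneg _).trans (hpt τ y hy))
        _ = (2 * (∫ y in c..d, X τ y) + 2 * r * ((2 * N + 6 * C + L) * r ^ 2)) * (A / r ^ 2) := by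
            rw [intervalIntegral.integral_mul_const, intervalIntegral.integral_add
              ((cX τ).intervalIntegrable _ _ |>.const_mul 2) (by simp),
              intervalIntegral.integral_const_mul, intervalIntegral.integral_const, smul_eq_mul, hdc]
        _ ≤ (2 * Φ + 2 * r * ((2 * N + 6 * C + L) * r ^ 2)) * (A / r ^ 2) := by
            have := XΦ τ hτ
            gcongr
        _ = A * (2 * N + 6 * C + L) * (2 * r) + 2 * A * Φ / r ^ 2 := by field_simp; ring
        _ ≤ _ := by
            have : 0 ≤ A * (10 * N) * (2 * r) := by positivity
            linarith
  have hΦ0 : 0 ≤ Φ := (intervalIntegral.integral_nonneg hcd fun y _ => X0 t y).trans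
    (XΦ t ⟨hσt, le_rfl⟩)
  have ioff := int_off (α := α) (β := β) (a := a) (b := b) B.closed
  have r1 := rect_mul_snd cζ hA (H.int_on_wt B)
  have r2 := rect_mul_snd cζ hA (H.int_on_wyy B)
  have rw' := rect_mul_snd hζc hA₂ H.int_w
  have r3 := rect_mul_snd cζ hA (H.int_off_mul B.closed)
  have r4 := H.int_off_one_add B.closed
  have r5 : IntegrableOn (Function.uncurry fun τ y => off K τ y * |F τ y|)
      (Ioo α β ×ˢ Ioo a b) := by
    refine (H.int_off_mul B.closed).norm.congr (Eventually.of_forall fun p => ?_)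
    simp only [Function.uncurry, Real.norm_eq_abs, abs_mul, abs_of_nonneg (off_nonneg _ _)]
  have hmeas := integrableOn_integral_snd hc hd ioff
  set μ := ∫ τ in s..t, ∫ y in c..d, off K τ y with hμ
  have I1 : |∫ y in c..d, ((w t y - w σ y) - ∫ τ in σ..t, (1 - off K τ y) * wt τ y) * ζ y| ≤
      A * ((8 * N + 6 * C + L) * μ + 2 * Φ) := by
    have j1 : IntervalIntegrable (fun y => ∫ τ in s..t, off K τ y) volume c d :=
      IntegrableOn.interval (integrableOn_integral_fst (inI hsI) (inI htI) ioff) hc hd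
    have j3 := cX t
    have j4 : IntervalIntegrable (fun y => 2 * X t y) volume c d :=
      Continuous.intervalIntegrable (by fun_prop) _ _
    have j2 : IntervalIntegrable (fun y => A * ((8 * N + 6 * C + L) * (∫ τ in s..t, off K τ y) +
        2 * X t y)) volume c d := ((j1.const_mul _).add j4).const_mul A
    have cs := H.cont_y σ
    have ct := H.cont_y t
    have j5 : IntervalIntegrable (fun y => ((w t y - w σ y) -
        ∫ τ in σ..t, (1 - off K τ y) * wt τ y) * ζ y) volume c d :=
      ((Continuous.intervalIntegrable (by fun_prop) _ _).sub (IntegrableOn.interval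
        (integrableOn_integral_fst (inI hσI) (inI htI) (H.int_on_wt B)) hc hd)).mul_continuousOn
        cζ.continuousOn
    refine (intervalIntegral.abs_integral_le_integral_abs hcd).trans ?_
    refine (intervalIntegral.integral_mono_on hcd j5.abs j2 T1).trans ?_
    rw [intervalIntegral.integral_const_mul, intervalIntegral.integral_add (j1.const_mul _) j4,
      intervalIntegral.integral_const_mul, intervalIntegral.integral_const_mul,
      ← rect_swap (inI hsI) (inI htI) hc hd ioff]
    have := XΦ t ⟨hσt, le_rfl⟩
    gcongr
  have I2 : |∫ τ in σ..t, ((∫ y in c..d, w τ y * ζ'' y) -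
        ∫ y in c..d, (1 - off K τ y) * wyy τ y * ζ y)| ≤
      A * (12 * N + 6 * C + L) * μ + 2 * A * Φ := by
    have j1 : IntervalIntegrable (fun τ => ∫ y in c..d, off K τ y) volume σ t :=
      IntegrableOn.interval hmeas (inI hσI) (inI htI)
    have j5 := (IntegrableOn.interval (integrableOn_integral_snd hc hd rw') (inI hσI) (inI htI)).sub
      (IntegrableOn.interval (integrableOn_integral_snd hc hd r2) (inI hσI) (inI htI))
    refine (intervalIntegral.abs_integral_le_integral_abs hσt).trans ?_
    refine (intervalIntegral.integral_mono_on hσt j5.abs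
      ((j1.const_mul (A * (12 * N + 6 * C + L))).add (by simp)) T2).trans ?_
    rw [intervalIntegral.integral_add (j1.const_mul _) (by simp),
      intervalIntegral.integral_const_mul, intervalIntegral.integral_const, smul_eq_mul]
    have e1 : ∫ τ in σ..t, ∫ y in c..d, off K τ y ≤ μ :=
      intervalIntegral.integral_mono_interval hsσ.2 hσt le_rfl (Eventually.of_forall off0')
        (IntegrableOn.interval hmeas (inI hsI) (inI htI))
    have e2 : (t - σ) * (2 * A * Φ / r ^ 2) ≤ 2 * A * Φ := by
      rw [mul_div_assoc', div_le_iff₀ hr2, mul_comm]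
      exact mul_le_mul_of_nonneg_left (by linarith [hsσ.2]) (by positivity)
    have e3 := mul_le_mul_of_nonneg_left e1
      (by positivity : 0 ≤ A * (12 * N + 6 * C + L))
    linarith
  have I3 : |∫ τ in σ..t, ∫ y in c..d, off K τ y * F τ y * ζ y| ≤
      A * ∫ τ in s..t, ∫ y in c..d, off K τ y * |F τ y| := by
    have j1 := integrableOn_integral_snd hc hd r3
    have j2 := integrableOn_integral_snd hc hd r5
    refine (intervalIntegral.abs_integral_le_integral_abs hσt).trans ?_
    have e1 : ∫ τ in σ..t, |∫ y in c..d, off K τ y * F τ y * ζ y| ≤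
        ∫ τ in σ..t, A * ∫ y in c..d, off K τ y * |F τ y| := by
      apply intervalIntegral.integral_mono_ae_restrict hσt
        (IntegrableOn.interval j1 (inI hσI) (inI htI)).abs
        ((IntegrableOn.interval j2 (inI hσI) (inI htI)).const_mul A)
      rw [EventuallyLE, ae_restrict_iff' measurableSet_Icc]
      filter_upwards [ae_integrableOn_snd r3, ae_integrableOn_snd r5] with τ g1 g2 hτ
      have hτ' : τ ∈ Ioo α β := inI ⟨hσI.1.trans hτ.1, hτ.2.trans ht⟩
      refine (intervalIntegral.abs_integral_le_integral_abs hcd).trans ?_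
      rw [← intervalIntegral.integral_const_mul]
      apply intervalIntegral.integral_mono_on hcd (IntegrableOn.interval (g1 hτ') hc hd).abs
        ((IntegrableOn.interval (g2 hτ') hc hd).const_mul A)
      intro y _
      rw [abs_mul, abs_mul, abs_of_nonneg (off_nonneg _ _), mul_comm]
      exact mul_le_mul_of_nonneg_right (hA y) (mul_nonneg (off_nonneg _ _) (abs_nonneg _))
    refine e1.trans ?_
    rw [intervalIntegral.integral_const_mul]
    refine mul_le_mul_of_nonneg_left ?_ hA0
    refine intervalIntegral.integral_mono_interval hsσ.2 hσt le_rfl (Eventually.of_forall fun τ =>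
      intervalIntegral.integral_nonneg hcd fun y _ => mul_nonneg (off_nonneg _ _) (abs_nonneg _))
      (IntegrableOn.interval j2 (inI hsI) (inI htI))
  have hsplit : ∫ τ in s..t, ∫ y in c..d, off K τ y * (1 + |F τ y|) =
      μ + ∫ τ in s..t, ∫ y in c..d, off K τ y * |F τ y| := by
    rw [hμ, ← intervalIntegral.integral_add (IntegrableOn.interval hmeas (inI hsI) (inI htI))
      (IntegrableOn.interval (integrableOn_integral_snd hc hd r5) (inI hsI) (inI htI))]
    apply intervalIntegral.integral_congr_ae
    filter_upwards [ae_integrableOn_snd r5] with τ g hτ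
    rw [← intervalIntegral.integral_add (off_snd B.closed _ _ _)
      (IntegrableOn.interval (g (uIoc_subset_Ioo (inI hsI) (inI htI) hτ)) hc hd)]
    exact intervalIntegral.integral_congr fun y _ => by ring
  have hμ0 : 0 ≤ μ := intervalIntegral.integral_nonneg hst fun τ _ => off0' τ
  have hν0 : 0 ≤ ∫ τ in s..t, ∫ y in c..d, off K τ y * |F τ y| :=
    intervalIntegral.integral_nonneg hst fun τ _ => intervalIntegral.integral_nonneg hcd
      fun y _ => mul_nonneg (off_nonneg _ _) (abs_nonneg _)
  rw [H.Df_split B (inI hσI) (inI htI) hc hd cζ hζc hA hA₂, hsplit]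
  refine (abs_sub _ _).trans ((add_le_add ((abs_sub _ _).trans (add_le_add I1 I2)) I3).trans ?_)
  have p1 : 0 ≤ A * μ := mul_nonneg hA0 hμ0
  have p2 : 0 ≤ A * (20 * N + 12 * C + 2 * L) *
      ∫ τ in s..t, ∫ y in c..d, off K τ y * |F τ y| := mul_nonneg (by positivity) hν0
  linarith

end HeatData

lemma exists_first_touch {K : Set (ℝ × ℝ)} (hK : IsClosed K) {s t c d : ℝ}
    (h : ∃ τ ∈ Icc s t, ∃ y ∈ Icc c d, (τ, y) ∈ K) :
    ∃ σ ∈ Icc s t, ∃ y₀ ∈ Icc c d, (σ, y₀) ∈ K ∧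
      ∀ τ ∈ Ico s σ, ∀ y ∈ Icc c d, (τ, y) ∉ K := by
  obtain ⟨τ₀, hτ₀, y₁, hy₁, hk⟩ := h
  have hc : IsCompact (K ∩ Icc s t ×ˢ Icc c d) :=
    (isCompact_Icc.prod isCompact_Icc).inter_left hK
  obtain ⟨⟨σ, y₀⟩, ⟨h1, h2⟩, hmin⟩ := hc.exists_isMinOn ⟨(τ₀, y₁), hk, hτ₀, hy₁⟩
    continuous_fst.continuousOn
  refine ⟨σ, h2.1, y₀, h2.2, h1, fun τ hτ y hy hK' => ?_⟩
  have := hmin (show (τ, y) ∈ K ∩ Icc s t ×ˢ Icc c d from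
    ⟨hK', ⟨hτ.1, hτ.2.le.trans h2.1.2⟩, hy⟩)
  exact absurd hτ.2 (not_lt.2 this)

/-- The density controlling the defect at scale `r`. -/
noncomputable def excess (K : Set (ℝ × ℝ)) (F : ℝ → ℝ → ℝ) (P Q L r τ y : ℝ) : ℝ :=
  P * (Metric.cthickening (2 * r) K \ K).indicator (fun p => 1 + |F p.1 p.2|) (τ, y) +
    Q * max (|F τ y| - L) 0

lemma excess_nonneg {K : Set (ℝ × ℝ)} {F : ℝ → ℝ → ℝ} {P Q L r : ℝ} (hP : 0 ≤ P) (hQ : 0 ≤ Q)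
    (τ y : ℝ) : 0 ≤ excess K F P Q L r τ y :=
  add_nonneg (mul_nonneg hP (indicator_nonneg (fun _ _ => by positivity) _))
    (mul_nonneg hQ (le_max_right _ _))

lemma excess_le {K : Set (ℝ × ℝ)} {F : ℝ → ℝ → ℝ} {P Q L r : ℝ} (hP : 0 ≤ P) (hQ : 0 ≤ Q)
    (hL : 0 ≤ L) (τ y : ℝ) : excess K F P Q L r τ y ≤ P * (1 + |F τ y|) + Q * |F τ y| := by
  have h0 := abs_nonneg (F τ y)
  refine add_le_add (mul_le_mul_of_nonneg_left ?_ hP) (mul_le_mul_of_nonneg_left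
    (max_le (by linarith) h0) hQ)
  exact indicator_le_self' (fun _ _ => by positivity) (τ, y)

lemma rect_integral_mono {f : ℝ → ℝ → ℝ} {α β a b s t c d c₀ d₀ : ℝ} (hs : s ∈ Ioo α β) (ht : t ∈ Ioo α β)
    (hst : s ≤ t) (hc₀ : c₀ ∈ Ioo a b) (hd₀ : d₀ ∈ Ioo a b) (hc : c₀ ≤ c) (hcd : c ≤ d)
    (hd : d ≤ d₀) (hf : IntegrableOn (Function.uncurry f) (Ioo α β ×ˢ Ioo a b))
    (h0 : ∀ τ y, 0 ≤ f τ y) :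
    ∫ τ in s..t, ∫ y in c..d, f τ y ≤ ∫ τ in s..t, ∫ y in c₀..d₀, f τ y := by
  have hc' : c ∈ Ioo a b := ⟨hc₀.1.trans_le hc, (hcd.trans hd).trans_lt hd₀.2⟩
  have hd' : d ∈ Ioo a b := ⟨hc'.1.trans_le hcd, hd.trans_lt hd₀.2⟩
  apply intervalIntegral.integral_mono_ae_restrict hst
    (IntegrableOn.interval (integrableOn_integral_snd hc' hd' hf) hs ht)
    (IntegrableOn.interval (integrableOn_integral_snd hc₀ hd₀ hf) hs ht)
  rw [EventuallyLE, ae_restrict_iff' measurableSet_Icc]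
  filter_upwards [ae_integrableOn_snd hf] with τ g hτ
  exact intervalIntegral.integral_mono_interval hc hcd hd (Eventually.of_forall (h0 τ))
    (IntegrableOn.interval (g ⟨hs.1.trans_le hτ.1, hτ.2.trans_lt ht.2⟩) hc₀ hd₀)

namespace HeatData
variable {w wt wy wyy F : ℝ → ℝ → ℝ} {α β a b M : ℝ} (H : HeatData w wt wy wyy F α β a b M)
include H

lemma meas_excess {K : Set (ℝ × ℝ)} (hK : IsClosed K) (P Q L r : ℝ) :
    Measurable (Function.uncurry (excess K F P Q L r)) := by
  have h2 : Measurable fun p : ℝ × ℝ => F p.1 p.2 := H.meas_F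
  have h3 : Measurable fun p : ℝ × ℝ => |F p.1 p.2| := by
    simpa only [Real.norm_eq_abs] using h2.norm
  have h4 := ((h3.const_add 1).indicator
    (Metric.isClosed_cthickening (δ := 2 * r) (E := K) |>.measurableSet.diff hK.measurableSet))
  exact (h4.const_mul P).add (((h3.sub_const L).max measurable_const).const_mul Q)

lemma int_dom (P Q : ℝ) :
    IntegrableOn (Function.uncurry fun τ y => P * (1 + |F τ y|) + Q * |F τ y|)
      (Ioo α β ×ˢ Ioo a b) := by
  have h1 : IntegrableOn (fun _ : ℝ × ℝ => (1 : ℝ)) (Ioo α β ×ˢ Ioo a b) :=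
    integrableOn_const (by
      rw [Measure.volume_eq_prod, Measure.prod_prod]
      exact ENNReal.mul_ne_top (by simp) (by simp))
  exact ((h1.add H.iF.norm).const_mul P).add (H.iF.norm.const_mul Q)

lemma int_excess {K : Set (ℝ × ℝ)} (hK : IsClosed K) {P Q L : ℝ} (hP : 0 ≤ P) (hQ : 0 ≤ Q)
    (hL : 0 ≤ L) (r : ℝ) :
    IntegrableOn (Function.uncurry (excess K F P Q L r)) (Ioo α β ×ˢ Ioo a b) := by
  refine (H.int_dom P Q).mono' (H.meas_excess hK P Q L r).aestronglyMeasurable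
    (Eventually.of_forall fun p => ?_)
  rw [Real.norm_eq_abs]
  change |excess K F P Q L r p.1 p.2| ≤ _
  rw [abs_of_nonneg (excess_nonneg hP hQ _ _)]
  exact excess_le hP hQ hL _ _

lemma int_weight_excess {K : Set (ℝ × ℝ)} (hK : IsClosed K) {P Q L : ℝ} (hP : 0 ≤ P)
    (hQ : 0 ≤ Q) (hL : 0 ≤ L) (r r' m : ℝ) :
    IntegrableOn (Function.uncurry fun τ y => excess K F P Q L r τ y * weight r' m y)
      (Ioo α β ×ˢ Ioo a b) :=
  rect_mul_snd (continuous_weight r' m)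
    (fun y => by rw [abs_of_nonneg (weight_nonneg _ _ _)]; exact weight_le_one _ _ _)
    (H.int_excess hK hP hQ hL r)

lemma cell_bound {K : Set (ℝ × ℝ)} {i₁ i₂ c₀ d₀ N : ℝ}
    (B : BadBox w wy F K a b i₁ i₂ c₀ d₀ N) (hi₁ : i₁ ∈ Ioo α β) (hi₂ : i₂ ∈ Ioo α β)
    (hc₀ : c₀ ∈ Ioo a b) (hd₀ : d₀ ∈ Ioo a b) {s t r m ρ C L M₀ A : ℝ}
    (hs : i₁ ≤ s) (ht : t ≤ i₂) (hr : 0 < r) (hr1 : r ≤ 1)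
    (hrt : t - s = r ^ 2) (hρ : 0 < ρ) (hm₁ : c₀ + ρ ≤ m - r) (hm₂ : m + r ≤ d₀ - ρ)
    (hL : 0 ≤ L)
    (hCN : N ≤ C) (hCρ : M₀ + 2 * N ≤ C * ρ ^ 2)
    (hM₁ : ∀ s ∈ Icc i₁ i₂, |w s c₀| ≤ M₀) (hM₂ : ∀ s ∈ Icc i₁ i₂, |w s d₀| ≤ M₀)
    {ζ ζ' ζ'' : ℝ → ℝ} (hζ : ∀ y, HasDerivAt ζ (ζ' y) y) (hζ' : ∀ y, HasDerivAt ζ' (ζ'' y) y)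
    (hζc : Continuous ζ'') (h1 : ζ (m - r) = 0) (h2 : ζ (m + r) = 0) (h3 : ζ' (m - r) = 0)
    (h4 : ζ' (m + r) = 0) (hA : ∀ y, |ζ y| ≤ A) (hA₂ : ∀ y, |ζ'' y| ≤ A / r ^ 2) :
    |Df w F ζ ζ'' s t (m - r) (m + r)| ≤ ∫ τ in s..t, ∫ y in c₀..d₀,
      excess K F (2 * (A * (20 * N + 12 * C + 2 * L + 1))) (4 * A * Real.exp 6) L r τ y *
        weight r m y := by
  have hN := B.N0
  have hC : 0 ≤ C := hN.trans hCN
  have hA0 : 0 ≤ A := (abs_nonneg _).trans (hA 0)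
  have hr2 : 0 < r ^ 2 := by positivity
  have inI : ∀ {x}, x ∈ Icc i₁ i₂ → x ∈ Ioo α β := fun hx =>
    ⟨hi₁.1.trans_le hx.1, hx.2.trans_lt hi₂.2⟩
  have hst : s ≤ t := by linarith
  have hsI : s ∈ Icc i₁ i₂ := ⟨hs, hst.trans ht⟩
  have htI : t ∈ Icc i₁ i₂ := ⟨hs.trans hst, ht⟩
  set P := A * (20 * N + 12 * C + 2 * L + 1) with hPdef
  set Q := 4 * A * Real.exp 6 with hQdef
  have hP : 0 ≤ P := by positivity
  have hQ : 0 ≤ Q := by positivity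
  set c := m - r with hc_def
  set d := m + r with hd_def
  have hcd : c < d := by linarith
  have hcc : c₀ < c := by linarith
  have hdd : d < d₀ := by linarith
  have hc : c ∈ Ioo a b := ⟨hc₀.1.trans hcc, (hcd.trans hdd).trans hd₀.2⟩
  have hd : d ∈ Ioo a b := ⟨hc.1.trans hcd, hdd.trans hd₀.2⟩
  have cζ : Continuous ζ := continuous_iff_continuousAt.2 fun y => (hζ y).continuousAt
  have nn : ∀ τ y, 0 ≤ excess K F (2 * P) Q L r τ y * weight r m y := fun τ y =>
    mul_nonneg (excess_nonneg (by positivity) hQ _ _) (weight_nonneg _ _ _)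
  have free : ∀ τ ∈ Icc s t, (∀ x ∈ Icc s τ, ∀ y ∈ Icc c d, (x, y) ∉ K) →
      Df w F ζ ζ'' s τ c d = 0 := by
    intro τ hτ hf
    have hτI : τ ∈ Icc i₁ i₂ := ⟨hs.trans hτ.1, hτ.2.trans ht⟩
    refine H.Df_eq_zero_of_sol (inI hsI) (inI hτI) hc hd hcd ?_ hζ hζ' hζc h1 h2 h3 h4
    refine H.sol_of_local (inI hsI) (inI hτI) hc hd fun y hy => ?_
    obtain ⟨c', d', e1, e2, -, e3⟩ := B.loc s hsI τ hτI hτ.1 y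
      ⟨hcc.trans hy.1, hy.2.trans hdd⟩ fun x hx => hf x hx y ⟨hy.1.le, hy.2.le⟩
    exact ⟨c', d', e1, e2, e3⟩
  by_cases htouch : ∃ τ ∈ Icc s t, ∃ y ∈ Icc c d, (τ, y) ∈ K
  swap
  · push Not at htouch
    rw [free t ⟨hst, le_rfl⟩ htouch, abs_zero]
    exact intervalIntegral.integral_nonneg hst fun τ _ =>
      intervalIntegral.integral_nonneg (hcc.trans (hcd.trans hdd)).le fun y _ => nn τ y
  obtain ⟨σ, hσ, y₀, hy₀, hK, hfree⟩ := exists_first_touch B.closed htouch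
  have hσI : σ ∈ Icc i₁ i₂ := ⟨hs.trans hσ.1, hσ.2.trans ht⟩
  have z : Df w F ζ ζ'' s σ c d = 0 := by
    rcases hσ.1.eq_or_lt with h | h
    · subst h
      exact H.Df_eq_zero_of_sol (inI hsI) (inI hsI) hc hd hcd (sol_self _ _ _) hζ hζ' hζc
        h1 h2 h3 h4
    · have e1 := (H.Df_continuousAt (inI hsI) (inI hσI) hc hd hcd.le cζ hζc hA hA₂).mono_left
        (nhdsWithin_le_nhds (s := Iio σ))
      refine tendsto_nhds_unique e1 (tendsto_const_nhds.congr' ?_)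
      filter_upwards [Ioo_mem_nhdsLT h] with τ hτ
      exact (free τ ⟨hτ.1.le, hτ.2.le.trans hσ.2⟩ fun x hx =>
        hfree x ⟨hx.1, hx.2.trans_lt hτ.2⟩).symm
  rw [← H.Df_add (inI hsI) (inI hσI) (inI htI) hc hd cζ hζc, z, zero_add]
  refine (H.cell_bound_aux B hi₁ hi₂ hc₀ hd₀ hK ⟨hs, hσ.1⟩ hσ.2 ht hr hrt hρ hm₁ hm₂ hy₀ hL hCN
    hCρ hM₁ hM₂ hfree hζ hζ' hζc h1 h2 h3 h4 hA hA₂).trans ?_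
  have i1 := H.int_off_one_add B.closed
  have i2 := H.int_weight_pos (r := r) (m := m) hL
  have i3 : IntegrableOn (Function.uncurry fun τ y =>
      (2 * P) * (Metric.cthickening (2 * r) K \ K).indicator (fun p => 1 + |F p.1 p.2|) (τ, y) *
        weight r m y) (Ioo α β ×ˢ Ioo a b) := by
    have := H.int_weight_excess B.closed (by positivity : 0 ≤ 2 * P) le_rfl hL r r m
    simpa only [excess, zero_mul, add_zero] using this
  have e1 : P * (∫ τ in s..t, ∫ y in c..d, off K τ y * (1 + |F τ y|)) ≤
      ∫ τ in s..t, ∫ y in c₀..d₀,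
      (2 * P) * (Metric.cthickening (2 * r) K \ K).indicator (fun p => 1 + |F p.1 p.2|) (τ, y) *
        weight r m y := by
    refine le_trans ?_ (rect_integral_mono (inI hsI) (inI htI) hst hc₀ hd₀ hcc.le hcd.le hdd.le i3
      fun τ y => mul_nonneg (mul_nonneg (by positivity)
        (indicator_nonneg (fun _ _ => by positivity) _)) (weight_nonneg _ _ _))
    rw [← intervalIntegral.integral_const_mul]
    apply intervalIntegral.integral_mono_ae_restrict hst
      ((IntegrableOn.interval (integrableOn_integral_snd hc hd i1) (inI hsI) (inI htI)).const_mul P)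
      (IntegrableOn.interval (integrableOn_integral_snd hc hd i3) (inI hsI) (inI htI))
    rw [EventuallyLE, ae_restrict_iff' measurableSet_Icc]
    filter_upwards [ae_integrableOn_snd i1, ae_integrableOn_snd i3] with τ g1 g3 hτ
    have hτ' := inI (x := τ) ⟨hs.trans hτ.1, hτ.2.trans ht⟩
    rw [← intervalIntegral.integral_const_mul]
    apply intervalIntegral.integral_mono_on hcd.le
      ((IntegrableOn.interval (g1 hτ') hc hd).const_mul P)
      (IntegrableOn.interval (g3 hτ') hc hd)
    intro y hy
    by_cases hyK : (τ, y) ∈ K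
    · rw [off_of_mem hyK, indicator_of_notMem (by simp [hyK])]
      simp
    · rw [off_of_notMem hyK, indicator_of_mem]
      · have hw := half_le_weight (m := m) (y := y) hr (by
          rw [abs_le]; constructor <;> linarith [hy.1, hy.2])
        have : 0 ≤ P * (1 + |F τ y|) := by positivity
        nlinarith
      · refine ⟨Metric.mem_cthickening_of_dist_le _ (σ, y₀) _ _ hK ?_, hyK⟩
        rw [Prod.dist_eq, Real.dist_eq, Real.dist_eq]
        refine max_le (abs_le.2 ⟨?_, ?_⟩) (abs_le.2 ⟨?_, ?_⟩)
        · nlinarith [hτ.1, hτ.2, hσ.1, hσ.2]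
        · nlinarith [hτ.1, hτ.2, hσ.1, hσ.2]
        · linarith [hy.1, hy.2, hy₀.1, hy₀.2]
        · linarith [hy.1, hy.2, hy₀.1, hy₀.2]
  have e2 : 4 * A * (Real.exp 6 *
        ∫ τ in s..t, ∫ y in c₀..d₀, weight r m y * max (|F τ y| - L) 0) =
      Q * ∫ τ in s..t, ∫ y in c₀..d₀, weight r m y * max (|F τ y| - L) 0 := by
    rw [hQdef]; ring
  rw [e2]
  refine (add_le_add_left e1 _).trans (le_of_eq ?_)
  rw [← intervalIntegral.integral_const_mul, ← intervalIntegral.integral_add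
    (IntegrableOn.interval (integrableOn_integral_snd hc₀ hd₀ i3) (inI hsI) (inI htI))
    ((IntegrableOn.interval (integrableOn_integral_snd hc₀ hd₀ i2) (inI hsI) (inI htI)).const_mul Q)]
  apply intervalIntegral.integral_congr_ae
  filter_upwards [ae_integrableOn_snd i3, ae_integrableOn_snd i2] with τ g3 g2 hτ
  have hτ' := uIoc_subset_Ioo (inI hsI) (inI htI) hτ
  rw [← intervalIntegral.integral_const_mul, ← intervalIntegral.integral_add
    (IntegrableOn.interval (g3 hτ') hc₀ hd₀) ((IntegrableOn.interval (g2 hτ') hc₀ hd₀).const_mul Q)]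
  refine intervalIntegral.integral_congr fun y _ => ?_
  simp only [excess]
  ring

end HeatData

lemma testFunction_facts {φ : ℝ → ℝ} {c d : ℝ} (hφ : ContDiff ℝ ∞ φ) (hs : tsupport φ ⊆ Ioo c d) :
    (∀ y, HasDerivAt φ (deriv φ y) y) ∧ (∀ y, HasDerivAt (deriv φ) (deriv (deriv φ) y) y) ∧
    Continuous (deriv (deriv φ)) ∧
    (∃ B, 0 ≤ B ∧ ∀ y, |φ y| ≤ B ∧ |deriv φ y| ≤ B ∧ |deriv (deriv φ) y| ≤ B) ∧
    ∀ y ∉ Ioo c d, φ y = 0 ∧ deriv φ y = 0 ∧ deriv (deriv φ) y = 0 := by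
  have h1 : ContDiff ℝ ∞ (deriv φ) := by simpa using hφ.iterate_deriv 1
  have h2 : ContDiff ℝ ∞ (deriv (deriv φ)) := by simpa using hφ.iterate_deriv 2
  have s1 : tsupport (deriv φ) ⊆ tsupport φ :=
    closure_minimal support_deriv_subset (isClosed_tsupport _)
  have s2 : tsupport (deriv (deriv φ)) ⊆ tsupport φ :=
    (closure_minimal support_deriv_subset (isClosed_tsupport _)).trans s1
  have k : ∀ f : ℝ → ℝ, tsupport f ⊆ tsupport φ → HasCompactSupport f := fun f hf =>
    isCompact_Icc.of_isClosed_subset (isClosed_tsupport _)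
      ((hf.trans hs).trans Ioo_subset_Icc_self)
  obtain ⟨B0, hB0⟩ := hφ.continuous.bounded_above_of_compact_support (k _ subset_rfl)
  obtain ⟨B1, hB1⟩ := h1.continuous.bounded_above_of_compact_support (k _ s1)
  obtain ⟨B2, hB2⟩ := h2.continuous.bounded_above_of_compact_support (k _ s2)
  refine ⟨fun y => (hφ.differentiable (by simp) y).hasDerivAt,
    fun y => (h1.differentiable (by simp) y).hasDerivAt, h2.continuous,
    ⟨max B0 (max B1 B2), ?_, fun y => ⟨(hB0 y).trans (le_max_left _ _),
      (hB1 y).trans ((le_max_left _ _).trans (le_max_right _ _)),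
      (hB2 y).trans ((le_max_right _ _).trans (le_max_right _ _))⟩⟩, fun y hy => ?_⟩
  · exact (norm_nonneg _).trans ((hB0 0).trans (le_max_left _ _))
  · have z : ∀ f : ℝ → ℝ, tsupport f ⊆ tsupport φ → f y = 0 := fun f hf =>
      image_eq_zero_of_notMem_tsupport fun h => hy (hs (hf h))
    exact ⟨z _ subset_rfl, z _ s1, z _ s2⟩

/-- A smooth bump whose integer translates form a partition of unity. -/
lemma exists_partition_bump : ∃ ψ : ℝ → ℝ, ContDiff ℝ ∞ ψ ∧ tsupport ψ ⊆ Ioo 0 2 ∧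
    ∀ (n : ℕ) (x : ℝ), 1 ≤ x → x ≤ n → ∑ k ∈ Finset.range n, ψ (x - k) = 1 := by
  set S : ℝ → ℝ := fun x => Real.smoothTransition (2 * x - 1 / 2) with hS
  have cS : ContDiff ℝ ∞ S := Real.smoothTransition.contDiff.comp (by fun_prop)
  refine ⟨fun x => S x - S (x - 1), cS.sub (cS.comp (by fun_prop)), ?_, ?_⟩
  · have : tsupport (fun x => S x - S (x - 1)) ⊆ Icc (1 / 4) (7 / 4) := by
      refine closure_minimal (fun x hx => ?_) isClosed_Icc
      by_contra h
      refine hx ?_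
      simp only [mem_Icc, not_and_or, not_le] at h
      rcases h with h | h
      · simp only [hS]
        rw [Real.smoothTransition.zero_of_nonpos (by linarith),
          Real.smoothTransition.zero_of_nonpos (by linarith), sub_zero]
      · simp only [hS]
        rw [Real.smoothTransition.one_of_one_le (by linarith),
          Real.smoothTransition.one_of_one_le (by linarith), sub_self]
    exact this.trans (Icc_subset_Ioo (by norm_num) (by norm_num))
  · intro n x h1 h2
    have := Finset.sum_range_sub' (fun k : ℕ => S (x - k)) n
    simp only [Nat.cast_add, Nat.cast_one, Nat.cast_zero, sub_zero, ← sub_sub] at this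
    rw [this]
    simp only [hS]
    rw [Real.smoothTransition.one_of_one_le (by linarith),
      Real.smoothTransition.zero_of_nonpos (by linarith), sub_zero]

lemma exists_sum_lorentz_le :
    ∃ W : ℝ, 0 ≤ W ∧ ∀ (n : ℕ) (x : ℝ), ∑ k ∈ Finset.range n, (1 + (x - k) ^ 2)⁻¹ ≤ W := by
  have hs : Summable fun m : ℤ => (1 + (m : ℝ) ^ 2)⁻¹ := by
    have h1 : Summable fun m : ℤ => 1 / (m : ℝ) ^ 2 :=
      Real.summable_one_div_int_pow.2 one_lt_two
    have h2 : Summable fun m : ℤ => if m = 0 then (1 : ℝ) else 0 :=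
      (hasSum_ite_eq 0 1).summable
    refine Summable.of_nonneg_of_le (fun m => by positivity) (fun m => ?_) (h1.add h2)
    by_cases hm : m = 0
    · simp [hm]
    · have : (0 : ℝ) < (m : ℝ) ^ 2 := by positivity
      simp only [hm, if_false, add_zero, one_div]
      exact inv_anti₀ this (by linarith)
  refine ⟨3 * ∑' m : ℤ, (1 + (m : ℝ) ^ 2)⁻¹, by positivity, fun n x => ?_⟩
  have h1 : ∀ k : ℕ, (1 + (x - k) ^ 2)⁻¹ ≤ 3 * (1 + (((k : ℤ) - ⌊x⌋ : ℤ) : ℝ) ^ 2)⁻¹ := by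
    intro k
    have f0 := Int.floor_le x
    have f1 := Int.lt_floor_add_one x
    rw [← div_eq_mul_inv, le_div_iff₀ (by positivity), mul_comm, ← div_eq_mul_inv,
      div_le_iff₀ (by positivity)]
    push_cast
    nlinarith [sq_nonneg (2 * ((k : ℝ) - ⌊x⌋) - 2 * (x - ⌊x⌋)),
      sq_nonneg ((k : ℝ) - ⌊x⌋ - 2 * (x - ⌊x⌋))]
  refine (Finset.sum_le_sum fun k _ => h1 k).trans ?_
  rw [← Finset.mul_sum]
  refine mul_le_mul_of_nonneg_left ?_ (by norm_num)
  have inj : Function.Injective fun k : ℕ => ((k : ℤ) - ⌊x⌋ : ℤ) := fun i j h => by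
    simpa using h
  have := Summable.sum_le_tsum ((Finset.range n).map ⟨_, inj⟩)
    (fun (m : ℤ) _ => (by positivity : 0 ≤ (1 + (m : ℝ) ^ 2)⁻¹)) hs
  rwa [Finset.sum_map] at this

lemma Df_eq_of_support {w F : ℝ → ℝ → ℝ} {ζ ζ'' : ℝ → ℝ} {s t c d c₀ d₀ : ℝ} (hc : c₀ ≤ c)
    (hd : d ≤ d₀) (hζ : ∀ y ∉ Ioo c d, ζ y = 0) (hζ'' : ∀ y ∉ Ioo c d, ζ'' y = 0) :
    Df w F ζ ζ'' s t c₀ d₀ = Df w F ζ ζ'' s t c d := by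
  have hsup : Function.support (fun y => gf w F s t y * ζ y - Zf w s t y * ζ'' y) ⊆ Ioo c d := by
    intro y hy
    by_contra h
    exact hy (by simp [hζ y h, hζ'' y h])
  unfold Df
  rw [intervalIntegral.integral_eq_integral_of_support_subset
      (hsup.trans (Ioo_subset_Ioc_self.trans (Ioc_subset_Ioc hc hd))),
    intervalIntegral.integral_eq_integral_of_support_subset (hsup.trans Ioo_subset_Ioc_self)]

namespace HeatData
variable {w wt wy wyy F : ℝ → ℝ → ℝ} {α β a b M : ℝ} (H : HeatData w wt wy wyy F α β a b M)
include H

lemma Df_integrable {s t c d : ℝ} {ζ ζ'' : ℝ → ℝ} (hs : s ∈ Ioo α β) (ht : t ∈ Ioo α β)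
    (hc : c ∈ Ioo a b) (hd : d ∈ Ioo a b) (hζ : Continuous ζ) (hζc : Continuous ζ'') :
    IntervalIntegrable (fun y => gf w F s t y * ζ y - Zf w s t y * ζ'' y) volume c d :=
  ((IntegrableOn.interval (H.int_g hs ht) hc hd).mul_continuousOn hζ.continuousOn).sub
    (((H.Zf_continuousOn hs ht).mono (ordConnected_Ioo.uIcc_subset hc hd) |>.mul
      hζc.continuousOn).intervalIntegrable)

lemma Df_sum {s t c d : ℝ} {ζ ζ'' : ℕ → ℝ → ℝ} (hs : s ∈ Ioo α β) (ht : t ∈ Ioo α β)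
    (hc : c ∈ Ioo a b) (hd : d ∈ Ioo a b) (hζ : ∀ k, Continuous (ζ k))
    (hζc : ∀ k, Continuous (ζ'' k)) (n : ℕ) :
    Df w F (fun y => ∑ k ∈ Finset.range n, ζ k y) (fun y => ∑ k ∈ Finset.range n, ζ'' k y) s t c d =
      ∑ k ∈ Finset.range n, Df w F (ζ k) (ζ'' k) s t c d := by
  unfold Df
  rw [← intervalIntegral.integral_finsetSum fun k _ =>
    H.Df_integrable hs ht hc hd (hζ k) (hζc k)]
  refine intervalIntegral.integral_congr fun y _ => ?_
  simp only [Finset.mul_sum, Finset.sum_sub_distrib]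

/-- Defect over a parabolic time window. -/
lemma window_bound {K : Set (ℝ × ℝ)} {i₁ i₂ c₀ d₀ N : ℝ}
    (B : BadBox w wy F K a b i₁ i₂ c₀ d₀ N) (hi₁ : i₁ ∈ Ioo α β) (hi₂ : i₂ ∈ Ioo α β)
    (hc₀ : c₀ ∈ Ioo a b) (hd₀ : d₀ ∈ Ioo a b) {j₁ j₂ ρ C M₀ : ℝ} (hρ : 0 < ρ)
    (hj₁ : c₀ + 3 * ρ ≤ j₁) (hj₂ : j₂ ≤ d₀ - 3 * ρ) (hCN : N ≤ C)
    (hCρ : M₀ + 2 * N ≤ C * ρ ^ 2)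
    (hM₁ : ∀ s ∈ Icc i₁ i₂, |w s c₀| ≤ M₀) (hM₂ : ∀ s ∈ Icc i₁ i₂, |w s d₀| ≤ M₀)
    {φ : ℝ → ℝ} (hφ : ContDiff ℝ ∞ φ) (hsup : tsupport φ ⊆ Ioo j₁ j₂) :
    ∃ A W : ℝ, 0 ≤ A ∧ 0 ≤ W ∧ ∀ L, 0 ≤ L → ∀ r, 0 < r → r ≤ ρ → r ≤ 1 → ∀ s t, i₁ ≤ s → t ≤ i₂ →
      t - s = r ^ 2 → |Df w F φ (deriv (deriv φ)) s t c₀ d₀| ≤ W * ∫ τ in s..t, ∫ y in c₀..d₀,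
      excess K F (2 * (A * (20 * N + 12 * C + 2 * L + 1))) (4 * A * Real.exp 6) L r τ y := by
  obtain ⟨f1, f2, f3, ⟨b₁, hb₁, f4⟩, f5⟩ := testFunction_facts hφ hsup
  obtain ⟨ψ, hψ, hψs, hψ1⟩ := exists_partition_bump
  obtain ⟨g1, g2, g3, ⟨b₂, hb₂, g4⟩, g5⟩ := testFunction_facts hψ hψs
  obtain ⟨W, hW, hWs⟩ := exists_sum_lorentz_le
  have cφ := hφ.continuous
  have cψ := hψ.continuous
  have cφ' : Continuous (deriv φ) := continuous_iff_continuousAt.2 fun y => (f2 y).continuousAt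
  have cψ' : Continuous (deriv ψ) := continuous_iff_continuousAt.2 fun y => (g2 y).continuousAt
  have hbb : 0 ≤ b₁ * b₂ := mul_nonneg hb₁ hb₂
  refine ⟨4 * (b₁ * b₂), W, by positivity, hW, fun L hL r hr hrρ hr1 s t hs ht hrt => ?_⟩
  have hN := B.N0
  have hC : 0 ≤ C := hN.trans hCN
  have hr2 : 0 < r ^ 2 := by positivity
  have inI : ∀ {x}, x ∈ Icc i₁ i₂ → x ∈ Ioo α β := fun hx =>
    ⟨hi₁.1.trans_le hx.1, hx.2.trans_lt hi₂.2⟩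
  have hst : s ≤ t := by linarith
  have hsI : s ∈ Icc i₁ i₂ := ⟨hs, hst.trans ht⟩
  have htI : t ∈ Icc i₁ i₂ := ⟨hs.trans hst, ht⟩
  set A := 4 * (b₁ * b₂) with hAdef
  have hA0 : 0 ≤ A := by positivity
  set P := 2 * (A * (20 * N + 12 * C + 2 * L + 1)) with hPdef
  set Q := 4 * A * Real.exp 6 with hQdef
  have hP : 0 ≤ P := by positivity
  have hQ : 0 ≤ Q := by positivity
  set n := ⌈1 / r⌉₊ with hn
  set X : ℕ → ℝ → ℝ := fun k y => (y - c₀) / r - k with hX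
  have hXd : ∀ k y, HasDerivAt (X k) (1 / r) y := fun k y =>
    (((hasDerivAt_id y).sub_const c₀).div_const r).sub_const _
  have cX : ∀ k, Continuous (X k) := fun k =>
    continuous_iff_continuousAt.2 fun y => (hXd k y).continuousAt
  set ζ : ℕ → ℝ → ℝ := fun k y => φ y * ψ (X k y) with hζdef
  set ζ' : ℕ → ℝ → ℝ := fun k y => deriv φ y * ψ (X k y) + φ y * (deriv ψ (X k y) * (1 / r))
    with hζ'def
  set ζ'' : ℕ → ℝ → ℝ := fun k y => (deriv (deriv φ) y * ψ (X k y) +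
    deriv φ y * (deriv ψ (X k y) * (1 / r))) + (deriv φ y * (deriv ψ (X k y) * (1 / r)) +
    φ y * (deriv (deriv ψ) (X k y) * (1 / r) * (1 / r))) with hζ''def
  have hψX : ∀ k y, HasDerivAt (fun y => ψ (X k y)) (deriv ψ (X k y) * (1 / r)) y := fun k y =>
    (g1 _).comp y (hXd k y)
  have hψX' : ∀ k y, HasDerivAt (fun y => deriv ψ (X k y) * (1 / r))
      (deriv (deriv ψ) (X k y) * (1 / r) * (1 / r)) y := fun k y =>
    ((g2 _).comp y (hXd k y)).mul_const _
  have hζ : ∀ k y, HasDerivAt (ζ k) (ζ' k y) y := fun k y => (f1 y).mul (hψX k y)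
  have hζ' : ∀ k y, HasDerivAt (ζ' k) (ζ'' k y) y := fun k y =>
    ((f2 y).mul (hψX k y)).add ((f1 y).mul (hψX' k y))
  have cζ : ∀ k, Continuous (ζ k) := fun k => by
    have := cX k
    simp only [hζdef]; fun_prop
  have cζ'' : ∀ k, Continuous (ζ'' k) := fun k => by
    have := cX k
    simp only [hζ''def]; fun_prop
  have hn1 : 1 / r ≤ n := Nat.le_ceil _
  have hsum : φ = fun y => ∑ k ∈ Finset.range n, ζ k y := by
    ext y
    simp only [hζdef, ← Finset.mul_sum]
    by_cases hy : y ∈ Ioo j₁ j₂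
    · rw [hψ1 n ((y - c₀) / r), mul_one]
      · rw [le_div_iff₀ hr]; linarith [hy.1]
      · refine le_trans ?_ hn1
        have := B.hlen
        exact div_le_div_of_nonneg_right (by linarith [hy.2]) hr.le
    · rw [(f5 y hy).1, zero_mul]
  have hsum' : deriv φ = fun y => ∑ k ∈ Finset.range n, ζ' k y := by
    ext y
    have := HasDerivAt.fun_sum (u := Finset.range n) fun k _ => hζ k y
    rw [← hsum] at this
    exact this.deriv
  have hsum'' : deriv (deriv φ) = fun y => ∑ k ∈ Finset.range n, ζ'' k y := by
    ext y
    have := HasDerivAt.fun_sum (u := Finset.range n) fun k _ => hζ' k y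
    rw [← hsum'] at this
    exact this.deriv
  have hr' : 0 < 1 / r := by positivity
  have hr1' : 1 ≤ 1 / r := by rw [le_div_iff₀ hr]; linarith
  have bA : ∀ k y, |ζ k y| ≤ A := by
    intro k y
    simp only [hζdef]
    rw [abs_mul]
    refine (mul_le_mul (f4 y).1 (g4 _).1 (abs_nonneg _) hb₁).trans ?_
    rw [hAdef]; linarith
  have bA'' : ∀ k y, |ζ'' k y| ≤ A / r ^ 2 := by
    intro k y
    obtain ⟨p0, p1, p2⟩ := f4 y
    obtain ⟨q0, q1, q2⟩ := g4 (X k y)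
    have e0 : |deriv (deriv φ) y * ψ (X k y)| ≤ b₁ * b₂ * (1 / r) ^ 2 := by
      rw [abs_mul]
      refine (mul_le_mul p2 q0 (abs_nonneg _) hb₁).trans (le_mul_of_one_le_right hbb ?_)
      exact one_le_pow₀ hr1'
    have e1 : |deriv φ y * (deriv ψ (X k y) * (1 / r))| ≤ b₁ * b₂ * (1 / r) ^ 2 := by
      rw [← mul_assoc, abs_mul, abs_mul, abs_of_pos hr']
      refine (mul_le_mul_of_nonneg_right (mul_le_mul p1 q1 (abs_nonneg _) hb₁) hr'.le).trans ?_
      refine mul_le_mul_of_nonneg_left ?_ hbb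
      nlinarith
    have e2 : |φ y * (deriv (deriv ψ) (X k y) * (1 / r) * (1 / r))| ≤ b₁ * b₂ * (1 / r) ^ 2 := by
      rw [mul_assoc, ← mul_assoc, abs_mul, abs_mul, abs_of_pos (mul_pos hr' hr'), ← pow_two]
      exact mul_le_mul_of_nonneg_right (mul_le_mul p0 q2 (abs_nonneg _) hb₁) (by positivity)
    have e3 : A / r ^ 2 = (b₁ * b₂ * (1 / r) ^ 2 + b₁ * b₂ * (1 / r) ^ 2) +
        (b₁ * b₂ * (1 / r) ^ 2 + b₁ * b₂ * (1 / r) ^ 2) := by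
      rw [hAdef]; field_simp; ring
    rw [e3]
    exact (abs_add_le _ _).trans (add_le_add ((abs_add_le _ _).trans (add_le_add e0 e1))
      ((abs_add_le _ _).trans (add_le_add e1 e2)))
  have i1 := fun k : ℕ => H.int_weight_excess (a := a) B.closed hP hQ hL r r (c₀ + (k + 1) * r)
  have cell : ∀ k : ℕ, |Df w F (ζ k) (ζ'' k) s t c₀ d₀| ≤ ∫ τ in s..t, ∫ y in c₀..d₀,
      excess K F P Q L r τ y * weight r (c₀ + (k + 1) * r) y := by
    intro k
    set m := c₀ + (k + 1) * r with hm
    have hout : ∀ y ∉ Ioo (m - r) (m + r), X k y ∉ Ioo 0 2 := by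
      intro y hy h
      simp only [hX] at h
      refine hy ⟨?_, ?_⟩
      · have := (lt_div_iff₀ hr).1 (sub_pos.1 h.1)
        rw [hm]; linarith
      · have := (div_lt_iff₀ hr).1 (sub_lt_iff_lt_add.1 h.2)
        rw [hm]; linarith
    have hz : ∀ y ∉ Ioo (m - r) (m + r), ζ k y = 0 ∧ ζ' k y = 0 ∧ ζ'' k y = 0 := by
      intro y hy
      obtain ⟨q0, q1, q2⟩ := g5 _ (hout y hy)
      simp [hζdef, hζ'def, hζ''def, q0, q1, q2]
    by_cases hk : c₀ + ρ ≤ m - r ∧ m + r ≤ d₀ - ρ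
    · rw [Df_eq_of_support (c := m - r) (d := m + r) (by linarith) (by linarith)
        (fun y hy => (hz y hy).1) (fun y hy => (hz y hy).2.2)]
      obtain ⟨z1, z2, -⟩ := hz (m - r) (by simp)
      obtain ⟨z3, z4, -⟩ := hz (m + r) (by simp)
      exact H.cell_bound B hi₁ hi₂ hc₀ hd₀ hs ht hr hr1 hrt hρ hk.1 hk.2 hL hCN hCρ hM₁ hM₂
        (hζ k) (hζ' k) (cζ'' k) z1 z3 z2 z4 (bA k) (bA'' k)
    · have hz0 : ∀ y, ζ k y = 0 ∧ ζ'' k y = 0 := by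
        intro y
        by_cases hy : y ∈ Ioo j₁ j₂
        · have := hz y fun h => hk ⟨by linarith [hy.1, h.2], by linarith [hy.2, h.1]⟩
          exact ⟨this.1, this.2.2⟩
        · obtain ⟨q0, q1, q2⟩ := f5 _ hy
          simp [hζdef, hζ''def, q0, q1, q2]
      have : Df w F (ζ k) (ζ'' k) s t c₀ d₀ = 0 := by
        simp [Df, fun y => (hz0 y).1, fun y => (hz0 y).2]
      rw [this, abs_zero]
      exact intervalIntegral.integral_nonneg hst fun τ _ => intervalIntegral.integral_nonneg
        B.hcd.le fun y _ => mul_nonneg (excess_nonneg hP hQ _ _) (weight_nonneg _ _ _)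
  have e0 : Df w F φ (deriv (deriv φ)) s t c₀ d₀ =
      ∑ k ∈ Finset.range n, Df w F (ζ k) (ζ'' k) s t c₀ d₀ := by
    rw [← H.Df_sum (inI hsI) (inI htI) hc₀ hd₀ cζ cζ'', ← hsum, ← hsum'']
  have i2 := H.int_excess (a := a) B.closed hP hQ hL r
  rw [e0]
  refine (Finset.abs_sum_le_sum_abs _ _).trans ((Finset.sum_le_sum fun k _ => cell k).trans ?_)
  have j1 := fun k => integrableOn_integral_snd hc₀ hd₀ (i1 k)
  rw [← intervalIntegral.integral_finsetSum fun k _ =>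
    IntegrableOn.interval (j1 k) (inI hsI) (inI htI), ← intervalIntegral.integral_const_mul]
  have k1 := IntervalIntegrable.sum (Finset.range n) fun k _ =>
    IntegrableOn.interval (j1 k) (inI hsI) (inI htI)
  rw [Finset.sum_fn] at k1
  apply intervalIntegral.integral_mono_ae_restrict hst k1
    ((IntegrableOn.interval (integrableOn_integral_snd hc₀ hd₀ i2) (inI hsI) (inI htI)).const_mul W)
  rw [EventuallyLE, ae_restrict_iff' measurableSet_Icc]
  filter_upwards [ae_all_iff.2 fun k => ae_integrableOn_snd (i1 k), ae_integrableOn_snd i2]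
    with τ h1 h2 hτ
  have hτ' := inI (x := τ) ⟨hs.trans hτ.1, hτ.2.trans ht⟩
  rw [← intervalIntegral.integral_const_mul, ← intervalIntegral.integral_finsetSum fun k _ =>
    IntegrableOn.interval (h1 k hτ') hc₀ hd₀]
  have k2 := IntervalIntegrable.sum (Finset.range n) fun k _ =>
    IntegrableOn.interval (h1 k hτ') hc₀ hd₀
  rw [Finset.sum_fn] at k2
  apply intervalIntegral.integral_mono_on B.hcd.le k2
    ((IntegrableOn.interval (h2 hτ') hc₀ hd₀).const_mul W)
  intro y _
  rw [← Finset.mul_sum, mul_comm]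
  refine mul_le_mul_of_nonneg_right (le_trans (le_of_eq ?_) (hWs n ((y - c₀) / r - 1)))
    (excess_nonneg hP hQ _ _)
  refine Finset.sum_congr rfl fun k _ => ?_
  unfold weight
  have : (y - (c₀ + (k + 1) * r)) / r = (y - c₀) / r - 1 - k := by field_simp; ring
  rw [this]

end HeatData

lemma rect_integral_eq {f : ℝ → ℝ → ℝ} {α β a b s t c d : ℝ} (hs : s ∈ Ioo α β) (ht : t ∈ Ioo α β)
    (hc : c ∈ Ioo a b) (hd : d ∈ Ioo a b) (hst : s ≤ t) (hcd : c ≤ d)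
    (hf : IntegrableOn (Function.uncurry f) (Ioo α β ×ˢ Ioo a b)) :
    ∫ τ in s..t, ∫ y in c..d, f τ y = ∫ p in Ioc s t ×ˢ Ioc c d, f p.1 p.2 := by
  have hsub : Ioc s t ×ˢ Ioc c d ⊆ Ioo α β ×ˢ Ioo a b :=
    prod_mono (fun x hx => ⟨hs.1.trans hx.1, hx.2.trans_lt ht.2⟩)
      (fun x hx => ⟨hc.1.trans hx.1, hx.2.trans_lt hd.2⟩)
  rw [intervalIntegral.integral_of_le hst]
  simp only [intervalIntegral.integral_of_le hcd]
  have h := hf.mono_set hsub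
  rw [Measure.volume_eq_prod] at h ⊢
  exact (setIntegral_prod _ h).symm

lemma rect_tendsto {f : ℕ → ℝ → ℝ → ℝ} {g G : ℝ → ℝ → ℝ} {α β a b s t c d : ℝ}
    (hs : s ∈ Ioo α β) (ht : t ∈ Ioo α β)
    (hc : c ∈ Ioo a b) (hd : d ∈ Ioo a b) (hst : s ≤ t) (hcd : c ≤ d)
    (hf : ∀ n, IntegrableOn (Function.uncurry (f n)) (Ioo α β ×ˢ Ioo a b))
    (hg : IntegrableOn (Function.uncurry g) (Ioo α β ×ˢ Ioo a b))
    (hG : IntegrableOn (Function.uncurry G) (Ioo α β ×ˢ Ioo a b))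
    (hb : ∀ n τ y, |f n τ y| ≤ G τ y) (hl : ∀ τ y, Tendsto (fun n => f n τ y) atTop (𝓝 (g τ y))) :
    Tendsto (fun n => ∫ τ in s..t, ∫ y in c..d, f n τ y) atTop
      (𝓝 (∫ τ in s..t, ∫ y in c..d, g τ y)) := by
  have hsub : Ioc s t ×ˢ Ioc c d ⊆ Ioo α β ×ˢ Ioo a b :=
    prod_mono (fun x hx => ⟨hs.1.trans hx.1, hx.2.trans_lt ht.2⟩)
      (fun x hx => ⟨hc.1.trans hx.1, hx.2.trans_lt hd.2⟩)
  rw [rect_integral_eq hs ht hc hd hst hcd hg]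
  simp only [rect_integral_eq hs ht hc hd hst hcd (hf _)]
  exact tendsto_integral_of_dominated_convergence (fun p => G p.1 p.2)
    (fun n => ((hf n).mono_set hsub).aestronglyMeasurable) (hG.mono_set hsub)
    (fun n => Eventually.of_forall fun p => hb n p.1 p.2)
    (Eventually.of_forall fun p => hl p.1 p.2)

lemma excess_zero (K : Set (ℝ × ℝ)) (F : ℝ → ℝ → ℝ) (Q L r : ℝ) :
    excess K F 0 Q L r = fun τ y => Q * max (|F τ y| - L) 0 := by
  ext τ y
  rw [excess, zero_mul, zero_add]

lemma tendsto_excess {K : Set (ℝ × ℝ)} (hK : IsClosed K) {F : ℝ → ℝ → ℝ} {P Q L : ℝ}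
    {r : ℕ → ℝ} (hr : Tendsto r atTop (𝓝 0)) (τ y : ℝ) :
    Tendsto (fun n => excess K F P Q L (r n) τ y) atTop (𝓝 (Q * max (|F τ y| - L) 0)) := by
  refine tendsto_const_nhds.congr' ?_
  have : ∀ᶠ n in atTop, (τ, y) ∉ Metric.cthickening (2 * r n) K \ K := by
    by_cases h : (τ, y) ∈ K
    · exact Eventually.of_forall fun n h' => h'.2 h
    · have h' := h
      rw [← hK.closure_eq, Metric.closure_eq_iInter_cthickening] at h'
      simp only [mem_iInter, not_forall] at h'
      obtain ⟨δ, hδ, h'⟩ := h'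
      have hr2 : Tendsto (fun n => 2 * r n) atTop (𝓝 0) := by simpa using hr.const_mul 2
      filter_upwards [hr2.eventually_lt_const hδ] with n hn h3
      exact h' (Metric.cthickening_mono hn.le _ h3.1)
  filter_upwards [this] with n hn
  rw [excess, indicator_of_notMem hn, mul_zero, zero_add]

namespace HeatData
variable {w wt wy wyy F : ℝ → ℝ → ℝ} {α β a b M : ℝ} (H : HeatData w wt wy wyy F α β a b M)
include H

lemma Df_eq_zero_of_badBox {K : Set (ℝ × ℝ)} {i₁ i₂ c₀ d₀ N : ℝ}
    (B : BadBox w wy F K a b i₁ i₂ c₀ d₀ N) (hi₁ : i₁ ∈ Ioo α β) (hi₂ : i₂ ∈ Ioo α β)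
    (hc₀ : c₀ ∈ Ioo a b) (hd₀ : d₀ ∈ Ioo a b) {j₁ j₂ : ℝ}
    (hj₁ : c₀ < j₁) (hj₂ : j₂ < d₀)
    {φ : ℝ → ℝ} (hφ : ContDiff ℝ ∞ φ) (hsup : tsupport φ ⊆ Ioo j₁ j₂) {s t : ℝ} (hs : i₁ ≤ s)
    (ht : t ≤ i₂) (hst : s < t) : Df w F φ (deriv (deriv φ)) s t c₀ d₀ = 0 := by
  have inI : ∀ {x}, x ∈ Icc i₁ i₂ → x ∈ Ioo α β := fun hx =>
    ⟨hi₁.1.trans_le hx.1, hx.2.trans_lt hi₂.2⟩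
  have hsI : s ∈ Icc i₁ i₂ := ⟨hs, hst.le.trans ht⟩
  have htI : t ∈ Icc i₁ i₂ := ⟨hs.trans hst.le, ht⟩
  obtain ⟨M₁, hM₁⟩ := isCompact_Icc.exists_bound_of_continuousOn (s := Icc i₁ i₂)
    (H.cont_t c₀).continuousOn
  obtain ⟨M₂, hM₂⟩ := isCompact_Icc.exists_bound_of_continuousOn (s := Icc i₁ i₂)
    (H.cont_t d₀).continuousOn
  set ρ := min ((j₁ - c₀) / 3) ((d₀ - j₂) / 3) with hρdef
  have hρ : 0 < ρ := lt_min (by linarith) (by linarith)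
  have hρ1 : ρ ≤ (j₁ - c₀) / 3 := min_le_left _ _
  have hρ2 : ρ ≤ (d₀ - j₂) / 3 := min_le_right _ _
  set M₀ := max M₁ M₂
  set C := max N ((M₀ + 2 * N) / ρ ^ 2)
  have hCρ : M₀ + 2 * N ≤ C * ρ ^ 2 := by
    rw [← div_le_iff₀ (by positivity)]; exact le_max_right _ _
  have hN := B.N0
  have hC : 0 ≤ C := hN.trans (le_max_left _ _)
  obtain ⟨A, W, hA, hW, hwin⟩ := H.window_bound B hi₁ hi₂ hc₀ hd₀ hρ (by linarith) (by linarith)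
    (le_max_left _ _) hCρ (fun s hs => (hM₁ s hs).trans (le_max_left _ _))
    (fun s hs => (hM₂ s hs).trans (le_max_right _ _)) hφ hsup
  obtain ⟨-, -, f3, -, -⟩ := testFunction_facts hφ hsup
  set Q := 4 * A * Real.exp 6 with hQdef
  have hQ : 0 ≤ Q := by positivity
  have bound : ∀ L, 0 ≤ L → ∀ r, 0 < r → r ≤ ρ → r ≤ 1 → ∀ k : ℕ, s + k * r ^ 2 ≤ i₂ →
      |Df w F φ (deriv (deriv φ)) s (s + k * r ^ 2) c₀ d₀| ≤ W * ∫ τ in s..(s + k * r ^ 2),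
      ∫ y in c₀..d₀, excess K F (2 * (A * (20 * N + 12 * C + 2 * L + 1))) Q L r τ y := by
    intro L hL r hr hrρ hr1 k
    have hr2 : 0 < r ^ 2 := by positivity
    have j := integrableOn_integral_snd hc₀ hd₀ (H.int_excess (a := a) B.closed
      (by positivity : 0 ≤ 2 * (A * (20 * N + 12 * C + 2 * L + 1))) hQ hL r)
    induction k with
    | zero =>
      intro _
      simp [H.Df_eq_zero_of_sol (inI hsI) (inI hsI) hc₀ hd₀ B.hcd (sol_self _ _ _)
        (testFunction_facts hφ hsup).1 (testFunction_facts hφ hsup).2.1 f3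
        ((testFunction_facts hφ hsup).2.2.2.2 c₀ fun h => by linarith [h.1]).1
        ((testFunction_facts hφ hsup).2.2.2.2 d₀ fun h => by linarith [h.2]).1
        ((testFunction_facts hφ hsup).2.2.2.2 c₀ fun h => by linarith [h.1]).2.1
        ((testFunction_facts hφ hsup).2.2.2.2 d₀ fun h => by linarith [h.2]).2.1]
    | succ k ih =>
      intro hk
      have hk0 : (0 : ℝ) ≤ k * r ^ 2 := by positivity
      push_cast at hk ⊢
      have hx : s + k * r ^ 2 ∈ Icc i₁ i₂ := ⟨by linarith, by nlinarith⟩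
      have hx' : s + (k + 1) * r ^ 2 ∈ Icc i₁ i₂ := ⟨by nlinarith, hk⟩
      rw [← H.Df_add (inI hsI) (inI hx) (inI hx') hc₀ hd₀ hφ.continuous f3,
        ← intervalIntegral.integral_add_adjacent_intervals
        (IntegrableOn.interval j (inI hsI) (inI hx)) (IntegrableOn.interval j (inI hx) (inI hx')),
        mul_add]
      exact (abs_add_le _ _).trans (add_le_add (ih hx.2)
        (hwin L hL r hr hrρ hr1 _ _ hx.1 hx'.2 (by ring)))
  have hpos : 0 < t - s := sub_pos.2 hst
  set r : ℕ → ℝ := fun n => Real.sqrt ((t - s) / (n + 1)) with hrdef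
  have hr0 : ∀ n, 0 < r n := fun n => Real.sqrt_pos.2 (by positivity)
  have hrlim : Tendsto r atTop (𝓝 0) := by
    have := (tendsto_one_div_add_atTop_nhds_zero_nat (𝕜 := ℝ)).const_mul (t - s)
    rw [mul_zero] at this
    have := this.sqrt
    rw [Real.sqrt_zero] at this
    exact this.congr fun n => by rw [mul_one_div]
  have step : ∀ L, 0 ≤ L → |Df w F φ (deriv (deriv φ)) s t c₀ d₀| ≤
      W * ∫ τ in s..t, ∫ y in c₀..d₀, Q * max (|F τ y| - L) 0 := by
    intro L hL
    set P := 2 * (A * (20 * N + 12 * C + 2 * L + 1)) with hPdef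
    have hP : 0 ≤ P := by positivity
    have i0 := H.int_excess (K := K) (a := a) B.closed (by rfl : (0 : ℝ) ≤ 0) hQ hL 0
    rw [excess_zero] at i0
    have lim := (rect_tendsto (inI hsI) (inI htI) hc₀ hd₀ hst.le B.hcd.le
      (fun n => H.int_excess (a := a) B.closed hP hQ hL (r n)) i0 (H.int_dom P Q)
      (fun n τ y => by
        rw [abs_of_nonneg (excess_nonneg hP hQ _ _)]; exact excess_le hP hQ hL _ _)
      (fun τ y => tendsto_excess B.closed hrlim τ y)).const_mul W
    refine ge_of_tendsto lim ?_
    filter_upwards [hrlim.eventually_lt_const hρ, hrlim.eventually_lt_const one_pos] with n h1 h2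
    have e : s + ((n + 1 : ℕ) : ℝ) * r n ^ 2 = t := by
      rw [hrdef]
      simp only
      rw [Real.sq_sqrt (by positivity)]
      push_cast
      field_simp
      ring
    have := bound L hL (r n) (hr0 n) h1.le h2.le (n + 1) (by rw [e]; exact ht)
    rwa [e] at this
  have i0 : ∀ n : ℕ, IntegrableOn (Function.uncurry fun τ y => Q * max (|F τ y| - n) 0)
      (Ioo α β ×ˢ Ioo a b) := fun n => by
    have i0 := H.int_excess (K := K) (a := a) B.closed (by rfl : (0 : ℝ) ≤ 0) hQ
      (Nat.cast_nonneg n) 0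
    rwa [excess_zero] at i0
  have iz : IntegrableOn (Function.uncurry fun _ _ : ℝ => (0 : ℝ)) (Ioo α β ×ˢ Ioo a b) :=
    integrableOn_zero
  have lim := (rect_tendsto (inI hsI) (inI htI) hc₀ hd₀ hst.le B.hcd.le i0 iz (H.int_dom 0 Q)
    (fun n τ y => by
      have h0 := abs_nonneg (F τ y)
      have hn : (0 : ℝ) ≤ n := Nat.cast_nonneg n
      rw [abs_of_nonneg (mul_nonneg hQ (le_max_right _ _)), zero_mul, zero_add]
      exact mul_le_mul_of_nonneg_left (max_le (by linarith) h0) hQ)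
    (fun τ y => by
      refine tendsto_const_nhds.congr' ?_
      filter_upwards [eventually_ge_atTop ⌈|F τ y|⌉₊] with n hn
      have : |F τ y| ≤ n := (Nat.le_ceil _).trans (by exact_mod_cast hn)
      rw [max_eq_right (by linarith), mul_zero])).const_mul W
  simp only [intervalIntegral.integral_zero, mul_zero] at lim
  have := ge_of_tendsto lim (Eventually.of_forall fun n : ℕ => step n (Nat.cast_nonneg n))
  exact abs_eq_zero.1 (le_antisymm this (abs_nonneg _))

/-- The integrated equation holds inside a box with controlled singular set. -/
lemma sol_of_badBox {K : Set (ℝ × ℝ)} {i₁ i₂ c₀ d₀ N : ℝ}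
    (B : BadBox w wy F K a b i₁ i₂ c₀ d₀ N) (hi₁ : i₁ ∈ Ioo α β) (hi₂ : i₂ ∈ Ioo α β)
    (hc₀ : c₀ ∈ Ioo a b) (hd₀ : d₀ ∈ Ioo a b) {j₁ j₂ : ℝ}
    (hj₁ : c₀ < j₁) (hj : j₁ < j₂) (hj₂ : j₂ < d₀) {s t : ℝ} (hs : s ∈ Icc i₁ i₂)
    (ht : t ∈ Icc i₁ i₂) : Sol w F s t j₁ j₂ := by
  have inI : ∀ {x}, x ∈ Icc i₁ i₂ → x ∈ Ioo α β := fun hx =>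
    ⟨hi₁.1.trans_le hx.1, hx.2.trans_lt hi₂.2⟩
  have hj₁' : j₁ ∈ Ioo a b := ⟨hc₀.1.trans hj₁, (hj.trans hj₂).trans hd₀.2⟩
  have hj₂' : j₂ ∈ Ioo a b := ⟨hj₁'.1.trans hj, hj₂.trans hd₀.2⟩
  have main : ∀ {s t}, s ∈ Icc i₁ i₂ → t ∈ Icc i₁ i₂ → s < t → Sol w F s t j₁ j₂ := by
    intro s t hs ht hst
    refine H.sol_of_Df (inI hs) (inI ht) hj₁' hj₂' hj fun φ hφ hsup => ?_
    have f5 := (testFunction_facts hφ hsup).2.2.2.2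
    rw [← Df_eq_of_support hj₁.le hj₂.le (fun y hy => (f5 y hy).1) (fun y hy => (f5 y hy).2.2)]
    exact H.Df_eq_zero_of_badBox B hi₁ hi₂ hc₀ hd₀ hj₁ hj₂ hφ hsup hs.1 ht.2 hst
  rcases lt_trichotomy s t with h | h | h
  · exact main hs ht h
  · rw [h]; exact sol_self _ _ _
  · exact sol_symm (main ht hs h)

end HeatData

/-- Points at which `w` has derivative bounds in both variables with constant `N`, at scale
`1 / N`. -/
def quantSet (w : ℝ → ℝ → ℝ) (N : ℝ) : Set (ℝ × ℝ) :=
  {p | |w p.1 p.2| ≤ N ∧ (∀ τ', |τ' - p.1| < 1 / N → |w τ' p.2 - w p.1 p.2| ≤ N * |τ' - p.1|) ∧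
    ∃ q, |q| ≤ N ∧ ∀ y', |y' - p.2| < 1 / N →
      |w p.1 y' - w p.1 p.2 - q * (y' - p.2)| ≤ N * (y' - p.2) ^ 2}

lemma isClosed_quantSet {w : ℝ → ℝ → ℝ} (h1 : ∀ y, Continuous fun t => w t y)
    (h2 : ∀ t, Continuous (w t)) {N : ℝ} (hN : 0 < N) : IsClosed (quantSet w N) := by
  refine IsSeqClosed.isClosed fun z p hz hp => ?_
  obtain ⟨τ, y⟩ := p
  have hτ : Tendsto (fun n => (z n).1) atTop (𝓝 τ) := (continuous_fst.tendsto _).comp hp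
  have hy : Tendsto (fun n => (z n).2) atTop (𝓝 y) := (continuous_snd.tendsto _).comp hp
  have hN' : 0 < 1 / N := by positivity
  have hτ0 : Tendsto (fun n => τ - (z n).1) atTop (𝓝 0) := by
    simpa using hτ.const_sub τ
  have key : Tendsto (fun n => w (z n).1 (z n).2) atTop (𝓝 (w τ y)) := by
    have e1 : Tendsto (fun n => w τ (z n).2) atTop (𝓝 (w τ y)) := ((h2 τ).tendsto y).comp hy
    have e2 : Tendsto (fun n => w τ (z n).2 - w (z n).1 (z n).2) atTop (𝓝 0) := by
      have e3 : Tendsto (fun n => N * |τ - (z n).1|) atTop (𝓝 0) := by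
        simpa using hτ0.abs.const_mul N
      refine squeeze_zero_norm' ?_ e3
      have := hτ0.abs.eventually_lt_const (u := 1 / N) (by simpa using hN')
      filter_upwards [this] with n hn
      exact (hz n).2.1 τ hn
    simpa using e1.sub e2
  refine ⟨le_of_tendsto key.abs (Eventually.of_forall fun n => (hz n).1), ?_, ?_⟩
  · intro τ' hτ'
    have e1 : Tendsto (fun n => w τ' (z n).2) atTop (𝓝 (w τ' y)) := ((h2 τ').tendsto y).comp hy
    have e2 : Tendsto (fun n => |τ' - (z n).1|) atTop (𝓝 |τ' - τ|) := (hτ.const_sub τ').abs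
    refine le_of_tendsto_of_tendsto (e1.sub key).abs (e2.const_mul N) ?_
    filter_upwards [e2.eventually_lt_const hτ'] with n hn
    exact (hz n).2.1 τ' hn
  · choose q hq hq' using fun n => (hz n).2.2
    obtain ⟨q₀, hq₀, θ, hθ, hlim⟩ := (isCompact_Icc (a := -N) (b := N)).tendsto_subseq
      (x := q) fun n => abs_le.1 (hq n)
    refine ⟨q₀, abs_le.2 hq₀, fun y' hy' => ?_⟩
    have e1 : Tendsto (fun n => w (z (θ n)).1 y') atTop (𝓝 (w τ y')) :=
      ((h1 y').tendsto τ).comp (hτ.comp hθ.tendsto_atTop)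
    have e2 : Tendsto (fun n => y' - (z (θ n)).2) atTop (𝓝 (y' - y)) :=
      (hy.comp hθ.tendsto_atTop).const_sub y'
    refine le_of_tendsto_of_tendsto ((e1.sub (key.comp hθ.tendsto_atTop)).sub
      (hlim.mul e2)).abs ((e2.pow 2).const_mul N) ?_
    filter_upwards [e2.abs.eventually_lt_const hy'] with n hn
    exact hq' (θ n) y' hn

lemma eq_of_quadratic_approx {f : ℝ → ℝ} {f' q y N δ : ℝ} (hδ : 0 < δ) (hN : 0 ≤ N)
    (hf : HasDerivAt f f' y)
    (h : ∀ y', |y' - y| < δ → |f y' - f y - q * (y' - y)| ≤ N * (y' - y) ^ 2) : q = f' := by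
  have hg : HasDerivAt (fun x => f x - q * (x - y)) (f' - q) y := by
    have := hf.sub (((hasDerivAt_id y).sub_const y).const_mul q)
    rwa [mul_one] at this
  have key : ∀ ε, 0 < ε → ε < δ → |f' - q| ≤ N * ε := by
    intro ε h0 h1
    refine abs_deriv_le_of_lipschitz_at (i₁ := y - ε) (i₂ := y + ε) (by linarith)
      ⟨by linarith, by linarith⟩ hg fun y' hy' => ?_
    have hε : |y' - y| ≤ ε := abs_le.2 ⟨by linarith [hy'.1], by linarith [hy'.2]⟩
    have e := h y' (hε.trans_lt h1)
    have e2 : f y' - q * (y' - y) - (f y - q * (y - y)) = f y' - f y - q * (y' - y) := by ring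
    rw [e2]
    refine e.trans ?_
    rw [mul_assoc, ← sq_abs, pow_two]
    exact mul_le_mul_of_nonneg_left (mul_le_mul_of_nonneg_right hε (abs_nonneg _)) hN
  have lim : Tendsto (fun ε => N * ε) (𝓝[>] 0) (𝓝 0) := by
    have : Tendsto (fun ε => N * ε) (𝓝 0) (𝓝 (N * 0)) := (continuous_const.mul continuous_id).tendsto 0
    rw [mul_zero] at this
    exact this.mono_left nhdsWithin_le_nhds
  have : |f' - q| ≤ 0 := by
    refine ge_of_tendsto lim ?_
    filter_upwards [Ioo_mem_nhdsGT hδ] with ε hε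
    exact key ε hε.1 hε.2
  linarith [abs_nonpos_iff.1 this]

lemma exists_quadratic_approx {f f' : ℝ → ℝ} {f'' y : ℝ} (hf : ∀ x, HasDerivAt f (f' x) x)
    (hf' : HasDerivAt f' f'' y) : ∃ C, 0 ≤ C ∧ ∃ δ, 0 < δ ∧ ∀ y', |y' - y| < δ →
      |f y' - f y - f' y * (y' - y)| ≤ C * (y' - y) ^ 2 := by
  obtain ⟨C, hC⟩ := hf'.isBigO_sub.bound
  obtain ⟨δ, hδ, hball⟩ := Metric.eventually_nhds_iff.1 hC
  refine ⟨max C 0, le_max_right _ _, δ, hδ, fun y' hy' => ?_⟩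
  have hd : ∀ x ∈ uIcc y y', HasDerivWithinAt (fun x => f x - f' y * (x - y)) (f' x - f' y)
      (uIcc y y') x := fun x _ => by
    have := (hf x).sub (((hasDerivAt_id x).sub_const y).const_mul (f' y))
    rw [mul_one] at this
    exact this.hasDerivWithinAt
  have hb : ∀ x ∈ uIcc y y', ‖f' x - f' y‖ ≤ max C 0 * |y' - y| := fun x hx => by
    have hx' : |x - y| ≤ |y' - y| := abs_sub_left_of_mem_uIcc hx
    refine (hball (by rw [Real.dist_eq]; exact hx'.trans_lt hy')).trans ?_
    rw [Real.norm_eq_abs]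
    exact mul_le_mul (le_max_left _ _) hx' (abs_nonneg _) (le_max_right _ _)
  have := (convex_uIcc y y').norm_image_sub_le_of_norm_hasDerivWithin_le hd hb
    left_mem_uIcc right_mem_uIcc
  rw [Real.norm_eq_abs, Real.norm_eq_abs] at this
  have e2 : f y' - f' y * (y' - y) - (f y - f' y * (y - y)) = f y' - f y - f' y * (y' - y) := by
    ring
  rw [e2] at this
  rwa [← sq_abs, pow_two, ← mul_assoc]

namespace HeatData
variable {w wt wy wyy F : ℝ → ℝ → ℝ} {α β a b M : ℝ} (H : HeatData w wt wy wyy F α β a b M)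
include H

lemma exists_mem_quantSet (p : ℝ × ℝ) : ∃ n : ℕ, p ∈ quantSet w (n + 1) := by
  obtain ⟨τ, y⟩ := p
  obtain ⟨C₁, hC₁⟩ := (H.ht τ y).isBigO_sub.bound
  obtain ⟨δ₁, hδ₁, hb₁⟩ := Metric.eventually_nhds_iff.1 hC₁
  obtain ⟨C₂, hC₂, δ₂, hδ₂, hb₂⟩ := exists_quadratic_approx (H.hy τ) (H.hyy τ y)
  obtain ⟨n, hn⟩ := exists_nat_gt (|w τ y| + |wy τ y| + |C₁| + C₂ + 1 / δ₁ + 1 / δ₂)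
  have p1 := abs_nonneg (w τ y)
  have p2 := abs_nonneg (wy τ y)
  have p3 := abs_nonneg C₁
  have p4 : 0 < 1 / δ₁ := by positivity
  have p5 : 0 < 1 / δ₂ := by positivity
  have hn0 : (0 : ℝ) < n + 1 := by positivity
  have l1 : 1 / ((n : ℝ) + 1) ≤ δ₁ := by
    rw [one_div_le hn0 hδ₁]; linarith
  have l2 : 1 / ((n : ℝ) + 1) ≤ δ₂ := by
    rw [one_div_le hn0 hδ₂]; linarith
  refine ⟨n, show |w τ y| ≤ _ by linarith, fun τ' hτ' => ?_, wy τ y, by linarith, fun y' hy' => ?_⟩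
  · refine (hb₁ (by rw [Real.dist_eq]; exact hτ'.trans_le l1)).trans ?_
    rw [Real.norm_eq_abs]
    exact mul_le_mul_of_nonneg_right (by linarith [le_abs_self C₁]) (abs_nonneg _)
  · refine (hb₂ y' (hy'.trans_le l2)).trans ?_
    exact mul_le_mul_of_nonneg_right (by linarith) (sq_nonneg _)

end HeatData

/-- The points near which the time-integrated equation holds. -/
def goodSet (w F : ℝ → ℝ → ℝ) (α β a b : ℝ) : Set (ℝ × ℝ) :=
  {p | ∃ ε, 0 < ε ∧ p.1 - ε ∈ Ioo α β ∧ p.1 + ε ∈ Ioo α β ∧ p.2 - ε ∈ Ioo a b ∧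
    p.2 + ε ∈ Ioo a b ∧ ∀ s ∈ Icc (p.1 - ε) (p.1 + ε), ∀ t ∈ Icc (p.1 - ε) (p.1 + ε),
      Sol w F s t (p.2 - ε) (p.2 + ε)}

namespace HeatData
variable {w wt wy wyy F : ℝ → ℝ → ℝ} {α β a b M : ℝ} (H : HeatData w wt wy wyy F α β a b M)
include H

lemma isOpen_goodSet : IsOpen (goodSet w F α β a b) := by
  refine Metric.isOpen_iff.2 fun p hp => ?_
  obtain ⟨ε, hε, h1, h2, h3, h4, h⟩ := hp
  refine ⟨ε / 2, by positivity, fun q hq => ?_⟩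
  rw [Metric.mem_ball, Prod.dist_eq, max_lt_iff, Real.dist_eq, Real.dist_eq, abs_lt, abs_lt] at hq
  obtain ⟨⟨ha, hb⟩, hc, hd⟩ := hq
  have inI : ∀ {s}, s ∈ Icc (q.1 - ε / 2) (q.1 + ε / 2) → s ∈ Icc (p.1 - ε) (p.1 + ε) :=
    fun hs => ⟨by linarith [hs.1], by linarith [hs.2]⟩
  have inI' : ∀ {s}, s ∈ Icc (p.1 - ε) (p.1 + ε) → s ∈ Ioo α β :=
    fun hs => ⟨by linarith [hs.1, h1.1], by linarith [hs.2, h2.2]⟩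
  refine ⟨ε / 2, by positivity, inI' (inI ⟨by linarith, by linarith⟩),
    inI' (inI ⟨by linarith, by linarith⟩), ⟨by linarith [h3.1], by linarith [h4.2]⟩,
    ⟨by linarith [h3.1], by linarith [h4.2]⟩, fun s hs t ht => ?_⟩
  exact H.sol_mono (inI' (inI hs)) (inI' (inI ht)) h3 h4 (by linarith) (by linarith) (by linarith)
    (h s (inI hs) t (inI ht))

lemma sol_of_column {s t y : ℝ} (hs : s ∈ Ioo α β) (ht : t ∈ Ioo α β)
    (h : ∀ τ ∈ uIcc s t, (τ, y) ∈ goodSet w F α β a b) :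
    ∃ ε, 0 < ε ∧ y - ε ∈ Ioo a b ∧ y + ε ∈ Ioo a b ∧ Sol w F s t (y - ε) (y + ε) := by
  set P : ℝ → ℝ → Prop := fun s t =>
    ∃ ε, 0 < ε ∧ y - ε ∈ Ioo a b ∧ y + ε ∈ Ioo a b ∧ Sol w F s t (y - ε) (y + ε) with hP
  have inI : ∀ {τ}, τ ∈ uIcc s t → τ ∈ Ioo α β := fun hτ =>
    ⟨(lt_min hs.1 ht.1).trans_le hτ.1, hτ.2.trans_lt (max_lt hs.2 ht.2)⟩
  have hpre : IsPreconnected (uIcc s t) := isPreconnected_uIcc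
  refine hpre.induction₂' P (fun τ hτ => ?_) ?_ left_mem_uIcc right_mem_uIcc
  · obtain ⟨ε, hε, h1, h2, h3, h4, hh⟩ := h τ hτ
    filter_upwards [mem_nhdsWithin_of_mem_nhds (Icc_mem_nhds (a := τ - ε) (b := τ + ε)
      (by linarith) (by linarith))] with τ' hτ'
    have hm : τ ∈ Icc (τ - ε) (τ + ε) := ⟨by linarith, by linarith⟩
    exact ⟨⟨ε, hε, h3, h4, hh τ hm τ' hτ'⟩, ⟨ε, hε, h3, h4, hh τ' hτ' τ hm⟩⟩
  · rintro r₁ r₂ r₃ hr₁ hr₂ hr₃ ⟨ε, hε, h1, h2, h3⟩ ⟨ε', hε', h1', h2', h3'⟩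
    have m1 := min_le_left ε ε'
    have m2 := min_le_right ε ε'
    have m3 : 0 < min ε ε' := lt_min hε hε'
    refine ⟨min ε ε', m3, ⟨by linarith [h1.1], by linarith [h2.2]⟩,
      ⟨by linarith [h1.1], by linarith [h2.2]⟩, ?_⟩
    have hc : y - min ε ε' ∈ Ioo a b := ⟨by linarith [h1.1], by linarith [h2.2]⟩
    have hd : y + min ε ε' ∈ Ioo a b := ⟨by linarith [h1.1], by linarith [h2.2]⟩
    exact H.sol_trans (inI hr₁) (inI hr₂) (inI hr₃) hc hd
      (H.sol_mono (inI hr₁) (inI hr₂) h1 h2 (by linarith) (by linarith) (by linarith) h3)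
      (H.sol_mono (inI hr₂) (inI hr₃) h1' h2' (by linarith) (by linarith) (by linarith) h3')

lemma mem_goodSet_of_quantSet {U : Set (ℝ × ℝ)} (hU : IsOpen U)
    (hUΩ : U ⊆ Ioo α β ×ˢ Ioo a b) {N : ℝ} (hN : 0 < N)
    (hq : ∀ p ∈ U, p ∉ goodSet w F α β a b → p ∈ quantSet w N) {p : ℝ × ℝ} (hp : p ∈ U) :
    p ∈ goodSet w F α β a b := by
  obtain ⟨r, hr, hball⟩ := Metric.isOpen_iff.1 hU p hp
  set δ := min (r / 2) (min (1 / (4 * N)) (1 / 2)) with hδ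
  have hδ0 : 0 < δ := by positivity
  have d1 : δ ≤ r / 2 := min_le_left _ _
  have d2 : δ ≤ 1 / (4 * N) := (min_le_right _ _).trans (min_le_left _ _)
  have d3 : δ ≤ 1 / 2 := (min_le_right _ _).trans (min_le_right _ _)
  have d4 : 2 * δ < 1 / N := by
    have : 1 / (4 * N) = 1 / N / 4 := by field_simp
    have h' : 0 < 1 / N := by positivity
    rw [this] at d2
    linarith
  obtain ⟨τ, y⟩ := p
  have hbox : ∀ {τ' y'}, τ' ∈ Icc (τ - δ) (τ + δ) → y' ∈ Icc (y - δ) (y + δ) → (τ', y') ∈ U := by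
    intro τ' y' h1 h2
    refine hball ?_
    rw [Metric.mem_ball, Prod.dist_eq, max_lt_iff, Real.dist_eq, Real.dist_eq, abs_lt, abs_lt]
    simp only
    refine ⟨⟨?_, ?_⟩, ?_, ?_⟩ <;> linarith [h1.1, h1.2, h2.1, h2.2]
  have mτ : ∀ {x}, x ∈ Icc (τ - δ) (τ + δ) → x ∈ Ioo α β := fun hx =>
    (hUΩ (hbox hx ⟨by linarith, by linarith⟩ : (_, y) ∈ U)).1
  have my : ∀ {x}, x ∈ Icc (y - δ) (y + δ) → x ∈ Ioo a b := fun hx =>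
    (hUΩ (hbox (τ' := τ) ⟨by linarith, by linarith⟩ hx)).2
  set K := (goodSet w F α β a b)ᶜ ∩ (Icc (τ - δ) (τ + δ) ×ˢ Icc (y - δ) (y + δ)) with hK
  have hKq : ∀ {τ' y'}, (τ', y') ∈ K → (τ', y') ∈ quantSet w N := fun h =>
    hq _ (hbox h.2.1 h.2.2) h.1
  have hKq2 : ∀ {τ' y'}, (τ', y') ∈ K → |wy τ' y'| ≤ N ∧ ∀ z, |z - y'| < 1 / N →
      |w τ' z - w τ' y' - wy τ' y' * (z - y')| ≤ N * (z - y') ^ 2 := by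
    intro τ' y' h
    obtain ⟨-, -, q, hq1, hq2⟩ := hKq h
    have : q = wy τ' y' := eq_of_quadratic_approx (by positivity : 0 < 1 / N) hN.le
      (H.hy τ' y') hq2
    subst this
    exact ⟨hq1, hq2⟩
  have B : BadBox w wy F K a b (τ - δ) (τ + δ) (y - δ) (y + δ) N :=
    { hi := by linarith
      hcd := by linarith
      hlen := by linarith
      closed := H.isOpen_goodSet.isClosed_compl.inter (isClosed_Icc.prod isClosed_Icc)
      sub := inter_subset_right
      N0 := hN.le
      bw := fun τ' y' h => (hKq h).1
      bwy := fun τ' y' h => (hKq2 h).1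
      T := fun τ' y' h τ'' h' => (hKq h).2.1 τ'' (by
        have := h.2.1
        rw [abs_lt]
        constructor <;> linarith [this.1, this.2, h'.1, h'.2])
      Y := fun τ' y' h y'' h' => (hKq2 h).2 y'' (by
        have := h.2.2
        rw [abs_lt]
        constructor <;> linarith [this.1, this.2, h'.1, h'.2])
      loc := fun s hs t ht hst z hz hKz => by
        obtain ⟨ε, hε, h1, h2, h3⟩ := H.sol_of_column (y := z) (mτ hs) (mτ ht) (fun r hr => by
          rw [uIcc_of_le hst] at hr
          by_contra hcon
          exact hKz r hr ⟨hcon, ⟨hs.1.trans hr.1, hr.2.trans ht.2⟩, hz.1.le, hz.2.le⟩)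
        exact ⟨z - ε, z + ε, ⟨by linarith, by linarith⟩, h1, h2, h3⟩ }
  have e1 : ∀ {x}, x ∈ Icc (τ - δ / 2) (τ + δ / 2) → x ∈ Icc (τ - δ) (τ + δ) := fun hx =>
    ⟨by linarith [hx.1], by linarith [hx.2]⟩
  refine ⟨δ / 2, by positivity, mτ ⟨by simp only; linarith, by simp only; linarith⟩,
    mτ ⟨by simp only; linarith, by simp only; linarith⟩,
    my ⟨by simp only; linarith, by simp only; linarith⟩,
    my ⟨by simp only; linarith, by simp only; linarith⟩, fun s hs t ht => ?_⟩
  exact H.sol_of_badBox B (mτ ⟨le_rfl, by linarith⟩) (mτ ⟨by linarith, le_rfl⟩)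
    (my ⟨le_rfl, by linarith⟩) (my ⟨by linarith, le_rfl⟩) (by simp only; linarith)
    (by simp only; linarith) (by simp only; linarith) (e1 hs) (e1 ht)

lemma goodSet_eq : Ioo α β ×ˢ Ioo a b ⊆ goodSet w F α β a b := by
  by_contra hcon
  obtain ⟨p₀, hp₀, hp₀'⟩ := not_subset.1 hcon
  set X : Set (ℝ × ℝ) := (Ioo α β ×ˢ Ioo a b) ∩ (goodSet w F α β a b)ᶜ with hX
  have hΩ : IsOpen (Ioo α β ×ˢ Ioo a b) := isOpen_Ioo.prod isOpen_Ioo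
  have hlc : IsLocallyClosed X := hΩ.isLocallyClosed.inter
    H.isOpen_goodSet.isClosed_compl.isLocallyClosed
  have : LocallyCompactSpace X := hlc.locallyCompactSpace
  have : Nonempty X := ⟨⟨p₀, hp₀, hp₀'⟩⟩
  obtain ⟨n, q, hq⟩ := nonempty_interior_of_iUnion_of_closed
    (f := fun n : ℕ => ((↑) : X → ℝ × ℝ) ⁻¹' quantSet w (n + 1))
    (fun n => (isClosed_quantSet H.cont_t H.cont_y (by positivity)).preimage continuous_subtype_val)
    (by
      ext x
      simp only [mem_iUnion, mem_preimage, mem_univ, iff_true]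
      exact H.exists_mem_quantSet x)
  obtain ⟨V, hV, hVo, hqV⟩ := mem_interior.1 hq
  obtain ⟨U, hU, rfl⟩ := isOpen_induced_iff.1 hVo
  refine q.2.2 (H.mem_goodSet_of_quantSet (U := U ∩ Ioo α β ×ˢ Ioo a b) (hU.inter hΩ)
    inter_subset_right (N := n + 1) (by positivity) (fun p hp hpg => ?_) ⟨hqV, q.2.1⟩)
  exact hV (show (⟨p, hp.2, hpg⟩ : X) ∈ _ from hp.1)

theorem sol_all {s t c d : ℝ} (hs : s ∈ Ioo α β) (ht : t ∈ Ioo α β) (hc : c ∈ Ioo a b)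
    (hd : d ∈ Ioo a b) : Sol w F s t c d := by
  refine H.sol_of_local hs ht hc hd fun y hy => ?_
  obtain ⟨ε, hε, h1, h2, h3⟩ := H.sol_of_column (y := y) hs ht fun τ hτ =>
    H.goodSet_eq ⟨⟨(lt_min hs.1 ht.1).trans_le hτ.1, hτ.2.trans_lt (max_lt hs.2 ht.2)⟩,
      hc.1.trans hy.1, hy.2.trans hd.2⟩
  exact ⟨y - ε, y + ε, ⟨by linarith, by linarith⟩, h1, h3⟩

end HeatData

lemma integrable_of_sq {α : Type*} [MeasurableSpace α] {μ : Measure α} [IsFiniteMeasure μ]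
    {f : α → ℝ} (hm : AEStronglyMeasurable f μ) (hf : Integrable (fun x => f x ^ 2) μ) :
    Integrable f μ := by
  refine Integrable.mono' ((integrable_const (1 : ℝ)).add hf) hm (Eventually.of_forall fun x => ?_)
  simp only [Pi.add_apply, Real.norm_eq_abs]
  nlinarith [sq_abs (f x), sq_nonneg (|f x| - 1)]

lemma integrable_mul_of_sq {α : Type*} [MeasurableSpace α] {μ : Measure α}
    {f g : α → ℝ} (hfm : AEStronglyMeasurable f μ) (hgm : AEStronglyMeasurable g μ)
    (hf : Integrable (fun x => f x ^ 2) μ) (hg : Integrable (fun x => g x ^ 2) μ) :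
    Integrable (fun x => f x * g x) μ := by
  refine Integrable.mono' (hf.add hg) (hfm.mul hgm) (Eventually.of_forall fun x => ?_)
  simp only [Pi.add_apply, Real.norm_eq_abs, abs_mul]
  nlinarith [sq_abs (f x), sq_abs (g x), sq_nonneg (|f x| - |g x|), sq_nonneg (f x), sq_nonneg (g x)]

lemma integrable_add_sq {α : Type*} [MeasurableSpace α] {μ : Measure α}
    {f g : α → ℝ} (hfm : AEStronglyMeasurable f μ) (hgm : AEStronglyMeasurable g μ)
    (hf : Integrable (fun x => f x ^ 2) μ) (hg : Integrable (fun x => g x ^ 2) μ) :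
    Integrable (fun x => (f x + g x) ^ 2) μ := by
  refine ((hf.add hg).add ((integrable_mul_of_sq hfm hgm hf hg).const_mul 2)).congr
    (Eventually.of_forall fun x => ?_)
  simp only [Pi.add_apply]
  ring

lemma sq_integral_le {α : Type*} [MeasurableSpace α] {μ : Measure α} [IsFiniteMeasure μ]
    {f : α → ℝ} (hm : AEStronglyMeasurable f μ) (hf : Integrable (fun x => f x ^ 2) μ) :
    (∫ x, f x ∂μ) ^ 2 ≤ μ.real univ * ∫ x, f x ^ 2 ∂μ := by
  have h1 := integrable_of_sq hm hf
  have key : ∀ m : ℝ, 0 ≤ (∫ x, f x ^ 2 ∂μ) - 2 * m * (∫ x, f x ∂μ) + m ^ 2 * μ.real univ := by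
    intro m
    have h2 : 0 ≤ ∫ x, (f x - m) ^ 2 ∂μ := integral_nonneg fun x => sq_nonneg _
    have h3 : ∫ x, (f x - m) ^ 2 ∂μ = ∫ x, (f x ^ 2 - 2 * m * f x + m ^ 2) ∂μ :=
      integral_congr_ae (Eventually.of_forall fun x => by simp only; ring)
    have h4 : Integrable (fun x => f x ^ 2 - 2 * m * f x) μ := hf.sub (h1.const_mul _)
    rw [h3, integral_add h4 (integrable_const _),
      integral_sub hf (h1.const_mul _), integral_const_mul, integral_const, smul_eq_mul] at h2
    linarith
  have hV : 0 ≤ μ.real univ := measureReal_nonneg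
  rcases hV.eq_or_lt with h0 | h0
  · have : μ = 0 := by
      rw [← Measure.measure_univ_eq_zero]
      exact (measureReal_eq_zero_iff).1 h0.symm
    simp [this]
  · have := key ((∫ x, f x ∂μ) / μ.real univ)
    have h4 : 0 ≤ μ.real univ * ((∫ x, f x ^ 2 ∂μ) - 2 * ((∫ x, f x ∂μ) / μ.real univ) *
        (∫ x, f x ∂μ) + ((∫ x, f x ∂μ) / μ.real univ) ^ 2 * μ.real univ) := mul_nonneg hV this
    have h5 : μ.real univ * ((∫ x, f x ^ 2 ∂μ) - 2 * ((∫ x, f x ∂μ) / μ.real univ) *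
        (∫ x, f x ∂μ) + ((∫ x, f x ∂μ) / μ.real univ) ^ 2 * μ.real univ) =
        μ.real univ * (∫ x, f x ^ 2 ∂μ) - (∫ x, f x ∂μ) ^ 2 := by
      field_simp
      ring
    linarith

lemma integrableOn_prod_of_slice {α β : Type*} [MeasureSpace α] [MeasureSpace β]
    [SFinite (volume : Measure α)] [SFinite (volume : Measure β)] {G : α → β → ℝ} {S : Set α}
    {S' : Set β} {C : ℝ}
    (hS : MeasurableSet S) (hfin : volume S < ⊤)
    (hG : Measurable (Function.uncurry G)) (hi : ∀ τ ∈ S, IntegrableOn (G τ) S')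
    (hC : ∀ τ ∈ S, ∫ y in S', |G τ y| ≤ C) :
    IntegrableOn (Function.uncurry G) (S ×ˢ S') := by
  rw [IntegrableOn, Measure.volume_eq_prod, ← Measure.prod_restrict]
  rw [integrable_prod_iff hG.aestronglyMeasurable]
  constructor
  · rw [ae_restrict_iff' hS]
    exact Eventually.of_forall fun t ht => hi t ht
  · have hfin : IntegrableOn (fun _ : α => C) S := integrableOn_const hfin.ne
    refine Integrable.mono' hfin
      hG.norm.stronglyMeasurable.integral_prod_right.aestronglyMeasurable ?_
    rw [ae_restrict_iff' hS]
    refine Eventually.of_forall fun t ht => ?_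
    rw [Real.norm_eq_abs, abs_of_nonneg (integral_nonneg fun _ => norm_nonneg _)]
    exact hC t ht

/-- Functions of time and height which are square integrable in height, uniformly in time. -/
structure L2On (f : ℝ → ℝ → ℝ) (T A : ℝ) : Prop where
  meas : Measurable (Function.uncurry f)
  int : ∀ t ∈ Ioo 0 T, IntegrableOn (fun y => f t y ^ 2) (Ioi 0)
  bound : ∀ t ∈ Ioo 0 T, ∫ y in Ioi 0, f t y ^ 2 ≤ A

/-- Time primitive. -/
noncomputable def Pt (f : ℝ → ℝ → ℝ) (t y : ℝ) : ℝ := ∫ τ in Ioc 0 t, f τ y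

namespace L2On
variable {f g : ℝ → ℝ → ℝ} {T A B : ℝ}

lemma slice_meas (hf : L2On f T A) (t : ℝ) : Measurable (f t) :=
  hf.meas.comp (measurable_const.prodMk measurable_id)

lemma slice_meas' (hf : L2On f T A) (y : ℝ) : Measurable fun t => f t y :=
  hf.meas.comp (measurable_id.prodMk measurable_const)

lemma slice_int (hf : L2On f T A) {t : ℝ} (ht : t ∈ Ioo 0 T) (R : ℝ) :
    IntegrableOn (f t) (Ioc 0 R) :=
  integrable_of_sq (hf.slice_meas t).aestronglyMeasurable
    ((hf.int t ht).mono_set Ioc_subset_Ioi_self)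

lemma Ioc_sub {t : ℝ} (ht : t ∈ Ioo 0 T) {τ : ℝ} (hτ : τ ∈ Ioc 0 t) : τ ∈ Ioo 0 T :=
  ⟨hτ.1, hτ.2.trans_lt ht.2⟩

lemma sq_int (hf : L2On f T A) {t : ℝ} (ht : t ∈ Ioo 0 T) :
    IntegrableOn (Function.uncurry fun τ y => f τ y ^ 2) (Ioc 0 t ×ˢ Ioi 0) := by
  refine integrableOn_prod_of_slice (C := A) measurableSet_Ioc (by simp) (hf.meas.pow_const 2)
    (fun τ hτ => hf.int τ (Ioc_sub ht hτ)) (fun τ hτ => ?_)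
  simp only [abs_sq]
  exact hf.bound τ (Ioc_sub ht hτ)

lemma rect_int (hf : L2On f T A) {t : ℝ} (ht : t ∈ Ioo 0 T) (R : ℝ) :
    IntegrableOn (Function.uncurry f) (Ioc 0 t ×ˢ Ioc 0 R) := by
  have : IsFiniteMeasure ((volume : Measure (ℝ × ℝ)).restrict (Ioc 0 t ×ˢ Ioc 0 R)) := by
    rw [Measure.volume_eq_prod, ← Measure.prod_restrict]
    infer_instance
  exact integrable_of_sq hf.meas.aestronglyMeasurable
    ((hf.sq_int ht).mono_set (prod_mono_right Ioc_subset_Ioi_self))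

lemma mul_int (hf : L2On f T A) (hg : L2On g T B) {t : ℝ} (ht : t ∈ Ioo 0 T) :
    IntegrableOn (Function.uncurry fun τ y => f τ y * g τ y) (Ioc 0 t ×ˢ Ioi 0) :=
  integrable_mul_of_sq hf.meas.aestronglyMeasurable hg.meas.aestronglyMeasurable
    (hf.sq_int ht) (hg.sq_int ht)

lemma mul_slice_int (hf : L2On f T A) (hg : L2On g T B) {t : ℝ} (ht : t ∈ Ioo 0 T) :
    IntegrableOn (fun y => f t y * g t y) (Ioi 0) :=
  integrable_mul_of_sq (hf.slice_meas t).aestronglyMeasurable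
    (hg.slice_meas t).aestronglyMeasurable (hf.int t ht) (hg.int t ht)

lemma Pt_meas (hf : L2On f T A) : Measurable (Function.uncurry (Pt f)) := by
  have h1 : (fun p : ℝ × ℝ => Pt f p.1 p.2) =
      fun p => ∫ τ, indicator {q : (ℝ × ℝ) × ℝ | 0 < q.2 ∧ q.2 ≤ q.1.1}
        (fun q => f q.2 q.1.2) (p, τ) := by
    ext p
    rw [Pt, ← integral_indicator measurableSet_Ioc]
    rfl
  change Measurable fun p : ℝ × ℝ => Pt f p.1 p.2
  rw [h1]
  refine (StronglyMeasurable.integral_prod_right (ν := volume) ?_).measurable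
  refine Measurable.stronglyMeasurable (Measurable.indicator ?_ ?_)
  · exact hf.meas.comp (measurable_snd.prodMk (measurable_snd.comp measurable_fst))
  · exact (measurableSet_lt measurable_const measurable_snd).inter
      (measurableSet_le measurable_snd (measurable_fst.comp measurable_fst))

lemma Pt_sq_le (hf : L2On f T A) {t : ℝ} (ht : t ∈ Ioo 0 T) :
    ∀ᵐ y ∂volume.restrict (Ioi (0 : ℝ)), Pt f t y ^ 2 ≤ t * ∫ τ in Ioc 0 t, f τ y ^ 2 := by
  have h := hf.sq_int ht
  rw [IntegrableOn, Measure.volume_eq_prod, ← Measure.prod_restrict] at h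
  filter_upwards [h.prod_left_ae] with y hy
  refine (sq_integral_le (hf.slice_meas' y).aestronglyMeasurable hy).trans (le_of_eq ?_)
  simp [ht.1.le]

lemma Pt_sq (hf : L2On f T A) {t : ℝ} (ht : t ∈ Ioo 0 T) :
    IntegrableOn (fun y => Pt f t y ^ 2) (Ioi 0) ∧
      ∫ y in Ioi 0, Pt f t y ^ 2 ≤ t * ∫ τ in Ioc 0 t, ∫ y in Ioi 0, f τ y ^ 2 := by
  have h := hf.sq_int ht
  rw [IntegrableOn, Measure.volume_eq_prod, ← Measure.prod_restrict] at h
  have h2 := h.integral_prod_right.const_mul t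
  have hm : Measurable (Pt f t) := hf.Pt_meas.comp (measurable_const.prodMk measurable_id)
  have h3 : IntegrableOn (fun y => Pt f t y ^ 2) (Ioi 0) := by
    refine Integrable.mono' h2 (hm.pow_const 2).aestronglyMeasurable ?_
    filter_upwards [hf.Pt_sq_le ht] with y hy
    rw [Real.norm_eq_abs, abs_sq]
    exact hy
  refine ⟨h3, ?_⟩
  rw [integral_integral_swap h, ← integral_const_mul]
  exact integral_mono_ae h3 h2 (hf.Pt_sq_le ht)

lemma time_int (hf : L2On f T A) {t : ℝ} (ht : t ∈ Ioo 0 T) :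
    IntegrableOn (fun τ => ∫ y in Ioi 0, f τ y ^ 2) (Ioc 0 t) := by
  have h := hf.sq_int ht
  rw [IntegrableOn, Measure.volume_eq_prod, ← Measure.prod_restrict] at h
  exact h.integral_prod_left

lemma Pt_L2On (hf : L2On f T A) : L2On (Pt f) T (T * (T * A)) where
  meas := hf.Pt_meas
  int := fun t ht => (hf.Pt_sq ht).1
  bound := fun t ht => by
    have hA : 0 ≤ A := (integral_nonneg fun _ => sq_nonneg _).trans (hf.bound t ht)
    refine (hf.Pt_sq ht).2.trans ?_
    have h1 : ∫ τ in Ioc 0 t, ∫ y in Ioi 0, f τ y ^ 2 ≤ ∫ τ in Ioc 0 t, A := by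
      refine setIntegral_mono_on (hf.time_int ht) (integrableOn_const (by simp)) measurableSet_Ioc
        fun τ hτ => hf.bound τ (Ioc_sub ht hτ)
    have h2 : ∫ τ in Ioc 0 t, A = t * A := by simp [ht.1.le]
    rw [h2] at h1
    have h3 : t * A ≤ T * A := mul_le_mul_of_nonneg_right ht.2.le hA
    exact mul_le_mul ht.2.le (h1.trans h3) (integral_nonneg fun _ => integral_nonneg fun _ =>
      sq_nonneg _) (ht.1.le.trans ht.2.le)

lemma Pt_slice_int (hf : L2On f T A) {t : ℝ} (ht : t ∈ Ioo 0 T) (R : ℝ) :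
    IntegrableOn (Pt f t) (Ioc 0 R) := hf.Pt_L2On.slice_int ht R

/-- The energy identity in time. -/
lemma integral_Pt_mul_nonneg (hf : L2On f T A) {t : ℝ} (ht : t ∈ Ioo 0 T) :
    0 ≤ ∫ τ in Ioc 0 t, ∫ y in Ioi 0, Pt f τ y * f τ y := by
  have h := hf.Pt_L2On.mul_int hf ht
  rw [IntegrableOn, Measure.volume_eq_prod, ← Measure.prod_restrict] at h
  rw [integral_integral_swap h]
  refine integral_nonneg_of_ae ?_
  have hr := hf.sq_int ht
  rw [IntegrableOn, Measure.volume_eq_prod, ← Measure.prod_restrict] at hr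
  filter_upwards [hr.prod_left_ae] with y hy
  have hi : IntegrableOn (fun τ => f τ y) (Ioc 0 t) :=
    integrable_of_sq (hf.slice_meas' y).aestronglyMeasurable hy
  have hi' : IntervalIntegrable (fun τ => f τ y) volume 0 t :=
    (intervalIntegrable_iff_integrableOn_Ioc_of_le ht.1.le).2 hi
  have hac := hi'.absolutelyContinuousOnInterval_intervalIntegral (c := 0) (by simp)
  have h1 := hac.integral_mul_deriv_eq_deriv_mul hac
  have e1 : ∫ τ in (0 : ℝ)..t, (∫ r in (0 : ℝ)..τ, f r y) *
      deriv (fun τ => ∫ r in (0 : ℝ)..τ, f r y) τ = ∫ τ in Ioc 0 t, Pt f τ y * f τ y := by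
    rw [← intervalIntegral.integral_of_le ht.1.le]
    apply intervalIntegral.integral_congr_ae
    filter_upwards [hi'.ae_hasDerivAt_integral] with x hx hxm
    rw [(hx (uIoc_subset_uIcc hxm) 0 (by simp)).deriv]
    rw [uIoc_of_le ht.1.le] at hxm
    rw [Pt, intervalIntegral.integral_of_le hxm.1.le]
  have e2 : ∫ τ in (0 : ℝ)..t, deriv (fun τ => ∫ r in (0 : ℝ)..τ, f r y) τ *
      (∫ r in (0 : ℝ)..τ, f r y) = ∫ τ in Ioc 0 t, Pt f τ y * f τ y := by
    rw [← e1]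
    simp_rw [mul_comm]
  rw [e1, e2] at h1
  simp only [intervalIntegral.integral_same, mul_zero, sub_zero] at h1
  simp only [Pi.zero_apply]
  have := mul_self_nonneg (∫ r in (0 : ℝ)..t, f r y)
  linarith

end L2On

lemma eq_zero_of_tendsto_of_integrableOn_Ioi {h : ℝ → ℝ} {l c : ℝ} (hh : IntegrableOn h (Ioi c))
    (hl : Tendsto h atTop (𝓝 l)) : l = 0 := by
  by_contra hne
  have hpos : 0 < |l| := abs_pos.2 hne
  obtain ⟨R, hR⟩ := eventually_atTop.1
    (hl.abs.eventually (lt_mem_nhds (show |l| / 2 < |l| by linarith)))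
  have h1 : IntegrableOn h (Ioi (max c R)) := hh.mono_set (Ioi_subset_Ioi (le_max_left _ _))
  have h2 : IntegrableOn (fun _ : ℝ => |l| / 2) (Ioi (max c R)) := by
    refine Integrable.mono h1 aestronglyMeasurable_const ?_
    rw [ae_restrict_iff' measurableSet_Ioi]
    refine Eventually.of_forall fun x hx => ?_
    rw [Real.norm_eq_abs, Real.norm_eq_abs, abs_of_pos (by positivity : 0 < |l| / 2)]
    exact (hR x ((le_max_right _ _).trans (le_of_lt hx))).le
  rw [integrableOn_const_iff] at h2
  rcases h2 with h2 | h2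
  · simp only [div_eq_zero_iff, abs_eq_zero, OfNat.ofNat_ne_zero, or_false, enorm_eq_zero] at h2
    exact hne h2
  · simp at h2

/-- A one-dimensional mode: `a` solves the heat equation with source `G` in integrated form. -/
structure Mode (a ay G : ℝ → ℝ → ℝ) (T A A' B : ℝ) : Prop where
  ha : L2On a T A
  hay : L2On ay T A'
  hG : L2On G T B
  prim : ∀ t ∈ Ioo 0 T, ∀ y, 0 ≤ y → a t y = ∫ z in (0 : ℝ)..y, ay t z
  weak : ∀ t ∈ Ioo 0 T, ∀ R, 0 < R → ∀ φ : ℝ → ℝ, ContDiff ℝ ∞ φ → tsupport φ ⊆ Ioo 0 R →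
    ∫ y in (0 : ℝ)..R, ((a t y - Pt G t y) * φ y - Pt a t y * deriv (deriv φ) y) = 0

namespace Mode
variable {a ay G : ℝ → ℝ → ℝ} {T A A' B : ℝ} (H : Mode a ay G T A A' B)
include H

lemma g_sq {t : ℝ} (ht : t ∈ Ioo 0 T) :
    IntegrableOn (fun y => (a t y - Pt G t y) ^ 2) (Ioi 0) := by
  have h := integrable_add_sq (f := a t) (g := fun y => - Pt G t y)
    (H.ha.slice_meas t).aestronglyMeasurable
    (H.hG.Pt_L2On.slice_meas t).neg.aestronglyMeasurable (H.ha.int t ht)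
    (by simpa [IntegrableOn] using (H.hG.Pt_sq ht).1)
  exact h

lemma g_int {t : ℝ} (ht : t ∈ Ioo 0 T) {R R' : ℝ} (hR : 0 ≤ R) (hR' : 0 ≤ R') :
    IntervalIntegrable (fun y => a t y - Pt G t y) volume R R' := by
  have key : ∀ R, 0 ≤ R → IntervalIntegrable (fun y => a t y - Pt G t y) volume 0 R := fun R hR =>
    (intervalIntegrable_iff_integrableOn_Ioc_of_le hR).2
      ((H.ha.slice_int ht R).sub (H.hG.Pt_slice_int ht R))
  exact (key R hR).symm.trans (key R' hR')

lemma Pay_int {t : ℝ} (ht : t ∈ Ioo 0 T) {R : ℝ} (hR : 0 ≤ R) :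
    IntervalIntegrable (Pt ay t) volume 0 R :=
  (intervalIntegrable_iff_integrableOn_Ioc_of_le hR).2 (H.hay.Pt_slice_int ht R)

lemma Pt_eq {t : ℝ} (ht : t ∈ Ioo 0 T) {y : ℝ} (hy : 0 ≤ y) :
    Pt a t y = ∫ z in (0 : ℝ)..y, Pt ay t z := by
  have h := H.hay.rect_int ht y
  rw [IntegrableOn, Measure.volume_eq_prod, ← Measure.prod_restrict] at h
  rw [intervalIntegral.integral_of_le hy]
  simp only [Pt]
  rw [← integral_integral_swap h]
  refine setIntegral_congr_fun measurableSet_Ioc fun τ hτ => ?_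
  rw [H.prim τ (L2On.Ioc_sub ht hτ) y hy, intervalIntegral.integral_of_le hy]

lemma Pt_cont {t : ℝ} (ht : t ∈ Ioo 0 T) {R : ℝ} (hR : 0 ≤ R) :
    ContinuousOn (Pt a t) (Icc 0 R) := by
  have h := ((H.Pay_int ht hR).absolutelyContinuousOnInterval_intervalIntegral
    (c := 0) (by simp)).continuousOn
  rw [uIcc_of_le hR] at h
  exact h.congr fun y hy => H.Pt_eq ht hy.1

lemma exists_deriv {t : ℝ} (ht : t ∈ Ioo 0 T) : ∃ p : ℝ, ∀ y, 0 < y →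
    HasDerivAt (Pt a t) (p + ∫ z in (0 : ℝ)..y, (a t z - Pt G t z)) y := by
  have key : ∀ R, 0 < R → ∃ p : ℝ, ∀ y ∈ Ioo 0 R,
      HasDerivAt (Pt a t) (p + ∫ z in (0 : ℝ)..y, (a t z - Pt G t z)) y := by
    intro R hR
    obtain ⟨m, p, -, h⟩ := hasDerivAt_of_weak hR (H.Pt_cont ht hR.le)
      (H.g_int ht le_rfl hR.le) (H.weak t ht R hR)
    exact ⟨p, h⟩
  obtain ⟨p, hp⟩ := key 1 one_pos
  refine ⟨p, fun y hy => ?_⟩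
  obtain ⟨q, hq⟩ := key (y + 1) (by linarith)
  have h1 := hp (min y (1 / 2)) ⟨by positivity, (min_le_right _ _).trans_lt (by norm_num)⟩
  have h2 := hq (min y (1 / 2)) ⟨by positivity, (min_le_left _ _).trans_lt (by linarith)⟩
  have h3 : p = q := by linarith [h1.unique h2]
  rw [h3]
  exact hq y ⟨hy, by linarith⟩

lemma Pay_eq {t p : ℝ} (ht : t ∈ Ioo 0 T) (hp : ∀ y, 0 < y →
    HasDerivAt (Pt a t) (p + ∫ z in (0 : ℝ)..y, (a t z - Pt G t z)) y) :
    ∀ᵐ y, 0 < y → Pt ay t y = p + ∫ z in (0 : ℝ)..y, (a t z - Pt G t z) := by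
  have key : ∀ n : ℕ, ∀ᵐ y, y ∈ Ioo (0 : ℝ) n → Pt ay t y =
      p + ∫ z in (0 : ℝ)..y, (a t z - Pt G t z) := by
    intro n
    filter_upwards [(H.Pay_int ht (Nat.cast_nonneg n)).ae_hasDerivAt_integral] with y hy hyn
    have h1 := hy (by rw [uIcc_of_le (Nat.cast_nonneg n)]; exact ⟨hyn.1.le, hyn.2.le⟩) 0 (by simp)
    refine h1.unique ((hp y hyn.1).congr_of_eventuallyEq ?_)
    filter_upwards [lt_mem_nhds hyn.1] with z hz
    exact (H.Pt_eq ht hz.le).symm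
  filter_upwards [ae_all_iff.2 key] with y hy hy0
  obtain ⟨n, hn⟩ := exists_nat_gt y
  exact hy n ⟨hy0, hn⟩

lemma integral_mul_interval {t p : ℝ} (ht : t ∈ Ioo 0 T) (hp : ∀ y, 0 < y →
    HasDerivAt (Pt a t) (p + ∫ z in (0 : ℝ)..y, (a t z - Pt G t z)) y) {R : ℝ} (hR : 0 < R) :
    ∫ y in (0 : ℝ)..R, (a t y - Pt G t y) * a t y =
      (p + ∫ z in (0 : ℝ)..R, (a t z - Pt G t z)) * a t R - ∫ y in (0 : ℝ)..R, Pt ay t y * ay t y := by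
  set g : ℝ → ℝ := fun y => a t y - Pt G t y with hg
  have ig : IntervalIntegrable g volume 0 R := H.g_int ht le_rfl hR.le
  have iay : IntervalIntegrable (ay t) volume 0 R :=
    (intervalIntegrable_iff_integrableOn_Ioc_of_le hR.le).2 (H.hay.slice_int ht R)
  have hf : AbsolutelyContinuousOnInterval (fun y => ∫ z in (0 : ℝ)..y, ay t z) 0 R :=
    iay.absolutelyContinuousOnInterval_intervalIntegral (by simp)
  have hG : AbsolutelyContinuousOnInterval (fun y => ∫ z in (0 : ℝ)..y, g z) 0 R :=
    ig.absolutelyContinuousOnInterval_intervalIntegral (by simp)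
  have h1 := hf.integral_mul_deriv_eq_deriv_mul hG
  have e1 : ∫ y in (0 : ℝ)..R, (∫ z in (0 : ℝ)..y, ay t z) *
      deriv (fun y => ∫ z in (0 : ℝ)..y, g z) y = ∫ y in (0 : ℝ)..R, g y * a t y := by
    apply intervalIntegral.integral_congr_ae
    filter_upwards [ig.ae_hasDerivAt_integral] with x hx hxm
    rw [(hx (uIoc_subset_uIcc hxm) 0 (by simp)).deriv]
    rw [uIoc_of_le hR.le] at hxm
    rw [H.prim t ht x hxm.1.le, mul_comm]
  have e2 : ∫ y in (0 : ℝ)..R, deriv (fun y => ∫ z in (0 : ℝ)..y, ay t z) y *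
      (∫ z in (0 : ℝ)..y, g z) = ∫ y in (0 : ℝ)..R, (Pt ay t y * ay t y - p * ay t y) := by
    apply intervalIntegral.integral_congr_ae
    filter_upwards [iay.ae_hasDerivAt_integral, H.Pay_eq ht hp] with x hx hx' hxm
    rw [(hx (uIoc_subset_uIcc hxm) 0 (by simp)).deriv]
    rw [uIoc_of_le hR.le] at hxm
    rw [hx' hxm.1]
    ring
  have i3 : IntervalIntegrable (fun y => Pt ay t y * ay t y) volume 0 R :=
    (intervalIntegrable_iff_integrableOn_Ioc_of_le hR.le).2
      ((H.hay.Pt_L2On.mul_slice_int H.hay ht).mono_set Ioc_subset_Ioi_self)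
  rw [e1, e2, intervalIntegral.integral_sub i3 (iay.const_mul p),
    intervalIntegral.integral_const_mul, ← H.prim t ht R hR.le] at h1
  simp only [intervalIntegral.integral_same, mul_zero, sub_zero] at h1
  rw [h1]
  ring

lemma integral_mul_eq {t : ℝ} (ht : t ∈ Ioo 0 T) :
    ∫ y in Ioi 0, (a t y - Pt G t y) * a t y = - ∫ y in Ioi 0, Pt ay t y * ay t y := by
  obtain ⟨p, hp⟩ := H.exists_deriv ht
  have i1 : IntegrableOn (fun y => (a t y - Pt G t y) * a t y) (Ioi 0) :=
    integrable_mul_of_sq ((H.ha.slice_meas t).sub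
      (H.hG.Pt_L2On.slice_meas t)).aestronglyMeasurable
      (H.ha.slice_meas t).aestronglyMeasurable (H.g_sq ht) (H.ha.int t ht)
  have i2 := H.hay.Pt_L2On.mul_slice_int H.hay ht
  have i3 := H.hay.Pt_L2On.mul_slice_int H.ha ht
  have t1 := intervalIntegral_tendsto_integral_Ioi 0 i1 tendsto_id
  have t2 := intervalIntegral_tendsto_integral_Ioi 0 i2 tendsto_id
  have t3 := t1.add t2
  have i4 : IntegrableOn (fun R => (p + ∫ z in (0 : ℝ)..R, (a t z - Pt G t z)) * a t R)
      (Ioi 0) := by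
    refine i3.congr_fun_ae ?_
    rw [EventuallyEq, ae_restrict_iff' measurableSet_Ioi]
    filter_upwards [H.Pay_eq ht hp] with y hy hy0
    rw [hy hy0]
  have t4 := t3.congr' (f₂ := fun R => (p + ∫ z in (0 : ℝ)..R, (a t z - Pt G t z)) * a t R) (by
    filter_upwards [eventually_gt_atTop 0] with R hR
    simp only [id]
    rw [H.integral_mul_interval ht hp hR]
    ring)
  linarith [eq_zero_of_tendsto_of_integrableOn_Ioi i4 t4]

lemma energy_le {t : ℝ} (ht : t ∈ Ioo 0 T) :
    ∫ τ in Ioc 0 t, ∫ y in Ioi 0, a τ y ^ 2 ≤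
      ∫ τ in Ioc 0 t, τ * ∫ r in Ioc 0 τ, ∫ y in Ioi 0, G r y ^ 2 := by
  have hPG := H.hG.Pt_L2On
  have j1 := H.ha.time_int ht
  have j2 := hPG.time_int ht
  have j3 : IntegrableOn (fun τ => ∫ y in Ioi 0, Pt ay τ y * ay τ y) (Ioc 0 t) := by
    have h := H.hay.Pt_L2On.mul_int H.hay ht
    rw [IntegrableOn, Measure.volume_eq_prod, ← Measure.prod_restrict] at h
    exact h.integral_prod_left
  have pw : ∀ τ ∈ Ioc 0 t, ∫ y in Ioi 0, a τ y ^ 2 ≤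
      (∫ y in Ioi 0, Pt G τ y ^ 2) - 2 * ∫ y in Ioi 0, Pt ay τ y * ay τ y := by
    intro τ hτ
    have hτ' := L2On.Ioc_sub ht hτ
    have e1 := H.integral_mul_eq hτ'
    have i1 := H.ha.int τ hτ'
    have i2 := hPG.int τ hτ'
    have i3 := hPG.mul_slice_int H.ha hτ'
    have e2 : ∫ y in Ioi 0, (a τ y - Pt G τ y) * a τ y =
        (∫ y in Ioi 0, a τ y ^ 2) - ∫ y in Ioi 0, Pt G τ y * a τ y := by
      rw [← integral_sub i1 i3]
      exact integral_congr_ae (Eventually.of_forall fun y => by simp only; ring)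
    have e3 : 2 * ∫ y in Ioi 0, Pt G τ y * a τ y ≤
        (∫ y in Ioi 0, a τ y ^ 2) + ∫ y in Ioi 0, Pt G τ y ^ 2 := by
      rw [← integral_const_mul, ← integral_add i1 i2]
      exact integral_mono (i3.const_mul 2) (i1.add i2) fun y => by
        simp only
        nlinarith [sq_nonneg (a τ y - Pt G τ y)]
    linarith
  have h1 : ∫ τ in Ioc 0 t, ∫ y in Ioi 0, a τ y ^ 2 ≤
      (∫ τ in Ioc 0 t, ∫ y in Ioi 0, Pt G τ y ^ 2) -
        2 * ∫ τ in Ioc 0 t, ∫ y in Ioi 0, Pt ay τ y * ay τ y := by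
    rw [← integral_const_mul, ← integral_sub j2 (j3.const_mul 2)]
    exact setIntegral_mono_on j1 (j2.sub (j3.const_mul 2)) measurableSet_Ioc pw
  have h2 := H.hay.integral_Pt_mul_nonneg ht
  have j4 : IntegrableOn (fun τ => τ * ∫ r in Ioc 0 τ, ∫ y in Ioi 0, G r y ^ 2) (Ioc 0 t) := by
    have hi : IntervalIntegrable (fun τ => ∫ y in Ioi 0, G τ y ^ 2) volume 0 t :=
      (intervalIntegrable_iff_integrableOn_Ioc_of_le ht.1.le).2 (H.hG.time_int ht)
    have hc := (hi.absolutelyContinuousOnInterval_intervalIntegral (c := 0) (by simp)).continuousOn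
    have h3 := (continuousOn_id.mul hc).intervalIntegrable (μ := volume)
    rw [intervalIntegrable_iff_integrableOn_Ioc_of_le ht.1.le] at h3
    refine h3.congr_fun (fun τ hτ => ?_) measurableSet_Ioc
    simp only [Pi.mul_apply, id]
    rw [intervalIntegral.integral_of_le hτ.1.le]
  have h3 : ∫ τ in Ioc 0 t, ∫ y in Ioi 0, Pt G τ y ^ 2 ≤
      ∫ τ in Ioc 0 t, τ * ∫ r in Ioc 0 τ, ∫ y in Ioi 0, G r y ^ 2 :=
    setIntegral_mono_on j2 j4 measurableSet_Ioc fun τ hτ => (H.hG.Pt_sq (L2On.Ioc_sub ht hτ)).2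
  linarith

end Mode

lemma integral_eq_zero_of_gronwall {e : ℝ → ℝ} {t₁ K : ℝ} (ht₁ : 0 ≤ t₁)
    (hi : IntegrableOn e (Ioc 0 t₁)) (h0 : ∀ t, 0 ≤ e t)
    (h : ∀ t ∈ Icc 0 t₁, ∫ τ in Ioc 0 t, e τ ≤ K * ∫ τ in Ioc 0 t, ∫ r in Ioc 0 τ, e r) :
    ∫ τ in Ioc 0 t₁, e τ = 0 := by
  set e' : ℝ → ℝ := (Ioc 0 t₁).indicator e with he'
  have hintg : Integrable e' := (integrable_indicator_iff measurableSet_Ioc).2 hi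
  set S : ℝ → ℝ := fun t => ∫ τ in (0 : ℝ)..t, e' τ with hS
  have hSc : Continuous S :=
    intervalIntegral.continuous_primitive (fun a b => hintg.intervalIntegrable) 0
  have hSe : ∀ t ∈ Icc 0 t₁, S t = ∫ τ in Ioc 0 t, e τ := by
    intro t ht
    simp only [hS]
    rw [intervalIntegral.integral_of_le ht.1]
    refine setIntegral_congr_fun measurableSet_Ioc fun τ hτ => ?_
    exact indicator_of_mem (show τ ∈ Ioc 0 t₁ from ⟨hτ.1, hτ.2.trans ht.2⟩) e
  set J : ℝ → ℝ := fun t => ∫ τ in (0 : ℝ)..t, S τ with hJ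
  have hJd : ∀ t, HasDerivAt J (S t) t := fun t => hSc.integral_hasStrictDerivAt 0 t |>.hasDerivAt
  have hJe : ∀ t ∈ Icc 0 t₁, J t = ∫ τ in Ioc 0 t, ∫ r in Ioc 0 τ, e r := by
    intro t ht
    simp only [hJ]
    rw [intervalIntegral.integral_of_le ht.1]
    exact setIntegral_congr_fun measurableSet_Ioc fun τ hτ => hSe τ ⟨hτ.1.le, hτ.2.trans ht.2⟩
  have hS0 : ∀ t ∈ Icc 0 t₁, 0 ≤ S t := fun t ht => by
    rw [hSe t ht]
    exact integral_nonneg h0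
  have hJ0 : ∀ t ∈ Icc 0 t₁, 0 ≤ J t := fun t ht => by
    rw [hJe t ht]
    exact integral_nonneg fun τ => integral_nonneg h0
  have hz := eq_zero_of_abs_deriv_le_mul_abs_self_of_eq_zero_right (f := J) (f' := S) (K := K)
    (a := 0) (b := t₁) (fun t _ => (hJd t).continuousAt.continuousWithinAt)
    (fun t _ => (hJd t).hasDerivWithinAt) (by simp [hJ]) (fun t ht => by
      have ht' : t ∈ Icc 0 t₁ := ⟨ht.1, ht.2.le⟩
      rw [Real.norm_eq_abs, Real.norm_eq_abs, abs_of_nonneg (hS0 t ht'), abs_of_nonneg (hJ0 t ht'),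
        hSe t ht', hJe t ht']
      exact h t ht')
  have hr : t₁ ∈ Icc 0 t₁ := ⟨ht₁, le_rfl⟩
  refine le_antisymm ((h t₁ hr).trans ?_) (integral_nonneg h0)
  rw [← hJe t₁ hr, hz t₁ hr, mul_zero]

namespace Mode
variable {a₁ ay₁ G₁ a₂ ay₂ G₂ : ℝ → ℝ → ℝ} {T A A' B L : ℝ}

lemma ae_eq_zero (H₁ : Mode a₁ ay₁ G₁ T A A' B) (H₂ : Mode a₂ ay₂ G₂ T A A' B)
    (h₁ : ∀ t ∈ Ioo 0 T, ∫ y in Ioi 0, G₁ t y ^ 2 ≤ L * ∫ y in Ioi 0, a₂ t y ^ 2)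
    (h₂ : ∀ t ∈ Ioo 0 T, ∫ y in Ioi 0, G₂ t y ^ 2 ≤ L * ∫ y in Ioi 0, a₁ t y ^ 2) :
    ∀ᵐ t, t ∈ Ioo 0 T → ∀ᵐ y, 0 < y → a₁ t y = 0 := by
  have key : ∀ t₁ ∈ Ioo 0 T, ∫ τ in Ioc 0 t₁,
      ((∫ y in Ioi 0, a₁ τ y ^ 2) + ∫ y in Ioi 0, a₂ τ y ^ 2) = 0 := by
    intro t₁ ht₁
    have hT : 0 < T := ht₁.1.trans ht₁.2
    have inI : ∀ {t}, 0 < t → t ≤ t₁ → t ∈ Ioo 0 T := fun h h' => ⟨h, h'.trans_lt ht₁.2⟩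
    refine integral_eq_zero_of_gronwall (K := T * L) ht₁.1.le
      ((H₁.ha.time_int ht₁).add (H₂.ha.time_int ht₁))
      (fun t => add_nonneg (integral_nonneg fun _ => sq_nonneg _)
        (integral_nonneg fun _ => sq_nonneg _)) (fun t ht => ?_)
    rcases ht.1.eq_or_lt with h0 | h0
    · simp [← h0]
    have ht' := inI h0 ht.2
    have prim_int : ∀ {f : ℝ → ℝ → ℝ} {C : ℝ}, L2On f T C → IntegrableOn
        (fun τ => ∫ r in Ioc 0 τ, ∫ y in Ioi 0, f r y ^ 2) (Ioc 0 t) := by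
      intro f C hf
      have hi : IntervalIntegrable (fun τ => ∫ y in Ioi 0, f τ y ^ 2) volume 0 t :=
        (intervalIntegrable_iff_integrableOn_Ioc_of_le ht'.1.le).2 (hf.time_int ht')
      have hc := (hi.absolutelyContinuousOnInterval_intervalIntegral (c := 0)
        (by simp)).continuousOn
      have h3 := hc.intervalIntegrable (μ := volume)
      rw [intervalIntegrable_iff_integrableOn_Ioc_of_le ht'.1.le] at h3
      refine h3.congr_fun (fun τ hτ => ?_) measurableSet_Ioc
      simp only
      rw [intervalIntegral.integral_of_le hτ.1.le]
    have one : ∀ {a ay G b : ℝ → ℝ → ℝ}, Mode a ay G T A A' B → L2On b T A →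
        (∀ t ∈ Ioo 0 T, ∫ y in Ioi 0, G t y ^ 2 ≤ L * ∫ y in Ioi 0, b t y ^ 2) →
        ∫ τ in Ioc 0 t, ∫ y in Ioi 0, a τ y ^ 2 ≤
          T * L * ∫ τ in Ioc 0 t, ∫ r in Ioc 0 τ, ∫ y in Ioi 0, b r y ^ 2 := by
      intro a ay G b H hb hGb
      refine (H.energy_le ht').trans ?_
      rw [← integral_const_mul]
      refine integral_mono_of_nonneg ?_ ((prim_int hb).const_mul _) ?_
      · rw [EventuallyLE, ae_restrict_iff' measurableSet_Ioc]
        exact Eventually.of_forall fun τ hτ => mul_nonneg hτ.1.le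
          (integral_nonneg fun _ => integral_nonneg fun _ => sq_nonneg _)
      · rw [EventuallyLE, ae_restrict_iff' measurableSet_Ioc]
        refine Eventually.of_forall fun τ hτ => ?_
        have hτ' := L2On.Ioc_sub ht' hτ
        have i1 : ∫ r in Ioc 0 τ, ∫ y in Ioi 0, G r y ^ 2 ≤
            L * ∫ r in Ioc 0 τ, ∫ y in Ioi 0, b r y ^ 2 := by
          rw [← integral_const_mul]
          exact setIntegral_mono_on (H.hG.time_int hτ') ((hb.time_int hτ').const_mul L)
            measurableSet_Ioc fun r hr => hGb r (L2On.Ioc_sub hτ' hr)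
        have i2 : 0 ≤ ∫ r in Ioc 0 τ, ∫ y in Ioi 0, G r y ^ 2 :=
          integral_nonneg fun _ => integral_nonneg fun _ => sq_nonneg _
        rw [mul_assoc]
        exact mul_le_mul hτ'.2.le i1 i2 hT.le
    rw [integral_add (H₁.ha.time_int ht') (H₂.ha.time_int ht')]
    have e1 : ∫ τ in Ioc 0 t, ∫ r in Ioc 0 τ,
        ((∫ y in Ioi 0, a₁ r y ^ 2) + ∫ y in Ioi 0, a₂ r y ^ 2) =
        (∫ τ in Ioc 0 t, ∫ r in Ioc 0 τ, ∫ y in Ioi 0, a₁ r y ^ 2) +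
        ∫ τ in Ioc 0 t, ∫ r in Ioc 0 τ, ∫ y in Ioi 0, a₂ r y ^ 2 := by
      rw [← integral_add (prim_int H₁.ha) (prim_int H₂.ha)]
      refine setIntegral_congr_fun measurableSet_Ioc fun τ hτ => ?_
      have hτ' := L2On.Ioc_sub ht' hτ
      exact integral_add (H₁.ha.time_int hτ') (H₂.ha.time_int hτ')
    rw [e1]
    have := one H₁ H₂.ha h₁
    have := one H₂ H₁.ha h₂
    linarith
  have key2 : ∀ t₁ ∈ Ioo 0 T, ∀ᵐ t, t ∈ Ioc 0 t₁ → ∀ᵐ y, 0 < y → a₁ t y = 0 := by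
    intro t₁ ht₁
    have h := (setIntegral_eq_zero_iff_of_nonneg_ae
      (Eventually.of_forall fun t => add_nonneg (integral_nonneg fun _ => sq_nonneg _)
        (integral_nonneg fun _ => sq_nonneg _))
      ((H₁.ha.time_int ht₁).add (H₂.ha.time_int ht₁))).1 (key t₁ ht₁)
    rw [EventuallyEq, ae_restrict_iff' measurableSet_Ioc] at h
    filter_upwards [h] with t ht htm
    have h1 := ht htm
    simp only [Pi.zero_apply] at h1
    have p1 : 0 ≤ ∫ y in Ioi 0, a₁ t y ^ 2 := integral_nonneg fun _ => sq_nonneg _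
    have p2 : 0 ≤ ∫ y in Ioi 0, a₂ t y ^ 2 := integral_nonneg fun _ => sq_nonneg _
    have h2 : ∫ y in Ioi 0, a₁ t y ^ 2 = 0 := by linarith
    have h3 := (setIntegral_eq_zero_iff_of_nonneg_ae
      (Eventually.of_forall fun y => sq_nonneg _)
      (H₁.ha.int t (L2On.Ioc_sub ht₁ htm))).1 h2
    rw [EventuallyEq, ae_restrict_iff' measurableSet_Ioi] at h3
    filter_upwards [h3] with y hy hy0
    simpa using hy hy0
  by_cases hT : 0 < T
  · have : ∀ᵐ t, ∀ n : ℕ, t ∈ Ioc 0 (T * (1 - 1 / ((n : ℝ) + 2))) →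
        ∀ᵐ y, 0 < y → a₁ t y = 0 := by
      refine ae_all_iff.2 fun n => key2 _ ⟨?_, ?_⟩
      · refine mul_pos hT ?_
        have : 1 / ((n : ℝ) + 2) < 1 := by
          rw [div_lt_one (by positivity)]
          have : (0 : ℝ) ≤ n := Nat.cast_nonneg n
          linarith
        linarith
      · have : 0 < 1 / ((n : ℝ) + 2) := by positivity
        nlinarith
    filter_upwards [this] with t ht htm
    obtain ⟨n, hn⟩ := exists_nat_gt (T / (T - t))
    refine ht n ⟨htm.1, ?_⟩
    have hTt : 0 < T - t := by linarith [htm.2]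
    rw [div_lt_iff₀ hTt] at hn
    have h2 : T * (1 / ((n : ℝ) + 2)) ≤ T - t := by
      rw [mul_one_div, div_le_iff₀ (by positivity)]
      nlinarith
    linarith
  · exact Eventually.of_forall fun t ht => absurd (ht.1.trans ht.2) hT

end Mode

lemma integrable_prod_comm₃ {α β γ : Type*} [MeasurableSpace α] [MeasurableSpace β]
    [MeasurableSpace γ] {μ : Measure α} {ν : Measure β} {ρ : Measure γ} [SFinite μ] [SFinite ν]
    [SFinite ρ] {f : α → β → γ → ℝ} (hf : Measurable fun p : α × β × γ => f p.1 p.2.1 p.2.2)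
    (hi : Integrable (fun p : α × β × γ => f p.1 p.2.1 p.2.2) (μ.prod (ν.prod ρ))) :
    Integrable (fun p : β × α × γ => f p.2.1 p.1 p.2.2) (ν.prod (μ.prod ρ)) := by
  have hf' : Measurable fun p : β × α × γ => f p.2.1 p.1 p.2.2 :=
    hf.comp ((measurable_fst.comp measurable_snd).prodMk
      (measurable_fst.prodMk (measurable_snd.comp measurable_snd)))
  refine ⟨hf'.aestronglyMeasurable, ?_⟩
  have h := hi.2
  rw [hasFiniteIntegral_iff_enorm] at h ⊢
  rw [lintegral_prod _ hf'.enorm.aemeasurable]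
  rw [lintegral_prod _ hf.enorm.aemeasurable] at h
  have e1 : ∀ x : β, ∫⁻ q : α × γ, ‖f q.1 x q.2‖ₑ ∂(μ.prod ρ) =
      ∫⁻ t, ∫⁻ y, ‖f t x y‖ₑ ∂ρ ∂μ := fun x =>
    lintegral_prod _ (hf'.enorm.comp (measurable_const.prodMk measurable_id)).aemeasurable
  have e2 : ∀ t : α, ∫⁻ q : β × γ, ‖f t q.1 q.2‖ₑ ∂(ν.prod ρ) =
      ∫⁻ x, ∫⁻ y, ‖f t x y‖ₑ ∂ρ ∂ν := fun t =>
    lintegral_prod _ (hf.enorm.comp (measurable_const.prodMk measurable_id)).aemeasurable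
  simp only [e1]
  simp only [e2] at h
  rw [lintegral_lintegral_swap]
  · exact h
  · refine (Measurable.lintegral_prod_right' (ν := ρ) (f := fun q : (β × α) × γ => ‖f q.1.2 q.1.1 q.2‖ₑ)
      ?_).aemeasurable
    exact hf'.enorm.comp ((measurable_fst.comp measurable_fst).prodMk
      ((measurable_snd.comp measurable_fst).prodMk measurable_snd))

lemma integral_comm₃ {α β γ : Type*} [MeasurableSpace α] [MeasurableSpace β]
    [MeasurableSpace γ] {μ : Measure α} {ν : Measure β} {ρ : Measure γ} [SFinite μ] [SFinite ν]
    [SFinite ρ] {f : α → β → γ → ℝ}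
    (hi : Integrable (fun p : β × α × γ => f p.2.1 p.1 p.2.2) (ν.prod (μ.prod ρ))) :
    ∫ x, ∫ y, ∫ t, f t x y ∂μ ∂ρ ∂ν = ∫ t, ∫ y, ∫ x, f t x y ∂ν ∂ρ ∂μ := by
  have h1 : ∫ x, ∫ y, ∫ t, f t x y ∂μ ∂ρ ∂ν = ∫ x, ∫ q : α × γ, f q.1 x q.2 ∂(μ.prod ρ) ∂ν := by
    refine integral_congr_ae ?_
    filter_upwards [hi.prod_right_ae] with x hx
    rw [integral_prod _ hx]
    exact (integral_integral_swap hx).symm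
  rw [h1, integral_integral_swap (f := fun x (q : α × γ) => f q.1 x q.2) hi]
  exact integral_prod _ hi.integral_prod_right

/-- Value bound on the unit interval by the `H¹` norm. -/
lemma sq_le_of_hasDerivAt {f f' : ℝ → ℝ} (hf : ∀ x, HasDerivAt f (f' x) x)
    (h' : IntegrableOn (fun x => f' x ^ 2) (Ioc 0 1)) {x : ℝ} (hx : x ∈ Icc (0 : ℝ) 1) :
    f x ^ 2 ≤ 2 * ((∫ z in Ioc 0 1, f z ^ 2) + ∫ z in Ioc 0 1, f' z ^ 2) := by
  have hc : Continuous f := continuous_iff_continuousAt.2 fun x => (hf x).continuousAt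
  have hm' : AEStronglyMeasurable f' (volume.restrict (Ioc 0 1)) := by
    have : f' = deriv f := funext fun x => (hf x).deriv.symm
    rw [this]
    exact (measurable_deriv f).aestronglyMeasurable
  have hi' : IntegrableOn f' (Ioc 0 1) := integrable_of_sq hm' h'
  have hsq : IntegrableOn (fun z => f z ^ 2) (Ioc 0 1) :=
    ((hc.pow 2).integrableOn_Icc (a := 0) (b := 1)).mono_set Ioc_subset_Icc_self
  have hi : IntegrableOn f (Ioc 0 1) := hc.integrableOn_Icc.mono_set Ioc_subset_Icc_self
  have key : ∀ z ∈ Ioc (0 : ℝ) 1, |f x| ≤ |f z| + ∫ r in Ioc 0 1, |f' r| := by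
    intro z hz
    have hII : IntervalIntegrable f' volume z x := by
      rw [intervalIntegrable_iff]
      refine hi'.mono_set ?_
      rw [uIoc]
      exact Ioc_subset_Ioc (le_min hz.1.le hx.1) (max_le hz.2 hx.2)
    have h1 := intervalIntegral.integral_eq_sub_of_hasDerivAt (fun r _ => hf r) hII
    have h2 : |∫ r in z..x, f' r| ≤ ∫ r in Ioc 0 1, |f' r| := by
      rw [← Real.norm_eq_abs]
      refine (intervalIntegral.norm_integral_le_integral_norm_uIoc).trans ?_
      refine setIntegral_mono_set hi'.norm (Eventually.of_forall fun _ => norm_nonneg _) ?_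
      refine LE.le.eventuallyLE ?_
      rw [uIoc]
      exact Ioc_subset_Ioc (le_min hz.1.le hx.1) (max_le hz.2 hx.2)
    rw [h1] at h2
    have h3 := abs_add_le (f x - f z) (f z)
    rw [sub_add_cancel] at h3
    linarith
  have h1 : |f x| ≤ (∫ z in Ioc 0 1, |f z|) + ∫ r in Ioc 0 1, |f' r| := by
    have := setIntegral_mono_on (μ := volume) (f := fun _ => |f x|)
      (g := fun z => |f z| + ∫ r in Ioc 0 1, |f' r|) (s := Ioc (0 : ℝ) 1) (by simp)
      (hi.abs.add (by simp)) measurableSet_Ioc key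
    rw [integral_add hi.abs (by simp)] at this
    simpa using this
  have s1 : (∫ z in Ioc 0 1, |f z|) ^ 2 ≤ ∫ z in Ioc 0 1, f z ^ 2 := by
    have := sq_integral_le (μ := volume.restrict (Ioc (0 : ℝ) 1)) (f := fun z => |f z|)
      hc.abs.aestronglyMeasurable (by simpa only [sq_abs, IntegrableOn] using hsq)
    simpa [sq_abs] using this
  have s2 : (∫ z in Ioc 0 1, |f' z|) ^ 2 ≤ ∫ z in Ioc 0 1, f' z ^ 2 := by
    have := sq_integral_le (μ := volume.restrict (Ioc (0 : ℝ) 1)) (f := fun z => |f' z|)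
      hm'.norm (by simpa only [sq_abs, IntegrableOn] using h')
    simpa [sq_abs] using this
  have p : |f x| ^ 2 ≤ ((∫ z in Ioc 0 1, |f z|) + ∫ r in Ioc 0 1, |f' r|) ^ 2 :=
    pow_le_pow_left₀ (abs_nonneg _) h1 2
  rw [sq_abs] at p
  have q := sq_nonneg ((∫ z in Ioc 0 1, |f z|) - ∫ r in Ioc 0 1, |f' r|)
  nlinarith [q, p, s1, s2]

/-- Functions of time and position which are square integrable over a period in `x`,
uniformly in time. -/
structure L2Strip (q : ℝ → ℝ → ℝ → ℝ) (T A : ℝ) : Prop where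
  meas : Measurable fun p : ℝ × ℝ × ℝ => q p.1 p.2.1 p.2.2
  int : ∀ t ∈ Icc 0 T, IntegrableOn (fun p : ℝ × ℝ => q t p.1 p.2 ^ 2) (Ioc 0 1 ×ˢ Ioi 0)
  bound : ∀ t ∈ Icc 0 T, ∫ p in Ioc (0 : ℝ) 1 ×ˢ Ioi (0 : ℝ), q t p.1 p.2 ^ 2 ≤ A

/-- Weighted average over a period in `x`. -/
noncomputable def Xav (q : ℝ → ℝ → ℝ → ℝ) (e : ℝ → ℝ) (t y : ℝ) : ℝ :=
  ∫ x in Ioc 0 1, q t x y * e x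

namespace L2Strip
variable {q : ℝ → ℝ → ℝ → ℝ} {T A K t : ℝ} {e : ℝ → ℝ} (H : L2Strip q T A)
include H

lemma meas_slice (t : ℝ) : Measurable fun p : ℝ × ℝ => q t p.1 p.2 :=
  H.meas.comp (measurable_const.prodMk measurable_id)

lemma meas_y (t x : ℝ) : Measurable fun y => q t x y :=
  (H.meas_slice t).comp (measurable_const.prodMk measurable_id)

lemma meas_x (t y : ℝ) : Measurable fun x => q t x y :=
  (H.meas_slice t).comp (measurable_id.prodMk measurable_const)

lemma int_prod (ht : t ∈ Icc 0 T) : Integrable (fun p : ℝ × ℝ => q t p.1 p.2 ^ 2)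
    ((volume.restrict (Ioc 0 1)).prod (volume.restrict (Ioi 0))) := by
  have := H.int t ht
  rwa [IntegrableOn, Measure.volume_eq_prod, ← Measure.prod_restrict] at this

lemma bound_prod (ht : t ∈ Icc 0 T) :
    ∫ y in Ioi 0, ∫ x in Ioc 0 1, q t x y ^ 2 ≤ A := by
  have h := H.bound t ht
  rw [Measure.volume_eq_prod, ← Measure.prod_restrict, integral_prod _ (H.int_prod ht),
    integral_integral_swap (H.int_prod ht)] at h
  exact h

lemma sq_x (ht : t ∈ Icc 0 T) : ∀ᵐ y ∂volume.restrict (Ioi (0 : ℝ)),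
    IntegrableOn (fun x => q t x y ^ 2) (Ioc 0 1) := (H.int_prod ht).prod_left_ae

lemma sq_y (ht : t ∈ Icc 0 T) : ∀ᵐ x ∂volume.restrict (Ioc (0 : ℝ) 1),
    IntegrableOn (fun y => q t x y ^ 2) (Ioi 0) := (H.int_prod ht).prod_right_ae

lemma int_x (ht : t ∈ Icc 0 T) : ∀ᵐ y ∂volume.restrict (Ioi (0 : ℝ)),
    IntegrableOn (fun x => q t x y) (Ioc 0 1) := by
  filter_upwards [H.sq_x ht] with y hy
  exact integrable_of_sq (H.meas_x t y).aestronglyMeasurable hy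

lemma int_y (ht : t ∈ Icc 0 T) (R : ℝ) : ∀ᵐ x ∂volume.restrict (Ioc (0 : ℝ) 1),
    IntegrableOn (fun y => q t x y) (Ioc 0 R) := by
  filter_upwards [H.sq_y ht] with x hx
  exact integrable_of_sq (H.meas_y t x).aestronglyMeasurable
    (hx.mono_set Ioc_subset_Ioi_self)

lemma int_rect (ht : t ∈ Icc 0 T) (R : ℝ) : Integrable (fun p : ℝ × ℝ => q t p.1 p.2)
    ((volume.restrict (Ioc 0 1)).prod (volume.restrict (Ioc 0 R))) := by
  refine integrable_of_sq (H.meas_slice t).aestronglyMeasurable ?_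
  have := (H.int t ht).mono_set (prod_mono_right (s := Ioc (0 : ℝ) 1)
    (Ioc_subset_Ioi_self : Ioc 0 R ⊆ Ioi 0))
  rwa [IntegrableOn, Measure.volume_eq_prod, ← Measure.prod_restrict] at this

lemma int_rect_mul (he : Measurable e) (hK : ∀ x, |e x| ≤ K) (ht : t ∈ Icc 0 T) (R : ℝ) :
    Integrable (fun p : ℝ × ℝ => q t p.1 p.2 * e p.1)
    ((volume.restrict (Ioc 0 1)).prod (volume.restrict (Ioc 0 R))) :=
  (H.int_rect ht R).mul_bdd (c := K) (he.comp measurable_fst).aestronglyMeasurable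
    (Eventually.of_forall fun p => hK p.1)

lemma int_box (R : ℝ) : Integrable (fun p : ℝ × ℝ × ℝ => q p.2.1 p.1 p.2.2)
    ((volume.restrict (Ioc 0 1)).prod
      ((volume.restrict (Ioo 0 T)).prod (volume.restrict (Ioc 0 R)))) := by
  refine integrable_prod_comm₃ H.meas ?_
  refine integrable_of_sq H.meas.aestronglyMeasurable ?_
  rw [Measure.prod_restrict, Measure.prod_restrict]
  refine integrableOn_prod_of_slice (G := fun t (p : ℝ × ℝ) => q t p.1 p.2 ^ 2) (C := A)
    measurableSet_Ioo (by simp) (H.meas.pow_const 2) (fun τ hτ => ?_) (fun τ hτ => ?_)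
  · exact (H.int τ (Ioo_subset_Icc_self hτ)).mono_set (prod_mono_right Ioc_subset_Ioi_self)
  · simp only [abs_sq]
    refine (setIntegral_mono_set (H.int τ (Ioo_subset_Icc_self hτ))
      (Eventually.of_forall fun _ => sq_nonneg _) ?_).trans (H.bound τ (Ioo_subset_Icc_self hτ))
    exact (prod_mono_right Ioc_subset_Ioi_self).eventuallyLE

lemma Xav_meas (he : Measurable e) : Measurable (Function.uncurry (Xav q e)) := by
  change Measurable fun p : ℝ × ℝ => ∫ x in Ioc 0 1, q p.1 x p.2 * e x
  refine (StronglyMeasurable.integral_prod_right' (ν := volume.restrict (Ioc (0 : ℝ) 1))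
    (f := fun z : (ℝ × ℝ) × ℝ => q z.1.1 z.2 z.1.2 * e z.2) ?_).measurable
  refine Measurable.stronglyMeasurable (Measurable.mul ?_ (he.comp measurable_snd))
  exact H.meas.comp ((measurable_fst.comp measurable_fst).prodMk
    (measurable_snd.prodMk (measurable_snd.comp measurable_fst)))

lemma Xav_sq_le (he : Measurable e) (hK : ∀ x, |e x| ≤ K) (ht : t ∈ Icc 0 T) :
    ∀ᵐ y ∂volume.restrict (Ioi (0 : ℝ)), Xav q e t y ^ 2 ≤ K ^ 2 * ∫ x in Ioc 0 1, q t x y ^ 2 := by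
  filter_upwards [H.sq_x ht] with y hy
  have hle : ∀ x, (q t x y * e x) ^ 2 ≤ K ^ 2 * q t x y ^ 2 := fun x => by
    have : e x ^ 2 ≤ K ^ 2 := by
      rw [← sq_abs]
      exact pow_le_pow_left₀ (abs_nonneg _) (hK x) 2
    nlinarith [mul_le_mul_of_nonneg_left this (sq_nonneg (q t x y))]
  have hm : Measurable fun x => q t x y * e x := (H.meas_x t y).mul he
  have hi : IntegrableOn (fun x => (q t x y * e x) ^ 2) (Ioc 0 1) :=
    Integrable.mono' (hy.const_mul (K ^ 2)) (hm.pow_const 2).aestronglyMeasurable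
      (Eventually.of_forall fun x => by
        rw [Real.norm_eq_abs, abs_sq]
        exact hle x)
  have := sq_integral_le (μ := volume.restrict (Ioc (0 : ℝ) 1)) hm.aestronglyMeasurable hi
  simp only [measureReal_restrict_apply_univ, Real.volume_real_Ioc, sub_zero, max_eq_left
    zero_le_one, one_mul] at this
  refine this.trans ?_
  rw [← integral_const_mul]
  exact integral_mono hi (hy.const_mul _) hle

lemma Xav_L2On (he : Measurable e) (hK : ∀ x, |e x| ≤ K) : L2On (Xav q e) T (K ^ 2 * A) := by
  have hi : ∀ t ∈ Icc 0 T, IntegrableOn (fun y => ∫ x in Ioc 0 1, q t x y ^ 2) (Ioi 0) :=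
    fun t ht => (H.int_prod ht).integral_prod_right
  have hm : ∀ t, Measurable (Xav q e t) := fun t =>
    (H.Xav_meas he).comp (measurable_const.prodMk measurable_id)
  have hI : ∀ t ∈ Icc 0 T, IntegrableOn (fun y => Xav q e t y ^ 2) (Ioi 0) := fun t ht => by
    refine Integrable.mono' ((hi t ht).const_mul (K ^ 2))
      ((hm t).pow_const 2).aestronglyMeasurable ?_
    filter_upwards [H.Xav_sq_le he hK ht] with y hy
    rwa [Real.norm_eq_abs, abs_sq]
  refine ⟨H.Xav_meas he, fun t ht => hI t (Ioo_subset_Icc_self ht), fun t ht => ?_⟩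
  have ht' := Ioo_subset_Icc_self ht
  refine (integral_mono_ae (hI t ht') ((hi t ht').const_mul (K ^ 2))
    (H.Xav_sq_le he hK ht')).trans ?_
  rw [integral_const_mul]
  exact mul_le_mul_of_nonneg_left (H.bound_prod ht') (sq_nonneg K)

lemma integral_Xav (he : Measurable e) (hK : ∀ x, |e x| ≤ K) (ht : t ∈ Icc 0 T) {R : ℝ} :
    ∫ x in Ioc 0 1, (∫ y in Ioc 0 R, q t x y) * e x = ∫ y in Ioc 0 R, Xav q e t y := by
  have := integral_integral_swap (f := fun x y => q t x y * e x) (H.int_rect_mul he hK ht R)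
  simp only [integral_mul_const] at this
  exact this

end L2Strip

/-- Solutions of the linearized Prandtl equation with zero boundary and initial data. -/
structure PrandtlSol (us usy : ℝ → ℝ → ℝ) (u ut ux uy uyy : ℝ → ℝ → ℝ → ℝ) (T M A : ℝ) : Prop where
  cus : Continuous (Function.uncurry us)
  cusy : Continuous (Function.uncurry usy)
  usint : ∀ t ∈ Icc 0 T, IntegrableOn (fun y => y * usy t y ^ 2) (Ioi 0)
  usM : ∀ t ∈ Icc 0 T, ∀ y, 0 ≤ y → |us t y| ≤ M
  usyM : ∀ t ∈ Icc 0 T, ∫ y in Ioi 0, y * usy t y ^ 2 ≤ M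
  per : ∀ t x y, u t (x + 1) y = u t x y
  dt : ∀ t x y, HasDerivAt (fun s => u s x y) (ut t x y) t
  dx : ∀ t x y, HasDerivAt (fun s => u t s y) (ux t x y) x
  dy : ∀ t x y, HasDerivAt (fun s => u t x s) (uy t x y) y
  dyy : ∀ t x y, HasDerivAt (fun s => uy t x s) (uyy t x y) y
  Lu : L2Strip u T A
  Lux : L2Strip ux T A
  Luy : L2Strip uy T A
  mF : Measurable fun p : ℝ × ℝ × ℝ => ut p.1 p.2.1 p.2.2 - uyy p.1 p.2.1 p.2.2
  eqn : ∀ t ∈ Ioo (0 : ℝ) T, ∀ x : ℝ, ∀ y ∈ Ioi (0 : ℝ),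
    ut t x y - uyy t x y = usy t y * (∫ y' in Ioc 0 y, ux t x y') - us t y * ux t x y
  bc : ∀ t ∈ Icc (0 : ℝ) T, ∀ x : ℝ, u t x 0 = 0
  ic : ∀ x : ℝ, ∀ y, 0 ≤ y → u 0 x y = 0

/-- The source of a mode, in terms of the weighted average of the solution. -/
noncomputable def modeSource (us usy c : ℝ → ℝ → ℝ) (t y : ℝ) : ℝ :=
  us t y * c t y - usy t y * ∫ z in Ioc 0 y, c t z

namespace PrandtlSol
variable {us usy : ℝ → ℝ → ℝ} {u ut ux uy uyy : ℝ → ℝ → ℝ → ℝ} {T M A : ℝ}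
  (H : PrandtlSol us usy u ut ux uy uyy T M A)
include H

lemma source_int (R : ℝ) : Integrable
    (fun p : ℝ × ℝ × ℝ => ut p.2.1 p.1 p.2.2 - uyy p.2.1 p.1 p.2.2)
    ((volume.restrict (Ioc 0 1)).prod
      ((volume.restrict (Ioo 0 T)).prod (volume.restrict (Ioc 0 R)))) := by
  have hm : Measurable fun p : ℝ × ℝ × ℝ => ut p.2.1 p.1 p.2.2 - uyy p.2.1 p.1 p.2.2 :=
    H.mF.comp ((measurable_fst.comp measurable_snd).prodMk
      (measurable_fst.prodMk (measurable_snd.comp measurable_snd)))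
  have hmx : Measurable fun p : ℝ × ℝ × ℝ => ux p.2.1 p.1 p.2.2 :=
    H.Lux.meas.comp ((measurable_fst.comp measurable_snd).prodMk
      (measurable_fst.prodMk (measurable_snd.comp measurable_snd)))
  obtain ⟨C, hC⟩ := (isCompact_Icc.prod isCompact_Icc : IsCompact
    (Icc (0 : ℝ) T ×ˢ Icc (0 : ℝ) R)).exists_bound_of_continuousOn H.cusy.continuousOn
  have hb : ∀ t ∈ Ioo 0 T, ∀ x, ∫⁻ y in Ioc 0 R, ‖ut t x y - uyy t x y‖ₑ ≤
      (ENNReal.ofReal C * ENNReal.ofReal R + ENNReal.ofReal M) * ∫⁻ y in Ioc 0 R, ‖ux t x y‖ₑ := by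
    intro t ht x
    have ht' := Ioo_subset_Icc_self ht
    have hp : ∀ y ∈ Ioc 0 R, ‖ut t x y - uyy t x y‖ₑ ≤
        ENNReal.ofReal C * (∫⁻ y in Ioc 0 R, ‖ux t x y‖ₑ) + ENNReal.ofReal M * ‖ux t x y‖ₑ := by
      intro y hy
      rw [H.eqn t ht x y hy.1]
      refine (enorm_sub_le).trans ?_
      rw [enorm_mul, enorm_mul]
      have b1 : ‖usy t y‖ₑ ≤ ENNReal.ofReal C := by
        rw [← ofReal_norm]
        exact ENNReal.ofReal_le_ofReal (hC (t, y) ⟨ht', hy.1.le, hy.2⟩)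
      have b2 : ‖us t y‖ₑ ≤ ENNReal.ofReal M := by
        rw [← ofReal_norm]
        exact ENNReal.ofReal_le_ofReal (H.usM t ht' y hy.1.le)
      have b3 : ‖∫ y' in Ioc 0 y, ux t x y'‖ₑ ≤ ∫⁻ y in Ioc 0 R, ‖ux t x y‖ₑ :=
        (enorm_integral_le_lintegral_enorm _).trans
          (lintegral_mono_set (Ioc_subset_Ioc_right hy.2))
      exact add_le_add (mul_le_mul' b1 b3) (mul_le_mul' b2 le_rfl)
    refine (setLIntegral_mono' measurableSet_Ioc hp).trans ?_
    rw [lintegral_add_left measurable_const, lintegral_const,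
      lintegral_const_mul _ (H.Lux.meas_y t x).enorm]
    simp only [Measure.restrict_apply_univ, Real.volume_Ioc, sub_zero]
    refine le_of_eq ?_
    ring
  refine ⟨hm.aestronglyMeasurable, ?_⟩
  have hx := (H.Lux.int_box R).2
  rw [hasFiniteIntegral_iff_enorm] at hx ⊢
  have conv : ∀ f : ℝ → ℝ → ℝ → ℝ, Measurable (fun p : ℝ × ℝ × ℝ => f p.2.1 p.1 p.2.2) →
      ∫⁻ p : ℝ × ℝ × ℝ, ‖f p.2.1 p.1 p.2.2‖ₑ ∂((volume.restrict (Ioc 0 1)).prod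
        ((volume.restrict (Ioo 0 T)).prod (volume.restrict (Ioc 0 R)))) =
      ∫⁻ x in Ioc 0 1, ∫⁻ t in Ioo 0 T, ∫⁻ y in Ioc 0 R, ‖f t x y‖ₑ := by
    intro f hf
    rw [lintegral_prod _ hf.enorm.aemeasurable]
    refine lintegral_congr fun x => ?_
    exact lintegral_prod _ (hf.enorm.comp (measurable_const.prodMk measurable_id)).aemeasurable
  rw [conv (fun t x y => ut t x y - uyy t x y) hm]
  rw [conv ux hmx] at hx
  have hfin : (ENNReal.ofReal C * ENNReal.ofReal R + ENNReal.ofReal M) ≠ ⊤ := by finiteness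
  refine lt_of_le_of_lt ?_ (ENNReal.mul_lt_top hfin.lt_top hx)
  rw [← lintegral_const_mul' _ _ hfin]
  refine lintegral_mono fun x => ?_
  rw [← lintegral_const_mul' _ _ hfin]
  exact setLIntegral_mono' measurableSet_Ioo fun t ht => hb t ht x

lemma sq_slice {t : ℝ} (ht : t ∈ Icc 0 T) {x : ℝ} (hx : x ∈ Icc (0 : ℝ) 1) :
    IntegrableOn (fun y => u t x y ^ 2) (Ioi 0) ∧ ∫ y in Ioi 0, u t x y ^ 2 ≤ 4 * A := by
  have i1 := (H.Lu.int_prod ht).integral_prod_right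
  have i2 := (H.Lux.int_prod ht).integral_prod_right
  have hle : ∀ᵐ y ∂volume.restrict (Ioi (0 : ℝ)), u t x y ^ 2 ≤
      2 * ((∫ z in Ioc 0 1, u t z y ^ 2) + ∫ z in Ioc 0 1, ux t z y ^ 2) := by
    filter_upwards [H.Lux.sq_x ht] with y hy
    exact sq_le_of_hasDerivAt (fun x => H.dx t x y) hy hx
  have i3 : IntegrableOn (fun y => 2 * ((∫ z in Ioc 0 1, u t z y ^ 2) +
      ∫ z in Ioc 0 1, ux t z y ^ 2)) (Ioi 0) := (i1.add i2).const_mul 2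
  have i0 : IntegrableOn (fun y => u t x y ^ 2) (Ioi 0) := by
    refine Integrable.mono' i3 ((H.Lu.meas_y t x).pow_const 2).aestronglyMeasurable ?_
    filter_upwards [hle] with y hy
    rwa [Real.norm_eq_abs, abs_sq]
  refine ⟨i0, (integral_mono_ae i0 i3 hle).trans ?_⟩
  rw [integral_const_mul, integral_add i1 i2]
  have := H.Lu.bound_prod ht
  have := H.Lux.bound_prod ht
  linarith

lemma heatData (R : ℝ) : ∀ᵐ x ∂volume.restrict (Ioc (0 : ℝ) 1),
    HeatData (fun t y => u t x y) (fun t y => ut t x y) (fun t y => uy t x y)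
      (fun t y => uyy t x y) (fun t y => ut t x y - uyy t x y) 0 T 0 R (4 * A) := by
  have hsub : Ioo 0 T ×ˢ Ioo 0 R ⊆ Ioo 0 T ×ˢ Ioc 0 R := prod_mono_right Ioo_subset_Ioc_self
  filter_upwards [(H.source_int R).prod_right_ae, (H.Luy.int_box R).prod_right_ae,
    ae_restrict_mem measurableSet_Ioc] with x h1 h2 hx
  rw [Measure.prod_restrict, ← Measure.volume_eq_prod] at h1 h2
  have hx' := Ioc_subset_Icc_self hx
  refine ⟨fun t y => H.dt t x y, fun t y => H.dy t x y, fun t y => H.dyy t x y, fun _ _ => rfl,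
    IntegrableOn.mono_set h1 hsub, IntegrableOn.mono_set h2 hsub, fun t ht => ?_, fun t ht => ?_⟩
  · exact (H.sq_slice (Ioo_subset_Icc_self ht) hx').1.mono_set Ioo_subset_Ioi_self
  · refine (setIntegral_mono_set (H.sq_slice (Ioo_subset_Icc_self ht) hx').1
      (Eventually.of_forall fun _ => sq_nonneg _) ?_).trans
      (H.sq_slice (Ioo_subset_Icc_self ht) hx').2
    exact Ioo_subset_Ioi_self.eventuallyLE

omit H in
lemma prim_meas {c : ℝ → ℝ → ℝ} (hc : Measurable (Function.uncurry c)) :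
    Measurable fun p : ℝ × ℝ => ∫ z in Ioc 0 p.2, c p.1 z := by
  have h1 : (fun p : ℝ × ℝ => ∫ z in Ioc 0 p.2, c p.1 z) =
      fun p => ∫ z, indicator {q : (ℝ × ℝ) × ℝ | 0 < q.2 ∧ q.2 ≤ q.1.2}
        (fun q => c q.1.1 q.2) (p, z) := by
    ext p
    rw [← integral_indicator measurableSet_Ioc]
    rfl
  rw [h1]
  refine (StronglyMeasurable.integral_prod_right (ν := volume) ?_).measurable
  refine Measurable.stronglyMeasurable (Measurable.indicator ?_ ?_)
  · exact hc.comp ((measurable_fst.comp measurable_fst).prodMk measurable_snd)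
  · exact (measurableSet_lt measurable_const measurable_snd).inter
      (measurableSet_le measurable_snd (measurable_snd.comp measurable_fst))

lemma modeSource_bound {c : ℝ → ℝ → ℝ} {B t : ℝ} (hc : L2On c T B) (ht : t ∈ Ioo 0 T) :
    IntegrableOn (fun y => modeSource us usy c t y ^ 2) (Ioi 0) ∧
    ∫ y in Ioi 0, modeSource us usy c t y ^ 2 ≤
      (2 * M ^ 2 + 2 * M) * ∫ y in Ioi 0, c t y ^ 2 := by
  have ht' := Ioo_subset_Icc_self ht
  have hle : ∀ y ∈ Ioi (0 : ℝ), modeSource us usy c t y ^ 2 ≤ 2 * M ^ 2 * c t y ^ 2 +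
      2 * (∫ y in Ioi 0, c t y ^ 2) * (y * usy t y ^ 2) := by
    intro y (hy : 0 < y)
    have b1 : us t y ^ 2 ≤ M ^ 2 := by
      rw [← sq_abs]
      exact pow_le_pow_left₀ (abs_nonneg _) (H.usM t ht' y hy.le) 2
    have b2 : (∫ z in Ioc 0 y, c t z) ^ 2 ≤ y * ∫ y in Ioi 0, c t y ^ 2 := by
      have h1 := sq_integral_le (μ := volume.restrict (Ioc 0 y))
        (hc.slice_meas t).aestronglyMeasurable ((hc.int t ht).mono_set Ioc_subset_Ioi_self)
      simp only [measureReal_restrict_apply_univ, Real.volume_real_Ioc, sub_zero,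
        max_eq_left hy.le] at h1
      refine h1.trans (mul_le_mul_of_nonneg_left ?_ hy.le)
      exact setIntegral_mono_set (hc.int t ht) (Eventually.of_forall fun _ => sq_nonneg _)
        Ioc_subset_Ioi_self.eventuallyLE
    have b3 := mul_le_mul_of_nonneg_left b1 (sq_nonneg (c t y))
    have b4 := mul_le_mul_of_nonneg_left b2 (sq_nonneg (usy t y))
    rw [modeSource]
    nlinarith [sq_nonneg (us t y * c t y + usy t y * ∫ z in Ioc 0 y, c t z)]
  have hi1 := (hc.int t ht).const_mul (2 * M ^ 2)
  have hi2 := (H.usint t ht').const_mul (2 * (∫ y in Ioi 0, c t y ^ 2))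
  have hm : Measurable (modeSource us usy c t) := by
    refine Measurable.sub (Measurable.mul ?_ (hc.slice_meas t)) (Measurable.mul ?_ ?_)
    · exact (H.cus.comp (continuous_const.prodMk continuous_id)).measurable
    · exact (H.cusy.comp (continuous_const.prodMk continuous_id)).measurable
    · exact (prim_meas hc.meas).comp (measurable_const.prodMk measurable_id)
  have hi : IntegrableOn (fun y => modeSource us usy c t y ^ 2) (Ioi 0) := by
    refine Integrable.mono' (hi1.add hi2) (hm.pow_const 2).aestronglyMeasurable ?_
    rw [ae_restrict_iff' measurableSet_Ioi]
    refine Eventually.of_forall fun y hy => ?_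
    rw [Real.norm_eq_abs, abs_sq]
    exact hle y hy
  refine ⟨hi, (setIntegral_mono_on hi (hi1.add hi2) measurableSet_Ioi hle).trans ?_⟩
  have e1 : ∫ y in Ioi 0, (2 * M ^ 2 * c t y ^ 2 +
      2 * (∫ y in Ioi 0, c t y ^ 2) * (y * usy t y ^ 2)) = _ := integral_add hi1 hi2
  rw [integral_const_mul, integral_const_mul] at e1
  refine e1.le.trans ?_
  have p : 0 ≤ ∫ y in Ioi 0, c t y ^ 2 := integral_nonneg fun _ => sq_nonneg _
  nlinarith [mul_le_mul_of_nonneg_left (H.usyM t ht') p]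

lemma modeSource_L2On {c : ℝ → ℝ → ℝ} {B : ℝ} (hM : 0 ≤ M) (hc : L2On c T B) :
    L2On (modeSource us usy c) T ((2 * M ^ 2 + 2 * M) * B) := by
  refine ⟨?_, fun t ht => (H.modeSource_bound hc ht).1, fun t ht =>
    (H.modeSource_bound hc ht).2.trans (mul_le_mul_of_nonneg_left (hc.bound t ht) (by positivity))⟩
  exact (H.cus.measurable.mul hc.meas).sub (H.cusy.measurable.mul (prim_meas hc.meas))

end PrandtlSol

/-- Bounded `C¹` weights taking the same value at the ends of the unit interval. -/
structure PeriodWeight (e e' : ℝ → ℝ) (K : ℝ) : Prop where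
  deriv : ∀ x, HasDerivAt e (e' x) x
  cont : Continuous e'
  bound : ∀ x, |e x| ≤ K
  bound' : ∀ x, |e' x| ≤ K
  ends : e 1 = e 0

namespace PeriodWeight
variable {e e' : ℝ → ℝ} {K : ℝ} (W : PeriodWeight e e' K)
include W

lemma continuous : Continuous e := continuous_iff_continuousAt.2 fun x => (W.deriv x).continuousAt

end PeriodWeight

lemma exists_Ioo_subset_of_isCompact {a b : ℝ} (hab : a < b) {S : Set ℝ} (hS : IsCompact S)
    (h : S ⊆ Ioo a b) : ∃ c d, a < c ∧ c < d ∧ d < b ∧ S ⊆ Ioo c d := by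
  rcases S.eq_empty_or_nonempty with rfl | hne
  · exact ⟨(2 * a + b) / 3, (a + 2 * b) / 3, by linarith, by linarith, by linarith, by simp⟩
  · have h1 := h (hS.sInf_mem hne)
    have h2 := h (hS.sSup_mem hne)
    have hsub : ∀ y ∈ S, sInf S ≤ y ∧ y ≤ sSup S := fun y hy =>
      ⟨csInf_le hS.bddBelow hy, le_csSup hS.bddAbove hy⟩
    obtain ⟨y, hy⟩ := hne
    have h3 := hsub y hy
    refine ⟨(a + sInf S) / 2, (sSup S + b) / 2, by linarith [h1.1], by linarith [h1.1, h2.2],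
      by linarith [h2.2], fun z hz => ⟨?_, ?_⟩⟩
    · linarith [(hsub z hz).1, h1.1]
    · linarith [(hsub z hz).2, h2.2]

namespace PrandtlSol
variable {us usy : ℝ → ℝ → ℝ} {u ut ux uy uyy : ℝ → ℝ → ℝ → ℝ} {T M A t K : ℝ} {e e' : ℝ → ℝ}
  (H : PrandtlSol us usy u ut ux uy uyy T M A) (W : PeriodWeight e e' K)
include H W

lemma Xav_ux (ht : t ∈ Icc 0 T) :
    ∀ᵐ y ∂volume.restrict (Ioi (0 : ℝ)), Xav ux e t y = - Xav u e' t y := by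
  filter_upwards [H.Lux.int_x ht] with y hy
  have hII : IntervalIntegrable (fun x => ux t x y) volume 0 1 :=
    (intervalIntegrable_iff_integrableOn_Ioc_of_le zero_le_one).2 hy
  have h := intervalIntegral.integral_mul_deriv_eq_deriv_mul (a := 0) (b := 1)
    (u := fun x => u t x y) (u' := fun x => ux t x y) (v := e) (v' := e')
    (fun x _ => H.dx t x y) (fun x _ => W.deriv x) hII (W.cont.intervalIntegrable _ _)
  have hp : u t 1 y = u t 0 y := by simpa using H.per t 0 y
  rw [hp, W.ends, sub_self, zero_sub, intervalIntegral.integral_of_le zero_le_one,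
    intervalIntegral.integral_of_le zero_le_one] at h
  rw [Xav, Xav, h, neg_neg]

lemma source_avg (ht : t ∈ Ioo 0 T) : ∀ᵐ y ∂volume.restrict (Ioi (0 : ℝ)),
    IntegrableOn (fun x => (ut t x y - uyy t x y) * e x) (Ioc 0 1) ∧
    ∫ x in Ioc 0 1, (ut t x y - uyy t x y) * e x = modeSource us usy (Xav u e') t y := by
  have ht' := Ioo_subset_Icc_self ht
  have hx := H.Xav_ux W ht'
  filter_upwards [hx, H.Lux.int_x ht', ae_restrict_mem measurableSet_Ioi] with y h1 hi hy
  have em := W.continuous.measurable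
  have i1 : IntegrableOn (fun x => ux t x y * e x) (Ioc 0 1) :=
    Integrable.mul_bdd hi em.aestronglyMeasurable (Eventually.of_forall W.bound)
  have i2 : IntegrableOn (fun x => (∫ z in Ioc 0 y, ux t x z) * e x) (Ioc 0 1) :=
    Integrable.mul_bdd (H.Lux.int_rect ht' y).integral_prod_left em.aestronglyMeasurable
      (Eventually.of_forall W.bound)
  have i3 : IntegrableOn (fun x => usy t y * ((∫ z in Ioc 0 y, ux t x z) * e x)) (Ioc 0 1) :=
    i2.const_mul _
  have i4 : IntegrableOn (fun x => us t y * (ux t x y * e x)) (Ioc 0 1) := i1.const_mul _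
  have e1 : ∀ x, (ut t x y - uyy t x y) * e x =
      usy t y * ((∫ z in Ioc 0 y, ux t x z) * e x) - us t y * (ux t x y * e x) := fun x => by
    rw [H.eqn t ht x y hy]
    ring
  simp only [e1]
  refine ⟨i3.sub i4, ?_⟩
  rw [integral_sub i3 i4, integral_const_mul, integral_const_mul,
    H.Lux.integral_Xav em W.bound ht']
  have e2 : ∫ z in Ioc 0 y, Xav ux e t z = ∫ z in Ioc 0 y, - Xav u e' t z :=
    integral_congr_ae (ae_restrict_of_ae_restrict_of_subset Ioc_subset_Ioi_self hx)
  have e3 : ∫ x in Ioc 0 1, ux t x y * e x = - Xav u e' t y := h1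
  rw [e2, e3, integral_neg, modeSource]
  ring

lemma Xav_prim (ht : t ∈ Icc 0 T) {y : ℝ} (hy : 0 ≤ y) :
    Xav u e t y = ∫ z in (0 : ℝ)..y, Xav uy e t z := by
  rw [intervalIntegral.integral_of_le hy,
    ← H.Luy.integral_Xav W.continuous.measurable W.bound ht, Xav]
  refine integral_congr_ae ?_
  filter_upwards [H.Luy.int_y ht y] with x hx
  have hII : IntervalIntegrable (fun z => uy t x z) volume 0 y :=
    (intervalIntegrable_iff_integrableOn_Ioc_of_le hy).2 hx
  have := intervalIntegral.integral_eq_sub_of_hasDerivAt (fun z _ => H.dy t x z) hII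
  rw [H.bc t ht, sub_zero, intervalIntegral.integral_of_le hy] at this
  rw [this]

omit W in
lemma eqn_slice {s R : ℝ} (hs : s ∈ Ioo 0 T) (ht : t ∈ Ioo 0 T) (hst : s ≤ t) (hR : 0 < R) {φ : ℝ → ℝ}
    (hφ : ContDiff ℝ ∞ φ) (hsupp : tsupport φ ⊆ Ioo 0 R) :
    ∀ᵐ x ∂volume.restrict (Ioc (0 : ℝ) 1), ∫ y in Ioc 0 R, (u t x y - u s x y) * φ y =
      ∫ y in Ioc 0 R, ∫ τ in Ioc s t,
        ((ut τ x y - uyy τ x y) * φ y + u τ x y * deriv (deriv φ) y) := by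
  obtain ⟨c, d, hc, hcd, hd, hcd'⟩ : ∃ c d, 0 < c ∧ c < d ∧ d < R ∧ tsupport φ ⊆ Ioo c d := by
    exact exists_Ioo_subset_of_isCompact hR
      (isCompact_Icc.of_isClosed_subset (isClosed_tsupport _) (hsupp.trans Ioo_subset_Icc_self)) hsupp
  obtain ⟨d1, d2, d3, ⟨B, -, hB⟩, hz⟩ := testFunction_facts hφ hcd'
  filter_upwards [H.heatData R, (H.source_int R).prod_right_ae,
    (H.Lu.int_box R).prod_right_ae] with x hx h1 h1'
  rw [Measure.prod_restrict, ← Measure.volume_eq_prod] at h1 h1'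
  have hcm : c ∈ Ioo 0 R := ⟨hc, hcd.trans hd⟩
  have hdm : d ∈ Ioo 0 R := ⟨hc.trans hcd, hd⟩
  have hD := hx.Df_eq_zero_of_sol hs ht hcm hdm hcd (hx.sol_all hs ht hcm hdm) d1 d2 d3
    (hz c (by simp)).1 (hz d (by simp)).1 (hz c (by simp)).2.1 (hz d (by simp)).2.1
  have hsub : Ioc s t ⊆ Ioo 0 T := fun τ hτ => ⟨hs.1.trans hτ.1, hτ.2.trans_lt ht.2⟩
  have h2 : Integrable (fun p : ℝ × ℝ => ut p.1 x p.2 - uyy p.1 x p.2)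
      ((volume.restrict (Ioc s t)).prod (volume.restrict (Ioc 0 R))) := by
    rw [Measure.prod_restrict]
    exact IntegrableOn.mono_set h1 (prod_mono_left hsub)
  have hut : ∀ t, Continuous fun y => u t x y := fun t =>
    continuous_iff_continuousAt.2 fun y => (H.dy t x y).continuousAt
  have h3 : Integrable (fun p : ℝ × ℝ => u p.1 x p.2)
      ((volume.restrict (Ioc s t)).prod (volume.restrict (Ioc 0 R))) := by
    rw [Measure.prod_restrict]
    exact IntegrableOn.mono_set h1' (prod_mono_left hsub)
  have i1 : IntegrableOn (fun y => (u t x y - u s x y) * φ y) (Ioc 0 R) :=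
    ((((hut t).sub (hut s)).mul hφ.continuous).integrableOn_Icc).mono_set Ioc_subset_Icc_self
  have h4 : Integrable (fun p : ℝ × ℝ => (ut p.1 x p.2 - uyy p.1 x p.2) * φ p.2 +
      u p.1 x p.2 * deriv (deriv φ) p.2)
      ((volume.restrict (Ioc s t)).prod (volume.restrict (Ioc 0 R))) := by
    refine (h2.mul_bdd (c := B) ?_ (Eventually.of_forall fun p => (hB p.2).1)).add
      (h3.mul_bdd (c := B) ?_ (Eventually.of_forall fun p => (hB p.2).2.2))
    · exact (hφ.continuous.comp continuous_snd).aestronglyMeasurable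
    · exact (d3.comp continuous_snd).aestronglyMeasurable
  have i2 : IntegrableOn (fun y => ∫ τ in Ioc s t,
      ((ut τ x y - uyy τ x y) * φ y + u τ x y * deriv (deriv φ) y)) (Ioc 0 R) :=
    h4.integral_prod_right
  rw [← sub_eq_zero, ← integral_sub i1 i2]
  refine Eq.trans ?_ hD
  rw [Df, intervalIntegral.integral_of_le hcd.le]
  have hsub2 : Ioc c d ⊆ Ioc 0 R := Ioc_subset_Ioc hc.le hd.le
  rw [← setIntegral_eq_of_subset_of_forall_sdiff_eq_zero (μ := volume) (t := Ioc 0 R)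
    (f := fun y => gf (fun t y => u t x y) (fun t y => ut t x y - uyy t x y) s t y * φ y -
      Zf (fun t y => u t x y) s t y * deriv (deriv φ) y) measurableSet_Ioc hsub2 fun y hy => ?_]
  · refine integral_congr_ae ?_
    filter_upwards [h2.prod_left_ae, h3.prod_left_ae] with y k1 k2
    simp only [gf, Zf]
    rw [intervalIntegral.integral_of_le hst, intervalIntegral.integral_of_le hst,
      integral_add (k1.mul_const _) (k2.mul_const _), integral_mul_const, integral_mul_const]
    ring
  · have hy' : y ∉ Ioo c d := fun h => hy.2 (Ioo_subset_Ioc_self h)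
    simp [(hz y hy').1, (hz y hy').2.2]

end PrandtlSol

namespace PrandtlSol
variable {us usy : ℝ → ℝ → ℝ} {u ut ux uy uyy : ℝ → ℝ → ℝ → ℝ} {T M A t K : ℝ} {e e' : ℝ → ℝ}
  (H : PrandtlSol us usy u ut ux uy uyy T M A) (W : PeriodWeight e e' K)
include H W

/-- Time integrated equation for a mode, tested against `φ`. -/
lemma mode_eqn {s R : ℝ} (hs : s ∈ Ioo 0 T) (ht : t ∈ Ioo 0 T) (hst : s ≤ t) (hR : 0 < R)
    {φ : ℝ → ℝ} (hφ : ContDiff ℝ ∞ φ) (hsupp : tsupport φ ⊆ Ioo 0 R) :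
    ∫ y in Ioc 0 R, (Xav u e t y - Xav u e s y) * φ y =
      ∫ τ in Ioc s t, ∫ y in Ioc 0 R, (modeSource us usy (Xav u e') τ y * φ y +
        Xav u e τ y * deriv (deriv φ) y) := by
  obtain ⟨-, -, d3, ⟨B, -, hB⟩, -⟩ := testFunction_facts hφ hsupp
  have em := W.continuous.measurable
  have hsub : Ioc s t ⊆ Ioo 0 T := fun τ hτ => ⟨hs.1.trans hτ.1, hτ.2.trans_lt ht.2⟩
  have hle : (volume.restrict (Ioc (0 : ℝ) 1)).prod
      ((volume.restrict (Ioc s t)).prod (volume.restrict (Ioc 0 R))) ≤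
      (volume.restrict (Ioc 0 1)).prod
      ((volume.restrict (Ioo 0 T)).prod (volume.restrict (Ioc 0 R))) :=
    Measure.prod_mono le_rfl (Measure.prod_mono (Measure.restrict_mono hsub le_rfl) le_rfl)
  have k1 := ((H.source_int R).mono_measure hle).mul_bdd (c := B)
    (g := fun p => φ p.2.2) (hφ.continuous.comp (continuous_snd.comp continuous_snd)).aestronglyMeasurable
    (Eventually.of_forall fun p => (hB p.2.2).1)
  have k2 := ((H.Lu.int_box R).mono_measure hle).mul_bdd (c := B)
    (g := fun p => deriv (deriv φ) p.2.2)
    (d3.comp (continuous_snd.comp continuous_snd)).aestronglyMeasurable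
    (Eventually.of_forall fun p => (hB p.2.2).2.2)
  have k3 := (k1.add k2).mul_bdd (c := K) (g := fun p => e p.1)
    (em.comp measurable_fst).aestronglyMeasurable (Eventually.of_forall fun p => W.bound p.1)
  have sw := integral_comm₃ (f := fun τ x y => ((ut τ x y - uyy τ x y) * φ y +
    u τ x y * deriv (deriv φ) y) * e x) k3
  have l1 : ∫ x in Ioc 0 1, (∫ y in Ioc 0 R, (u t x y - u s x y) * φ y) * e x =
      ∫ x in Ioc 0 1, ∫ y in Ioc 0 R, ∫ τ in Ioc s t, ((ut τ x y - uyy τ x y) * φ y +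
        u τ x y * deriv (deriv φ) y) * e x := by
    refine integral_congr_ae ?_
    filter_upwards [H.eqn_slice hs ht hst hR hφ hsupp] with x hx
    simp only [integral_mul_const]
    rw [hx]
  have hs' := Ioo_subset_Icc_self hs
  have ht' := Ioo_subset_Icc_self ht
  have l2 : ∫ x in Ioc 0 1, (∫ y in Ioc 0 R, (u t x y - u s x y) * φ y) * e x =
      ∫ y in Ioc 0 R, (Xav u e t y - Xav u e s y) * φ y := by
    have j1 := ((H.Lu.int_rect ht' R).sub (H.Lu.int_rect hs' R)).mul_bdd (c := B)
      (g := fun p => φ p.2) (hφ.continuous.comp continuous_snd).aestronglyMeasurable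
      (Eventually.of_forall fun p => (hB p.2).1)
    have j2 := j1.mul_bdd (c := K) (g := fun p => e p.1)
      (em.comp measurable_fst).aestronglyMeasurable (Eventually.of_forall fun p => W.bound p.1)
    have j3 := integral_integral_swap
      (f := fun x y => (u t x y - u s x y) * φ y * e x) j2
    simp only [integral_mul_const] at j3
    rw [j3]
    refine integral_congr_ae ?_
    filter_upwards [(H.Lu.int_rect_mul em W.bound ht' R).prod_left_ae,
      (H.Lu.int_rect_mul em W.bound hs' R).prod_left_ae] with y h1 h2
    rw [Xav, Xav, ← integral_sub h1 h2, ← integral_mul_const]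
    congr 1 with x
    ring
  rw [← l2, l1, sw]
  refine setIntegral_congr_fun measurableSet_Ioc fun τ hτ => ?_
  have hτ' := hsub hτ
  refine integral_congr_ae ?_
  filter_upwards [ae_restrict_of_ae_restrict_of_subset Ioc_subset_Ioi_self (H.source_avg W hτ'),
    (H.Lu.int_rect_mul em W.bound (Ioo_subset_Icc_self hτ') R).prod_left_ae] with y h1 h2
  rw [← h1.2, Xav, ← integral_mul_const, ← integral_mul_const,
    ← integral_add (h1.1.mul_const _) (h2.mul_const _)]
  congr 1 with x
  ring

omit W in
lemma tendsto_initial (R : ℝ) (hT : 0 < T) : Tendsto (fun s => ∫ p, |u s p.1 p.2|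
    ∂((volume.restrict (Ioc 0 1)).prod (volume.restrict (Ioc 0 R)))) (𝓝[>] 0) (𝓝 0) := by
  have hev : ∀ᶠ s in 𝓝[>] (0 : ℝ), s ∈ Icc 0 T := by
    filter_upwards [Ioc_mem_nhdsGT hT] with s hs using Ioc_subset_Icc_self hs
  have hsub : Ioc (0 : ℝ) 1 ×ˢ Ioc 0 R ⊆ Ioc (0 : ℝ) 1 ×ˢ Ioi 0 :=
    prod_mono_right Ioc_subset_Ioi_self
  have h := tendsto_integral_abs_sub_of_sq_bounded (l := 𝓝[>] (0 : ℝ)) (M := max A 0)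
    (μ := (volume.restrict (Ioc (0 : ℝ) 1)).prod (volume.restrict (Ioc 0 R)))
    (f := fun s (p : ℝ × ℝ) => u s p.1 p.2) (g := fun _ => 0)
    (Eventually.of_forall fun s => (H.Lu.meas_slice s).aestronglyMeasurable)
    aestronglyMeasurable_const ?_ (by simp) ?_ (by simp) ?_
  · simpa using h
  · filter_upwards [hev] with s hs
    rw [Measure.prod_restrict]
    exact (H.Lu.int s hs).mono_set hsub
  · filter_upwards [hev] with s hs
    refine le_max_of_le_left ?_
    rw [Measure.prod_restrict]
    exact (setIntegral_mono_set (H.Lu.int s hs) (Eventually.of_forall fun _ => sq_nonneg _)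
      hsub.eventuallyLE).trans (H.Lu.bound s hs)
  · rw [Measure.prod_restrict]
    filter_upwards [ae_restrict_mem (measurableSet_Ioc.prod measurableSet_Ioc)] with p hp
    have := (H.dt 0 p.1 p.2).continuousAt.tendsto
    rw [H.ic p.1 p.2 hp.2.1.le] at this
    exact this.mono_left nhdsWithin_le_nhds

lemma tendsto_Xav_initial (R : ℝ) (hT : 0 < T) {φ : ℝ → ℝ} {B : ℝ} (hφ : Continuous φ)
    (hB : ∀ y, |φ y| ≤ B) :
    Tendsto (fun s => ∫ y in Ioc 0 R, Xav u e s y * φ y) (𝓝[>] 0) (𝓝 0) := by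
  have em := W.continuous.measurable
  have hev : ∀ᶠ s in 𝓝[>] (0 : ℝ), s ∈ Icc 0 T := by
    filter_upwards [Ioc_mem_nhdsGT hT] with s hs using Ioc_subset_Icc_self hs
  have hlim := (H.tendsto_initial R hT).const_mul (K * B)
  rw [mul_zero] at hlim
  refine squeeze_zero_norm' ?_ hlim
  filter_upwards [hev] with s hs
  have j1 := (H.Lu.int_rect_mul em W.bound hs R).mul_bdd (c := B)
      (g := fun p => φ p.2) (hφ.comp continuous_snd).aestronglyMeasurable
      (Eventually.of_forall fun p => hB p.2)
  have j2 : ∫ y in Ioc 0 R, Xav u e s y * φ y = ∫ p, u s p.1 p.2 * e p.1 * φ p.2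
      ∂((volume.restrict (Ioc 0 1)).prod (volume.restrict (Ioc 0 R))) := by
    rw [integral_prod _ j1, integral_integral_swap (f := fun x y => u s x y * e x * φ y) j1]
    simp only [integral_mul_const, Xav]
  rw [j2, ← integral_const_mul]
  refine (norm_integral_le_integral_norm _).trans ?_
  refine integral_mono j1.norm ((H.Lu.int_rect hs R).abs.const_mul _) fun p => ?_
  have hK : 0 ≤ K := (abs_nonneg _).trans (W.bound 0)
  simp only [Real.norm_eq_abs, abs_mul]
  calc |u s p.1 p.2| * |e p.1| * |φ p.2| ≤ |u s p.1 p.2| * K * B :=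
        mul_le_mul (mul_le_mul_of_nonneg_left (W.bound _) (abs_nonneg _)) (hB _) (abs_nonneg _)
          (mul_nonneg (abs_nonneg _) hK)
    _ = _ := by ring

/-- The weighted averages of a solution are modes. -/
lemma mode (hM : 0 ≤ M) : Mode (Xav u e) (Xav uy e) (modeSource us usy (Xav u e')) T
    (K ^ 2 * A) (K ^ 2 * A) ((2 * M ^ 2 + 2 * M) * (K ^ 2 * A)) := by
  have em := W.continuous.measurable
  have ha := H.Lu.Xav_L2On em W.bound
  have hG := H.modeSource_L2On hM (H.Lu.Xav_L2On W.cont.measurable W.bound')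
  refine ⟨ha, H.Luy.Xav_L2On em W.bound, hG, fun t ht y hy =>
    H.Xav_prim W (Ioo_subset_Icc_self ht) hy, fun t ht R hR φ hφ hsupp => ?_⟩
  obtain ⟨-, -, d3, ⟨B, -, hB⟩, -⟩ := testFunction_facts hφ hsupp
  have hT : 0 < T := ht.1.trans ht.2
  rw [intervalIntegral.integral_of_le hR.le]
  have g1 := hG.rect_int ht R
  have g2 := ha.rect_int ht R
  rw [IntegrableOn, Measure.volume_eq_prod, ← Measure.prod_restrict] at g1 g2
  have g1' := g1.mul_bdd (c := B) (g := fun p => φ p.2)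
    (hφ.continuous.comp continuous_snd).aestronglyMeasurable
    (Eventually.of_forall fun p => (hB p.2).1)
  have g2' := g2.mul_bdd (c := B) (g := fun p => deriv (deriv φ) p.2)
    (d3.comp continuous_snd).aestronglyMeasurable
    (Eventually.of_forall fun p => (hB p.2).2.2)
  set J : ℝ → ℝ := fun τ => ∫ y in Ioc 0 R, (modeSource us usy (Xav u e') τ y * φ y +
        Xav u e τ y * deriv (deriv φ) y) with hJ
  have hJi : IntegrableOn J (Ioc 0 t) := (g1'.add g2').integral_prod_left
  have slice : ∀ s ∈ Ioo 0 T, IntegrableOn (fun y => Xav u e s y * φ y) (Ioc 0 R) := fun s hs =>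
    Integrable.mul_bdd (c := B) (ha.slice_int hs R) hφ.continuous.aestronglyMeasurable
      (Eventually.of_forall fun y => (hB y).1)
  have hlim : ∫ y in Ioc 0 R, Xav u e t y * φ y = ∫ τ in Ioc 0 t, J τ := by
    have hII : IntervalIntegrable J volume 0 t :=
      (intervalIntegrable_iff_integrableOn_Ioc_of_le ht.1.le).2 hJi
    have hc := (hII.absolutelyContinuousOnInterval_intervalIntegral (c := t) (by simp)).continuousOn
    have hc0 : Tendsto (fun s => ∫ τ in t..s, J τ) (𝓝[>] 0) (𝓝 (∫ τ in t..0, J τ)) := by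
      have h0 : ContinuousWithinAt (fun s => ∫ τ in t..s, J τ) (uIcc 0 t) 0 := hc 0 (by simp)
      refine (h0.tendsto).mono_left ?_
      rw [← nhdsWithin_Ioo_eq_nhdsGT ht.1]
      refine nhdsWithin_mono _ ?_
      rw [uIcc_of_le ht.1.le]
      exact Ioo_subset_Icc_self
    have hl := ((tendsto_const_nhds (x := ∫ y in Ioc 0 R, Xav u e t y * φ y)).sub
      (H.tendsto_Xav_initial W R hT hφ.continuous fun y => (hB y).1)).add hc0
    have hz : Tendsto (fun s => (∫ y in Ioc 0 R, Xav u e t y * φ y) -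
        (∫ y in Ioc 0 R, Xav u e s y * φ y) + ∫ τ in t..s, J τ) (𝓝[>] 0) (𝓝 0) := by
      refine tendsto_const_nhds.congr' ?_
      filter_upwards [Ioo_mem_nhdsGT ht.1] with s hs
      have hs' : s ∈ Ioo 0 T := ⟨hs.1, hs.2.trans ht.2⟩
      have := H.mode_eqn W hs' ht hs.2.le hR hφ hsupp
      rw [intervalIntegral.integral_symm, intervalIntegral.integral_of_le hs.2.le,
        ← integral_sub (slice t ht) (slice s hs')]
      simp only [← sub_mul]
      rw [this]
      simp [hJ]
    have hq := tendsto_nhds_unique hl hz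
    rw [intervalIntegral.integral_symm, intervalIntegral.integral_of_le ht.1.le] at hq
    linarith
  have sw : ∫ τ in Ioc 0 t, J τ = ∫ y in Ioc 0 R, ∫ τ in Ioc 0 t,
      (modeSource us usy (Xav u e') τ y * φ y + Xav u e τ y * deriv (deriv φ) y) :=
    integral_integral_swap (g1'.add g2')
  have i2 : IntegrableOn (fun y => ∫ τ in Ioc 0 t,
      (modeSource us usy (Xav u e') τ y * φ y + Xav u e τ y * deriv (deriv φ) y)) (Ioc 0 R) :=
    (g1'.add g2').integral_prod_right
  rw [sw, ← sub_eq_zero, ← integral_sub (slice t ht) i2] at hlim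
  refine Eq.trans (integral_congr_ae ?_) hlim
  filter_upwards [g1.prod_left_ae, g2.prod_left_ae] with y h1 h2
  simp only [Pt]
  have h3 : ∫ τ in Ioc 0 t,
      (modeSource us usy (Xav u e') τ y * φ y + Xav u e τ y * deriv (deriv φ) y) = _ :=
    integral_add (h1.mul_const _) (h2.mul_const _)
  rw [integral_mul_const, integral_mul_const] at h3
  refine Eq.trans ?_ (congrArg (fun z => Xav u e t y * φ y - z) h3).symm
  ring

end PrandtlSol

lemma eq_zero_of_fourier {f : ℝ → ℝ} (hf : Continuous f) (hp : ∀ x, f (x + 1) = f x)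
    (hc : ∀ n : ℤ, ∫ x in Ioc 0 1, f x * Real.cos (2 * Real.pi * n * x) = 0)
    (hs : ∀ n : ℤ, ∫ x in Ioc 0 1, f x * Real.sin (2 * Real.pi * n * x) = 0) (x : ℝ) :
    f x = 0 := by
  have : Fact ((0 : ℝ) < 1) := ⟨one_pos⟩
  have hper : Function.Periodic (fun x => (f x : ℂ)) 1 := fun x => by simp [hp x]
  have hcont : Continuous (hper.lift : AddCircle (1 : ℝ) → ℂ) := by
    refine continuous_coinduced_dom.2 ?_
    exact Complex.continuous_ofReal.comp hf
  let F : C(AddCircle (1 : ℝ), ℂ) := ⟨hper.lift, hcont⟩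
  have hcoef : fourierCoeff F = 0 := by
    ext n
    rw [fourierCoeff_eq_intervalIntegral (F : AddCircle (1 : ℝ) → ℂ) n 0, zero_add,
      intervalIntegral.integral_of_le zero_le_one]
    have e1 : ∀ x : ℝ, (fourier (-n) (x : AddCircle (1 : ℝ)) : ℂ) • F (x : AddCircle (1 : ℝ)) =
        ((f x * Real.cos (2 * Real.pi * n * x) : ℝ) : ℂ) -
          ((f x * Real.sin (2 * Real.pi * n * x) : ℝ) : ℂ) * Complex.I := by
      intro x
      have e2 : F (x : AddCircle (1 : ℝ)) = (f x : ℂ) := rfl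
      rw [e2, fourier_coe_apply, smul_eq_mul]
      have e3 : 2 * (Real.pi : ℂ) * Complex.I * ((-n : ℤ) : ℂ) * (x : ℂ) / ((1 : ℝ) : ℂ) =
          ((-(2 * Real.pi * n * x) : ℝ) : ℂ) * Complex.I := by
        push_cast
        ring
      rw [e3, Complex.exp_mul_I, ← Complex.ofReal_cos, ← Complex.ofReal_sin, Real.cos_neg,
        Real.sin_neg]
      push_cast
      ring
    simp only [e1]
    have i1 : IntegrableOn (fun x => f x * Real.cos (2 * Real.pi * n * x)) (Ioc 0 1) :=
      Continuous.integrableOn_Ioc (by fun_prop)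
    have i2 : IntegrableOn (fun x => f x * Real.sin (2 * Real.pi * n * x)) (Ioc 0 1) :=
      Continuous.integrableOn_Ioc (by fun_prop)
    rw [integral_sub i1.ofReal (i2.ofReal.mul_const _), integral_mul_const,
      integral_complex_ofReal, integral_complex_ofReal, hc n, hs n]
    simp
  have h := has_pointwise_sum_fourier_series_of_summable (f := F)
    (by rw [hcoef]; exact summable_zero) (x : AddCircle (1 : ℝ))
  rw [hcoef] at h
  simp only [Pi.zero_apply, zero_smul] at h
  have h2 : F (x : AddCircle (1 : ℝ)) = (f x : ℂ) := rfl
  rw [h2] at h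
  exact_mod_cast h.unique hasSum_zero

lemma periodWeight_cos (n : ℤ) : PeriodWeight (fun x => Real.cos (2 * Real.pi * n * x))
    (fun x => -(2 * Real.pi * n) * Real.sin (2 * Real.pi * n * x)) (1 + |2 * Real.pi * n|) := by
  refine ⟨fun x => ?_, by fun_prop, fun x => ?_, fun x => ?_, ?_⟩
  · have h := ((hasDerivAt_id x).const_mul (2 * Real.pi * n)).cos
    convert! h using 1
    simp only [id]
    ring
  · exact (Real.abs_cos_le_one _).trans (by linarith [abs_nonneg (2 * Real.pi * n)])
  · rw [abs_mul, abs_neg]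
    nlinarith [abs_nonneg (2 * Real.pi * n), Real.abs_sin_le_one (2 * Real.pi * n * x)]
  · have := Real.cos_int_mul_two_pi n
    simp only [mul_one, mul_zero, Real.cos_zero]
    rw [← this]
    congr 1
    ring

lemma periodWeight_sin (n : ℤ) : PeriodWeight (fun x => Real.sin (2 * Real.pi * n * x))
    (fun x => (2 * Real.pi * n) * Real.cos (2 * Real.pi * n * x)) (1 + |2 * Real.pi * n|) := by
  refine ⟨fun x => ?_, by fun_prop, fun x => ?_, fun x => ?_, ?_⟩
  · have h := ((hasDerivAt_id x).const_mul (2 * Real.pi * n)).sin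
    convert! h using 1
    simp only [id]
    ring
  · exact (Real.abs_sin_le_one _).trans (by linarith [abs_nonneg (2 * Real.pi * n)])
  · rw [abs_mul]
    nlinarith [abs_nonneg (2 * Real.pi * n), Real.abs_cos_le_one (2 * Real.pi * n * x)]
  · have := Real.sin_int_mul_pi (2 * n)
    simp only [mul_one, mul_zero, Real.sin_zero]
    rw [← this]
    congr 1
    push_cast
    ring

lemma integral_Xav_const_mul_sq (q : ℝ → ℝ → ℝ → ℝ) (e : ℝ → ℝ) (l t : ℝ) :
    ∫ y in Ioi 0, Xav q (fun x => l * e x) t y ^ 2 = l ^ 2 * ∫ y in Ioi 0, Xav q e t y ^ 2 := by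
  rw [← integral_const_mul]
  congr 1 with y
  rw [← mul_pow, Xav, Xav, ← integral_const_mul]
  congr 2 with x
  ring

namespace PrandtlSol
variable {us usy : ℝ → ℝ → ℝ} {u ut ux uy uyy : ℝ → ℝ → ℝ → ℝ} {T M A : ℝ}
  (H : PrandtlSol us usy u ut ux uy uyy T M A)
include H

lemma modes_eq_zero (hM : 0 ≤ M) (n : ℤ) : ∀ᵐ t, t ∈ Ioo 0 T → ∀ᵐ y, 0 < y →
    Xav u (fun x => Real.cos (2 * Real.pi * n * x)) t y = 0 ∧
    Xav u (fun x => Real.sin (2 * Real.pi * n * x)) t y = 0 := by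
  have H₁ := H.mode (periodWeight_cos n) hM
  have H₂ := H.mode (periodWeight_sin n) hM
  have b₁ : ∀ t ∈ Ioo 0 T, ∫ y in Ioi 0, modeSource us usy (Xav u fun x =>
      -(2 * Real.pi * n) * Real.sin (2 * Real.pi * n * x)) t y ^ 2 ≤
      (2 * M ^ 2 + 2 * M) * (2 * Real.pi * n) ^ 2 *
        ∫ y in Ioi 0, Xav u (fun x => Real.sin (2 * Real.pi * n * x)) t y ^ 2 := by
    intro t ht
    refine (H.modeSource_bound (H.Lu.Xav_L2On (periodWeight_cos n).cont.measurable
      (periodWeight_cos n).bound') ht).2.trans (le_of_eq ?_)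
    rw [integral_Xav_const_mul_sq, neg_sq, ← mul_assoc]
  have b₂ : ∀ t ∈ Ioo 0 T, ∫ y in Ioi 0, modeSource us usy (Xav u fun x =>
      (2 * Real.pi * n) * Real.cos (2 * Real.pi * n * x)) t y ^ 2 ≤
      (2 * M ^ 2 + 2 * M) * (2 * Real.pi * n) ^ 2 *
        ∫ y in Ioi 0, Xav u (fun x => Real.cos (2 * Real.pi * n * x)) t y ^ 2 := by
    intro t ht
    refine (H.modeSource_bound (H.Lu.Xav_L2On (periodWeight_sin n).cont.measurable
      (periodWeight_sin n).bound') ht).2.trans (le_of_eq ?_)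
    rw [integral_Xav_const_mul_sq, ← mul_assoc]
  filter_upwards [H₁.ae_eq_zero H₂ b₁ b₂, H₂.ae_eq_zero H₁ b₂ b₁] with t h1 h2 ht
  filter_upwards [h1 ht, h2 ht] with y k1 k2 hy using ⟨k1 hy, k2 hy⟩

theorem eq_zero (hM : 0 ≤ M) (hT : 0 < T) :
    ∀ t ∈ Icc (0 : ℝ) T, ∀ x : ℝ, ∀ y, 0 ≤ y → u t x y = 0 := by
  have h1 : ∀ᵐ t, t ∈ Ioo 0 T → ∀ x : ℝ, ∀ y, 0 ≤ y → u t x y = 0 := by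
    filter_upwards [ae_all_iff.2 (H.modes_eq_zero hM)] with t ht htm x
    have h2 : ∀ᵐ y, 0 < y → u t x y = 0 := by
      filter_upwards [ae_all_iff.2 fun n => ht n htm] with y hy hy0
      exact eq_zero_of_fourier (f := fun x => u t x y)
        (continuous_iff_continuousAt.2 fun x => (H.dx t x y).continuousAt) (fun x => H.per t x y)
        (fun n => (hy n hy0).1) (fun n => (hy n hy0).2) x
    have h3 : EqOn (fun y => u t x y) (fun _ => 0) (Ioi 0) := by
      refine Measure.eqOn_open_of_ae_eq (μ := volume) ?_ isOpen_Ioi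
        (fun y _ => (H.dy t x y).continuousAt.continuousWithinAt) continuousOn_const
      rw [EventuallyEq, ae_restrict_iff' measurableSet_Ioi]
      exact h2
    intro y hy
    rcases hy.eq_or_lt with rfl | hy
    · exact H.bc t (Ioo_subset_Icc_self htm) x
    · exact h3 hy
  intro t ht x y hy
  have hc : Continuous fun t => u t x y :=
    continuous_iff_continuousAt.2 fun t => (H.dt t x y).continuousAt
  have h3 : EqOn (fun t => u t x y) (fun _ => 0) (Ioo 0 T) := by
    refine Measure.eqOn_open_of_ae_eq (μ := volume) ?_ isOpen_Ioo hc.continuousOn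
      continuousOn_const
    rw [EventuallyEq, ae_restrict_iff' measurableSet_Ioo]
    filter_upwards [h1] with t h htm using h htm x y hy
  have h4 := h3.closure hc continuous_const
  rw [closure_Ioo hT.ne] at h4
  exact h4 ht

end PrandtlSol

lemma measurable_triple {q : ℝ → ℝ → ℝ → ℝ} (h1 : ∀ x y, Continuous fun t => q t x y)
    (h2 : ∀ t y, Continuous fun x => q t x y) (h3 : ∀ t x, Continuous fun y => q t x y) :
    Measurable fun p : ℝ × ℝ × ℝ => q p.1 p.2.1 p.2.2 :=
  measurable_uncurry_of_continuous_of_measurable (u := fun t (p : ℝ × ℝ) => q t p.1 p.2)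
    (fun p => h1 p.1 p.2) fun t => measurable_uncurry_of_sep (w := fun x y => q t x y)
    (fun y => h2 t y) fun x => h3 t x

lemma measurable_triple_deriv_t {q q' : ℝ → ℝ → ℝ → ℝ}
    (hq : Measurable fun p : ℝ × ℝ × ℝ => q p.1 p.2.1 p.2.2)
    (h : ∀ t x y, HasDerivAt (fun s => q s x y) (q' t x y) t) :
    Measurable fun p : ℝ × ℝ × ℝ => q' p.1 p.2.1 p.2.2 :=
  measurable_uncurry_of_hasDerivAt_fst (f := fun t (p : ℝ × ℝ) => q t p.1 p.2)
    (f' := fun t (p : ℝ × ℝ) => q' t p.1 p.2) hq fun t p => h t p.1 p.2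

lemma measurable_triple_deriv_x {q q' : ℝ → ℝ → ℝ → ℝ}
    (hq : Measurable fun p : ℝ × ℝ × ℝ => q p.1 p.2.1 p.2.2)
    (h : ∀ t x y, HasDerivAt (fun s => q t s y) (q' t x y) x) :
    Measurable fun p : ℝ × ℝ × ℝ => q' p.1 p.2.1 p.2.2 := by
  have hs : Measurable fun p : ℝ × ℝ × ℝ => (p.2.1, p.1, p.2.2) := by fun_prop
  exact (measurable_uncurry_of_hasDerivAt_fst (f := fun x (p : ℝ × ℝ) => q p.1 x p.2)
    (f' := fun x (p : ℝ × ℝ) => q' p.1 x p.2) (hq.comp hs) fun x p => h p.1 x p.2).comp hs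

lemma measurable_triple_deriv_y {q q' : ℝ → ℝ → ℝ → ℝ}
    (hq : Measurable fun p : ℝ × ℝ × ℝ => q p.1 p.2.1 p.2.2)
    (h : ∀ t x y, HasDerivAt (fun s => q t x s) (q' t x y) y) :
    Measurable fun p : ℝ × ℝ × ℝ => q' p.1 p.2.1 p.2.2 := by
  have hs : Measurable fun p : ℝ × ℝ × ℝ => (p.2.1, p.2.2, p.1) := by fun_prop
  have hs' : Measurable fun p : ℝ × ℝ × ℝ => (p.2.2, p.1, p.2.1) := by fun_prop
  exact (measurable_uncurry_of_hasDerivAt_fst (f := fun y (p : ℝ × ℝ) => q p.1 p.2 y)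
    (f' := fun y (p : ℝ × ℝ) => q' p.1 p.2 y) (hq.comp hs) fun y p => h p.1 p.2 y).comp hs'

lemma L2Strip.of_le {q s : ℝ → ℝ → ℝ → ℝ} {T A : ℝ}
    (hm : Measurable fun p : ℝ × ℝ × ℝ => q p.1 p.2.1 p.2.2)
    (hi : ∀ t ∈ Icc (0 : ℝ) T, IntegrableOn (fun p : ℝ × ℝ => s t p.1 p.2) (Ioc 0 1 ×ˢ Ioi 0))
    (hb : ∀ t ∈ Icc (0 : ℝ) T, ∫ x in Ioc 0 1, ∫ y in Ioi 0, s t x y ≤ A)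
    (hle : ∀ t x y, q t x y ^ 2 ≤ s t x y) : L2Strip q T A := by
  have hm' : ∀ t, Measurable fun p : ℝ × ℝ => q t p.1 p.2 := fun t =>
    hm.comp (measurable_const.prodMk measurable_id)
  have hI : ∀ t ∈ Icc (0 : ℝ) T,
      IntegrableOn (fun p : ℝ × ℝ => q t p.1 p.2 ^ 2) (Ioc 0 1 ×ˢ Ioi 0) := fun t ht =>
    Integrable.mono' (hi t ht) ((hm' t).pow_const 2).aestronglyMeasurable
      (Eventually.of_forall fun p => by
        rw [Real.norm_eq_abs, abs_sq]
        exact hle t p.1 p.2)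
  refine ⟨hm, hI, fun t ht => (integral_mono (hI t ht) (hi t ht) fun p => hle t p.1 p.2).trans ?_⟩
  have h := hi t ht
  rw [IntegrableOn, Measure.volume_eq_prod, ← Measure.prod_restrict] at h
  rw [Measure.volume_eq_prod, ← Measure.prod_restrict, integral_prod _ h]
  exact hb t ht

end Prandtl

/-- Uniqueness for the linearized Prandtl equation around a
shear flow `u_s(t,y)` satisfying
`sup_{0≤t≤T} (sup_y |u_s| + ∫₀^∞ y |∂_y u_s|² dy) < ∞`: a classical solution
`u(t,x,y)` (periodic in `x`, `C¹` in `t` and `x`, `C²` in `y`, with `u, ∂ₓu, ∂_y u`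
square integrable on `𝕋 × (0,∞)` uniformly in `t`) of
`∂ₜu + u_s ∂ₓu + v ∂_y u_s - ∂_y² u = 0`, `v = -∫₀^y ∂ₓu`, with `u(t,x,0) = 0`
and `u(0,x,y) = 0`, vanishes identically on `[0,T] × 𝕋 × [0,∞)`. -/
theorem linearized_prandtl_uniqueness
    (T : ℝ) (hT : 0 < T)
    (us usy : ℝ → ℝ → ℝ)
    (husmooth : ContDiff ℝ (⊤ : ℕ∞) (fun p : ℝ × ℝ => us p.1 p.2))
    (husy : ∀ t y, HasDerivAt (fun y' => us t y') (usy t y) y)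
    (M : ℝ)
    (husint : ∀ t ∈ Set.Icc (0 : ℝ) T,
      IntegrableOn (fun y => y * usy t y ^ 2) (Set.Ioi (0 : ℝ)))
    (hM : ∀ t ∈ Set.Icc (0 : ℝ) T, ∀ y, 0 ≤ y →
      |us t y| + ∫ y' in Set.Ioi (0 : ℝ), y' * usy t y' ^ 2 ≤ M)
    (u ut ux uy uyy : ℝ → ℝ → ℝ → ℝ)
    (huper : ∀ t x y, u t (x + 1) y = u t x y)
    (hut : ∀ t x y, HasDerivAt (fun s => u s x y) (ut t x y) t)
    (hux : ∀ t x y, HasDerivAt (fun s => u t s y) (ux t x y) x)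
    (huy : ∀ t x y, HasDerivAt (fun s => u t x s) (uy t x y) y)
    (huyy : ∀ t x y, HasDerivAt (fun s => uy t x s) (uyy t x y) y)
    (Mu : ℝ)
    (huL2 : ∀ t ∈ Set.Icc (0 : ℝ) T,
      IntegrableOn (fun p : ℝ × ℝ => u t p.1 p.2 ^ 2 + ux t p.1 p.2 ^ 2 + uy t p.1 p.2 ^ 2)
        (Set.Ioc (0 : ℝ) 1 ×ˢ Set.Ioi (0 : ℝ)))
    (huL2bound : ∀ t ∈ Set.Icc (0 : ℝ) T,
      (∫ x in Set.Ioc (0 : ℝ) 1, ∫ y in Set.Ioi (0 : ℝ),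
        (u t x y ^ 2 + ux t x y ^ 2 + uy t x y ^ 2)) ≤ Mu)
    (heq : ∀ t ∈ Set.Ioo (0 : ℝ) T, ∀ x : ℝ, ∀ y ∈ Set.Ioi (0 : ℝ),
      ut t x y + us t y * ux t x y
        + (-∫ y' in (0 : ℝ)..y, ux t x y') * usy t y - uyy t x y = 0)
    (hbc : ∀ t ∈ Set.Icc (0 : ℝ) T, ∀ x : ℝ, u t x 0 = 0)
    (hic : ∀ x : ℝ, ∀ y, 0 ≤ y → u 0 x y = 0) :
    ∀ t ∈ Set.Icc (0 : ℝ) T, ∀ x : ℝ, ∀ y, 0 ≤ y → u t x y = 0 := by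
  have hC : ∀ {f f' : ℝ → ℝ}, (∀ x, HasDerivAt f (f' x) x) → Continuous f := fun h =>
    continuous_iff_continuousAt.2 fun x => (h x).continuousAt
  have mu := Prandtl.measurable_triple (fun x y => hC fun t => hut t x y)
    (fun t y => hC fun x => hux t x y) (fun t x => hC fun y => huy t x y)
  have muy := Prandtl.measurable_triple_deriv_y mu huy
  have mux := Prandtl.measurable_triple_deriv_x mu hux
  have hI : ∀ t, 0 ≤ ∫ y' in Set.Ioi (0 : ℝ), y' * usy t y' ^ 2 := fun t =>
    setIntegral_nonneg measurableSet_Ioi fun y hy => mul_nonneg (le_of_lt hy) (sq_nonneg _)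
  have h0 : (0 : ℝ) ∈ Set.Icc (0 : ℝ) T := ⟨le_rfl, hT.le⟩
  have hM0 : 0 ≤ M :=
    (add_nonneg (abs_nonneg _) (hI 0)).trans (hM 0 h0 0 le_rfl)
  have husyc : Continuous (Function.uncurry usy) := by
    have hd := husmooth.continuous_fderiv (by simp)
    have he : Function.uncurry usy =
        fun p => fderiv ℝ (fun p : ℝ × ℝ => us p.1 p.2) p ((0 : ℝ), (1 : ℝ)) := by
      ext ⟨t, y⟩
      have h1 := (husmooth.differentiable (by simp) (t, y)).hasFDerivAt
      have h2 : HasDerivAt (fun y' : ℝ => (t, y')) ((0 : ℝ), (1 : ℝ)) y :=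
        (hasDerivAt_const y t).prodMk (hasDerivAt_id y)
      exact (husy t y).unique (h1.comp_hasDerivAt y h2)
    rw [he]
    exact hd.clm_apply continuous_const
  have H : Prandtl.PrandtlSol us usy u ut ux uy uyy T M Mu :=
    { cus := husmooth.continuous
      cusy := husyc
      usint := husint
      usM := fun t ht y hy => by linarith [hM t ht y hy, hI t]
      usyM := fun t ht => by linarith [hM t ht 0 le_rfl, abs_nonneg (us t 0)]
      per := huper
      dt := hut
      dx := hux
      dy := huy
      dyy := huyy
      Lu := Prandtl.L2Strip.of_le mu huL2 huL2bound fun t x y => by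
        linarith [sq_nonneg (ux t x y), sq_nonneg (uy t x y)]
      Lux := Prandtl.L2Strip.of_le mux huL2 huL2bound fun t x y => by
        linarith [sq_nonneg (u t x y), sq_nonneg (uy t x y)]
      Luy := Prandtl.L2Strip.of_le muy huL2 huL2bound fun t x y => by
        linarith [sq_nonneg (u t x y), sq_nonneg (ux t x y)]
      mF := (Prandtl.measurable_triple_deriv_t mu hut).sub
        (Prandtl.measurable_triple_deriv_y muy huyy)
      eqn := fun t ht x y hy => by
        have h := heq t ht x y hy
        rw [intervalIntegral.integral_of_le (le_of_lt hy)] at h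
        linarith
      bc := hbc
      ic := hic }
  exact H.eq_zero hM0 hT
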